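/- Let N ≥ 2 and q > q* := (N+2)/N, or q = q* := (N+2)/N with N ≥ 3, and set q' = q/(q-1). Let O ⊂ ℝ^{N+1} be a bounded open set. If for every point (x,t) of the parabolic boundary ∂_pO one has ∫_0^1 Cap_{2,1,q'}( O^c ∩ ( B_{ρ/30}(x) × (t−30ρ², t−ρ²) ) ) ρ^{−N} (dρ/ρ) = ∞, then the equation ∂_t u − Δu + u^q = 0 admits a large solution in O. -/

import Mathlib

open MeasureTheory Metric Set
open scoped ENNReal NNReal

noncomputable section

/-- Points of `ℝ^{N+1}` are written `(x, t)` with `x ∈ ℝ^N` and `t ∈ ℝ`. -/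
abbrev PSpace (N : ℕ) := EuclideanSpace ℝ (Fin N) × ℝ

/-- The parabolic cylinder `Q_δ(x,t) = B_δ(x) × (t - δ², t]`. -/
def pQ (N : ℕ) (δ : ℝ) (z : PSpace N) : Set (PSpace N) :=
  ball z.1 δ ×ˢ Ioc (z.2 - δ ^ 2) z.2

/-- The parabolic cylinder `Q̃_r(x,t) = B_r(x) × (t - r², t + r²)`. -/
def pQt (N : ℕ) (r : ℝ) (z : PSpace N) : Set (PSpace N) :=
  ball z.1 r ×ˢ Ioo (z.2 - r ^ 2) (z.2 + r ^ 2)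

/-- The parabolic boundary of an open set `O ⊆ ℝ^{N+1}`: points of the topological
boundary such that every downward cylinder `Q_δ` meets the complement of `O`. -/
def pBoundary (N : ℕ) (O : Set (PSpace N)) : Set (PSpace N) :=
  {z ∈ frontier O | ∀ δ > 0, (pQ N δ z ∩ Oᶜ).Nonempty}

/-- Partial derivative in time. -/
def tDeriv {N : ℕ} (u : PSpace N → ℝ) (z : PSpace N) : ℝ :=
  deriv (fun s => u (z.1, s)) z.2

/-- Partial derivative in the `i`-th spatial direction. -/
def xDeriv {N : ℕ} (i : Fin N) (u : PSpace N → ℝ) (z : PSpace N) : ℝ :=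
  lineDeriv ℝ (fun y => u (y, z.2)) z.1 (EuclideanSpace.single i 1)

/-- Second spatial partial derivative. -/
def xxDeriv {N : ℕ} (i j : Fin N) (u : PSpace N → ℝ) (z : PSpace N) : ℝ :=
  xDeriv i (xDeriv j u) z

/-- Spatial Laplacian. -/
def lapl {N : ℕ} (u : PSpace N → ℝ) (z : PSpace N) : ℝ :=
  ∑ i : Fin N, xxDeriv i i u z

/-- Euclidean norm of the spatial gradient. -/
def gradNorm {N : ℕ} (u : PSpace N → ℝ) (z : PSpace N) : ℝ :=
  Real.sqrt (∑ i : Fin N, (xDeriv i u z) ^ 2)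

/-- `u ∈ C^{2,1}(O)` : `u`, its first and second spatial derivatives and its time
derivative exist and are continuous in `O`. -/
structure IsC21 {N : ℕ} (O : Set (PSpace N)) (u : PSpace N → ℝ) : Prop where
  cont : ContinuousOn u O
  diff_t : ∀ z ∈ O, DifferentiableAt ℝ (fun s => u (z.1, s)) z.2
  cont_t : ContinuousOn (tDeriv u) O
  diff_x : ∀ (i : Fin N), ∀ z ∈ O,
    LineDifferentiableAt ℝ (fun y => u (y, z.2)) z.1 (EuclideanSpace.single i 1)
  cont_x : ∀ i : Fin N, ContinuousOn (xDeriv i u) O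
  diff_xx : ∀ (i j : Fin N), ∀ z ∈ O,
    LineDifferentiableAt ℝ (fun y => xDeriv j u (y, z.2)) z.1 (EuclideanSpace.single i 1)
  cont_xx : ∀ i j : Fin N, ContinuousOn (xxDeriv i j u) O

/-- The blow-up condition `lim_{δ→0} inf_{O ∩ Q_δ(z)} u = ∞` at every point of the
parabolic boundary. -/
def BlowsUp {N : ℕ} (O : Set (PSpace N)) (u : PSpace N → ℝ) : Prop :=
  ∀ z ∈ pBoundary N O, ∀ M : ℝ, ∃ δ > (0 : ℝ), ∀ w ∈ O ∩ pQ N δ z, M ≤ u w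

/-- A large solution of `∂_t u - Δu + f(u) = 0` in `O`. -/
def IsLargeSolution {N : ℕ} (O : Set (PSpace N)) (f : ℝ → ℝ) (u : PSpace N → ℝ) : Prop :=
  IsC21 O u ∧ (∀ z ∈ O, tDeriv u z - lapl u z + f (u z) = 0) ∧ BlowsUp O u

/-- The parabolic Sobolev norm `‖φ‖_{W^{2,1}_p(ℝ^{N+1})}`. -/
def W21Norm (N : ℕ) (p : ℝ) (φ : PSpace N → ℝ) : ℝ :=
  (eLpNorm φ (ENNReal.ofReal p) volume).toReal
    + (eLpNorm (tDeriv φ) (ENNReal.ofReal p) volume).toReal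
    + (eLpNorm (gradNorm φ) (ENNReal.ofReal p) volume).toReal
    + ∑ i : Fin N, ∑ j : Fin N, (eLpNorm (xxDeriv i j φ) (ENNReal.ofReal p) volume).toReal

/-- The capacity `Cap_{2,1,p}` of a compact set `K ⊆ ℝ^{N+1}`. -/
def cap21c (N : ℕ) (p : ℝ) (K : Set (PSpace N)) : ℝ :=
  sInf { c | ∃ φ : SchwartzMap (PSpace N) ℝ,
    (∃ U, IsOpen U ∧ K ⊆ U ∧ ∀ z ∈ U, 1 ≤ φ z) ∧ c = W21Norm N p (fun z => φ z) ^ p }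

/-- The capacity `Cap_{2,1,p}` of an arbitrary (Suslin) set. -/
def cap21 (N : ℕ) (p : ℝ) (E : Set (PSpace N)) : ℝ :=
  sSup { c | ∃ D, D ⊆ E ∧ IsCompact D ∧ c = cap21c N p D }

/-- The parabolic Hausdorff capacity `PH_ρ^N(E)`. -/
def PHcap (N : ℕ) (ρ : ℝ) (E : Set (PSpace N)) : ℝ≥0∞ :=
  ⨅ (c : ℕ → PSpace N × ℝ)
    (_ : (∀ j, 0 ≤ (c j).2 ∧ (c j).2 ≤ ρ) ∧ E ⊆ ⋃ j, pQt N (c j).2 (c j).1),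
    ∑' j, ENNReal.ofReal ((c j).2 ^ N)

/-- The truncated Riesz parabolic potential `I_2^R[μ]`. -/
def riesz (N : ℕ) (R : ℝ) (μ : Measure (PSpace N)) (z : PSpace N) : ℝ≥0∞ :=
  ∫⁻ ρ in Ioo (0 : ℝ) R, μ (pQt N ρ z) / ENNReal.ofReal (ρ ^ (N + 1))

/-- The truncated fractional maximal parabolic potential `M_2^R[μ]`. -/
def maxPot (N : ℕ) (R : ℝ) (μ : Measure (PSpace N)) (z : PSpace N) : ℝ≥0∞ :=
  ⨆ (ρ : ℝ) (_ : ρ ∈ Ioo (0 : ℝ) R), μ (pQt N ρ z) / ENNReal.ofReal (ρ ^ N)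

/-- The Gaussian heat kernel on `ℝ^{N+1}`. -/
def heatK (N : ℕ) (z : PSpace N) : ℝ :=
  if 0 < z.2 then (4 * Real.pi * z.2) ^ (-(N : ℝ) / 2) * Real.exp (-‖z.1‖ ^ 2 / (4 * z.2))
  else 0

/-- The heat potential `(ℍ * μ)(x,t)` of a nonnegative measure. -/
def heatPot (N : ℕ) (μ : Measure (PSpace N)) (z : PSpace N) : ℝ≥0∞ :=
  ∫⁻ w, ENNReal.ofReal (heatK N (z.1 - w.1, z.2 - w.2)) ∂μ

/-- Exponential on `ℝ≥0∞`. -/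
def expE (x : ℝ≥0∞) : ℝ≥0∞ := if x = ⊤ then ⊤ else ENNReal.ofReal (Real.exp x.toReal)

/-- Parabolic distance from a point to a set (taken over points at earlier times). -/
def pDist (N : ℕ) (z : PSpace N) (S : Set (PSpace N)) : ℝ :=
  sInf { r | ∃ w ∈ S, w.2 ≤ z.2 ∧ r = max (dist z.1 w.1) (Real.sqrt (z.2 - w.2)) }

end

namespace ParabolicWiener

open MeasureTheory Metric Set Filter Topology
open scoped ENNReal NNReal

instance instIsAddHaarMeasurePSpace (N : ℕ) :
    (volume : Measure (PSpace N)).IsAddHaarMeasure :=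
  inferInstanceAs ((volume : Measure (EuclideanSpace ℝ (Fin N))).prod
    (volume : Measure ℝ)).IsAddHaarMeasure

theorem heatK_nonneg (N : ℕ) (z : PSpace N) : 0 ≤ heatK N z := by
  unfold heatK; split_ifs with h
  · positivity
  · exact le_rfl

theorem heatK_of_nonpos {N : ℕ} {z : PSpace N} (h : z.2 ≤ 0) : heatK N z = 0 := by
  simp [heatK, not_lt.2 h]

theorem heatK_of_pos {N : ℕ} {z : PSpace N} (h : 0 < z.2) :
    heatK N z = (4 * Real.pi * z.2) ^ (-(N : ℝ) / 2) * Real.exp (-‖z.1‖ ^ 2 / (4 * z.2)) := by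
  simp [heatK, h]

@[fun_prop]
theorem measurable_heatK (N : ℕ) : Measurable (heatK N) := by
  unfold heatK
  refine Measurable.ite (measurableSet_lt measurable_const measurable_snd) ?_ measurable_const
  fun_prop

/-- The heat kernel with values in `[0, ∞]`. -/
noncomputable def Gam (N : ℕ) (z : PSpace N) : ℝ≥0∞ := ENNReal.ofReal (heatK N z)

/-- The heat kernel damped by `exp (-lam t)`. -/
noncomputable def GamL (N : ℕ) (lam : ℝ) (z : PSpace N) : ℝ≥0∞ :=
  ENNReal.ofReal (Real.exp (-lam * z.2)) * Gam N z

@[fun_prop]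
theorem measurable_Gam (N : ℕ) : Measurable (Gam N) := by unfold Gam; fun_prop

@[fun_prop]
theorem measurable_GamL (N : ℕ) (lam : ℝ) : Measurable (GamL N lam) := by unfold GamL; fun_prop

theorem Gam_of_nonpos {N : ℕ} {z : PSpace N} (h : z.2 ≤ 0) : Gam N z = 0 := by
  simp [Gam, heatK_of_nonpos h]

theorem GamL_of_nonpos {N : ℕ} {lam : ℝ} {z : PSpace N} (h : z.2 ≤ 0) : GamL N lam z = 0 := by
  simp [GamL, Gam_of_nonpos h]

theorem Gam_ne_top {N : ℕ} (z : PSpace N) : Gam N z ≠ ⊤ := ENNReal.ofReal_ne_top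

/-- Gaussian integral in the normalisation used for the heat kernel. -/
theorem integral_gaussian_norm {N : ℕ} {b : ℝ} (hb : 0 < b) :
    ∫ y : EuclideanSpace ℝ (Fin N), Real.exp (-b * ‖y‖ ^ 2) = (Real.pi / b) ^ ((N : ℝ) / 2) := by
  have := GaussianFourier.integral_rexp_neg_mul_sq_norm (V := EuclideanSpace ℝ (Fin N)) hb
  simpa using this

theorem integrable_gaussian_norm {N : ℕ} {b : ℝ} (hb : 0 < b) :
    Integrable (fun y : EuclideanSpace ℝ (Fin N) => Real.exp (-b * ‖y‖ ^ 2)) := by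
  by_contra h
  have h1 := integral_gaussian_norm (N := N) hb
  rw [integral_undef h] at h1
  have : 0 < (Real.pi / b) ^ ((N : ℝ) / 2) := by positivity
  linarith

theorem lintegral_gaussian_norm {N : ℕ} {b : ℝ} (hb : 0 < b) :
    ∫⁻ y : EuclideanSpace ℝ (Fin N), ENNReal.ofReal (Real.exp (-b * ‖y‖ ^ 2))
      = ENNReal.ofReal ((Real.pi / b) ^ ((N : ℝ) / 2)) := by
  rw [← integral_gaussian_norm hb, ofReal_integral_eq_lintegral_ofReal (integrable_gaussian_norm hb)]
  exact ae_of_all _ fun _ => (Real.exp_pos _).le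

theorem heatK_slice {N : ℕ} {s : ℝ} (hs : 0 < s) (y : EuclideanSpace ℝ (Fin N)) :
    heatK N (y, s) = (4 * Real.pi * s) ^ (-(N : ℝ) / 2) * Real.exp (-(1 / (4 * s)) * ‖y‖ ^ 2) := by
  rw [heatK_of_pos (by exact hs)]; congr 2; simp only; ring

theorem heat_norm_const {N : ℕ} {s : ℝ} (hs : 0 < s) :
    (4 * Real.pi * s) ^ (-(N : ℝ) / 2) * (Real.pi / (1 / (4 * s))) ^ ((N : ℝ) / 2) = 1 := by
  rw [show Real.pi / (1 / (4 * s)) = 4 * Real.pi * s by field_simp,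
    ← Real.rpow_add (by positivity)]
  simp [neg_div]

theorem lintegral_Gam_slice {N : ℕ} {s : ℝ} (hs : 0 < s) :
    ∫⁻ y : EuclideanSpace ℝ (Fin N), Gam N (y, s) = 1 := by
  simp_rw [Gam, heatK_slice hs]
  have h0 : (0 : ℝ) ≤ (4 * Real.pi * s) ^ (-(N : ℝ) / 2) := by positivity
  simp_rw [ENNReal.ofReal_mul h0]
  rw [lintegral_const_mul _ (by fun_prop), lintegral_gaussian_norm (by positivity),
    ← ENNReal.ofReal_mul h0, heat_norm_const hs, ENNReal.ofReal_one]

theorem semigroup_sq {N : ℕ} {r s : ℝ} (hr : 0 < r) (hs : 0 < s)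
    (x w : EuclideanSpace ℝ (Fin N)) :
    ‖w‖ ^ 2 / (4 * r) + ‖x - w‖ ^ 2 / (4 * s)
      = ‖x‖ ^ 2 / (4 * (r + s))
        + (1 / (4 * (r * s / (r + s)))) * ‖w - (r / (r + s)) • x‖ ^ 2 := by
  rw [norm_sub_sq_real, norm_sub_sq_real, norm_smul, inner_smul_right, real_inner_comm,
    Real.norm_of_nonneg (by positivity)]
  field_simp
  ring

/-- The semigroup property of the heat kernel. -/
theorem heatK_semigroup {N : ℕ} {r s : ℝ} (hr : 0 < r) (hs : 0 < s)
    (x : EuclideanSpace ℝ (Fin N)) :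
    ∫⁻ w, Gam N (w, r) * Gam N (x - w, s) = Gam N (x, r + s) := by
  set m := r * s / (r + s) with hm
  have hm0 : 0 < m := by positivity
  have key : ∀ w, Gam N (w, r) * Gam N (x - w, s)
      = Gam N (x, r + s) * Gam N (w - (r / (r + s)) • x, m) := by
    intro w
    unfold Gam
    rw [← ENNReal.ofReal_mul (heatK_nonneg _ _), ← ENNReal.ofReal_mul (heatK_nonneg _ _)]
    congr 1
    rw [heatK_of_pos (by exact hr), heatK_of_pos (by exact hs),
      heatK_of_pos (z := (x, r + s)) (by simp only; positivity), heatK_slice hm0]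
    simp only
    have e1 : (4 * Real.pi * r) ^ (-(N : ℝ) / 2) * (4 * Real.pi * s) ^ (-(N : ℝ) / 2)
        = (4 * Real.pi * (r + s)) ^ (-(N : ℝ) / 2) * (4 * Real.pi * m) ^ (-(N : ℝ) / 2) := by
      rw [← Real.mul_rpow (by positivity) (by positivity),
        ← Real.mul_rpow (by positivity) (by positivity)]
      congr 1
      rw [hm]; field_simp
    have e2 : Real.exp (-‖w‖ ^ 2 / (4 * r)) * Real.exp (-‖x - w‖ ^ 2 / (4 * s))
        = Real.exp (-‖x‖ ^ 2 / (4 * (r + s)))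
          * Real.exp (-(1 / (4 * m)) * ‖w - (r / (r + s)) • x‖ ^ 2) := by
      rw [← Real.exp_add, ← Real.exp_add]
      congr 1
      have := semigroup_sq hr hs x w
      rw [neg_div, neg_div, neg_div, neg_mul]
      linarith
    calc _ = ((4 * Real.pi * r) ^ (-(N : ℝ) / 2) * (4 * Real.pi * s) ^ (-(N : ℝ) / 2))
          * (Real.exp (-‖w‖ ^ 2 / (4 * r)) * Real.exp (-‖x - w‖ ^ 2 / (4 * s))) := by ring
      _ = _ := by rw [e1, e2]; ring
  simp_rw [key]
  rw [lintegral_const_mul _ (by fun_prop)]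
  rw [lintegral_sub_right_eq_self (fun w => Gam N (w, m)), lintegral_Gam_slice hm0, mul_one]

theorem lintegral_exp_Ioo {lam s : ℝ} (hl : 0 < lam) (hs : 0 ≤ s) :
    ∫⁻ r in Ioo 0 s, ENNReal.ofReal (Real.exp (-lam * (s - r)))
      = ENNReal.ofReal ((1 - Real.exp (-lam * s)) / lam) := by
  rw [← ofReal_integral_eq_lintegral_ofReal]
  · congr 1
    rw [← integral_Ioc_eq_integral_Ioo, ← intervalIntegral.integral_of_le hs]
    have : ∀ r ∈ uIcc 0 s, HasDerivAt (fun r => Real.exp (-lam * (s - r)) / lam)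
        (Real.exp (-lam * (s - r))) r := by
      intro r _
      have h1 : HasDerivAt (fun r => -lam * (s - r)) (-lam * (-1)) r :=
        ((hasDerivAt_id r).const_sub s).const_mul _
      exact (h1.exp.div_const lam).congr_deriv (by field_simp)
    rw [intervalIntegral.integral_eq_sub_of_hasDerivAt this
      (Continuous.intervalIntegrable (by fun_prop) _ _)]
    simp; ring
  · refine (Continuous.integrableOn_Icc (by fun_prop)).mono_set Ioo_subset_Icc_self
  · exact ae_of_all _ fun _ => (Real.exp_pos _).le

theorem lconv_eq {N : ℕ} (f g : PSpace N → ℝ≥0∞) (z : PSpace N) :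
    (f ⋆ₗ g) z = ∫⁻ w, f w * g (z - w) := by
  rw [lconvolution_def]; simp_rw [neg_add_eq_sub]

/-- First resolvent identity for the heat kernel. -/
theorem Gam_resolvent (N : ℕ) {lam : ℝ} (hl : 0 < lam) (z : PSpace N) :
    Gam N z = GamL N lam z + ENNReal.ofReal lam * (Gam N ⋆ₗ GamL N lam) z := by
  obtain ⟨x, s⟩ := z
  rw [lconv_eq, Measure.volume_eq_prod, lintegral_prod_symm' _ (by fun_prop)]
  rcases le_or_gt s 0 with hs | hs
  · rw [Gam_of_nonpos hs, GamL_of_nonpos hs, eq_comm]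
    simp only [zero_add, mul_eq_zero]
    right
    simp only [Prod.mk_sub_mk]
    rw [lintegral_eq_zero_iff (by fun_prop)]
    refine ae_of_all _ fun r => ?_
    simp only [Pi.zero_apply]
    rw [lintegral_eq_zero_iff (by fun_prop)]
    refine ae_of_all _ fun w => ?_
    rcases le_or_gt r 0 with hr | hr
    · simp [Gam_of_nonpos (z := (w, r)) hr]
    · simp [GamL_of_nonpos (z := (x - w, s - r)) (lam := lam) (by simp only; linarith)]
  · have h1 : ∀ r, ∫⁻ w, Gam N (w, r) * GamL N lam ((x, s) - (w, r))
        = (Ioo 0 s).indicator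
          (fun r => ENNReal.ofReal (Real.exp (-lam * (s - r))) * Gam N (x, s)) r := by
      intro r
      simp only [Prod.mk_sub_mk]
      by_cases hr : r ∈ Ioo 0 s
      · rw [indicator_of_mem hr]
        simp_rw [GamL, mul_left_comm (Gam N _)]
        rw [lintegral_const_mul _ (by fun_prop), heatK_semigroup hr.1 (sub_pos.2 hr.2)]
        simp
      · rw [indicator_of_notMem hr, lintegral_eq_zero_iff (by fun_prop)]
        refine ae_of_all _ fun w => ?_
        rcases le_or_gt r 0 with hr0 | hr0
        · simp [Gam_of_nonpos (z := (w, r)) hr0]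
        · have : s ≤ r := by by_contra h; exact hr ⟨hr0, not_le.1 h⟩
          simp [GamL_of_nonpos (z := (x - w, s - r)) (lam := lam) (by simp only; linarith)]
    simp_rw [h1]
    rw [lintegral_indicator measurableSet_Ioo, lintegral_mul_const _ (by fun_prop),
      lintegral_exp_Ioo hl hs.le, GamL, ← mul_assoc, ← add_mul, ← ENNReal.ofReal_mul hl.le,
      mul_div_cancel₀ _ hl.ne']
    simp only
    rw [← ENNReal.ofReal_add (Real.exp_pos _).le (by
      rw [sub_nonneg]; exact Real.exp_le_one_iff.2 (by nlinarith))]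
    simp

end ParabolicWiener

namespace ParabolicWiener

open MeasureTheory Metric Set Filter Topology
open scoped ENNReal NNReal

variable {N : ℕ}

theorem lconv_add (k : PSpace N → ℝ≥0∞) {f g : PSpace N → ℝ≥0∞} (hk : Measurable k)
    (hf : Measurable f) : k ⋆ₗ (f + g) = k ⋆ₗ f + k ⋆ₗ g := by
  ext z
  simp only [lconv_eq, Pi.add_apply, mul_add]
  rw [lintegral_add_left (by fun_prop)]

theorem add_lconv {k f : PSpace N → ℝ≥0∞} (g : PSpace N → ℝ≥0∞) (hk : Measurable k)
    (hf : Measurable f) : (f + g) ⋆ₗ k = f ⋆ₗ k + g ⋆ₗ k := by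
  ext z
  simp only [lconv_eq, Pi.add_apply, add_mul]
  rw [lintegral_add_left (by fun_prop)]

theorem lconv_const_mul {k f : PSpace N → ℝ≥0∞} (c : ℝ≥0∞) (hk : Measurable k)
    (hf : Measurable f) : k ⋆ₗ (fun z => c * f z) = fun z => c * (k ⋆ₗ f) z := by
  ext z
  simp only [lconv_eq, mul_left_comm _ c]
  rw [lintegral_const_mul _ (by fun_prop)]

theorem const_mul_lconv {k f : PSpace N → ℝ≥0∞} (c : ℝ≥0∞) (hk : Measurable k)
    (hf : Measurable f) : (fun z => c * k z) ⋆ₗ f = fun z => c * (k ⋆ₗ f) z := by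
  ext z
  simp only [lconv_eq, mul_assoc]
  rw [lintegral_const_mul _ (by fun_prop)]

theorem lconv_mono {k k' f f' : PSpace N → ℝ≥0∞} (hk : k ≤ k') (hf : f ≤ f') :
    k ⋆ₗ f ≤ k' ⋆ₗ f' := by
  intro z
  simp only [lconv_eq]
  exact lintegral_mono fun w => mul_le_mul' (hk _) (hf _)

theorem lintegral_slab {k : PSpace N → ℝ≥0∞} (hk : Measurable k) {m : ℝ → ℝ≥0∞}
    (hkm : ∀ s > 0, ∫⁻ y, k (y, s) = m s) (a : ℝ) :
    ∫⁻ w in {w : PSpace N | w.2 ∈ Ioo 0 a}, k w = ∫⁻ s in Ioo 0 a, m s := by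
  have hS : MeasurableSet {w : PSpace N | w.2 ∈ Ioo 0 a} := measurable_snd measurableSet_Ioo
  rw [← lintegral_indicator hS, ← lintegral_indicator measurableSet_Ioo, Measure.volume_eq_prod,
    lintegral_prod_symm' _ (hk.indicator hS)]
  congr 1; ext s
  by_cases hs : s ∈ Ioo 0 a
  · rw [indicator_of_mem hs, ← hkm s hs.1]
    congr 1; ext y; rw [indicator_of_mem (by exact hs)]
  · rw [indicator_of_notMem hs]
    simp [indicator, show ¬ (0 < s ∧ s < a) from hs]

/-- `f` vanishes up to time `τ`. -/
def Causal (τ : ℝ) (f : PSpace N → ℝ≥0∞) : Prop := ∀ z : PSpace N, z.2 ≤ τ → f z = 0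

theorem causal_lconv {k f : PSpace N → ℝ≥0∞} {τ : ℝ} (hk : Causal 0 k) (hf : Causal τ f) :
    Causal τ (k ⋆ₗ f) := by
  intro z hz
  rw [lconv_eq]
  refine (lintegral_congr fun w => ?_).trans (lintegral_zero)
  rcases le_or_gt w.2 0 with h | h
  · simp [hk w h]
  · simp [hf (z - w) (by simp only [Prod.snd_sub]; linarith)]

theorem lconv_le_slab {k f : PSpace N → ℝ≥0∞} {τ : ℝ} (hk : Causal 0 k) (hf : Causal τ f)
    {M : ℝ≥0∞} {z : PSpace N} (hM : ∀ w : PSpace N, w.2 ≤ z.2 → f w ≤ M) (hkm : Measurable k) :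
    (k ⋆ₗ f) z ≤ (∫⁻ w in {w : PSpace N | w.2 ∈ Ioo 0 (z.2 - τ)}, k w) * M := by
  have hS : MeasurableSet {w : PSpace N | w.2 ∈ Ioo 0 (z.2 - τ)} :=
    measurable_snd measurableSet_Ioo
  rw [lconv_eq, ← lintegral_mul_const _ hkm, ← lintegral_indicator hS]
  refine lintegral_mono fun w => ?_
  by_cases hw : w.2 ∈ Ioo 0 (z.2 - τ)
  · rw [indicator_of_mem (by exact hw)]
    gcongr
    exact hM _ (by simp only [Prod.snd_sub]; linarith [hw.1])
  · rcases le_or_gt w.2 0 with h | h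
    · simp [hk w h]
    · have : z.2 - τ ≤ w.2 := by by_contra h'; exact hw ⟨h, not_le.1 h'⟩
      simp [hf (z - w) (by simp only [Prod.snd_sub]; linarith)]

theorem causal_Gam : Causal 0 (Gam N) := fun _ h => Gam_of_nonpos h

theorem causal_GamL {lam : ℝ} : Causal 0 (GamL N lam) := fun _ h => GamL_of_nonpos h

theorem Gam_lconv_le {f : PSpace N → ℝ≥0∞} {τ : ℝ} (hf : Causal τ f)
    {M : ℝ≥0∞} {z : PSpace N} (hM : ∀ w : PSpace N, w.2 ≤ z.2 → f w ≤ M) :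
    (Gam N ⋆ₗ f) z ≤ ENNReal.ofReal (z.2 - τ) * M := by
  refine (lconv_le_slab causal_Gam hf hM (measurable_Gam N)).trans_eq ?_
  rw [lintegral_slab (measurable_Gam N) (m := fun _ => 1) (fun s hs => lintegral_Gam_slice hs)]
  simp

theorem GamL_lconv_le {lam : ℝ} (hl : 0 < lam) {f : PSpace N → ℝ≥0∞} {τ : ℝ} (hf : Causal τ f)
    {M : ℝ≥0∞} {z : PSpace N} (hM : ∀ w : PSpace N, w.2 ≤ z.2 → f w ≤ M) (hz : τ ≤ z.2) :
    (GamL N lam ⋆ₗ f) z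
      ≤ ENNReal.ofReal ((1 - Real.exp (-lam * (z.2 - τ))) / lam) * M := by
  refine (lconv_le_slab causal_GamL hf hM (measurable_GamL N lam)).trans_eq ?_
  rw [lintegral_slab (measurable_GamL N lam) (m := fun s => ENNReal.ofReal (Real.exp (-lam * s)))]
  · congr 1
    have h0 : 0 ≤ z.2 - τ := by linarith
    rw [← lintegral_exp_Ioo hl h0]
    rw [← lintegral_indicator measurableSet_Ioo, ← lintegral_indicator measurableSet_Ioo,
      ← lintegral_sub_left_eq_self _ (z.2 - τ)]
    congr 1; ext s
    simp only [indicator, mem_Ioo, sub_pos, sub_lt_self_iff]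
    simp [and_comm]
  · intro s hs
    simp only [GamL]
    rw [lintegral_const_mul _ (by fun_prop), lintegral_Gam_slice hs, mul_one]

theorem Gam_lconv_ne_top {f : PSpace N → ℝ≥0∞} {τ : ℝ} (hf : Causal τ f) {M : ℝ≥0∞}
    (hM' : M ≠ ⊤) (hM : ∀ w, f w ≤ M) (z : PSpace N) : (Gam N ⋆ₗ f) z ≠ ⊤ :=
  ne_top_of_le_ne_top (by finiteness) (Gam_lconv_le hf fun w _ => hM w)

theorem GamL_lconv_ne_top {lam : ℝ} (hl : 0 < lam) {f : PSpace N → ℝ≥0∞} {τ : ℝ}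
    (hf : Causal τ f) {M : ℝ≥0∞}
    (hM' : M ≠ ⊤) (hM : ∀ w, f w ≤ M) (z : PSpace N) : (GamL N lam ⋆ₗ f) z ≠ ⊤ := by
  rcases le_or_gt τ z.2 with h | h
  · exact ne_top_of_le_ne_top (by finiteness) (GamL_lconv_le hl hf (fun w _ => hM w) h)
  · rw [causal_lconv causal_GamL hf z h.le]; simp

theorem GamL_lconv_le' {lam : ℝ} (hl : 0 < lam) {f : PSpace N → ℝ≥0∞} {τ : ℝ}
    (hf : Causal τ f) {M : ℝ≥0∞} (hM : ∀ w, f w ≤ M) (z : PSpace N) :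
    ENNReal.ofReal lam * (GamL N lam ⋆ₗ f) z ≤ M := by
  rcases le_or_gt τ z.2 with h | h
  · calc _ ≤ ENNReal.ofReal lam *
          (ENNReal.ofReal ((1 - Real.exp (-lam * (z.2 - τ))) / lam) * M) := by
          gcongr; exact GamL_lconv_le hl hf (fun w _ => hM w) h
      _ = ENNReal.ofReal (1 - Real.exp (-lam * (z.2 - τ))) * M := by
          rw [← mul_assoc, ← ENNReal.ofReal_mul hl.le, mul_div_cancel₀ _ hl.ne']
      _ ≤ 1 * M := by
          gcongr
          rw [← ENNReal.ofReal_one]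
          exact ENNReal.ofReal_le_ofReal (by linarith [Real.exp_pos (-lam * (z.2 - τ))])
      _ = M := one_mul _
  · rw [causal_lconv causal_GamL hf z h.le]; simp

theorem Gam_lconv_resolvent {lam : ℝ} (hl : 0 < lam) {f : PSpace N → ℝ≥0∞} (hf : Measurable f)
    (z : PSpace N) :
    (Gam N ⋆ₗ f) z = (GamL N lam ⋆ₗ f) z
      + ENNReal.ofReal lam * (Gam N ⋆ₗ (GamL N lam ⋆ₗ f)) z := by
  have h : Gam N = GamL N lam + fun z => ENNReal.ofReal lam * (Gam N ⋆ₗ GamL N lam) z := by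
    ext z; exact Gam_resolvent N hl z
  have hm := measurable_Gam N
  have hm' := measurable_GamL N lam
  conv_lhs => rw [h, add_lconv _ hf hm', const_mul_lconv _ (by fun_prop) hf,
    ← lconvolution_assoc hm hm' hf]
  rfl

/-- `u` is a bounded mild solution of `∂ₜu - Δu + u^q = g` vanishing up to time `τ`. -/
structure IsMild (q τ : ℝ) (g u : PSpace N → ℝ≥0∞) : Prop where
  meas : Measurable u
  bdd : ∃ L : ℝ≥0, ∀ z, u z ≤ L
  causal : Causal τ u
  eqn : ∀ z, u z + (Gam N ⋆ₗ fun w => u w ^ q) z = (Gam N ⋆ₗ g) z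

theorem rpow_lip_nnreal {q : ℝ} (hq : 1 < q) {x y L : ℝ≥0} (hxy : x ≤ y) (hy : y ≤ L) :
    (y : ℝ) ^ q + q * (L : ℝ) ^ (q - 1) * x ≤ (x : ℝ) ^ q + q * (L : ℝ) ^ (q - 1) * y := by
  rcases eq_or_lt_of_le (zero_le : 0 ≤ y) with h0 | h0
  · have : x = 0 := by rw [← h0] at hxy; simpa using hxy
    subst this; rw [← h0]
  have hy0 : (0 : ℝ) < y := h0
  have hb := one_add_mul_self_le_rpow_one_add (s := (x : ℝ) / y - 1)
    (by have : (0 : ℝ) ≤ (x : ℝ) / y := by positivity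
        linarith) hq.le
  rw [add_sub_cancel, Real.div_rpow (by positivity) (by positivity), le_div_iff₀ (by positivity)]
    at hb
  have h1 : (y : ℝ) ^ q = (y : ℝ) ^ (q - 1) * y := by
    rw [← Real.rpow_add_one hy0.ne']; simp
  have h2 : (y : ℝ) ^ (q - 1) ≤ (L : ℝ) ^ (q - 1) :=
    Real.rpow_le_rpow hy0.le (by exact_mod_cast hy) (by linarith)
  have h3 : (1 + q * ((x : ℝ) / y - 1)) * (y : ℝ) ^ q
      = (y : ℝ) ^ q - q * (y : ℝ) ^ (q - 1) * (y - x) := by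
    rw [h1]; field_simp; ring
  rw [h3] at hb
  have h4 : (x : ℝ) ≤ y := by exact_mod_cast hxy
  have h5 : q * (y : ℝ) ^ (q - 1) * (y - x) ≤ q * (L : ℝ) ^ (q - 1) * (y - x) := by
    have : (0 : ℝ) ≤ y - x := by linarith
    gcongr
  linarith

theorem rpow_lip {q : ℝ} (hq : 1 < q) {x y : ℝ≥0∞} {L : ℝ≥0} (hxy : x ≤ y) (hy : y ≤ L) :
    y ^ q + ENNReal.ofReal (q * (L : ℝ) ^ (q - 1)) * x
      ≤ x ^ q + ENNReal.ofReal (q * (L : ℝ) ^ (q - 1)) * y := by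
  lift y to ℝ≥0 using ne_top_of_le_ne_top (by simp) hy
  lift x to ℝ≥0 using ne_top_of_le_ne_top (by simp) hxy
  have hb : 0 ≤ q * (L : ℝ) ^ (q - 1) := by positivity
  have := rpow_lip_nnreal hq (by exact_mod_cast hxy) (by exact_mod_cast hy : y ≤ L)
  have hx' : (x : ℝ≥0∞) = ENNReal.ofReal x := by simp
  have hy' : (y : ℝ≥0∞) = ENNReal.ofReal y := by simp
  rw [hx', hy', ENNReal.ofReal_rpow_of_nonneg (by simp) (by linarith),
    ENNReal.ofReal_rpow_of_nonneg (by simp) (by linarith), ← ENNReal.ofReal_mul hb,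
    ← ENNReal.ofReal_mul hb, ← ENNReal.ofReal_add (by positivity) (by positivity),
    ← ENNReal.ofReal_add (by positivity) (by positivity)]
  exact ENNReal.ofReal_le_ofReal this

section Mild

variable {q τ lam : ℝ} {g g' u u' : PSpace N → ℝ≥0∞}

theorem rpow_causal (hq : 1 < q) (hu : Causal τ u) : Causal τ (fun w => u w ^ q) := fun z hz => by
  simp [hu z hz, show 0 < q by linarith]

theorem rpow_bdd (hq : 1 < q) {L : ℝ≥0} (hu : ∀ z, u z ≤ L) (z : PSpace N) :
    u z ^ q ≤ (L : ℝ≥0∞) ^ q := ENNReal.rpow_le_rpow (hu z) (by linarith)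

theorem rpow_coe_ne_top (hq : 1 < q) (L : ℝ≥0) : (L : ℝ≥0∞) ^ q ≠ ⊤ :=
  ENNReal.rpow_ne_top_of_nonneg (by linarith) (by simp)

/-- The damped form of the mild equation implies the mild equation. -/
theorem mild_of_damped (hl : 0 < lam) (hg : Measurable g) (hum : Measurable u)
    {L : ℝ≥0} (huL : ∀ z, u z ≤ L) (huc : Causal τ u)
    (h : ∀ z, u z + (GamL N lam ⋆ₗ fun w => u w ^ q) z
      = (GamL N lam ⋆ₗ fun w => g w + ENNReal.ofReal lam * u w) z) :
    IsMild q τ g u := by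
  refine ⟨hum, ⟨L, huL⟩, huc, fun z => ?_⟩
  set b := ENNReal.ofReal lam with hb
  have hm := measurable_Gam N
  have hm' := measurable_GamL N lam
  have huq : Measurable fun w => u w ^ q := by fun_prop
  have hfin : b * (Gam N ⋆ₗ u) z ≠ ⊤ :=
    ENNReal.mul_ne_top (by simp [hb]) (Gam_lconv_ne_top huc (by simp) huL z)
  have hfun : u + (GamL N lam ⋆ₗ fun w => u w ^ q) = GamL N lam ⋆ₗ fun w => g w + b * u w := by
    ext z; exact h z
  have h1 : (Gam N ⋆ₗ fun w => g w + b * u w) z = (Gam N ⋆ₗ g) z + b * (Gam N ⋆ₗ u) z := by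
    have := lconv_add (Gam N) (f := g) (g := fun w => b * u w) hm hg
    rw [lconv_const_mul b hm hum] at this
    exact congrFun this z
  have h2 := Gam_lconv_resolvent hl huq z
  have h3 := Gam_lconv_resolvent hl (f := fun w => g w + b * u w) (by fun_prop) z
  have h4 : (Gam N ⋆ₗ (GamL N lam ⋆ₗ fun w => g w + b * u w)) z
      = (Gam N ⋆ₗ u) z + (Gam N ⋆ₗ (GamL N lam ⋆ₗ fun w => u w ^ q)) z := by
    rw [← hfun, lconv_add (Gam N) hm hum]; rfl
  refine (ENNReal.add_left_inj hfin).1 ?_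
  rw [← h1, h3, ← h z, h2, h4]
  ring

theorem damped_of_mild (hl : 0 < lam) (hg : Measurable g) {G : ℝ≥0}
    (hgG : ∀ z, g z ≤ G) (hgc : Causal τ g) (hu : IsMild q τ g u) (z : PSpace N) :
    u z + (GamL N lam ⋆ₗ fun w => u w ^ q) z
      = (GamL N lam ⋆ₗ fun w => g w + ENNReal.ofReal lam * u w) z := by
  set b := ENNReal.ofReal lam with hb
  have hm := measurable_Gam N
  have hm' := measurable_GamL N lam
  have hum := hu.meas
  have huq : Measurable fun w => u w ^ q := by fun_prop
  have comm : ∀ f : PSpace N → ℝ≥0∞, Measurable f →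
      Gam N ⋆ₗ (GamL N lam ⋆ₗ f) = GamL N lam ⋆ₗ (Gam N ⋆ₗ f) := by
    intro f hf
    rw [lconvolution_assoc hm hm' hf, lconvolution_assoc hm' hm hf,
      lconvolution_comm (f := Gam N)]
  have hfun : u + (Gam N ⋆ₗ fun w => u w ^ q) = Gam N ⋆ₗ g := by ext z; exact hu.eqn z
  have h1 : (GamL N lam ⋆ₗ fun w => g w + b * u w) z
      = (GamL N lam ⋆ₗ g) z + b * (GamL N lam ⋆ₗ u) z := by
    have := lconv_add (GamL N lam) (f := g) (g := fun w => b * u w) hm' hg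
    rw [lconv_const_mul b hm' hum] at this
    exact congrFun this z
  have h2 := Gam_lconv_resolvent hl huq z
  have h3 := Gam_lconv_resolvent hl hg z
  have h4 : (Gam N ⋆ₗ (GamL N lam ⋆ₗ g)) z
      = (GamL N lam ⋆ₗ u) z + (Gam N ⋆ₗ (GamL N lam ⋆ₗ fun w => u w ^ q)) z := by
    rw [comm g hg, comm _ huq, ← hfun, lconv_add _ hm' hum]; rfl
  have hfin : b * (Gam N ⋆ₗ (GamL N lam ⋆ₗ fun w => u w ^ q)) z ≠ ⊤ := by
    have : (Gam N ⋆ₗ g) z ≠ ⊤ := Gam_lconv_ne_top hgc (by simp) hgG z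
    rw [h3, h4] at this
    simp only [ne_eq, ENNReal.add_eq_top, mul_add, not_or] at this
    exact this.2.2
  refine (ENNReal.add_left_inj hfin).1 ?_
  rw [add_assoc, ← h2, hu.eqn, h3, h1, h4]
  ring

/-- Comparison principle for bounded mild solutions. -/
theorem IsMild.le (hq : 1 < q) (hg : Measurable g) (hg' : Measurable g') {G : ℝ≥0}
    (hgG : ∀ z, g' z ≤ G) (hgc : Causal τ g') (hgg : g ≤ g') (hu : IsMild q τ g u)
    (hu' : IsMild q τ g' u') : u ≤ u' := by
  obtain ⟨L₁, hL₁⟩ := hu.bdd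
  obtain ⟨L₂, hL₂⟩ := hu'.bdd
  set L : ℝ≥0 := max (max L₁ L₂) 1 with hL
  have huL : ∀ z, u z ≤ L := fun z => (hL₁ z).trans (by simp [hL])
  have huL' : ∀ z, u' z ≤ L := fun z => (hL₂ z).trans (by simp [hL])
  have hL0 : 0 < L := lt_of_lt_of_le one_pos (le_max_right _ _)
  set lam : ℝ := q * (L : ℝ) ^ (q - 1) with hlam
  have hl : 0 < lam := by positivity
  set b := ENNReal.ofReal lam with hb
  have hm' := measurable_GamL N lam
  have hum := hu.meas
  have hum' := hu'.meas
  have huq : Measurable fun w => u w ^ q := by fun_prop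
  have huq' : Measurable fun w => u' w ^ q := by fun_prop
  have hD : Measurable fun w => u w - u' w := by fun_prop
  have e1 := damped_of_mild hl hg (fun z => (hgg z).trans (hgG z))
    (fun z hz => le_antisymm ((hgg z).trans_eq (hgc z hz)) zero_le) hu
  have e2 := damped_of_mild hl hg' hgG hgc hu'
  have hpt : ∀ w, b * u w + u' w ^ q ≤ u w ^ q + b * u' w + b * (u w - u' w) := by
    intro w
    rcases le_total (u w) (u' w) with h | h
    · have := rpow_lip hq h (huL' w)
      rw [tsub_eq_zero_of_le h, mul_zero, add_zero, add_comm]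
      exact this
    · have h1 : b * u w = b * u' w + b * (u w - u' w) := by
        rw [← mul_add, add_tsub_cancel_of_le h]
      rw [h1]
      have h2 : u' w ^ q ≤ u w ^ q := ENNReal.rpow_le_rpow h (by linarith)
      calc _ ≤ b * u' w + b * (u w - u' w) + u w ^ q := by gcongr
        _ = _ := by ring
  have hstep : ∀ z, u z - u' z ≤ b * (GamL N lam ⋆ₗ fun w => u w - u' w) z := by
    intro z
    rw [tsub_le_iff_right]
    have hf1 : (GamL N lam ⋆ₗ fun w => u w ^ q) z ≠ ⊤ :=
      GamL_lconv_ne_top hl (rpow_causal hq hu.causal) (rpow_coe_ne_top hq L) (rpow_bdd hq huL) z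
    have hf2 : (GamL N lam ⋆ₗ fun w => u' w ^ q) z ≠ ⊤ :=
      GamL_lconv_ne_top hl (rpow_causal hq hu'.causal) (rpow_coe_ne_top hq L) (rpow_bdd hq huL') z
    have i1 : ((GamL N lam ⋆ₗ fun w => g w + b * u w) z)
        + (GamL N lam ⋆ₗ fun w => u' w ^ q) z
        ≤ (GamL N lam ⋆ₗ fun w => g' w + b * u' w) z
          + (GamL N lam ⋆ₗ fun w => u w ^ q) z
          + b * (GamL N lam ⋆ₗ fun w => u w - u' w) z := by
      have a1 := congrFun (lconv_add (GamL N lam) (f := fun w => g w + b * u w)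
        (g := fun w => u' w ^ q) hm' (by fun_prop)) z
      have a2 := congrFun (lconv_add (GamL N lam) (f := fun w => g' w + b * u' w)
        (g := fun w => u w ^ q) hm' (by fun_prop)) z
      have a3 := congrFun (lconv_add (GamL N lam)
        (f := (fun w => g' w + b * u' w) + (fun w => u w ^ q))
        (g := fun w => b * (u w - u' w)) hm' (by fun_prop)) z
      rw [lconv_const_mul b hm' hD] at a3
      rw [Pi.add_apply] at a1 a2 a3
      rw [← a1, ← a2, ← a3]
      refine lconv_mono le_rfl (fun w => ?_) z
      simp only [Pi.add_apply]
      calc g w + b * u w + u' w ^ q = g w + (b * u w + u' w ^ q) := by ring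
        _ ≤ g' w + (u w ^ q + b * u' w + b * (u w - u' w)) := add_le_add (hgg w) (hpt w)
        _ = _ := by ring
    rw [← e1, ← e2] at i1
    refine (ENNReal.add_le_add_iff_right (ENNReal.add_ne_top.2 ⟨hf1, hf2⟩)).1 ?_
    calc _ = u z + (GamL N lam ⋆ₗ fun w => u w ^ q) z
          + (GamL N lam ⋆ₗ fun w => u' w ^ q) z := by ring
      _ ≤ _ := i1
      _ = _ := by ring
  have hDc : Causal τ fun w => u w - u' w := fun z hz => by simp [hu.causal z hz]
  intro z
  set M : ℝ≥0∞ := ⨆ w : {w : PSpace N // w.2 ≤ z.2}, (u w - u' w) with hM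
  have hMle : ∀ w : PSpace N, w.2 ≤ z.2 → u w - u' w ≤ M := fun w hw =>
    le_iSup (fun w : {w : PSpace N // w.2 ≤ z.2} => u w - u' w) ⟨w, hw⟩
  have hMtop : M ≠ ⊤ := ne_top_of_le_ne_top (b := (L : ℝ≥0∞)) (by simp)
    (iSup_le fun w => tsub_le_self.trans (huL _))
  set θ : ℝ := 1 - Real.exp (-lam * (z.2 - τ)) with hθ
  have hMθ : M ≤ ENNReal.ofReal θ * M := by
    refine iSup_le fun ⟨w, hw⟩ => ?_
    rcases le_or_gt τ w.2 with h | h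
    · calc u w - u' w ≤ b * (GamL N lam ⋆ₗ fun w => u w - u' w) w := hstep w
        _ ≤ b * (ENNReal.ofReal ((1 - Real.exp (-lam * (w.2 - τ))) / lam) * M) := by
          gcongr
          exact GamL_lconv_le hl hDc (fun v hv => hMle v (hv.trans hw)) h
        _ = ENNReal.ofReal (1 - Real.exp (-lam * (w.2 - τ))) * M := by
          rw [← mul_assoc, hb, ← ENNReal.ofReal_mul hl.le, mul_div_cancel₀ _ hl.ne']
        _ ≤ _ := by
          gcongr
          rw [hθ]
          have : Real.exp (-lam * (z.2 - τ)) ≤ Real.exp (-lam * (w.2 - τ)) := by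
            apply Real.exp_le_exp.2; nlinarith
          linarith
    · have := hDc w h.le
      simp only at this
      simp [this]
  have hM0 : M = 0 := by
    by_contra hne
    have : ENNReal.ofReal θ < 1 := by
      rw [ENNReal.ofReal_lt_one, hθ]; linarith [Real.exp_pos (-lam * (z.2 - τ))]
    have h2 : ENNReal.ofReal θ * M < 1 * M := (ENNReal.mul_lt_mul_iff_left hne hMtop).2 this
    rw [one_mul] at h2
    exact absurd hMθ (not_le.2 h2)
  have := hMle z le_rfl
  rw [hM0, nonpos_iff_eq_zero, tsub_eq_zero_iff_le] at this
  exact this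

/-- Existence of bounded mild solutions. -/
theorem exists_isMild (hq : 1 < q) (hg : Measurable g) {L : ℝ≥0} (hL0 : 0 < L)
    (hgL : ∀ z, g z ≤ (L : ℝ≥0∞) ^ q) (hgc : Causal τ g) : ∃ u, IsMild q τ g u := by
  set lam : ℝ := q * (L : ℝ) ^ (q - 1) with hlam
  have hl : 0 < lam := by positivity
  set b := ENNReal.ofReal lam with hb
  have hm' := measurable_GamL N lam
  have hlip : ∀ {x y : ℝ≥0∞}, x ≤ y → y ≤ L → y ^ q + b * x ≤ x ^ q + b * y :=
    fun h1 h2 => rpow_lip hq h1 h2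
  have hq0 : ∀ {x : ℝ≥0∞}, x ≤ L → x ^ q ≤ b * x := by
    intro x hx
    have := hlip (zero_le (a := x)) hx
    simpa [show 0 < q by linarith] using this
  have htop : ∀ {x : ℝ≥0∞}, x ≤ L → x ^ q ≠ ⊤ := fun {x} hx =>
    ENNReal.rpow_ne_top_of_nonneg (by linarith) (ne_top_of_le_ne_top (by simp) hx)
  have hmono : ∀ {x y : ℝ≥0∞}, x ≤ y → y ≤ L → b * x - x ^ q ≤ b * y - y ^ q := by
    intro x y h1 h2
    have hx := h1.trans h2
    refine (ENNReal.add_le_add_iff_right (ENNReal.add_ne_top.2 ⟨htop hx, htop h2⟩)).1 ?_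
    calc b * x - x ^ q + (x ^ q + y ^ q) = (b * x - x ^ q + x ^ q) + y ^ q := by ring
      _ = b * x + y ^ q := by rw [tsub_add_cancel_of_le (hq0 hx)]
      _ ≤ x ^ q + b * y := by rw [add_comm]; exact hlip h1 h2
      _ = (b * y - y ^ q + y ^ q) + x ^ q := by rw [tsub_add_cancel_of_le (hq0 h2), add_comm]
      _ = _ := by ring
  let T : (PSpace N → ℝ≥0∞) → PSpace N → ℝ≥0∞ := fun u =>
    GamL N lam ⋆ₗ fun w => g w + (b * u w - u w ^ q)
  let U : ℕ → PSpace N → ℝ≥0∞ := fun k => T^[k] 0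
  have hU0 : U 0 = 0 := rfl
  have hUs : ∀ k, U (k + 1) = T (U k) := fun k => Function.iterate_succ_apply' _ _ _
  have hUm : ∀ k, Measurable (U k) := by
    intro k
    induction k with
    | zero => rw [hU0]; exact measurable_const
    | succ k ih => rw [hUs]; exact measurable_lconvolution _ hm' (by fun_prop)
  have hUc : ∀ k, Causal τ (U k) := by
    intro k
    induction k with
    | zero => intro z _; rw [hU0]; rfl
    | succ k ih =>
      rw [hUs]
      refine causal_lconv causal_GamL fun z hz => ?_
      simp [hgc z hz, ih z hz]
  have hUL : ∀ k z, U k z ≤ L := by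
    intro k
    induction k with
    | zero => intro z; rw [hU0]; exact zero_le
    | succ k ih =>
      intro z
      have hb1 : ∀ w, g w + (b * U k w - U k w ^ q) ≤ b * L := by
        intro w
        calc _ ≤ (L : ℝ≥0∞) ^ q + (b * L - (L : ℝ≥0∞) ^ q) :=
              add_le_add (hgL w) (hmono (ih w) le_rfl)
          _ = b * L := by rw [add_tsub_cancel_of_le (hq0 le_rfl)]
      have := GamL_lconv_le' hl (f := fun w => g w + (b * U k w - U k w ^ q)) (τ := τ)
        (fun z hz => by simp [hgc z hz, hUc k z hz]) hb1 z
      rw [hUs]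
      exact (ENNReal.mul_le_mul_iff_right (by simp [hl]) (by simp)).1 this
  have hUmono : Monotone U := by
    refine monotone_nat_of_le_succ fun k => ?_
    induction k with
    | zero => rw [hU0]; exact fun _ => zero_le
    | succ k ih =>
      rw [hUs, hUs (k + 1)]
      exact lconv_mono le_rfl fun w => by
        exact add_le_add le_rfl (hmono (ih w) (hUL _ w))
  let u : PSpace N → ℝ≥0∞ := fun z => ⨆ k, U k z
  have hum : Measurable u := Measurable.iSup hUm
  have huL : ∀ z, u z ≤ L := fun z => iSup_le fun k => hUL k z
  have htend : ∀ z, Tendsto (fun k => U k z) atTop (𝓝 (u z)) := fun z =>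
    tendsto_atTop_iSup fun i j h => hUmono h z
  refine ⟨u, mild_of_damped hl hg hum huL (fun z hz => by simp [u, hUc _ z hz]) fun z => ?_⟩
  have hk : ∀ k, U (k + 1) z + (GamL N lam ⋆ₗ fun w => U k w ^ q) z
      = (GamL N lam ⋆ₗ fun w => g w + b * U k w) z := by
    intro k
    have h1 := hUm k
    have := congrFun (lconv_add (GamL N lam) (f := fun w => g w + (b * U k w - U k w ^ q))
      (g := fun w => U k w ^ q) hm' (by fun_prop)) z
    rw [hUs]
    refine this.symm.trans ?_
    congr 1; ext w
    simp only [Pi.add_apply]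
    rw [add_assoc, tsub_add_cancel_of_le (hq0 (hUL k w))]
  have hconv : ∀ {F : ℕ → PSpace N → ℝ≥0∞} {f : PSpace N → ℝ≥0∞}, (∀ k, Measurable (F k)) →
      Monotone F → (∀ w, Tendsto (fun k => F k w) atTop (𝓝 (f w))) →
      Tendsto (fun k => (GamL N lam ⋆ₗ F k) z) atTop (𝓝 ((GamL N lam ⋆ₗ f) z)) := by
    intro F f hF hFm hFt
    simp only [lconv_eq]
    refine lintegral_tendsto_of_tendsto_of_monotone (fun k => ?_) (ae_of_all _ fun w => ?_)
      (ae_of_all _ fun w => ?_)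
    · have := hF k
      fun_prop
    · exact fun i j h => mul_le_mul_right (hFm h _) _
    · exact ENNReal.Tendsto.const_mul (hFt _) (Or.inr (by
        simp only [GamL]; exact ENNReal.mul_ne_top (by simp) (Gam_ne_top _)))
  have t1 := hconv (F := fun k w => U k w ^ q) (f := fun w => u w ^ q)
    (fun k => (hUm k).pow_const q) (fun i j h w => ENNReal.rpow_le_rpow (hUmono h w) (by linarith))
    (fun w => ((ENNReal.continuous_rpow_const).tendsto _).comp (htend w))
  have t2 := hconv (F := fun k w => g w + b * U k w) (f := fun w => g w + b * u w)
    (fun k => by have := hUm k; fun_prop)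
    (fun i j h w => by simp only; gcongr; exact hUmono h w)
    (fun w => tendsto_const_nhds.add (ENNReal.Tendsto.const_mul (htend w) (Or.inr (by simp [hb]))))
  have t3 := ((htend z).comp (tendsto_add_atTop_nat 1)).add t1
  exact tendsto_nhds_unique (t3.congr hk) t2

end Mild

end ParabolicWiener

namespace ParabolicWiener

open MeasureTheory Metric Set Filter Topology
open scoped ENNReal NNReal ContDiff

variable {N : ℕ}

/-- The `i`-th spatial derivative as a directional Fréchet derivative. -/
noncomputable def dX (i : Fin N) (φ : PSpace N → ℝ) (z : PSpace N) : ℝ :=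
  fderiv ℝ φ z (EuclideanSpace.single i 1, 0)

/-- The time derivative as a directional Fréchet derivative. -/
noncomputable def dT (φ : PSpace N → ℝ) (z : PSpace N) : ℝ :=
  fderiv ℝ φ z (0, 1)

/-- The heat operator `∂ₜ - Δ`. -/
noncomputable def heatOp (φ : PSpace N → ℝ) (z : PSpace N) : ℝ :=
  dT φ z - ∑ i, dX i (dX i φ) z

section smooth

variable {φ : PSpace N → ℝ} (hφ : ContDiff ℝ ∞ φ) (hc : HasCompactSupport φ)

include hφ in
theorem contDiff_dX (i : Fin N) : ContDiff ℝ ∞ (dX i φ) :=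
  (hφ.fderiv_right (by simp)).clm_apply contDiff_const

include hφ in
theorem contDiff_dT : ContDiff ℝ ∞ (dT φ) :=
  (hφ.fderiv_right (by simp)).clm_apply contDiff_const

include hφ in
theorem contDiff_heatOp : ContDiff ℝ ∞ (heatOp φ) :=
  (contDiff_dT hφ).sub (ContDiff.sum fun i _ => contDiff_dX (contDiff_dX hφ i) i)

include hc in
theorem hasCompactSupport_dX (i : Fin N) : HasCompactSupport (dX i φ) :=
  (hc.fderiv ℝ).comp_left (g := fun L : PSpace N →L[ℝ] ℝ => L (EuclideanSpace.single i 1, 0)) rfl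

include hc in
theorem hasCompactSupport_dT : HasCompactSupport (dT φ) :=
  (hc.fderiv ℝ).comp_left (g := fun L : PSpace N →L[ℝ] ℝ => L (0, 1)) rfl

include hc in
theorem hasCompactSupport_heatOp : HasCompactSupport (heatOp φ) := by
  refine HasCompactSupport.sub (hasCompactSupport_dT hc) ?_
  have : (fun z => ∑ i, dX i (dX i φ) z) = ∑ i, dX i (dX i φ) := by ext z; simp
  rw [this]
  have key : ∀ s : Finset (Fin N), HasCompactSupport (∑ i ∈ s, dX i (dX i φ)) := by
    intro s
    induction s using Finset.cons_induction with
    | empty => simp only [Finset.sum_empty]; exact HasCompactSupport.zero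
    | cons a s h ih =>
      rw [Finset.sum_cons]
      exact (hasCompactSupport_dX (hasCompactSupport_dX hc a) a).add ih
  exact key _

theorem fderiv_space (φ : PSpace N → ℝ) (z : PSpace N) (η : EuclideanSpace ℝ (Fin N)) :
    fderiv ℝ φ z (η, 0) = ∑ i, η i * dX i φ z := by
  have h : ((η, 0) : PSpace N)
      = ∑ i, η i • ((EuclideanSpace.single i (1 : ℝ), (0 : ℝ)) : PSpace N) := by
    have h0 : η = ∑ i, η i • EuclideanSpace.single i (1 : ℝ) := by
      ext j; simp [Finset.sum_apply, Pi.single_apply]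
    refine Prod.ext ?_ ?_
    · conv_lhs => rw [h0]
      simp [Prod.fst_sum]
    · simp [Prod.snd_sum]
  rw [h, map_sum]
  simp only [map_smul, smul_eq_mul, dX]

end smooth

/-- The Gaussian profile of the heat kernel at time one. -/
noncomputable def gauss (N : ℕ) (η : EuclideanSpace ℝ (Fin N)) : ℝ := heatK N (η, 1)

theorem gauss_eq (η : EuclideanSpace ℝ (Fin N)) :
    gauss N η = (4 * Real.pi) ^ (-(N : ℝ) / 2) * Real.exp (-(1 / 4) * ‖η‖ ^ 2) := by
  rw [gauss, heatK_slice one_pos]; simp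

theorem gauss_nonneg (η : EuclideanSpace ℝ (Fin N)) : 0 ≤ gauss N η := heatK_nonneg _ _

theorem contDiff_gauss : ContDiff ℝ ∞ (gauss N) := by
  have : gauss N = fun η => (4 * Real.pi) ^ (-(N : ℝ) / 2) * Real.exp (-(1 / 4) * ‖η‖ ^ 2) :=
    funext gauss_eq
  rw [this]
  exact contDiff_const.mul (Real.contDiff_exp.comp (contDiff_const.mul (contDiff_norm_sq ℝ)))

theorem integrable_gauss : Integrable (gauss N) := by
  have : gauss N = fun η => (4 * Real.pi) ^ (-(N : ℝ) / 2) * Real.exp (-(1 / 4) * ‖η‖ ^ 2) :=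
    funext gauss_eq
  rw [this]
  exact (integrable_gaussian_norm (by norm_num)).const_mul _

theorem integral_gauss : ∫ η, gauss N η = 1 := by
  have h := lintegral_Gam_slice (N := N) one_pos
  change ∫⁻ η, ENNReal.ofReal (gauss N η) = 1 at h
  rw [← ofReal_integral_eq_lintegral_ofReal integrable_gauss (ae_of_all _ gauss_nonneg)] at h
  simpa using h

theorem integrable_norm_mul_gauss : Integrable (fun η => ‖η‖ * gauss N η) := by
  have h0 := ((integrable_gaussian_norm (N := N) (b := 1 / 8) (by norm_num)).const_mul
    (2 * (4 * Real.pi) ^ (-(N : ℝ) / 2)))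
  refine h0.mono' (by have := contDiff_gauss (N := N).continuous; fun_prop) (ae_of_all _ fun η => ?_)
  rw [Real.norm_of_nonneg (by have := gauss_nonneg η; positivity), gauss_eq]
  have h1 : ‖η‖ ≤ 2 * Real.exp (1 / 8 * ‖η‖ ^ 2) := by
    have := Real.add_one_le_exp (1 / 8 * ‖η‖ ^ 2)
    nlinarith [sq_nonneg (‖η‖ - 4)]
  have h2 : Real.exp (-(1 / 4) * ‖η‖ ^ 2) * Real.exp (1 / 8 * ‖η‖ ^ 2)
      = Real.exp (-(1 / 8) * ‖η‖ ^ 2) := by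
    rw [← Real.exp_add]; congr 1; ring
  calc ‖η‖ * ((4 * Real.pi) ^ (-(N : ℝ) / 2) * Real.exp (-(1 / 4) * ‖η‖ ^ 2))
      ≤ 2 * Real.exp (1 / 8 * ‖η‖ ^ 2)
        * ((4 * Real.pi) ^ (-(N : ℝ) / 2) * Real.exp (-(1 / 4) * ‖η‖ ^ 2)) := by gcongr
    _ = _ := by rw [← h2]; ring

theorem fderiv_gauss (η v : EuclideanSpace ℝ (Fin N)) :
    fderiv ℝ (gauss N) η v = -(1 / 2) * inner ℝ η v * gauss N η := by
  have : gauss N = fun η => (4 * Real.pi) ^ (-(N : ℝ) / 2) * Real.exp (-(1 / 4) * ‖η‖ ^ 2) :=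
    funext gauss_eq
  rw [this]
  have h := (((hasStrictFDerivAt_norm_sq η).hasFDerivAt.const_mul (-(1 / 4 : ℝ))).exp).const_mul
    ((4 * Real.pi) ^ (-(N : ℝ) / 2))
  rw [h.fderiv]
  simp
  ring

theorem integrable_gauss_mul {f : EuclideanSpace ℝ (Fin N) → ℝ} (hf : Continuous f) {C : ℝ}
    (hC : ∀ η, |f η| ≤ C) : Integrable (fun η => gauss N η * f η) :=
  integrable_gauss.mul_bdd (c := C) hf.aestronglyMeasurable (ae_of_all _ fun η => hC η)

theorem exists_bound {φ : PSpace N → ℝ} (hφ : Continuous φ) (hc : HasCompactSupport φ) :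
    ∃ C, ∀ z, |φ z| ≤ C := hφ.bounded_above_of_compact_support hc

theorem gauss_ibp {φ : PSpace N → ℝ} (hφ : ContDiff ℝ ∞ φ) (hc : HasCompactSupport φ)
    (x : EuclideanSpace ℝ (Fin N)) (r τ : ℝ) (i : Fin N) :
    ∫ η, gauss N η * (η i * φ (x - r • η, τ))
      = -(2 * r) * ∫ η, gauss N η * dX i φ (x - r • η, τ) := by
  set ψ : EuclideanSpace ℝ (Fin N) → ℝ := fun η => φ (x - r • η, τ) with hψ
  have hψd : ContDiff ℝ ∞ ψ := hφ.comp (by fun_prop)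
  have hder : ∀ η, fderiv ℝ ψ η (EuclideanSpace.single i 1) = -r * dX i φ (x - r • η, τ) := by
    intro η
    have h1 : HasFDerivAt (fun η : EuclideanSpace ℝ (Fin N) => ((x - r • η, τ) : PSpace N))
        ((-(r • ContinuousLinearMap.id ℝ (EuclideanSpace ℝ (Fin N)))).prod 0) η := by
      refine HasFDerivAt.prodMk ?_ (hasFDerivAt_const _ _)
      exact ((hasFDerivAt_id η).const_smul r).const_sub x
    have h2 := ((hφ.differentiable (by simp) (x - r • η, τ)).hasFDerivAt.comp η h1).fderiv
    have : ψ = φ ∘ fun η => (x - r • η, τ) := rfl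
    rw [this, h2]
    simp only [ContinuousLinearMap.comp_apply, dX]
    have : ((-(r • ContinuousLinearMap.id ℝ (EuclideanSpace ℝ (Fin N)))).prod
        (0 : EuclideanSpace ℝ (Fin N) →L[ℝ] ℝ)) (EuclideanSpace.single i 1)
        = (-r) • ((EuclideanSpace.single i (1 : ℝ), (0 : ℝ)) : PSpace N) := by
      refine Prod.ext ?_ ?_ <;> simp
    rw [this, map_smul, smul_eq_mul]
  obtain ⟨C, hC⟩ := exists_bound hφ.continuous hc
  obtain ⟨C', hC'⟩ := exists_bound (contDiff_dX hφ i).continuous (hasCompactSupport_dX hc i)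
  have hG : ∀ η : EuclideanSpace ℝ (Fin N),
      fderiv ℝ (gauss N) η (EuclideanSpace.single i 1) = -(1 / 2) * η i * gauss N η := by
    intro η; rw [fderiv_gauss]; simp [EuclideanSpace.inner_single_right]
  have hcd := (contDiff_dX hφ i).continuous
  have hψc := hψd.continuous
  have hgc := (contDiff_gauss (N := N)).continuous
  have ibp := integral_mul_fderiv_eq_neg_fderiv_mul_of_integrable (μ := volume) (f := gauss N)
    (g := ψ) (v := EuclideanSpace.single i (1 : ℝ)) ?_ ?_ ?_
    (fun η _ => contDiff_gauss.differentiable (by simp) η)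
    (fun η _ => hψd.differentiable (by simp) η)
  · simp_rw [hder, hG] at ibp
    have e1 : ∀ η, gauss N η * (-r * dX i φ (x - r • η, τ))
        = -r * (gauss N η * dX i φ (x - r • η, τ)) := fun η => by ring
    have e2 : ∀ η : EuclideanSpace ℝ (Fin N), -(1 / 2) * η i * gauss N η * ψ η
        = -(1 / 2) * (gauss N η * (η i * φ (x - r • η, τ))) := fun η => by rw [hψ]; ring
    simp_rw [e1, e2] at ibp
    rw [integral_const_mul, integral_const_mul] at ibp
    linarith
  · simp_rw [hG]
    refine ((integrable_norm_mul_gauss (N := N)).const_mul C).mono' (by fun_prop)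
      (ae_of_all _ fun η => ?_)
    have h1 : |η i| ≤ ‖η‖ := PiLp.norm_apply_le η i
    have h2 := hC (x - r • η, τ)
    have h3 := gauss_nonneg η
    have hC0 : 0 ≤ C := (abs_nonneg _).trans h2
    rw [Real.norm_eq_abs, abs_mul, abs_mul, abs_mul, abs_of_nonneg h3]
    calc |-(1 / 2 : ℝ)| * |η i| * gauss N η * |ψ η| ≤ 1 * ‖η‖ * gauss N η * C := by
          gcongr
          rw [abs_neg, abs_of_pos] <;> norm_num
      _ = C * (‖η‖ * gauss N η) := by ring
  · simp_rw [hder]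
    refine integrable_gauss_mul (by fun_prop) (C := |r| * C') fun η => ?_
    rw [abs_mul, abs_neg]
    gcongr
    exact hC' _
  · exact integrable_gauss_mul hψc (C := C) fun η => hC _

theorem continuous_gauss_avg {φ : PSpace N → ℝ} (hφ : Continuous φ) {C : ℝ}
    (hC : ∀ z, |φ z| ≤ C) (x : EuclideanSpace ℝ (Fin N)) (t : ℝ) :
    Continuous (fun s : ℝ => ∫ η, gauss N η * φ (x - Real.sqrt s • η, t - s)) := by
  have hgc := (contDiff_gauss (N := N)).continuous
  refine continuous_of_dominated (bound := fun η => gauss N η * C) (fun s => by fun_prop)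
    (fun s => ae_of_all _ fun η => ?_) (integrable_gauss.mul_const C) (ae_of_all _ fun η => ?_)
  · rw [Real.norm_eq_abs, abs_mul, abs_of_nonneg (gauss_nonneg η)]
    exact mul_le_mul_of_nonneg_left (hC _) (gauss_nonneg η)
  · fun_prop

theorem hasDerivAt_gauss_avg {φ : PSpace N → ℝ} (hφ : ContDiff ℝ ∞ φ) (hc : HasCompactSupport φ)
    (x : EuclideanSpace ℝ (Fin N)) (t : ℝ) {s : ℝ} (hs : 0 < s) :
    HasDerivAt (fun s : ℝ => ∫ η, gauss N η * φ (x - Real.sqrt s • η, t - s))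
      (-∫ η, gauss N η * heatOp φ (x - Real.sqrt s • η, t - s)) s := by
  have hgc := (contDiff_gauss (N := N)).continuous
  have hφc := hφ.continuous
  have hfc : Continuous (fderiv ℝ φ) := hφ.continuous_fderiv (by simp)
  obtain ⟨C, hC⟩ := exists_bound hφc hc
  obtain ⟨C', hC'⟩ := hfc.bounded_above_of_compact_support (hc.fderiv ℝ)
  let D : ℝ → EuclideanSpace ℝ (Fin N) → ℝ := fun σ η => gauss N η *
    fderiv ℝ φ (x - Real.sqrt σ • η, t - σ) (-((1 / (2 * Real.sqrt σ)) • η), -1)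
  have hD : ∀ η : EuclideanSpace ℝ (Fin N), ∀ σ ∈ Ioi (s / 4),
      HasDerivAt (fun σ => gauss N η * φ (x - Real.sqrt σ • η, t - σ)) (D σ η) σ := by
    intro η σ hσ
    have hσ0 : 0 < σ := lt_trans (by positivity) hσ
    have h1 : HasDerivAt (fun σ => ((x - Real.sqrt σ • η, t - σ) : PSpace N))
        (-((1 / (2 * Real.sqrt σ)) • η), -1) σ := by
      refine HasDerivAt.prodMk ?_ ?_
      · exact ((Real.hasDerivAt_sqrt hσ0.ne').smul_const η).const_sub x
      · exact (hasDerivAt_id σ).const_sub t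
    exact ((hφ.differentiable (by simp) _).hasFDerivAt.comp_hasDerivAt σ h1).const_mul _
  have main := hasDerivAt_integral_of_dominated_loc_of_deriv_le (μ := volume)
    (F := fun σ η => gauss N η * φ (x - Real.sqrt σ • η, t - σ)) (x₀ := s) (F' := D)
    (bound := fun η => C' * ((1 / Real.sqrt s) * (‖η‖ * gauss N η) + gauss N η))
    (s := Ioi (s / 4)) (Ioi_mem_nhds (by linarith)) (Eventually.of_forall fun σ => by fun_prop)
    (integrable_gauss_mul (by fun_prop) fun η => hC _) (by fun_prop)
    (ae_of_all _ fun η σ hσ => ?_)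
    (((integrable_norm_mul_gauss.const_mul _).add integrable_gauss).const_mul _)
    (ae_of_all _ fun η σ hσ => hD η σ hσ)
  · refine main.2.congr_deriv ?_
    have hr : 0 < Real.sqrt s := Real.sqrt_pos.2 hs
    set r := Real.sqrt s with hrdef
    have e : ∀ η, D s η = -(1 / (2 * r)) * (∑ i, gauss N η * (η i * dX i φ (x - r • η, t - s)))
        - gauss N η * dT φ (x - r • η, t - s) := by
      intro η
      have hv : ((-((1 / (2 * r)) • η), -1) : PSpace N)
          = (-(1 / (2 * r))) • ((η, 0) : PSpace N) - ((0, 1) : PSpace N) := by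
        refine Prod.ext ?_ ?_ <;> simp
      simp only [D]
      rw [← hrdef, hv, map_sub, map_smul, fderiv_space, ← Finset.mul_sum, dT, smul_eq_mul]
      ring
    simp_rw [e]
    have hi : ∀ i, Integrable fun η : EuclideanSpace ℝ (Fin N) =>
        gauss N η * (η i * dX i φ (x - r • η, t - s)) := by
      intro i
      have hcd := (contDiff_dX hφ i).continuous
      obtain ⟨C₁, hC₁⟩ := exists_bound hcd (hasCompactSupport_dX hc i)
      refine ((integrable_norm_mul_gauss (N := N)).const_mul C₁).mono' (by fun_prop)
        (ae_of_all _ fun η => ?_)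
      have h1 : |η i| ≤ ‖η‖ := PiLp.norm_apply_le η i
      have h2 := hC₁ (x - r • η, t - s)
      have h3 := gauss_nonneg η
      rw [Real.norm_eq_abs, abs_mul, abs_mul, abs_of_nonneg h3]
      calc gauss N η * (|η i| * |dX i φ (x - r • η, t - s)|)
          ≤ gauss N η * (‖η‖ * C₁) := by gcongr
        _ = _ := by ring
    obtain ⟨C₂, hC₂⟩ := exists_bound (contDiff_dT hφ).continuous (hasCompactSupport_dT hc)
    have hdtc := (contDiff_dT hφ).continuous
    have hiT : Integrable fun η => gauss N η * dT φ (x - r • η, t - s) :=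
      integrable_gauss_mul (by fun_prop) fun η => hC₂ _
    rw [integral_sub ((integrable_finsetSum _ fun i _ => hi i).const_mul _) hiT,
      integral_const_mul, integral_finsetSum _ fun i _ => hi i]
    have hXX : ∀ i, Integrable fun η => gauss N η * dX i (dX i φ) (x - r • η, t - s) := by
      intro i
      have hcd := (contDiff_dX (contDiff_dX hφ i) i).continuous
      obtain ⟨C₁, hC₁⟩ := exists_bound hcd (hasCompactSupport_dX (hasCompactSupport_dX hc i) i)
      exact integrable_gauss_mul (by fun_prop) fun η => hC₁ _
    have e2 : ∀ η, gauss N η * heatOp φ (x - r • η, t - s)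
        = gauss N η * dT φ (x - r • η, t - s)
          - ∑ i, gauss N η * dX i (dX i φ) (x - r • η, t - s) := by
      intro η; rw [heatOp, mul_sub, Finset.mul_sum]
    simp_rw [e2]
    rw [integral_sub hiT (integrable_finsetSum _ fun i _ => hXX i),
      integral_finsetSum _ fun i _ => hXX i, Finset.mul_sum]
    have e3 : ∀ i, -(1 / (2 * r)) * ∫ η, gauss N η * (η i * dX i φ (x - r • η, t - s))
        = ∫ η, gauss N η * dX i (dX i φ) (x - r • η, t - s) := by
      intro i
      rw [gauss_ibp (contDiff_dX hφ i) (hasCompactSupport_dX hc i)]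
      field_simp
    simp_rw [e3]
    ring
  · have hσ0 : 0 < σ := lt_trans (by positivity) hσ
    have h3 := gauss_nonneg η
    have hr : 0 < Real.sqrt s := Real.sqrt_pos.2 hs
    have hrs : Real.sqrt s / 2 ≤ Real.sqrt σ := by
      have : Real.sqrt (s / 4) = Real.sqrt s / 2 := by
        rw [Real.sqrt_div hs.le]; congr 1
        rw [show (4 : ℝ) = 2 ^ 2 by norm_num, Real.sqrt_sq (by norm_num)]
      rw [← this]; exact Real.sqrt_le_sqrt (le_of_lt hσ)
    have hC'0 : 0 ≤ C' := (norm_nonneg _).trans (hC' 0)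
    simp only [D]
    rw [norm_mul, Real.norm_of_nonneg h3]
    have h4 : ‖((-((1 / (2 * Real.sqrt σ)) • η), -1) : PSpace N)‖
        ≤ (1 / Real.sqrt s) * ‖η‖ + 1 := by
      rw [Prod.norm_def]
      simp only [norm_neg, norm_smul, norm_one]
      refine max_le ?_ ?_
      · rw [Real.norm_of_nonneg (by positivity)]
        have : 1 / (2 * Real.sqrt σ) ≤ 1 / Real.sqrt s :=
          one_div_le_one_div_of_le hr (by linarith)
        nlinarith [norm_nonneg η]
      · have : 0 ≤ (1 / Real.sqrt s) * ‖η‖ := by positivity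
        linarith
    calc _ ≤ gauss N η * (C' * ((1 / Real.sqrt s) * ‖η‖ + 1)) := by
          gcongr
          refine (ContinuousLinearMap.le_opNorm _ _).trans ?_
          gcongr
          exact hC' _
      _ = _ := by ring

theorem integral_gauss_eq_heatK {s : ℝ} (hs : 0 < s) (f : EuclideanSpace ℝ (Fin N) → ℝ)
    (x : EuclideanSpace ℝ (Fin N)) :
    ∫ η, gauss N η * f (x - Real.sqrt s • η) = ∫ y, heatK N (y, s) * f (x - y) := by
  have hr : 0 < Real.sqrt s := Real.sqrt_pos.2 hs
  have h := Measure.integral_comp_smul (volume : Measure (EuclideanSpace ℝ (Fin N)))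
    (fun y => heatK N (y, s) * f (x - y)) (Real.sqrt s)
  rw [finrank_euclideanSpace, Fintype.card_fin, abs_of_pos (by positivity), smul_eq_mul] at h
  have e : ∀ η, heatK N (Real.sqrt s • η, s) * f (x - Real.sqrt s • η)
      = ((Real.sqrt s ^ N)⁻¹) * (gauss N η * f (x - Real.sqrt s • η)) := by
    intro η
    rw [heatK_slice hs, gauss_eq, norm_smul, Real.norm_of_nonneg hr.le, mul_pow,
      Real.sq_sqrt hs.le, Real.mul_rpow (by positivity) hs.le]
    have h1 : s ^ (-(N : ℝ) / 2) = (Real.sqrt s ^ N)⁻¹ := by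
      rw [Real.sqrt_eq_rpow, ← Real.rpow_natCast, ← Real.rpow_mul hs.le, ← Real.rpow_neg hs.le]
      congr 1; ring
    have h2 : -(1 / (4 * s)) * (s * ‖η‖ ^ 2) = -(1 / 4) * ‖η‖ ^ 2 := by field_simp
    rw [h1, h2]; ring
  simp_rw [e] at h
  rw [integral_const_mul] at h
  exact mul_left_cancel₀ (by positivity) h

theorem locallyIntegrable_aux {F : PSpace N → ℝ} (hF : Continuous F) (hc : HasCompactSupport F)
    (z : PSpace N) : Integrable (fun v => heatK N v * F (z - v)) := by
  obtain ⟨C, hC⟩ := exists_bound hF hc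
  obtain ⟨R, hR⟩ := hc.isCompact.isBounded.subset_closedBall (0 : PSpace N)
  have hC0 : 0 ≤ C := (abs_nonneg _).trans (hC 0)
  set S : Set (PSpace N) := {w : PSpace N | w.2 ∈ Ioo 0 (z.2 + R + 1)} with hSdef
  have hS : MeasurableSet S := measurable_snd measurableSet_Ioo
  have hi : IntegrableOn (heatK N) S := by
    refine ⟨(measurable_heatK N).aestronglyMeasurable, ?_⟩
    have := lintegral_slab (measurable_Gam N) (m := fun _ => 1)
      (fun s hs => lintegral_Gam_slice hs) (z.2 + R + 1)
    rw [hasFiniteIntegral_iff_ofReal (ae_of_all _ fun w => heatK_nonneg _ _)]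
    change ∫⁻ w in S, Gam N w < ⊤
    rw [this]; simp
  have hi2 : Integrable (fun w => C * S.indicator (heatK N) w) :=
    ((integrable_indicator_iff hS).2 hi).const_mul C
  refine hi2.mono' (by have := measurable_heatK N; fun_prop) (ae_of_all _ fun v => ?_)
  rw [norm_mul, Real.norm_of_nonneg (heatK_nonneg _ _), Real.norm_eq_abs]
  by_cases hv : v ∈ S
  · rw [indicator_of_mem hv, mul_comm]
    gcongr
    · exact heatK_nonneg _ _
    · exact hC _
  · rw [indicator_of_notMem hv]
    rcases le_or_gt v.2 0 with h | h
    · rw [heatK_of_nonpos h]; simp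
    · have h2 : z.2 + R + 1 ≤ v.2 := by by_contra h'; exact hv ⟨h, not_le.1 h'⟩
      have : F (z - v) = 0 := by
        by_contra hne
        have := hR (subset_tsupport _ (Function.mem_support.2 hne))
        rw [mem_closedBall_zero_iff] at this
        have h3 : |(z - v).2| ≤ R := (norm_snd_le (z - v)).trans this
        rw [Prod.snd_sub, abs_le] at h3
        linarith [h3.1]
      simp [this]

/-- The heat kernel is a fundamental solution: `Γ * (∂ₜ - Δ)φ = φ`. -/
theorem heatK_conv_heatOp {φ : PSpace N → ℝ} (hφ : ContDiff ℝ ∞ φ) (hc : HasCompactSupport φ)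
    (z : PSpace N) : ∫ v, heatK N v * heatOp φ (z - v) = φ z := by
  obtain ⟨x, t⟩ := z
  have hLc := (contDiff_heatOp hφ).continuous
  have hLs := hasCompactSupport_heatOp hc
  have hInt := locallyIntegrable_aux hLc hLs (x, t)
  obtain ⟨C, hC⟩ := exists_bound hφ.continuous hc
  obtain ⟨C', hC'⟩ := exists_bound hLc hLs
  obtain ⟨R, hR⟩ := (hc.isCompact.union hLs.isCompact).isBounded.subset_closedBall (0 : PSpace N)
  set T : ℝ := max (t + R + 1) 0 with hT
  have hT0 : 0 ≤ T := le_max_right _ _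
  have hout : ∀ w : PSpace N, ∀ s, T ≤ s → w.2 = t - s → φ w = 0 ∧ heatOp φ w = 0 := by
    intro w s hs hw
    have hn : w ∉ closedBall (0 : PSpace N) R := by
      rw [mem_closedBall_zero_iff, not_le]
      refine lt_of_lt_of_le ?_ (norm_snd_le w)
      rw [hw, Real.norm_eq_abs, abs_sub_comm]
      refine lt_of_lt_of_le ?_ (le_abs_self _)
      have := (le_max_left (t + R + 1) 0).trans hs
      linarith
    constructor
    · by_contra h; exact hn (hR (Or.inl (subset_tsupport _ (Function.mem_support.2 h))))
    · by_contra h; exact hn (hR (Or.inr (subset_tsupport _ (Function.mem_support.2 h))))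
  set θ : ℝ → ℝ := fun s => ∫ η, gauss N η * φ (x - Real.sqrt s • η, t - s) with hθ
  have hft := intervalIntegral.integral_eq_sub_of_hasDerivAt_of_le hT0
    (continuous_gauss_avg hφ.continuous hC x t).continuousOn
    (fun s hs => hasDerivAt_gauss_avg hφ hc x t hs.1)
    ((continuous_gauss_avg hLc hC' x t).neg.intervalIntegrable _ _)
  have e0 : θ 0 = φ (x, t) := by
    simp only [hθ, Real.sqrt_zero, zero_smul, sub_zero]
    rw [integral_mul_const, integral_gauss, one_mul]
  have eT : θ T = 0 := by
    simp only [hθ]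
    refine (integral_congr_ae (ae_of_all _ fun η => ?_)).trans (integral_zero _ _)
    rw [(hout (x - Real.sqrt T • η, t - T) T le_rfl rfl).1, mul_zero]
  change _ = θ T - θ 0 at hft
  rw [eT, e0, intervalIntegral.integral_neg, zero_sub, neg_inj] at hft
  rw [← hft, Measure.volume_eq_prod, integral_prod_symm _ (by rw [← Measure.volume_eq_prod]; exact hInt),
    intervalIntegral.integral_of_le hT0, ← integral_indicator measurableSet_Ioc]
  congr 1; ext s
  by_cases hs : s ∈ Ioc 0 T
  · rw [indicator_of_mem hs]
    exact (integral_gauss_eq_heatK hs.1 (fun y => heatOp φ (y, t - s)) x).symm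
  · rw [indicator_of_notMem hs]
    refine (integral_congr_ae (ae_of_all _ fun η => ?_)).trans (integral_zero _ _)
    rcases le_or_gt s 0 with h | h
    · rw [heatK_of_nonpos (by exact h), zero_mul]
    · have h2 : T ≤ s := by by_contra h'; exact hs ⟨h, (not_le.1 h').le⟩
      rw [(hout ((x, t) - (η, s)) s h2 rfl).2, mul_zero]

end ParabolicWiener

namespace ParabolicWiener

open MeasureTheory Metric Set Filter Topology
open scoped ENNReal NNReal ContDiff

variable {N : ℕ}

/-- The function `x^a exp (-1/(4x))` on the positive half-line, extended by zero. -/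
noncomputable def powExp (a x : ℝ) : ℝ := if 0 < x then x ^ a * Real.exp (-1 / (4 * x)) else 0

theorem pow_mul_exp_neg_le (k : ℕ) {X : ℝ} (hX : 0 ≤ X) :
    X ^ k * Real.exp (-X / 4) ≤ 4 ^ k * k.factorial := by
  have h := Real.pow_div_factorial_le_exp (X / 4) (by positivity) k
  rw [div_le_iff₀ (by positivity), div_pow, div_le_iff₀ (by positivity)] at h
  rw [neg_div, Real.exp_neg, ← div_eq_mul_inv, div_le_iff₀ (Real.exp_pos _)]
  linarith

theorem powExp_le (a : ℝ) : ∃ C, ∀ x ∈ Ioc (0 : ℝ) 1, powExp a x ≤ C * x ^ 2 := by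
  obtain ⟨k, hk⟩ := exists_nat_ge (2 - a)
  refine ⟨4 ^ k * k.factorial, fun x hx => ?_⟩
  have hx0 := hx.1
  rw [powExp, if_pos hx0]
  have h1 := pow_mul_exp_neg_le k (inv_nonneg.2 hx0.le)
  have h2 : x ^ a ≤ (x⁻¹) ^ k * x ^ 2 := by
    rw [inv_pow, ← Real.rpow_natCast, ← Real.rpow_neg hx0.le, ← Real.rpow_natCast,
      ← Real.rpow_add hx0]
    apply Real.rpow_le_rpow_of_exponent_ge hx0 hx.2
    push_cast; linarith
  have h3 : -1 / (4 * x) = -x⁻¹ / 4 := by field_simp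
  calc x ^ a * Real.exp (-1 / (4 * x)) ≤ (x⁻¹) ^ k * x ^ 2 * Real.exp (-x⁻¹ / 4) := by
        rw [h3]; gcongr
    _ = ((x⁻¹) ^ k * Real.exp (-x⁻¹ / 4)) * x ^ 2 := by ring
    _ ≤ _ := by gcongr

theorem powExp_nonneg (a x : ℝ) : 0 ≤ powExp a x := by
  unfold powExp; split_ifs <;> positivity

theorem hasDerivAt_powExp (a x : ℝ) :
    HasDerivAt (powExp a) (a * powExp (a - 1) x + powExp (a - 2) x / 4) x := by
  rcases lt_trichotomy x 0 with h | h | h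
  · have h1 : powExp a =ᶠ[𝓝 x] fun _ => 0 := by
      filter_upwards [Iio_mem_nhds h] with y hy
      rw [powExp, if_neg (not_lt.2 (le_of_lt hy))]
    refine ((hasDerivAt_const x (0 : ℝ)).congr_of_eventuallyEq h1).congr_deriv ?_
    simp [powExp, not_lt.2 h.le]
  · subst h
    obtain ⟨C, hC⟩ := powExp_le a
    have hC0 : 0 ≤ C := by
      have := (powExp_nonneg a 1).trans (hC 1 ⟨one_pos, le_rfl⟩)
      simpa using this
    refine HasDerivAt.congr_deriv (f' := 0) ?_ (by simp [powExp])
    rw [hasDerivAt_iff_isLittleO_nhds_zero]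
    simp only [zero_add, smul_zero, sub_zero]
    have h0 : powExp a 0 = 0 := by simp [powExp]
    rw [h0]
    simp only [sub_zero]
    have hO : (fun h => powExp a h) =O[𝓝 0] fun h : ℝ => h ^ 2 := by
      refine Asymptotics.IsBigO.of_bound C ?_
      filter_upwards [Iio_mem_nhds (one_pos)] with y hy
      rw [Real.norm_of_nonneg (powExp_nonneg _ _), Real.norm_of_nonneg (by positivity)]
      rcases le_or_gt y 0 with hy0 | hy0
      · rw [powExp, if_neg (not_lt.2 hy0)]; positivity
      · exact hC y ⟨hy0, le_of_lt hy⟩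
    exact hO.trans_isLittleO (Asymptotics.isLittleO_pow_id one_lt_two)
  · have h1 : powExp a =ᶠ[𝓝 x] fun y => y ^ a * Real.exp (-1 / (4 * y)) := by
      filter_upwards [Ioi_mem_nhds h] with y hy
      rw [powExp, if_pos (show 0 < y from hy)]
    refine HasDerivAt.congr_of_eventuallyEq ?_ h1
    have h2 : HasDerivAt (fun y : ℝ => -1 / (4 * y)) (1 / (4 * x ^ 2)) x := by
      have : HasDerivAt (fun y : ℝ => -(1 / 4) * y⁻¹) (-(1 / 4) * -(x ^ 2)⁻¹) x :=
        (hasDerivAt_inv h.ne').const_mul _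
      refine (this.congr_of_eventuallyEq (Eventually.of_forall fun y => ?_)).congr_deriv ?_
      · simp only [mul_inv, div_eq_mul_inv]; ring
      · field_simp
    refine ((Real.hasDerivAt_rpow_const (Or.inl h.ne')).mul h2.exp).congr_deriv ?_
    have e2 : x ^ (a - 2) = x ^ a / x ^ 2 := by
      rw [Real.rpow_sub h, Real.rpow_two]
    rw [powExp, powExp, if_pos h, if_pos h, Real.rpow_sub_one h.ne', e2]
    field_simp

theorem contDiff_powExp (n : ℕ) : ∀ a, ContDiff ℝ n (powExp a) := by
  induction n with
  | zero =>
    intro a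
    exact contDiff_zero.2 (continuous_iff_continuousAt.2 fun x => (hasDerivAt_powExp a x).continuousAt)
  | succ n ih =>
    intro a
    have hd : deriv (powExp a) = fun x => a * powExp (a - 1) x + powExp (a - 2) x / 4 :=
      funext fun x => (hasDerivAt_powExp a x).deriv
    push_cast
    rw [contDiff_succ_iff_deriv]
    refine ⟨fun x => (hasDerivAt_powExp a x).differentiableAt, by simp, ?_⟩
    rw [hd]
    exact (contDiff_const.mul (ih _)).add ((ih _).div_const _)

theorem heatK_eq_powExp {y : EuclideanSpace ℝ (Fin N)} (hy : y ≠ 0) (s : ℝ) :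
    heatK N (y, s) = (4 * Real.pi) ^ (-(N : ℝ) / 2) * (‖y‖ ^ 2) ^ (-(N : ℝ) / 2)
      * powExp (-(N : ℝ) / 2) (s / ‖y‖ ^ 2) := by
  have hn : 0 < ‖y‖ := norm_pos_iff.2 hy
  by_cases hs : 0 < s
  · rw [heatK_of_pos (by exact hs), powExp, if_pos (by positivity)]
    simp only
    rw [Real.mul_rpow (by positivity) hs.le, Real.div_rpow hs.le (by positivity)]
    have : 0 < (‖y‖ ^ 2) ^ (-(N : ℝ) / 2) := by positivity
    have h2 : -‖y‖ ^ 2 / (4 * s) = -1 / (4 * (s / ‖y‖ ^ 2)) := by field_simp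
    rw [h2]; field_simp
  · rw [heatK_of_nonpos (by exact not_lt.1 hs), powExp, if_neg, mul_zero]
    rw [not_lt]
    exact div_nonpos_of_nonpos_of_nonneg (not_lt.1 hs) (by positivity)

theorem contDiffAt_heatK {z : PSpace N} (hz : z ≠ 0) : ContDiffAt ℝ ∞ (heatK N) z := by
  obtain ⟨y, s⟩ := z
  by_cases hy : y = 0
  · have hs : s ≠ 0 := fun h => hz (by rw [hy, h]; rfl)
    rcases lt_or_gt_of_ne hs with h | h
    · have h1 : heatK N =ᶠ[𝓝 (y, s)] fun _ => 0 := by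
        filter_upwards [(isOpen_Iio.preimage continuous_snd).mem_nhds (show (y, s).2 < 0 from h)]
          with w hw
        exact heatK_of_nonpos (le_of_lt hw)
      exact contDiffAt_const.congr_of_eventuallyEq h1
    · have h1 : heatK N =ᶠ[𝓝 (y, s)] fun w => (4 * Real.pi * w.2) ^ (-(N : ℝ) / 2)
          * Real.exp (-‖w.1‖ ^ 2 / (4 * w.2)) := by
        filter_upwards [(isOpen_Ioi.preimage continuous_snd).mem_nhds (show 0 < (y, s).2 from h)]
          with w hw
        exact heatK_of_pos hw
      refine ContDiffAt.congr_of_eventuallyEq ?_ h1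
      refine ContDiffAt.mul ?_ ?_
      · refine ContDiffAt.rpow_const_of_ne (contDiffAt_const.mul contDiffAt_snd) ?_
        simp only; positivity
      · refine ContDiffAt.exp (ContDiffAt.div (contDiffAt_fst.norm_sq ℝ).neg
          (contDiffAt_const.mul contDiffAt_snd) ?_)
        simp only; positivity
  · have h1 : heatK N =ᶠ[𝓝 (y, s)] fun w => (4 * Real.pi) ^ (-(N : ℝ) / 2)
        * (‖w.1‖ ^ 2) ^ (-(N : ℝ) / 2) * powExp (-(N : ℝ) / 2) (w.2 / ‖w.1‖ ^ 2) := by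
      filter_upwards [(isOpen_ne.preimage continuous_fst).mem_nhds (show (y, s).1 ≠ 0 from hy)]
        with w hw
      exact heatK_eq_powExp hw w.2
    refine ContDiffAt.congr_of_eventuallyEq ?_ h1
    have hn : ‖y‖ ^ 2 ≠ 0 := by simpa using hy
    have hN : ContDiffAt ℝ ∞ (fun w : PSpace N => ‖w.1‖ ^ 2) (y, s) := contDiffAt_fst.norm_sq ℝ
    refine (contDiffAt_const.mul (hN.rpow_const_of_ne hn)).mul ?_
    have hP : ContDiff ℝ ∞ (powExp (-(N : ℝ) / 2)) := contDiff_infty.2 fun n => contDiff_powExp n _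
    exact ContDiffAt.comp (y, s) (g := powExp (-(N : ℝ) / 2)) hP.contDiffAt
      (contDiffAt_snd.div hN hn)

/-- Off a parabolic cylinder of radius `r` the heat kernel is at most a multiple of `r^{-N}`. -/
theorem heatK_le {z : PSpace N} {r : ℝ} (hr : 0 < r) (hz : r ≤ ‖z.1‖ ∨ r ^ 2 ≤ |z.2|) :
    heatK N z ≤ (1 + 4 ^ N * N.factorial) * (r ^ N)⁻¹ := by
  have hC : (1 : ℝ) ≤ 1 + 4 ^ N * N.factorial := by
    have : (0 : ℝ) ≤ 4 ^ N * N.factorial := by positivity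
    linarith
  rcases le_or_gt z.2 0 with hs | hs
  · rw [heatK_of_nonpos hs]; positivity
  rw [heatK_of_pos hs]
  have hpi : (1 : ℝ) ≤ 4 * Real.pi := by linarith [Real.pi_gt_three]
  have hrN : (r ^ 2) ^ (-(N : ℝ) / 2) = (r ^ N)⁻¹ := by
    rw [← Real.rpow_natCast, ← Real.rpow_mul hr.le, ← Real.rpow_natCast, ← Real.rpow_neg hr.le]
    congr 1; push_cast; ring
  have h1 : (4 * Real.pi * z.2) ^ (-(N : ℝ) / 2) ≤ z.2 ^ (-(N : ℝ) / 2) := by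
    refine Real.rpow_le_rpow_of_nonpos hs (by nlinarith) ?_
    rw [neg_div]; simp; positivity
  rcases hz with hz | hz
  · set X := r ^ 2 / z.2 with hX
    have hX0 : 0 < X := by positivity
    have h2 : z.2 ^ (-(N : ℝ) / 2) = (r ^ N)⁻¹ * X ^ ((N : ℝ) / 2) := by
      rw [← hrN, hX, Real.div_rpow (by positivity) hs.le, neg_div,
        Real.rpow_neg hs.le, Real.rpow_neg (sq_nonneg r)]
      have : 0 < (r ^ 2) ^ ((N : ℝ) / 2) := by positivity
      field_simp
    have h3 : Real.exp (-‖z.1‖ ^ 2 / (4 * z.2)) ≤ Real.exp (-X / 4) := by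
      apply Real.exp_le_exp.2
      rw [hX, neg_div, neg_div, neg_le_neg_iff, div_div, mul_comm z.2]
      gcongr
    have h4 : X ^ ((N : ℝ) / 2) * Real.exp (-X / 4) ≤ 1 + 4 ^ N * N.factorial := by
      rcases le_or_gt X 1 with h | h
      · calc X ^ ((N : ℝ) / 2) * Real.exp (-X / 4) ≤ 1 * 1 := by
              gcongr
              · exact Real.rpow_le_one hX0.le h (by positivity)
              · rw [Real.exp_le_one_iff]; linarith
          _ ≤ _ := by linarith
      · calc X ^ ((N : ℝ) / 2) * Real.exp (-X / 4) ≤ X ^ N * Real.exp (-X / 4) := by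
              gcongr
              rw [← Real.rpow_natCast]
              exact Real.rpow_le_rpow_of_exponent_le h.le (by
                have : (0 : ℝ) ≤ N := by positivity
                linarith)
          _ ≤ 4 ^ N * N.factorial := pow_mul_exp_neg_le N hX0.le
          _ ≤ _ := by linarith
    calc _ ≤ z.2 ^ (-(N : ℝ) / 2) * Real.exp (-X / 4) := by gcongr
      _ = (r ^ N)⁻¹ * (X ^ ((N : ℝ) / 2) * Real.exp (-X / 4)) := by rw [h2]; ring
      _ ≤ (r ^ N)⁻¹ * (1 + 4 ^ N * N.factorial) := by gcongr
      _ = _ := mul_comm _ _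
  · rw [abs_of_pos hs] at hz
    calc _ ≤ z.2 ^ (-(N : ℝ) / 2) * 1 := by
          gcongr
          rw [Real.exp_le_one_iff, neg_div]
          simp; positivity
      _ ≤ (r ^ 2) ^ (-(N : ℝ) / 2) * 1 := by
          refine mul_le_mul_of_nonneg_right
            (Real.rpow_le_rpow_of_nonpos (by positivity) hz ?_) zero_le_one
          rw [neg_div]; simp; positivity
      _ = 1 * (r ^ N)⁻¹ := by rw [hrN]; ring
      _ ≤ _ := by gcongr

theorem le_heatK {z : PSpace N} {a b R : ℝ} (ha : 0 < a) (h1 : a ≤ z.2) (h2 : z.2 ≤ b)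
    (hR : ‖z.1‖ ≤ R) :
    (4 * Real.pi * b) ^ (-(N : ℝ) / 2) * Real.exp (-(R ^ 2 / (4 * a))) ≤ heatK N z := by
  have hs : 0 < z.2 := ha.trans_le h1
  rw [heatK_of_pos hs]
  gcongr ?_ * Real.exp ?_
  · refine Real.rpow_le_rpow_of_nonpos (by positivity) (by gcongr) ?_
    rw [neg_div]; simp; positivity
  · rw [neg_div, neg_le_neg_iff]
    gcongr

theorem integrable_slab_heatK (N : ℕ) (T : ℝ) :
    Integrable ({w : PSpace N | w.2 ∈ Ioo 0 T}.indicator (heatK N)) := by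
  have hS : MeasurableSet {w : PSpace N | w.2 ∈ Ioo 0 T} := measurable_snd measurableSet_Ioo
  rw [integrable_indicator_iff hS]
  refine ⟨(measurable_heatK N).aestronglyMeasurable, ?_⟩
  have := lintegral_slab (measurable_Gam N) (m := fun _ => 1)
    (fun s hs => lintegral_Gam_slice hs) T
  rw [hasFiniteIntegral_iff_ofReal (ae_of_all _ fun w => heatK_nonneg _ _)]
  change ∫⁻ w in {w : PSpace N | w.2 ∈ Ioo 0 T}, Gam N w < ⊤
  rw [this]; simp

theorem heatK_eq_slab {z : PSpace N} {T : ℝ} (h : z.2 < T) :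
    heatK N z = {w : PSpace N | w.2 ∈ Ioo 0 T}.indicator (heatK N) z := by
  by_cases hz : z.2 ∈ Ioo 0 T
  · rw [indicator_of_mem (by exact hz)]
  · rw [indicator_of_notMem (by exact hz), heatK_of_nonpos]
    by_contra h'; exact hz ⟨not_le.1 h', h⟩

end ParabolicWiener

namespace ParabolicWiener

open MeasureTheory Metric Set Filter Topology
open scoped ENNReal NNReal ContDiff

variable {N : ℕ}

/-- A smooth cut-off function equal to one near the origin, supported in a ball of radius `δ`. -/
structure IsCutoff (δ : ℝ) (ψ : PSpace N → ℝ) : Prop where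
  smooth : ContDiff ℝ ∞ ψ
  nonneg : ∀ z, 0 ≤ ψ z
  le_one : ∀ z, ψ z ≤ 1
  supp : tsupport ψ ⊆ closedBall 0 δ
  eq_one : ψ =ᶠ[𝓝 0] fun _ => 1

theorem exists_isCutoff {δ : ℝ} (hδ : 0 < δ) : ∃ ψ : PSpace N → ℝ, IsCutoff δ ψ := by
  let f : ContDiffBump (0 : PSpace N) := ⟨δ / 2, δ, by positivity, by linarith⟩
  exact ⟨f, f.contDiff, fun z => f.nonneg, fun z => f.le_one, f.tsupport_eq.le,
    f.eventuallyEq_one⟩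

/-- The heat kernel localised near the origin. -/
noncomputable def locK (ψ : PSpace N → ℝ) (z : PSpace N) : ℝ := ψ z * heatK N z

/-- The part of the heat kernel away from the origin. -/
noncomputable def farK (ψ : PSpace N → ℝ) (z : PSpace N) : ℝ := (1 - ψ z) * heatK N z

/-- The error kernel of the parametrix `locK ψ`. -/
noncomputable def errK (ψ : PSpace N → ℝ) : PSpace N → ℝ := heatOp (farK ψ)

section ibp

theorem integral_fderiv_mul_comp_sub {w φ : PSpace N → ℝ} (hw : ContDiff ℝ ∞ w)
    (hφ : ContDiff ℝ ∞ φ) (hc : HasCompactSupport φ) (z e : PSpace N) :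
    ∫ v, fderiv ℝ w v e * φ (z - v) = ∫ v, w v * fderiv ℝ φ (z - v) e := by
  have hφ' : ContDiff ℝ ∞ fun v => φ (z - v) := hφ.comp (contDiff_const.sub contDiff_id)
  have hc' : HasCompactSupport fun v => φ (z - v) :=
    hc.comp_homeomorph (Homeomorph.subLeft z)
  have hd : ∀ v, fderiv ℝ (fun v => φ (z - v)) v e = -fderiv ℝ φ (z - v) e := by
    intro v
    have h1 : HasFDerivAt φ (fderiv ℝ φ (z - v)) (z - v) :=
      (hφ.differentiable (by simp) _).hasFDerivAt
    have h2 := h1.comp v ((hasFDerivAt_id v).const_sub z)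
    have h3 : HasFDerivAt (fun v => φ (z - v)) _ v := h2
    rw [h3.fderiv]; simp
  have hwd : Continuous fun v => fderiv ℝ w v e :=
    ((hw.continuous_fderiv (by simp)).clm_apply continuous_const)
  have hφd : Continuous fun v => fderiv ℝ (fun v => φ (z - v)) v e :=
    ((hφ'.continuous_fderiv (by simp)).clm_apply continuous_const)
  have hcd : HasCompactSupport fun v => fderiv ℝ (fun v => φ (z - v)) v e :=
    (hc'.fderiv ℝ).comp_left (g := fun L : PSpace N →L[ℝ] ℝ => L e) rfl
  have key := integral_mul_fderiv_eq_neg_fderiv_mul_of_integrable (μ := volume) (f := w)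
    (g := fun v => φ (z - v)) (v := e)
    ((hwd.mul hφ'.continuous).integrable_of_hasCompactSupport hc'.mul_left)
    ((hw.continuous.mul hφd).integrable_of_hasCompactSupport hcd.mul_left)
    ((hw.continuous.mul hφ'.continuous).integrable_of_hasCompactSupport hc'.mul_left)
    (fun x _ => hw.differentiable (by simp) x) (fun x _ => hφ'.differentiable (by simp) x)
  simp_rw [hd, mul_neg, integral_neg] at key
  linarith

theorem integral_heatOp_mul_comp_sub {w φ : PSpace N → ℝ} (hw : ContDiff ℝ ∞ w)
    (hφ : ContDiff ℝ ∞ φ) (hc : HasCompactSupport φ) (z : PSpace N) :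
    ∫ v, heatOp w v * φ (z - v) = ∫ v, w v * heatOp φ (z - v) := by
  have int : ∀ {f g : PSpace N → ℝ}, ContDiff ℝ ∞ f → ContDiff ℝ ∞ g → HasCompactSupport g →
      Integrable fun v => f v * g (z - v) := fun {f g} hf hg hgc =>
    (hf.continuous.mul (hg.continuous.comp (continuous_const.sub continuous_id)))
      |>.integrable_of_hasCompactSupport
        ((hgc.comp_homeomorph (Homeomorph.subLeft z)).mul_left)
  simp only [heatOp, sub_mul, mul_sub, Finset.sum_mul, Finset.mul_sum]
  rw [integral_sub (int (contDiff_dT hw) hφ hc)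
      (integrable_finsetSum _ fun i _ => int (contDiff_dX (contDiff_dX hw i) i) hφ hc),
    integral_sub (int hw (contDiff_dT hφ) (hasCompactSupport_dT hc))
      (integrable_finsetSum _ fun i _ => int hw (contDiff_dX (contDiff_dX hφ i) i)
        (hasCompactSupport_dX (hasCompactSupport_dX hc i) i)),
    integral_finsetSum _ (fun i _ => int (contDiff_dX (contDiff_dX hw i) i) hφ hc),
    integral_finsetSum _ (fun i _ => int hw (contDiff_dX (contDiff_dX hφ i) i)
        (hasCompactSupport_dX (hasCompactSupport_dX hc i) i))]
  congr 1
  · exact integral_fderiv_mul_comp_sub hw hφ hc z _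
  · refine Finset.sum_congr rfl fun i _ => ?_
    have h1 : ∫ v, dX i (dX i w) v * φ (z - v) = ∫ v, dX i w v * dX i φ (z - v) :=
      integral_fderiv_mul_comp_sub (contDiff_dX hw i) hφ hc z _
    have h2 : ∫ v, dX i w v * dX i φ (z - v) = ∫ v, w v * dX i (dX i φ) (z - v) :=
      integral_fderiv_mul_comp_sub hw (contDiff_dX hφ i) (hasCompactSupport_dX hc i) z _
    rw [h1, h2]

end ibp

namespace IsCutoff

variable {δ : ℝ} {ψ : PSpace N → ℝ} (h : IsCutoff δ ψ)
include h

theorem hasCompactSupport : HasCompactSupport ψ :=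
  (isCompact_closedBall (0 : PSpace N) δ).of_isClosed_subset (isClosed_tsupport ψ) h.supp

theorem locK_nonneg (z : PSpace N) : 0 ≤ locK ψ z := mul_nonneg (h.nonneg z) (heatK_nonneg _ _)

theorem farK_nonneg (z : PSpace N) : 0 ≤ farK ψ z :=
  mul_nonneg (sub_nonneg.2 (h.le_one z)) (heatK_nonneg _ _)

theorem locK_le (z : PSpace N) : locK ψ z ≤ heatK N z :=
  mul_le_of_le_one_left (heatK_nonneg _ _) (h.le_one z)

theorem farK_le (z : PSpace N) : farK ψ z ≤ heatK N z :=
  mul_le_of_le_one_left (heatK_nonneg _ _) (by linarith [h.nonneg z])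

theorem measurable_locK : Measurable (locK ψ) :=
  h.smooth.continuous.measurable.mul (measurable_heatK N)

theorem contDiff_farK : ContDiff ℝ ∞ (farK ψ) := by
  rw [contDiff_iff_contDiffAt]
  intro z
  by_cases hz : z = 0
  · have : farK ψ =ᶠ[𝓝 z] fun _ => 0 := by
      rw [hz]
      filter_upwards [h.eq_one] with v hv
      simp [farK, hv]
    exact contDiffAt_const.congr_of_eventuallyEq this
  · exact (contDiffAt_const.sub h.smooth.contDiffAt).mul (contDiffAt_heatK hz)

theorem contDiff_errK : ContDiff ℝ ∞ (errK ψ) := contDiff_heatOp h.contDiff_farK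

omit h in
theorem locK_eq_zero {z : PSpace N} (hz : z ∉ tsupport ψ) : locK ψ z = 0 := by
  rw [locK, image_eq_zero_of_notMem_tsupport hz, zero_mul]

/-- The parametrix identity. -/
theorem integral_locK_heatOp {φ : PSpace N → ℝ} (hφ : ContDiff ℝ ∞ φ) (hc : HasCompactSupport φ)
    (z : PSpace N) :
    ∫ v, locK ψ v * heatOp φ (z - v) = φ z - ∫ v, errK ψ v * φ (z - v) := by
  rw [errK, integral_heatOp_mul_comp_sub h.contDiff_farK hφ hc z, ← heatK_conv_heatOp hφ hc z,
    ← integral_sub]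
  · congr 1; ext v; simp only [locK, farK]; ring
  · exact locallyIntegrable_aux (contDiff_heatOp hφ).continuous (hasCompactSupport_heatOp hc) z
  · refine (h.contDiff_farK.continuous.mul ((contDiff_heatOp hφ).continuous.comp
      (continuous_const.sub continuous_id))).integrable_of_hasCompactSupport
      (((hasCompactSupport_heatOp hc).comp_homeomorph (Homeomorph.subLeft z)).mul_left)

theorem errK_eq_zero {z : PSpace N} (hz : z ∉ tsupport ψ) : errK ψ z = 0 := by
  have hcont := h.contDiff_errK.continuous
  have hU : IsOpen (tsupport ψ)ᶜ := (isClosed_tsupport ψ).isOpen_compl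
  have h0 : (0 : PSpace N) ∈ tsupport ψ := by
    refine subset_tsupport _ ?_
    rw [Function.mem_support, h.eq_one.self_of_nhds]; exact one_ne_zero
  have hae : ∀ᵐ v, v ∈ (tsupport ψ)ᶜ → errK ψ v = 0 := by
    refine hU.ae_eq_zero_of_integral_contDiff_smul_eq_zero
      (hcont.locallyIntegrable.locallyIntegrableOn _) fun g hg hgc hgs => ?_
    have hg' : ContDiff ℝ ∞ fun v => g (-v) := hg.comp contDiff_neg
    have hgc' : HasCompactSupport fun v => g (-v) :=
      hgc.comp_homeomorph (Homeomorph.neg (PSpace N))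
    have := h.integral_locK_heatOp hg' hgc' 0
    simp only [zero_sub, neg_neg, neg_zero] at this
    have hg0 : g 0 = 0 := by
      by_contra hne
      exact hgs (subset_tsupport _ hne) h0
    have hL : ∀ v, locK ψ v * heatOp (fun v => g (-v)) (-v) = 0 := by
      intro v
      by_cases hv : v ∈ tsupport ψ
      · have hz' : (fun v => g (-v)) =ᶠ[𝓝 (-v)] fun _ => 0 := by
          have : v ∈ (tsupport g)ᶜ := fun h' => hgs h' hv
          have h2 := (isClosed_tsupport g).isOpen_compl.mem_nhds this
          have h3 : Tendsto (fun v : PSpace N => -v) (𝓝 (-v)) (𝓝 v) := by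
            simpa using (continuous_neg.tendsto (-v))
          filter_upwards [h3 h2] with y hy
          exact image_eq_zero_of_notMem_tsupport hy
        have hX : ∀ i : Fin N, dX i (fun v => g (-v)) =ᶠ[𝓝 (-v)] fun _ => 0 := by
          intro i
          filter_upwards [hz'.fderiv (𝕜 := ℝ)] with y hy
          simp [dX, hy]
        have : heatOp (fun v => g (-v)) (-v) = 0 := by
          simp [heatOp, dT, dX, hz'.fderiv_eq]
          refine Finset.sum_eq_zero fun i _ => ?_
          have := (hX i).fderiv_eq (𝕜 := ℝ)
          change fderiv ℝ (dX i fun v => g (-v)) (-v) _ = 0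
          rw [this]; simp
        rw [this, mul_zero]
      · rw [locK_eq_zero hv, zero_mul]
    simp only [hL, integral_zero, hg0, zero_sub] at this
    simp only [smul_eq_mul]
    rw [← neg_eq_zero, this]
    congr 2; ext v; ring
  by_contra hne
  have h1 : {v | errK ψ v ≠ 0} ∩ (tsupport ψ)ᶜ ∈ 𝓝 z :=
    inter_mem ((isOpen_ne.preimage hcont).mem_nhds hne) (hU.mem_nhds hz)
  have h3 : volume ({v | errK ψ v ≠ 0} ∩ (tsupport ψ)ᶜ) = 0 := by
    refine measure_mono_null (fun v hv => ?_) (ae_iff.1 hae)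
    rw [mem_ofPred_eq, Classical.not_imp]
    exact ⟨hv.2, hv.1⟩
  exact (Measure.measure_pos_of_mem_nhds volume h1).ne' h3

theorem hasCompactSupport_errK : HasCompactSupport (errK ψ) :=
  HasCompactSupport.intro h.hasCompactSupport.isCompact fun _ hz => h.errK_eq_zero hz

end IsCutoff

end ParabolicWiener

namespace ParabolicWiener

open MeasureTheory Metric Set Filter Topology
open scoped ENNReal NNReal ContDiff

variable {N : ℕ}

/-- Positive part of a real function as an extended nonnegative function. -/
noncomputable def pos (f : PSpace N → ℝ) (z : PSpace N) : ℝ≥0∞ := ENNReal.ofReal (f z)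

/-- Negative part of a real function as an extended nonnegative function. -/
noncomputable def neg (f : PSpace N → ℝ) (z : PSpace N) : ℝ≥0∞ := ENNReal.ofReal (-f z)

@[fun_prop]
theorem measurable_pos {f : PSpace N → ℝ} (hf : Measurable f) : Measurable (pos f) :=
  ENNReal.measurable_ofReal.comp hf

@[fun_prop]
theorem measurable_neg' {f : PSpace N → ℝ} (hf : Measurable f) : Measurable (neg f) :=
  ENNReal.measurable_ofReal.comp hf.neg

theorem neg_eq_pos (f : PSpace N → ℝ) : neg f = pos fun z => -f z := rfl

theorem lintegral_pos_add {f : PSpace N → ℝ} (hf : Integrable f) :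
    (∫⁻ z, ENNReal.ofReal (f z)) + ENNReal.ofReal (-∫ z, f z)
      = (∫⁻ z, ENNReal.ofReal (-f z)) + ENNReal.ofReal (∫ z, f z) := by
  rw [integral_eq_lintegral_pos_part_sub_lintegral_neg_part hf]
  have h1 : ∫⁻ z, ENNReal.ofReal (f z) ≠ ⊤ := (hf.lintegral_lt_top).ne
  have h2 : ∫⁻ z, ENNReal.ofReal (-f z) ≠ ⊤ := (hf.neg.lintegral_lt_top).ne
  generalize ∫⁻ z, ENNReal.ofReal (f z) = a at *
  generalize ∫⁻ z, ENNReal.ofReal (-f z) = b at *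
  lift a to ℝ≥0 using h1
  lift b to ℝ≥0 using h2
  rw [← ENNReal.toReal_eq_toReal_iff' (by finiteness) (by finiteness), ENNReal.toReal_add
    (by finiteness) (by finiteness), ENNReal.toReal_add (by finiteness) (by finiteness)]
  simp only [ENNReal.coe_toReal, ENNReal.toReal_ofReal']
  rcases le_total (a : ℝ) b with h | h
  · rw [max_eq_left (by linarith), max_eq_right (by linarith)]; ring
  · rw [max_eq_right (by linarith), max_eq_left (by linarith)]; ring

theorem pos_lconv_pos {k : PSpace N → ℝ} (hk : ∀ z, 0 ≤ k z) (f : PSpace N → ℝ) (z : PSpace N) :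
    (pos k ⋆ₗ pos f) z = ∫⁻ v, ENNReal.ofReal (k v * f (z - v)) := by
  rw [lconv_eq]
  simp only [pos, ENNReal.ofReal_mul (hk _)]

theorem pos_lconv_neg {k : PSpace N → ℝ} (hk : ∀ z, 0 ≤ k z) (f : PSpace N → ℝ) (z : PSpace N) :
    (pos k ⋆ₗ neg f) z = ∫⁻ v, ENNReal.ofReal (-(k v * f (z - v))) := by
  rw [neg_eq_pos, pos_lconv_pos hk]
  simp only [mul_neg]

/-- A pair `(k⁺, k⁻)` such that `Γ * (k⁺ - k⁻) = w`. -/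
structure HeatPair (kp kn w : PSpace N → ℝ≥0∞) : Prop where
  meas_p : Measurable kp
  meas_n : Measurable kn
  meas_w : Measurable w
  causal : ∃ τ, Causal τ kn
  fin : ∫⁻ v, kn v ≠ ⊤
  eqn : Gam N ⋆ₗ kp = w + Gam N ⋆ₗ kn

theorem causal_lconv' {k f : PSpace N → ℝ≥0∞} {τ τ' : ℝ} (hk : Causal τ' k) (hf : Causal τ f) :
    Causal (τ' + τ) (k ⋆ₗ f) := by
  intro z hz
  rw [lconv_eq]
  refine (lintegral_congr fun w => ?_).trans (lintegral_zero)
  rcases le_or_gt w.2 τ' with h | h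
  · simp [hk w h]
  · simp [hf (z - w) (by simp only [Prod.snd_sub]; linarith)]

theorem lconv_le_mul {k f : PSpace N → ℝ≥0∞} (hk : Measurable k) {M : ℝ≥0∞} (hM : ∀ w, f w ≤ M)
    (z : PSpace N) : (k ⋆ₗ f) z ≤ (∫⁻ v, k v) * M := by
  rw [lconv_eq, ← lintegral_mul_const _ hk]
  exact lintegral_mono fun v => by gcongr; exact hM _

section

variable {q τ : ℝ} {g u kp kn w : PSpace N → ℝ≥0∞}

/-- Convolving the mild equation with a heat pair. -/
theorem HeatPair.mild (hp : HeatPair kp kn w) (hq : 1 < q) (hg : Measurable g)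
    (hu : IsMild q τ g u) (z : PSpace N) :
    (kp ⋆ₗ u) z + (w ⋆ₗ fun v => u v ^ q) z = (w ⋆ₗ g) z + (kn ⋆ₗ u) z := by
  obtain ⟨L, hL⟩ := hu.bdd
  obtain ⟨τ', hτ'⟩ := hp.causal
  have hum := hu.meas
  set U : PSpace N → ℝ≥0∞ := fun v => u v ^ q with hU
  have hUm : Measurable U := hum.pow_const q
  have hG := measurable_Gam N
  have hkp := hp.meas_p
  have hkn := hp.meas_n
  have hw := hp.meas_w
  have heq : u + Gam N ⋆ₗ U = Gam N ⋆ₗ g := funext hu.eqn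
  have hGU : Measurable (Gam N ⋆ₗ U) := measurable_lconvolution _ hG hUm
  have hcomm : ∀ {k f : PSpace N → ℝ≥0∞}, Measurable k → Measurable f →
      k ⋆ₗ Gam N ⋆ₗ f = (Gam N ⋆ₗ k) ⋆ₗ f := by
    intro k f hk hf
    rw [lconvolution_assoc hk hG hf, lconvolution_comm (f := k)]
  have e1 : kp ⋆ₗ u + (w ⋆ₗ U + (Gam N ⋆ₗ kn) ⋆ₗ U) = w ⋆ₗ g + (Gam N ⋆ₗ kn) ⋆ₗ g := by
    have := congrArg (fun f => kp ⋆ₗ f) heq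
    rw [lconv_add kp hkp hum, hcomm hkp hUm, hcomm hkp hg, hp.eqn] at this
    rwa [add_lconv _ hUm hw, add_lconv _ hg hw] at this
  have e2 : (Gam N ⋆ₗ kn) ⋆ₗ g = kn ⋆ₗ u + (Gam N ⋆ₗ kn) ⋆ₗ U := by
    rw [← hcomm hkn hg, ← heq, lconv_add kn hkn hum, hcomm hkn hUm]
  have hfin : ((Gam N ⋆ₗ kn) ⋆ₗ U) z ≠ ⊤ := by
    rw [← lconvolution_assoc hG hkn hUm]
    refine Gam_lconv_ne_top (causal_lconv' hτ' (rpow_causal hq hu.causal))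
      (M := (∫⁻ v, kn v) * (L : ℝ≥0∞) ^ q) ?_ (fun v => lconv_le_mul hkn (rpow_bdd hq hL) v) z
    exact ENNReal.mul_ne_top hp.fin (rpow_coe_ne_top hq L)
  have := congrFun e1 z
  rw [e2] at this
  simp only [Pi.add_apply] at this
  rw [← add_assoc, ← add_assoc] at this
  exact (ENNReal.add_left_inj hfin).1 this

end

theorem pos_neg_of_hasCompactSupport {f : PSpace N → ℝ} (hf : Continuous f)
    (hc : HasCompactSupport f) :
    (∃ τ, Causal τ (neg f)) ∧ (∃ τ, Causal τ (pos f)) ∧ (∫⁻ v, neg f v ≠ ⊤) ∧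
      ∫⁻ v, pos f v ≠ ⊤ := by
  obtain ⟨R, hR⟩ := hc.isCompact.isBounded.subset_closedBall (0 : PSpace N)
  have h0 : ∀ z : PSpace N, z.2 ≤ -R - 1 → f z = 0 := by
    intro z hz
    by_contra hne
    have := hR (subset_tsupport _ (Function.mem_support.2 hne))
    rw [mem_closedBall_zero_iff] at this
    have h3 : |z.2| ≤ R := (norm_snd_le z).trans this
    rw [abs_le] at h3
    linarith [h3.1]
  have hi := hf.integrable_of_hasCompactSupport (μ := volume) hc
  refine ⟨⟨-R - 1, fun z hz => ?_⟩, ⟨-R - 1, fun z hz => ?_⟩, hi.neg.lintegral_lt_top.ne,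
    hi.lintegral_lt_top.ne⟩
  · simp [neg, h0 z hz]
  · simp [pos, h0 z hz]

theorem Gam_eq_pos : Gam N = pos (heatK N) := rfl

theorem heatPair_of_smooth {φ : PSpace N → ℝ} (hφ : ContDiff ℝ ∞ φ) (hc : HasCompactSupport φ)
    (h0 : ∀ z, 0 ≤ φ z) : HeatPair (pos (heatOp φ)) (neg (heatOp φ)) (pos φ) := by
  have hL := (contDiff_heatOp hφ).continuous
  have hLc := hasCompactSupport_heatOp hc
  obtain ⟨h1, -, h2, -⟩ := pos_neg_of_hasCompactSupport hL hLc
  have hLm := hL.measurable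
  have hφm := hφ.continuous.measurable
  refine ⟨by fun_prop, by fun_prop, by fun_prop, h1, h2, ?_⟩
  ext z
  have := lintegral_pos_add (locallyIntegrable_aux hL hLc z)
  rw [heatK_conv_heatOp hφ hc, ← pos_lconv_pos (heatK_nonneg N), ← pos_lconv_neg (heatK_nonneg N),
    ENNReal.ofReal_of_nonpos (by linarith [h0 z]), add_zero, add_comm] at this
  exact this

theorem continuous_lconv_pos {k f : PSpace N → ℝ} (hk : ∀ z, 0 ≤ k z)
    (hki : LocallyIntegrable k) (hf : Continuous f) (hc : HasCompactSupport f)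
    (hf0 : ∀ z, 0 ≤ f z) :
    Continuous (pos k ⋆ₗ pos f) := by
  have h := hc.continuous_convolution_right (ContinuousLinearMap.mul ℝ ℝ) hki hf
  have h2 : pos k ⋆ₗ pos f = fun z =>
      ENNReal.ofReal ((convolution k f (ContinuousLinearMap.mul ℝ ℝ) volume) z) := by
    ext z
    rw [pos_lconv_pos hk, convolution_def]
    rw [← ofReal_integral_eq_lintegral_ofReal]
    · rfl
    · exact hc.convolutionExists_right (ContinuousLinearMap.mul ℝ ℝ) hki hf z
    · exact ae_of_all _ fun v => mul_nonneg (hk _) (hf0 _)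
  rw [h2]
  exact ENNReal.continuous_ofReal.comp h

theorem locallyIntegrable_heatK : LocallyIntegrable (heatK N) := by
  intro z
  have hi := integrable_slab_heatK N (z.2 + 1)
  refine ⟨{w : PSpace N | w.2 < z.2 + 1}, (isOpen_Iio.preimage continuous_snd).mem_nhds
    (by change z.2 < z.2 + 1; linarith), ?_⟩
  refine hi.integrableOn.congr_fun (fun w hw => (heatK_eq_slab hw).symm)
    (measurable_snd measurableSet_Iio)

/-- Continuous functions with the same smooth averages coincide. -/
theorem eq_of_lconv_bump {A B : PSpace N → ℝ≥0∞} (hA : Continuous A) (hB : Continuous B)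
    (h : ∀ φ : PSpace N → ℝ, ContDiff ℝ ∞ φ → HasCompactSupport φ → (∀ z, 0 ≤ φ z) →
      pos φ ⋆ₗ A = pos φ ⋆ₗ B) : A = B := by
  wlog hlt : ∃ z, A z < B z generalizing A B
  · by_contra hne
    obtain ⟨z, hz⟩ := Function.ne_iff.1 hne
    rcases lt_or_gt_of_ne hz with h' | h'
    · exact hlt ⟨z, h'⟩
    · exact hne (this hB hA (fun φ h1 h2 h3 => (h φ h1 h2 h3).symm) ⟨z, h'⟩).symm
  exfalso
  obtain ⟨z, hz⟩ := hlt
  obtain ⟨c, hc1, hc2⟩ := exists_between hz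
  obtain ⟨d, hd1, hd2⟩ := exists_between hc2
  have hev : ∀ᶠ y in 𝓝 z, A y < c ∧ d < B y :=
    (hA.tendsto z |>.eventually (gt_mem_nhds hc1)).and (hB.tendsto z |>.eventually (lt_mem_nhds hd2))
  obtain ⟨ε, hε, hball⟩ := Metric.eventually_nhds_iff_ball.1 hev
  let f : ContDiffBump (0 : PSpace N) := ⟨ε / 2, ε, by positivity, by linarith⟩
  have hh := congrFun (h f f.contDiff f.hasCompactSupport fun z => f.nonneg) z
  rw [lconv_eq, lconv_eq] at hh
  have hfi : ∫⁻ v, pos f v ≠ ⊤ := (f.integrable (μ := volume)).lintegral_lt_top.ne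
  have hf0 : ∫⁻ v, pos f v ≠ 0 := by
    have := f.integral_pos (μ := volume)
    rw [integral_eq_lintegral_of_nonneg_ae (ae_of_all _ fun v => f.nonneg)
      f.continuous.aestronglyMeasurable] at this
    exact (ENNReal.toReal_pos_iff.1 this).1.ne'
  have hfm : Measurable (pos f) := measurable_pos f.continuous.measurable
  have hz' : ∀ v, f v ≠ 0 → z - v ∈ ball z ε := by
    intro v hv
    have : v ∈ ball (0 : PSpace N) ε := by
      have := f.support_eq ▸ Function.mem_support.2 hv
      exact this
    rw [mem_ball_zero_iff] at this
    rw [mem_ball_iff_norm]; simpa using this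
  have h1 : ∫⁻ v, pos f v * A (z - v) ≤ (∫⁻ v, pos f v) * c := by
    rw [← lintegral_mul_const _ hfm]
    refine lintegral_mono fun v => ?_
    by_cases hv : f v = 0
    · simp [pos, hv]
    · gcongr; exact (hball _ (hz' v hv)).1.le
  have h2 : (∫⁻ v, pos f v) * d ≤ ∫⁻ v, pos f v * B (z - v) := by
    rw [← lintegral_mul_const _ hfm]
    refine lintegral_mono fun v => ?_
    by_cases hv : f v = 0
    · simp [pos, hv]
    · gcongr; exact (hball _ (hz' v hv)).2.le
  have h3 : (∫⁻ v, pos f v) * d ≤ (∫⁻ v, pos f v) * c := h2.trans (hh ▸ h1)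
  exact absurd ((ENNReal.mul_le_mul_iff_right hf0 hfi).1 h3) (not_le.2 hd1)

namespace IsCutoff

variable {δ : ℝ} {ψ : PSpace N → ℝ} (h : IsCutoff δ ψ)
include h

theorem heatPair : HeatPair (pos (errK ψ)) (neg (errK ψ)) (pos (farK ψ)) := by
  have hL := h.contDiff_errK.continuous
  have hLc := h.hasCompactSupport_errK
  obtain ⟨⟨τn, hn⟩, ⟨τp, hp⟩, h2, h3⟩ := pos_neg_of_hasCompactSupport hL hLc
  have hLm := hL.measurable
  have hFc := h.contDiff_farK.continuous
  have hFm := hFc.measurable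
  have hG := measurable_Gam N
  refine ⟨by fun_prop, by fun_prop, by fun_prop, ⟨τn, hn⟩, h2, ?_⟩
  have hposc : ∀ f : PSpace N → ℝ, Continuous f → HasCompactSupport f →
      Continuous (Gam N ⋆ₗ pos f) := by
    intro f hf hfc
    have : pos f = pos fun z => max (f z) 0 := by
      ext z; simp only [pos, ENNReal.ofReal_max, ENNReal.ofReal_zero, max_zero]
    rw [this, Gam_eq_pos]
    refine continuous_lconv_pos (heatK_nonneg N) locallyIntegrable_heatK (by fun_prop) ?_
      fun z => le_max_right _ _
    exact hfc.comp_left (g := fun x => max x 0) (by simp)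
  refine eq_of_lconv_bump (hposc _ hL hLc) (Continuous.add
    (ENNReal.continuous_ofReal.comp hFc) (hposc _ hL.neg hLc.neg)) fun φ hφ hc h0 => ?_
  have hpφ := heatPair_of_smooth hφ hc h0
  have ha := (contDiff_heatOp hφ).continuous
  have hac := hasCompactSupport_heatOp hc
  have ham := ha.measurable
  have hφm := hφ.continuous.measurable
  have key : pos φ ⋆ₗ pos (errK ψ) + pos (farK ψ) ⋆ₗ neg (heatOp φ)
      = pos (farK ψ) ⋆ₗ pos (heatOp φ) + pos φ ⋆ₗ neg (errK ψ) := by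
    ext z
    simp only [Pi.add_apply]
    rw [pos_lconv_pos h0, pos_lconv_neg h0, pos_lconv_neg h.farK_nonneg,
      pos_lconv_pos h.farK_nonneg]
    have i1 : Integrable fun v => φ v * errK ψ (z - v) :=
      (hφ.continuous.mul (hL.comp (continuous_const.sub continuous_id)))
        |>.integrable_of_hasCompactSupport hc.mul_right
    have i2 : Integrable fun v => farK ψ v * heatOp φ (z - v) :=
      (hFc.mul (ha.comp (continuous_const.sub continuous_id)))
        |>.integrable_of_hasCompactSupport
          ((hac.comp_homeomorph (Homeomorph.subLeft z)).mul_left)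
    have e : ∫ v, φ v * errK ψ (z - v) = ∫ v, farK ψ v * heatOp φ (z - v) := by
      rw [← integral_heatOp_mul_comp_sub h.contDiff_farK hφ hc z,
        ← integral_sub_left_eq_self _ volume z]
      congr 1; ext v
      rw [sub_sub_cancel, mul_comm]; rfl
    have j1 := lintegral_pos_add i1
    have j2 := lintegral_pos_add i2
    rw [e] at j1
    set I := ∫ v, farK ψ v * heatOp φ (z - v)
    have f1 := i1.lintegral_lt_top.ne
    have f2 := i2.lintegral_lt_top.ne
    have f3 := i1.neg.lintegral_lt_top.ne
    have f4 := i2.neg.lintegral_lt_top.ne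
    simp only [Pi.neg_apply] at f3 f4
    have := congrArg₂ (· + ·) j1 j2.symm
    have hfin : ENNReal.ofReal I + ENNReal.ofReal (-I) ≠ ⊤ := by finiteness
    refine (ENNReal.add_left_inj hfin).1 ?_
    calc _ = _ := by abel
      _ = _ := this
      _ = _ := by abel
  have hfin : ∀ z, ((Gam N ⋆ₗ neg (heatOp φ)) ⋆ₗ pos (farK ψ)) z ≠ ⊤ := by
    intro z
    obtain ⟨τ, hτ⟩ := hpφ.causal
    obtain ⟨C, hC⟩ := exists_bound ha hac
    rw [lconvolution_comm]
    refine ne_top_of_le_ne_top ?_ (lconv_mono (k' := Gam N) (f' := Gam N ⋆ₗ neg (heatOp φ))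
      (fun v => ENNReal.ofReal_le_ofReal (h.farK_le v)) le_rfl z)
    refine ne_top_of_le_ne_top ?_ (Gam_lconv_le (causal_lconv causal_Gam hτ)
      (M := ENNReal.ofReal (z.2 - τ) * ENNReal.ofReal C) fun w hw => ?_)
    · finiteness
    · refine (Gam_lconv_le hτ (M := ENNReal.ofReal C) fun w _ => ?_).trans (by gcongr)
      exact ENNReal.ofReal_le_ofReal ((neg_le_abs _).trans (hC w))
  have key2 := congrArg (fun f => Gam N ⋆ₗ f) key
  have m1 : Measurable (pos φ ⋆ₗ pos (errK ψ)) :=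
    measurable_lconvolution _ (by fun_prop) (by fun_prop)
  have m2 : Measurable (pos (farK ψ) ⋆ₗ pos (heatOp φ)) :=
    measurable_lconvolution _ (by fun_prop) (by fun_prop)
  rw [lconv_add _ hG m1, lconv_add _ hG m2, lconvolution_comm (f := pos (farK ψ)),
    lconvolution_comm (f := pos (farK ψ)),
    lconvolution_assoc hG (measurable_neg' ham) (measurable_pos hFm),
    lconvolution_assoc hG (measurable_pos ham) (measurable_pos hFm), hpφ.eqn,
    add_lconv _ (by fun_prop) (by fun_prop)] at key2
  have hcm : ∀ f : PSpace N → ℝ≥0∞, Measurable f →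
      Gam N ⋆ₗ pos φ ⋆ₗ f = pos φ ⋆ₗ Gam N ⋆ₗ f := by
    intro f hf
    rw [lconvolution_assoc hG (by fun_prop) hf, lconvolution_assoc (by fun_prop) hG hf,
      lconvolution_comm (f := Gam N)]
  rw [hcm _ (by fun_prop), hcm _ (by fun_prop)] at key2
  ext z
  change _ = (pos φ ⋆ₗ (pos (farK ψ) + Gam N ⋆ₗ neg (errK ψ))) z
  rw [lconv_add _ (by fun_prop) (by fun_prop)]
  have := congrFun key2 z
  simp only [Pi.add_apply] at this ⊢
  refine (ENNReal.add_left_inj (hfin z)).1 ?_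
  rw [this]; abel

end IsCutoff

end ParabolicWiener

namespace ParabolicWiener

open MeasureTheory Metric Set Filter Topology
open scoped ENNReal NNReal ContDiff

variable {N : ℕ} {q τ : ℝ} {g u : PSpace N → ℝ≥0∞}

/-- The local integral equation at `z` attached to a cut-off `ψ`. -/
def LocalEq (q : ℝ) (ψ : PSpace N → ℝ) (u : PSpace N → ℝ≥0∞) (z : PSpace N) : Prop :=
  u z + (pos (locK ψ) ⋆ₗ fun v => u v ^ q) z + (neg (errK ψ) ⋆ₗ u) z = (pos (errK ψ) ⋆ₗ u) z

theorem lconv_eq_zero_of_closedBall {k f : PSpace N → ℝ≥0∞} {z : PSpace N} {δ : ℝ}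
    (hk : ∀ v ∉ closedBall (0 : PSpace N) δ, k v = 0) (hf : ∀ w ∈ closedBall z δ, f w = 0) :
    (k ⋆ₗ f) z = 0 := by
  rw [lconv_eq]
  refine (lintegral_congr fun v => ?_).trans lintegral_zero
  by_cases hv : v ∈ closedBall (0 : PSpace N) δ
  · rw [hf _ (by rw [mem_closedBall_iff_norm]; simpa using hv), mul_zero]
  · rw [hk v hv, zero_mul]

theorem IsMild.localEq (hu : IsMild q τ g u) (hq : 1 < q) (hg : Measurable g) {δ : ℝ}
    {ψ : PSpace N → ℝ} (h : IsCutoff δ ψ) {z : PSpace N} (hz : ∀ w ∈ closedBall z δ, g w = 0) :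
    LocalEq q ψ u z := by
  have h1 := h.heatPair.mild hq hg hu z
  have h2 := hu.eqn z
  have hum := hu.meas
  have hlm := measurable_pos h.measurable_locK
  have hG : Gam N = pos (locK ψ) + pos (farK ψ) := by
    ext v
    simp only [Gam_eq_pos, pos, Pi.add_apply]
    rw [← ENNReal.ofReal_add (h.locK_nonneg v) (h.farK_nonneg v)]
    simp only [locK, farK]; congr 1; ring
  have hfin : (pos (farK ψ) ⋆ₗ fun v => u v ^ q) z ≠ ⊤ := by
    obtain ⟨L, hL⟩ := hu.bdd
    refine ne_top_of_le_ne_top (Gam_lconv_ne_top (rpow_causal hq hu.causal)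
      (rpow_coe_ne_top hq L) (rpow_bdd hq hL) z) (lconv_mono ?_ le_rfl z)
    exact fun v => ENNReal.ofReal_le_ofReal (h.farK_le v)
  rw [hG, add_lconv _ (by fun_prop) hlm, add_lconv _ hg hlm] at h2
  simp only [Pi.add_apply] at h2
  have h3 : (pos (locK ψ) ⋆ₗ g) z = 0 := by
    refine lconv_eq_zero_of_closedBall (fun v hv => ?_) hz
    simp [pos, IsCutoff.locK_eq_zero (fun h' => hv (h.supp h'))]
  rw [h3, zero_add] at h2
  refine (ENNReal.add_left_inj hfin).1 ?_
  calc _ = (u z + ((pos (locK ψ) ⋆ₗ fun v => u v ^ q) z + (pos (farK ψ) ⋆ₗ fun v => u v ^ q) z))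
        + (neg (errK ψ) ⋆ₗ u) z := by abel
    _ = _ := by rw [h2, ← h1]

section kellerOsserman

theorem dX_pow {η : PSpace N → ℝ} (hη : ContDiff ℝ ∞ η) (m : ℕ) (i : Fin N) :
    dX i (fun z => η z ^ m) = fun z => m * η z ^ (m - 1) * dX i η z := by
  ext z
  have : HasFDerivAt η (fderiv ℝ η z) z := (hη.differentiable (by simp) z).hasFDerivAt
  rw [dX, (this.pow m).fderiv]
  simp [dX]

theorem dT_pow {η : PSpace N → ℝ} (hη : ContDiff ℝ ∞ η) (m : ℕ) :
    dT (fun z => η z ^ m) = fun z => m * η z ^ (m - 1) * dT η z := by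
  ext z
  have : HasFDerivAt η (fderiv ℝ η z) z := (hη.differentiable (by simp) z).hasFDerivAt
  rw [dT, (this.pow m).fderiv]
  simp [dT]

theorem dX_mul {f g : PSpace N → ℝ} (hf : ContDiff ℝ ∞ f) (hg : ContDiff ℝ ∞ g) (i : Fin N)
    (z : PSpace N) : dX i (fun z => f z * g z) z = dX i f z * g z + f z * dX i g z := by
  have h1 : HasFDerivAt f (fderiv ℝ f z) z := (hf.differentiable (by simp) z).hasFDerivAt
  have h2 : HasFDerivAt g (fderiv ℝ g z) z := (hg.differentiable (by simp) z).hasFDerivAt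
  have h3 : HasFDerivAt (fun z => f z * g z) _ z := h1.mul h2
  rw [dX, h3.fderiv]
  simp [dX]; ring

theorem exists_heatOp_pow_le {η : PSpace N → ℝ} (hη : ContDiff ℝ ∞ η) (hc : HasCompactSupport η)
    (h0 : ∀ z, 0 ≤ η z) (h1 : ∀ z, η z ≤ 1) (m : ℕ) :
    ∃ C : ℝ, 0 ≤ C ∧ ∀ z, |heatOp (fun z => η z ^ (m + 2)) z| ≤ C * η z ^ m := by
  obtain ⟨A, hA⟩ := exists_bound (contDiff_dT hη).continuous (hasCompactSupport_dT hc)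
  have hB : ∀ i : Fin N, ∃ B, ∀ z, |dX i η z| ≤ B := fun i =>
    exists_bound (contDiff_dX hη i).continuous (hasCompactSupport_dX hc i)
  choose B hB using hB
  have hD : ∀ i : Fin N, ∃ D, ∀ z, |dX i (dX i η) z| ≤ D := fun i =>
    exists_bound (contDiff_dX (contDiff_dX hη i) i).continuous
      (hasCompactSupport_dX (hasCompactSupport_dX hc i) i)
  choose D hD using hD
  have hA0 : 0 ≤ A := (abs_nonneg _).trans (hA 0)
  have hB0 : ∀ i, 0 ≤ B i := fun i => (abs_nonneg _).trans (hB i 0)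
  have hD0 : ∀ i, 0 ≤ D i := fun i => (abs_nonneg _).trans (hD i 0)
  refine ⟨(m + 2) * A + ∑ i, ((m + 2) * ((m + 1) * B i * B i) + (m + 2) * D i),
    add_nonneg (by positivity) (Finset.sum_nonneg fun i _ => by
      have := hB0 i; have := hD0 i; positivity), fun z => ?_⟩
  have hT : |dT (fun z => η z ^ (m + 2)) z| ≤ (m + 2) * A * η z ^ m := by
    rw [dT_pow hη]
    simp only [Nat.add_succ_sub_one, abs_mul, abs_pow, abs_of_nonneg (h0 z)]
    push_cast
    rw [abs_of_nonneg (by positivity), pow_succ]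
    have := h0 z
    calc (m + 2 : ℝ) * (η z ^ m * η z) * |dT η z| ≤ (m + 2 : ℝ) * (η z ^ m * 1) * A := by
          gcongr
          · exact h1 z
          · exact hA z
      _ = _ := by ring
  have hX : ∀ i, |dX i (dX i fun z => η z ^ (m + 2)) z|
      ≤ ((m + 2) * ((m + 1) * B i * B i) + (m + 2) * D i) * η z ^ m := by
    intro i
    have e : dX i (fun z => η z ^ (m + 2))
        = fun z => (fun z => ((m + 2 : ℕ) : ℝ) * η z ^ (m + 1)) z * dX i η z := by
      rw [dX_pow hη]; rfl
    have e2 : dX i (fun z => ((m + 2 : ℕ) : ℝ) * η z ^ (m + 1)) z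
        = ((m + 2 : ℕ) : ℝ) * ((m + 1) * η z ^ m * dX i η z) := by
      rw [dX_mul contDiff_const (hη.pow _), dX_pow hη]
      simp [dX]
    rw [e, dX_mul (contDiff_const.mul (hη.pow _)) (contDiff_dX hη i), e2]
    push_cast
    refine (abs_add_le _ _).trans ?_
    simp only [abs_mul, abs_pow, abs_of_nonneg (h0 z)]
    rw [abs_of_nonneg (show (0 : ℝ) ≤ m + 2 by positivity),
      abs_of_nonneg (show (0 : ℝ) ≤ m + 1 by positivity), pow_succ]
    have := h0 z
    have := hB0 i
    calc (m + 2 : ℝ) * ((m + 1) * η z ^ m * |dX i η z|) * |dX i η z|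
          + (m + 2) * (η z ^ m * η z) * |dX i (dX i η) z|
        ≤ (m + 2 : ℝ) * ((m + 1) * η z ^ m * B i) * B i + (m + 2) * (η z ^ m * 1) * D i := by
          gcongr
          · exact hB i z
          · exact hB i z
          · exact h1 z
          · exact hD i z
      _ = _ := by ring
  rw [heatOp, add_mul, Finset.sum_mul]
  refine (abs_sub _ _).trans (add_le_add hT ((Finset.abs_sum_le_sum_abs _ _).trans
    (Finset.sum_le_sum fun i _ => hX i)))

theorem young_absorb (hq : 1 < q) (C : ℝ≥0) :
    ∃ D : ℝ≥0, ∀ x : ℝ≥0∞, C * x ≤ 2⁻¹ * x ^ q + D := by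
  refine ⟨C * (2 * C) ^ (1 / (q - 1)), fun x => ?_⟩
  have hq1 : 0 < q - 1 := by linarith
  rcases le_or_gt x (((2 * C) ^ (1 / (q - 1)) : ℝ≥0) : ℝ≥0∞) with h | h
  · refine le_add_left ?_
    push_cast
    gcongr
  · refine le_add_right ?_
    rcases eq_or_ne x ⊤ with rfl | hx
    · rw [ENNReal.top_rpow_of_pos (by linarith), ENNReal.mul_top (a := 2⁻¹) (by simp)]; exact le_top
    lift x to ℝ≥0 using hx
    have h' : (2 * C) ^ (1 / (q - 1)) < x := by exact_mod_cast h
    have h2 : 2 * C ≤ x ^ (q - 1) := by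
      calc 2 * C = ((2 * C) ^ (1 / (q - 1))) ^ (q - 1) := by
            rw [← NNReal.rpow_mul, one_div, inv_mul_cancel₀ hq1.ne', NNReal.rpow_one]
        _ ≤ _ := NNReal.rpow_le_rpow h'.le hq1.le
    have hx0 : x ≠ 0 := (lt_of_le_of_lt zero_le h').ne'
    have h3 : C * x ≤ 2⁻¹ * x ^ q := by
      have : x ^ q = x ^ (q - 1) * x := by
        rw [← NNReal.rpow_add_one hx0, sub_add_cancel]
      rw [this, ← mul_assoc]
      gcongr
      calc C = 2⁻¹ * (2 * C) := by rw [← mul_assoc, inv_mul_cancel₀ two_ne_zero, one_mul]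
        _ ≤ _ := by gcongr
    calc (C : ℝ≥0∞) * x = ((C * x : ℝ≥0) : ℝ≥0∞) := by push_cast; rfl
      _ ≤ ((2⁻¹ * x ^ q : ℝ≥0) : ℝ≥0∞) := by exact_mod_cast h3
      _ = _ := by
        rw [ENNReal.coe_mul, ENNReal.coe_inv two_ne_zero, ENNReal.coe_rpow_of_nonneg _ (by linarith)]
        rfl

/-- Keller–Osserman estimate: mild solutions are bounded away from the support of the source,
uniformly in the source. -/
theorem keller_osserman (N : ℕ) (hq : 1 < q) {δ : ℝ} (hδ : 0 < δ) :
    ∃ C : ℝ≥0, ∀ (τ : ℝ) (g u : PSpace N → ℝ≥0∞), Measurable g → IsMild q τ g u →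
      ∀ z, (∀ w ∈ closedBall z δ, g w = 0) → u z ≤ C := by
  let f : ContDiffBump (0 : PSpace N) := ⟨δ / 2, δ, by positivity, by linarith⟩
  obtain ⟨m, hm⟩ : ∃ m : ℕ, (m + 2 : ℝ) ≤ m * q := by
    obtain ⟨m, hm⟩ := exists_nat_gt (2 / (q - 1))
    rw [div_lt_iff₀ (by linarith)] at hm
    exact ⟨m, by nlinarith⟩
  obtain ⟨A, hA0, hA⟩ := exists_heatOp_pow_le f.contDiff f.hasCompactSupport (fun z => f.nonneg)
    (fun z => f.le_one) m
  set φ : PSpace N → ℝ := fun z => f z ^ (m + 2) with hφdef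
  have hφ : ContDiff ℝ ∞ φ := f.contDiff.pow _
  have hφc : HasCompactSupport φ :=
    f.hasCompactSupport.comp_left (g := fun x => x ^ (m + 2)) (by simp)
  have hφ0 : ∀ z, 0 ≤ φ z := fun z => pow_nonneg f.nonneg _
  have hp := heatPair_of_smooth hφ hφc hφ0
  obtain ⟨D, hD⟩ := young_absorb hq (A.toNNReal)
  obtain ⟨ψ, hψ⟩ := exists_isCutoff (N := N) (half_pos hδ)
  obtain ⟨B, hB⟩ := exists_bound hψ.contDiff_errK.continuous hψ.hasCompactSupport_errK
  set V : ℝ≥0∞ := volume (closedBall (0 : PSpace N) δ) with hV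
  have hVf : V ≠ ⊤ := (isCompact_closedBall (0 : PSpace N) δ).measure_lt_top.ne
  have hBf : ENNReal.ofReal B * (V + 2 * (D * V)) ≠ ⊤ := by finiteness
  refine ⟨(ENNReal.ofReal B * (V + 2 * (D * V))).toNNReal, fun τ g u hg hu z hz => ?_⟩
  rw [ENNReal.coe_toNNReal hBf]
  have hum := hu.meas
  obtain ⟨L, hL⟩ := hu.bdd
  have hball : MeasurableSet (closedBall (0 : PSpace N) δ) := measurableSet_closedBall
  have hfsupp : ∀ v ∉ closedBall (0 : PSpace N) δ, f v = 0 := fun v hv =>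
    image_eq_zero_of_notMem_tsupport (by rw [f.tsupport_eq]; exact hv)
  have h1 := hp.mild hq hg hu z
  have hφg : (pos φ ⋆ₗ g) z = 0 := by
    refine lconv_eq_zero_of_closedBall (fun v hv => ?_) hz
    simp [pos, hφdef, hfsupp v hv]
  rw [hφg, zero_add] at h1
  set X := (pos φ ⋆ₗ fun v => u v ^ q) z with hX
  have hXf : X ≠ ⊤ := by
    refine ne_top_of_le_ne_top ?_ (lconv_le_mul hp.meas_w (rpow_bdd hq hL) z)
    exact ENNReal.mul_ne_top (pos_neg_of_hasCompactSupport hφ.continuous hφc).2.2.2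
      (rpow_coe_ne_top hq L)
  have hXle : X ≤ 2⁻¹ * X + D * V := by
    calc X ≤ (neg (heatOp φ) ⋆ₗ u) z := by rw [← h1]; exact le_add_self
      _ ≤ ∫⁻ v, (2⁻¹ * (pos φ v * u (z - v) ^ q)
            + (closedBall (0 : PSpace N) δ).indicator (fun _ => (D : ℝ≥0∞)) v) := by
          rw [lconv_eq]
          refine lintegral_mono fun v => ?_
          by_cases hv : v ∈ closedBall (0 : PSpace N) δ
          · rw [indicator_of_mem hv]
            have hfq : ENNReal.ofReal (f v ^ m) ^ q ≤ pos φ v := by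
              rw [ENNReal.ofReal_rpow_of_nonneg (pow_nonneg f.nonneg _) (by linarith)]
              refine ENNReal.ofReal_le_ofReal ?_
              rw [hφdef]
              simp only
              rcases eq_or_lt_of_le (f.nonneg (x := v)) with h0 | h0
              · rw [← h0]
                rcases Nat.eq_zero_or_pos m with rfl | hm0
                · norm_num at hm
                · rw [zero_pow hm0.ne', Real.zero_rpow (by linarith)]; positivity
              · rw [← Real.rpow_natCast, ← Real.rpow_natCast, ← Real.rpow_mul f.nonneg]
                exact Real.rpow_le_rpow_of_exponent_ge h0 f.le_one (by push_cast; exact hm)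
            calc neg (heatOp φ) v * u (z - v)
                ≤ (A.toNNReal * ENNReal.ofReal (f v ^ m)) * u (z - v) := by
                  gcongr
                  rw [show ((A.toNNReal : ℝ≥0) : ℝ≥0∞) = ENNReal.ofReal A from rfl,
                    ← ENNReal.ofReal_mul hA0]
                  exact ENNReal.ofReal_le_ofReal ((neg_le_abs _).trans (hA v))
              _ = A.toNNReal * (ENNReal.ofReal (f v ^ m) * u (z - v)) := mul_assoc _ _ _
              _ ≤ 2⁻¹ * (ENNReal.ofReal (f v ^ m) * u (z - v)) ^ q + D := hD _
              _ ≤ _ := by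
                  rw [ENNReal.mul_rpow_of_nonneg _ _ (by linarith)]
                  gcongr
          · have : heatOp φ v = 0 := by
              have := hA v
              rw [hfsupp v hv] at this
              rcases Nat.eq_zero_or_pos m with rfl | hm0
              · norm_num at hm
              · rw [zero_pow hm0.ne', mul_zero] at this
                exact abs_eq_zero.1 (le_antisymm this (abs_nonneg _))
            simp [neg, this]
      _ = 2⁻¹ * X + D * V := by
          have : Measurable fun v => pos φ v * u (z - v) ^ q :=
            hp.meas_w.mul ((hum.comp (measurable_const.sub measurable_id)).pow_const q)
          rw [lintegral_add_left (this.const_mul _), lintegral_const_mul _ this,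
            lintegral_indicator hball, lintegral_const, Measure.restrict_apply_univ, hX, lconv_eq]
  have hX2 : X ≤ 2 * (D * V) := by
    have h2 : 2 * X ≤ X + 2 * (D * V) := by
      calc 2 * X ≤ 2 * (2⁻¹ * X + D * V) := by gcongr
        _ = _ := by rw [mul_add, ← mul_assoc, ENNReal.mul_inv_cancel (by simp) (by simp), one_mul]
    rw [two_mul] at h2
    exact (ENNReal.add_le_add_iff_left hXf).1 h2
  have hle := hu.localEq hq hg hψ (z := z)
    fun w hw => hz w (closedBall_subset_closedBall (by linarith) hw)
  unfold LocalEq at hle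
  calc u z ≤ (pos (errK ψ) ⋆ₗ u) z := by rw [← hle, add_assoc]; exact le_self_add
    _ ≤ ∫⁻ v, ENNReal.ofReal B * ((closedBall (0 : PSpace N) δ).indicator (fun _ => 1) v
          + pos φ v * u (z - v) ^ q) := by
        rw [lconv_eq]
        refine lintegral_mono fun v => ?_
        by_cases hv : v ∈ closedBall (0 : PSpace N) (δ / 2)
        · have hvδ := closedBall_subset_closedBall (show δ / 2 ≤ δ by linarith) hv
          have hf1 : pos φ v = 1 := by
            simp only [pos, hφdef]
            rw [f.one_of_mem_closedBall hv]; simp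
          rw [indicator_of_mem hvδ, hf1, one_mul]
          gcongr
          · exact ENNReal.ofReal_le_ofReal ((le_abs_self _).trans (hB v))
          · rcases le_total (u (z - v)) 1 with h | h
            · exact h.trans le_self_add
            · exact (le_add_left (ENNReal.le_rpow_self_of_one_le h hq.le))
        · have : errK ψ v = 0 := hψ.errK_eq_zero fun h' => hv (hψ.supp h')
          simp [pos, this]
    _ = ENNReal.ofReal B * (V + X) := by
        rw [lintegral_const_mul' _ _ (by simp), lintegral_add_left (measurable_const.indicator hball),
          lintegral_indicator hball, lintegral_const, Measure.restrict_apply_univ, one_mul, hX,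
          lconv_eq]
    _ ≤ _ := by gcongr

end kellerOsserman

end ParabolicWiener

namespace ParabolicWiener

open MeasureTheory Metric Set Filter Topology
open scoped ENNReal NNReal ContDiff

variable {N : ℕ} {q : ℝ}

theorem sub_mem_closedBall {z v : PSpace N} {δ : ℝ} (hv : v ∈ closedBall (0 : PSpace N) δ) :
    z - v ∈ closedBall z δ := by
  rw [mem_closedBall_iff_norm]; simpa using hv

theorem tendsto_lconv {k : PSpace N → ℝ≥0∞} {f : ℕ → PSpace N → ℝ≥0∞} {F : PSpace N → ℝ≥0∞}
    {δ : ℝ} {z : PSpace N} {C : ℝ≥0∞} (hC : C ≠ ⊤) (hk : Measurable k)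
    (hk0 : ∀ v ∉ closedBall (0 : PSpace N) δ, k v = 0) (hki : ∫⁻ v, k v ≠ ⊤)
    (hf : ∀ j, Measurable (f j)) (hfC : ∀ j, ∀ w ∈ closedBall z δ, f j w ≤ C)
    (hlim : ∀ w ∈ closedBall z δ, Tendsto (fun j => f j w) atTop (𝓝 (F w)))
    (hkt : ∀ v, k v ≠ ⊤) :
    Tendsto (fun j => (k ⋆ₗ f j) z) atTop (𝓝 ((k ⋆ₗ F) z)) := by
  simp only [lconv_eq]
  refine tendsto_lintegral_of_dominated_convergence (fun v => k v * C) (fun j => ?_)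
    (fun j => ae_of_all _ fun v => ?_) ?_ (ae_of_all _ fun v => ?_)
  · exact hk.mul ((hf j).comp (measurable_const.sub measurable_id))
  · by_cases hv : v ∈ closedBall (0 : PSpace N) δ
    · simp only; gcongr; exact hfC j _ (sub_mem_closedBall hv)
    · simp [hk0 v hv]
  · rw [lintegral_mul_const _ hk]; exact ENNReal.mul_ne_top hki hC
  · by_cases hv : v ∈ closedBall (0 : PSpace N) δ
    · exact ENNReal.Tendsto.const_mul (hlim _ (sub_mem_closedBall hv)) (Or.inr (hkt v))
    · simp [hk0 v hv]

/-- Stability of a local property under bounded pointwise limits. -/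
def LimitStable (δ : ℝ) (P : (PSpace N → ℝ≥0∞) → PSpace N → Prop) : Prop :=
  ∀ (f : ℕ → PSpace N → ℝ≥0∞) (F : PSpace N → ℝ≥0∞) (z : PSpace N) (C : ℝ≥0),
    (∀ j, Measurable (f j)) → (∀ j, ∀ w ∈ closedBall z δ, f j w ≤ C) → z ∈ closedBall z δ →
    (∀ w ∈ closedBall z δ, Tendsto (fun j => f j w) atTop (𝓝 (F w))) →
    (∀ j, P (f j) z) → P F z

/-- The weak form of the equation at `z`, tested with the reflected function `φ`. -/
def WeakEq (q : ℝ) (φ : PSpace N → ℝ) (u : PSpace N → ℝ≥0∞) (z : PSpace N) : Prop :=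
  (pos (heatOp φ) ⋆ₗ u) z + (pos φ ⋆ₗ fun v => u v ^ q) z = (neg (heatOp φ) ⋆ₗ u) z

theorem IsMild.weakEq {τ : ℝ} {g u : PSpace N → ℝ≥0∞} (hu : IsMild q τ g u) (hq : 1 < q)
    (hg : Measurable g) {δ : ℝ} {φ : PSpace N → ℝ} (hφ : ContDiff ℝ ∞ φ)
    (hs : tsupport φ ⊆ closedBall 0 δ) (h0 : ∀ v, 0 ≤ φ v) {z : PSpace N}
    (hz : ∀ w ∈ closedBall z δ, g w = 0) : WeakEq q φ u z := by
  have hc : HasCompactSupport φ :=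
    (isCompact_closedBall (0 : PSpace N) δ).of_isClosed_subset (isClosed_tsupport φ) hs
  have h1 := (heatPair_of_smooth hφ hc h0).mild hq hg hu z
  rw [WeakEq, h1, lconv_eq_zero_of_closedBall (fun v hv => ?_) hz, zero_add]
  simp [pos, image_eq_zero_of_notMem_tsupport fun h' => hv (hs h')]

theorem tsupport_dX_subset {φ : PSpace N → ℝ} (i : Fin N) : tsupport (dX i φ) ⊆ tsupport φ :=
  closure_minimal (fun z hz => by
    by_contra hz'
    have : fderiv ℝ φ z = 0 := by
      by_contra h
      exact hz' (support_fderiv_subset ℝ h)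
    exact hz (by simp [dX, this])) (isClosed_tsupport φ)

theorem heatOp_eq_zero {φ : PSpace N → ℝ} {z : PSpace N} (hz : z ∉ tsupport φ) :
    heatOp φ z = 0 := by
  have h : ∀ f : PSpace N → ℝ, z ∉ tsupport f → fderiv ℝ f z = 0 := by
    intro f hf
    by_contra h
    exact hf (support_fderiv_subset ℝ h)
  rw [heatOp, dT, h φ hz]
  simp only [zero_apply, zero_sub, neg_eq_zero]
  refine Finset.sum_eq_zero fun i _ => ?_
  rw [dX, h _ fun h' => hz (tsupport_dX_subset i h')]
  rfl

theorem limitStable_weakEq (hq : 1 < q) {δ : ℝ} {φ : PSpace N → ℝ} (hφ : ContDiff ℝ ∞ φ)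
    (hs : tsupport φ ⊆ closedBall 0 δ) : LimitStable δ (WeakEq q φ) := by
  intro f F z C hf hfC hz hlim heq
  have hc : HasCompactSupport φ :=
    (isCompact_closedBall (0 : PSpace N) δ).of_isClosed_subset (isClosed_tsupport φ) hs
  have hL := (contDiff_heatOp hφ).continuous
  obtain ⟨-, -, hn, hp⟩ := pos_neg_of_hasCompactSupport hL (hasCompactSupport_heatOp hc)
  obtain ⟨-, -, -, hp'⟩ := pos_neg_of_hasCompactSupport hφ.continuous hc
  have hlm := hφ.continuous.measurable
  have hLm := hL.measurable
  have he : ∀ v ∉ closedBall (0 : PSpace N) δ, heatOp φ v = 0 := fun v hv =>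
    heatOp_eq_zero fun h' => hv (hs h')
  have t1 : Tendsto (fun j => (pos φ ⋆ₗ fun v => f j v ^ q) z) atTop
      (𝓝 ((pos φ ⋆ₗ fun v => F v ^ q) z)) :=
    tendsto_lconv (C := (C : ℝ≥0∞) ^ q) (δ := δ) (rpow_coe_ne_top hq C) (by fun_prop)
      (fun v hv => by simp [pos, image_eq_zero_of_notMem_tsupport fun h' => hv (hs h')])
      hp' (fun j => (hf j).pow_const q)
      (fun j w hw => ENNReal.rpow_le_rpow (hfC j w hw) (by linarith))
      (fun w hw => (hlim w hw).ennrpow_const q) (fun v => ENNReal.ofReal_ne_top)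
  have t2 : Tendsto (fun j => (neg (heatOp φ) ⋆ₗ f j) z) atTop
      (𝓝 ((neg (heatOp φ) ⋆ₗ F) z)) :=
    tendsto_lconv (δ := δ) (C := C) (by simp) (by fun_prop) (fun v hv => by simp [neg, he v hv])
      hn hf hfC hlim (fun v => ENNReal.ofReal_ne_top)
  have t3 : Tendsto (fun j => (pos (heatOp φ) ⋆ₗ f j) z) atTop
      (𝓝 ((pos (heatOp φ) ⋆ₗ F) z)) :=
    tendsto_lconv (δ := δ) (C := C) (by simp) (by fun_prop) (fun v hv => by simp [pos, he v hv])
      hp hf hfC hlim (fun v => ENNReal.ofReal_ne_top)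
  exact tendsto_nhds_unique (t3.add t1) (t2.congr fun j => (heq j).symm)

namespace IsCutoff

variable {δ : ℝ} {ψ : PSpace N → ℝ} (h : IsCutoff δ ψ)
include h

theorem integrable_locK : Integrable (locK ψ) := by
  have hi := locallyIntegrable_heatK (N := N) |>.integrableOn_isCompact
    (isCompact_closedBall (0 : PSpace N) δ)
  rw [← integrable_indicator_iff measurableSet_closedBall] at hi
  refine hi.mono' h.measurable_locK.aestronglyMeasurable (ae_of_all _ fun v => ?_)
  by_cases hv : v ∈ closedBall (0 : PSpace N) δ
  · rw [indicator_of_mem hv, Real.norm_of_nonneg (h.locK_nonneg v)]; exact h.locK_le v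
  · rw [indicator_of_notMem hv, locK_eq_zero (fun h' => hv (h.supp h'))]; simp

theorem limitStable_localEq (hq : 1 < q) : LimitStable δ (LocalEq q ψ) := by
  intro f F z C hf hfC hz hlim heq
  have hL := h.contDiff_errK.continuous
  obtain ⟨-, -, hn, hp⟩ := pos_neg_of_hasCompactSupport hL h.hasCompactSupport_errK
  have hlm := h.measurable_locK
  have hLm := hL.measurable
  have he : ∀ v ∉ closedBall (0 : PSpace N) δ, errK ψ v = 0 := fun v hv =>
    h.errK_eq_zero fun h' => hv (h.supp h')
  have t1 : Tendsto (fun j => (pos (locK ψ) ⋆ₗ fun v => f j v ^ q) z) atTop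
      (𝓝 ((pos (locK ψ) ⋆ₗ fun v => F v ^ q) z)) :=
    tendsto_lconv (C := (C : ℝ≥0∞) ^ q) (δ := δ) (rpow_coe_ne_top hq C) (by fun_prop)
      (fun v hv => by simp [pos, locK_eq_zero (fun h' => hv (h.supp h'))])
      h.integrable_locK.lintegral_lt_top.ne (fun j => (hf j).pow_const q)
      (fun j w hw => ENNReal.rpow_le_rpow (hfC j w hw) (by linarith))
      (fun w hw => (hlim w hw).ennrpow_const q) (fun v => ENNReal.ofReal_ne_top)
  have t2 : Tendsto (fun j => (neg (errK ψ) ⋆ₗ f j) z) atTop (𝓝 ((neg (errK ψ) ⋆ₗ F) z)) :=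
    tendsto_lconv (δ := δ) (C := C) (by simp) (by fun_prop) (fun v hv => by simp [neg, he v hv])
      hn hf hfC hlim (fun v => ENNReal.ofReal_ne_top)
  have t3 : Tendsto (fun j => (pos (errK ψ) ⋆ₗ f j) z) atTop (𝓝 ((pos (errK ψ) ⋆ₗ F) z)) :=
    tendsto_lconv (δ := δ) (C := C) (by simp) (by fun_prop) (fun v hv => by simp [pos, he v hv])
      hp hf hfC hlim (fun v => ENNReal.ofReal_ne_top)
  have t4 := ((hlim z hz).add t1).add t2
  exact tendsto_nhds_unique t4 (t3.congr fun j => (heq j).symm)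

end IsCutoff

/-- Sources concentrated near the complement of `O`. -/
noncomputable def src (O : Set (PSpace N)) (R : ℝ) (n k : ℕ) : PSpace N → ℝ≥0∞ :=
  {z | z ∈ thickening (1 / ((n : ℝ) + 1)) Oᶜ ∧ -R < z.2}.indicator fun _ => (k : ℝ≥0∞)

theorem measurable_src (O : Set (PSpace N)) (R : ℝ) (n k : ℕ) : Measurable (src O R n k) := by
  refine measurable_const.indicator (MeasurableSet.inter isOpen_thickening.measurableSet ?_)
  exact measurableSet_lt measurable_const measurable_snd

theorem exists_limit_solution (hq : 1 < q) (O : Set (PSpace N)) (R : ℝ) :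
    ∃ u : PSpace N → ℝ≥0∞, Measurable u ∧
      (∀ δ > 0, ∃ C : ℝ≥0, ∀ z, closedBall z δ ⊆ O → u z ≤ C) ∧
      (∀ δ > 0, ∀ P, LimitStable δ P → (∀ τ g v, Measurable g → IsMild q τ g v →
        ∀ z, (∀ w ∈ closedBall z δ, g w = 0) → P v z) → ∀ z, closedBall z (3 * δ) ⊆ O → P u z) ∧
      ∀ z m, (∀ n : ℕ, ∃ h uh : PSpace N → ℝ≥0∞, Measurable h ∧ IsMild q (-R) h uh ∧
        (∃ k : ℕ, h ≤ src O R n k) ∧ m ≤ uh z) → m ≤ u z := by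
  have hsc : ∀ n k, Causal (-R) (src O R n k) := by
    intro n k z hz
    exact indicator_of_notMem (fun h => absurd h.2 (not_lt.2 hz)) _
  have hsk : ∀ n k z, src O R n k z ≤ ((k : ℝ≥0) : ℝ≥0∞) := fun n k z => by
    rw [ENNReal.coe_natCast]
    exact indicator_le_self' (fun _ _ => zero_le) z
  have hex : ∀ n k, ∃ u, IsMild q (-R) (src O R n k) u := by
    intro n k
    refine exists_isMild (L := k + 1) hq (measurable_src O R n k) (by positivity)
      (fun z => (hsk n k z).trans ?_) (hsc n k)
    calc ((k : ℝ≥0) : ℝ≥0∞) ≤ ((k + 1 : ℝ≥0) : ℝ≥0∞) := by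
          exact_mod_cast Nat.le_succ k
      _ ≤ _ := ENNReal.le_rpow_self_of_one_le (by exact_mod_cast Nat.le_add_left 1 k) hq.le
  choose U hU using hex
  have hmonok : ∀ n, Monotone (U n) := fun n k k' hk =>
    IsMild.le hq (measurable_src O R n k) (measurable_src O R n k') (hsk n k') (hsc n k')
      (fun z => indicator_le_indicator (by exact_mod_cast hk)) (hU n k) (hU n k')
  have hanti : ∀ k, Antitone fun n => U n k := fun k n n' hn =>
    IsMild.le hq (measurable_src O R n' k) (measurable_src O R n k) (hsk n k) (hsc n k)
      (fun z => by
        have hsub : {z : PSpace N | z ∈ thickening (1 / ((n' : ℝ) + 1)) Oᶜ ∧ -R < z.2} ⊆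
            {z | z ∈ thickening (1 / ((n : ℝ) + 1)) Oᶜ ∧ -R < z.2} := fun w hw =>
          ⟨thickening_mono (one_div_le_one_div_of_le (by positivity) (by simpa using hn)) _ hw.1,
            hw.2⟩
        exact indicator_le_indicator_of_subset hsub (fun _ => zero_le) z) (hU n' k) (hU n k)
  have hfree : ∀ {δ : ℝ} {n : ℕ}, 1 / ((n : ℝ) + 1) ≤ δ → ∀ {z}, closedBall z (2 * δ) ⊆ O →
      ∀ k, ∀ w ∈ closedBall z δ, src O R n k w = 0 := by
    intro δ n hn z hz k w hw
    refine indicator_of_notMem (fun h => ?_) _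
    obtain ⟨y, hy, hd⟩ := mem_thickening_iff.1 h.1
    refine hy (hz ?_)
    rw [mem_closedBall] at hw ⊢
    have := dist_triangle y w z
    rw [dist_comm w y] at hd
    linarith
  have hex_n : ∀ δ > (0 : ℝ), ∃ n₀ : ℕ, ∀ n ≥ n₀, 1 / ((n : ℝ) + 1) ≤ δ := by
    intro δ hδ
    obtain ⟨n₀, hn₀⟩ := exists_nat_one_div_lt hδ
    refine ⟨n₀, fun n hn => (one_div_le_one_div_of_le (by positivity) ?_).trans hn₀.le⟩
    simpa using hn
  have hKO : ∀ δ > (0 : ℝ), ∃ C : ℝ≥0, ∀ n : ℕ, 1 / ((n : ℝ) + 1) ≤ δ → ∀ k z,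
      closedBall z (2 * δ) ⊆ O → U n k z ≤ C := by
    intro δ hδ
    obtain ⟨C, hC⟩ := keller_osserman N hq hδ
    exact ⟨C, fun n hn k z hz => hC _ _ _ (measurable_src O R n k) (hU n k) z (hfree hn hz k)⟩
  set V : ℕ → PSpace N → ℝ≥0∞ := fun n z => ⨆ k, U n k z with hV
  have hVm : ∀ n, Measurable (V n) := fun n => Measurable.iSup fun k => (hU n k).meas
  have hVanti : ∀ z, Antitone fun n => V n z := fun z n n' hn =>
    iSup_mono fun k => hanti k hn z
  refine ⟨fun z => ⨅ n, V n z, Measurable.iInf hVm, ?_, ?_, ?_⟩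
  · intro δ hδ
    obtain ⟨C, hC⟩ := hKO (δ / 2) (by positivity)
    obtain ⟨n₀, hn₀⟩ := hex_n (δ / 2) (by positivity)
    refine ⟨C, fun z hz => (iInf_le _ n₀).trans (iSup_le fun k => hC n₀ (hn₀ n₀ le_rfl) k z ?_)⟩
    rwa [mul_div_cancel₀ _ two_ne_zero]
  · intro δ hδ P hP hloc z hz
    obtain ⟨C, hC⟩ := hKO δ hδ
    obtain ⟨n₀, hn₀⟩ := hex_n δ hδ
    have hsub : ∀ w ∈ closedBall z δ, closedBall w (2 * δ) ⊆ O := by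
      intro w hw
      refine (closedBall_subset_closedBall' ?_).trans hz
      rw [mem_closedBall] at hw; linarith
    have hzz : z ∈ closedBall z δ := mem_closedBall_self hδ.le
    refine hP (fun j => V (n₀ + j)) _ z C (fun j => hVm _)
      (fun j w hw => iSup_le fun k => hC _ (hn₀ _ (Nat.le_add_right _ _)) k w (hsub w hw)) hzz
      (fun w hw => ?_) (fun j => ?_)
    · have := tendsto_atTop_iInf (hVanti w)
      exact (this.comp (tendsto_add_atTop_nat n₀)).congr fun j => by
        simp [add_comm]
    · have hn := hn₀ (n₀ + j) (Nat.le_add_right _ _)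
      refine hP (fun k => U (n₀ + j) k) _ z C (fun k => (hU _ k).meas)
        (fun k w hw => hC _ hn k w (hsub w hw)) hzz
        (fun w hw => tendsto_atTop_iSup fun k k' hk => hmonok _ hk w) (fun k => ?_)
      exact hloc _ _ _ (measurable_src O R _ k) (hU _ k) z (hfree hn (hsub z hzz) k)
  · intro z m h
    refine le_iInf fun n => ?_
    obtain ⟨h', uh, hm, hmild, ⟨k, hk⟩, hle⟩ := h n
    refine hle.trans (le_trans ?_ (le_iSup (fun k => U n k z) k))
    exact IsMild.le hq hm (measurable_src O R n k) (hsk n k) (hsc n k) hk hmild (hU n k) z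

end ParabolicWiener

namespace ParabolicWiener

open MeasureTheory Metric Set Filter Topology
open scoped ENNReal NNReal ContDiff

variable {N : ℕ} {q : ℝ}

/-- Real convolution on `ℝ^{N+1}`. -/
noncomputable def cv (K F : PSpace N → ℝ) (z : PSpace N) : ℝ := ∫ v, K v * F (z - v)

theorem cv_eq_convolution (K F : PSpace N → ℝ) :
    cv K F = convolution K F (ContinuousLinearMap.mul ℝ ℝ) volume := rfl

theorem cv_comm (K F : PSpace N → ℝ) (z : PSpace N) : cv K F z = cv F K z := by
  rw [cv, cv, ← integral_sub_left_eq_self _ volume z]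
  simp [mul_comm]

section bounded

variable {K F : PSpace N → ℝ} {C : ℝ} (hK : Integrable K) (hF : Measurable F)
  (hC : ∀ z, |F z| ≤ C)
include hK hF hC

theorem integrable_cv (z : PSpace N) : Integrable fun v => K v * F (z - v) := by
  refine (hK.norm.mul_const C).mono' ?_ (ae_of_all _ fun v => ?_)
  · exact hK.aestronglyMeasurable.mul (hF.comp (measurable_const.sub measurable_id)).aestronglyMeasurable
  · rw [norm_mul]
    exact mul_le_mul_of_nonneg_left (hC _) (norm_nonneg _)

omit hF in
theorem abs_cv_le (z : PSpace N) : |cv K F z| ≤ (∫ v, ‖K v‖) * C := by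
  rw [cv, ← Real.norm_eq_abs, ← integral_mul_const]
  refine norm_integral_le_of_norm_le (hK.norm.mul_const C) (ae_of_all _ fun v => ?_)
  rw [norm_mul]
  exact mul_le_mul_of_nonneg_left (hC _) (norm_nonneg _)

omit hK in
theorem locallyIntegrable_of_bdd : LocallyIntegrable F :=
  (locallyIntegrable_const C).mono hF.aestronglyMeasurable
    (ae_of_all _ fun z => (hC z).trans (le_abs_self C))

theorem continuous_cv : Continuous (cv K F) := by
  refine continuous_of_uniform_approx_of_continuous fun u hu => ?_
  obtain ⟨ε, hε, hεu⟩ := Metric.mem_uniformity_dist.1 hu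
  have hC0 : 0 ≤ C := (abs_nonneg _).trans (hC 0)
  obtain ⟨g, hg, hgK, hgc, hgi⟩ := hK.exists_hasCompactSupport_integral_sub_le
    (ε := ε / (2 * (C + 1))) (by positivity)
  refine ⟨cv g F, hg.continuous_convolution_left (ContinuousLinearMap.mul ℝ ℝ) hgc
    (locallyIntegrable_of_bdd hF hC), fun z => hεu ?_⟩
  have h1 := abs_cv_le (hK.sub hgi) hC z
  have h2 : cv (K - g) F z = cv K F z - cv g F z := by
    rw [cv, cv, cv, ← integral_sub (integrable_cv hK hF hC z) (integrable_cv hgi hF hC z)]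
    congr 1; ext v; simp [sub_mul]
  rw [Real.dist_eq, ← h2]
  refine h1.trans_lt ?_
  have h3 : (∫ v, ‖(K - g) v‖) * C ≤ ε / (2 * (C + 1)) * C :=
    mul_le_mul_of_nonneg_right hgK hC0
  refine h3.trans_lt ?_
  rw [div_mul_eq_mul_div, div_lt_iff₀ (by positivity)]
  nlinarith

/-- Differentiating the kernel of a convolution along a direction. -/
theorem hasLineDerivAt_cv_left {K' : PSpace N → ℝ} (hK' : Integrable K') (hK'm : Measurable K')
    {e : PSpace N}
    (hd : ∀ v (s : ℝ), HasDerivAt (fun s => K (v + s • e)) (K' (v + s • e)) s)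
    (hcont : ∀ v, Continuous fun s : ℝ => K' (v + s • e)) (z : PSpace N) :
    HasLineDerivAt ℝ (cv K F) (cv K' F z) z e := by
  have hg := continuous_cv hK' hF hC
  have hgl : Continuous fun s : ℝ => cv K' F (z + s • e) :=
    hg.comp (continuous_const.add (continuous_id.smul continuous_const))
  have hrepr : ∀ K : PSpace N → ℝ, ∀ z, cv K F z = ∫ w, K (z - w) * F w := fun K z => by
    rw [cv_comm, cv]; simp_rw [mul_comm]
  have hInt : ∀ z, Integrable fun w => K (z - w) * F w := fun z => by
    have := (integrable_cv hK hF hC z).comp_sub_left z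
    simpa using this
  have key : ∀ h : ℝ, cv K F (z + h • e) = cv K F z + ∫ s in (0 : ℝ)..h, cv K' F (z + s • e) := by
    intro h
    have h1 : ∀ w, K (z + h • e - w) - K (z - w) = ∫ s in (0 : ℝ)..h, K' (z - w + s • e) := by
      intro w
      rw [intervalIntegral.integral_eq_sub_of_hasDerivAt (fun s _ => hd (z - w) s)
        ((hcont _).intervalIntegrable _ _)]
      simp only [zero_smul, add_zero]
      congr 2; abel
    rw [← sub_eq_iff_eq_add', hrepr, hrepr, ← integral_sub (hInt _) (hInt _)]
    simp_rw [← sub_mul, h1, ← intervalIntegral.integral_mul_const]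
    rw [← intervalIntegral_integral_swap]
    · refine intervalIntegral.integral_congr fun s _ => ?_
      rw [hrepr]
      congr 1; ext w; congr 2; abel
    · have hm : Measurable (Function.uncurry fun (s : ℝ) (w : PSpace N) =>
          K' (z - w + s • e) * F w) := by
        refine (hK'm.comp ?_).mul (hF.comp measurable_snd)
        exact (measurable_const.sub measurable_snd).add (measurable_fst.smul measurable_const)
      have hi : ∀ s : ℝ, Integrable fun w => K' (z - w + s • e) := fun s => by
        have := hK'.comp_sub_left (z + s • e)
        refine this.congr (ae_of_all _ fun w => ?_)
        simp only; congr 1; abel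
      rw [integrable_prod_iff hm.aestronglyMeasurable]
      have hb : ∀ (s : ℝ) w, ‖K' (z - w + s • e) * F w‖ ≤ ‖K' (z - w + s • e)‖ * C := fun s w => by
        rw [norm_mul]
        exact mul_le_mul_of_nonneg_left (hC _) (norm_nonneg _)
      constructor
      · refine ae_of_all _ fun s => ((hi s).norm.mul_const C).mono' ?_ (ae_of_all _ (hb s))
        exact (hm.comp measurable_prodMk_left).aestronglyMeasurable
      · refine Integrable.mono' (g := fun _ => (∫ v, ‖K' v‖) * C)
          (integrableOn_const (by simp [uIoc]))
          (hm.norm.aestronglyMeasurable).integral_prod_right' (ae_of_all _ fun s => ?_)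
        rw [Real.norm_of_nonneg (integral_nonneg fun _ => norm_nonneg _), ← integral_mul_const]
        rw [← integral_sub_left_eq_self _ volume (z + s • e)]
        refine integral_mono_of_nonneg (ae_of_all _ fun _ => norm_nonneg _) ?_
          (ae_of_all _ fun w => (hb s _).trans_eq ?_)
        · exact hK'.norm.mul_const C
        · simp only; congr 3; abel
  have := (intervalIntegral.integral_hasDerivAt_right (hgl.intervalIntegrable 0 0)
    (hgl.stronglyMeasurableAtFilter _ _) hgl.continuousAt).const_add (cv K F z)
  refine (this.congr_of_eventuallyEq (Eventually.of_forall key)).congr_deriv ?_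
  simp

/-- Differentiating the smooth factor of a convolution along a direction. -/
theorem hasLineDerivAt_cv_right {F' : PSpace N → ℝ} (hF' : Measurable F') {C' : ℝ}
    (hC' : ∀ z, |F' z| ≤ C') {e : PSpace N} (hd : ∀ v, HasLineDerivAt ℝ F (F' v) v e)
    (z : PSpace N) : HasLineDerivAt ℝ (cv K F) (cv K F' z) z e := by
  have hd' : ∀ v (s : ℝ), HasDerivAt (fun s => F (v + s • e)) (F' (v + s • e)) s := by
    intro v s
    have h := (hd (v + s • e)).scomp_of_eq (x := s) (h := fun r : ℝ => r - s)
      ((hasDerivAt_id s).sub_const s) (by simp)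
    simp only [one_smul] at h
    refine h.congr_of_eventuallyEq (Eventually.of_forall fun r => ?_)
    simp only [Function.comp]
    congr 1; rw [sub_smul]; abel
  have h := hasDerivAt_integral_of_dominated_loc_of_deriv_le (μ := volume) (x₀ := (0 : ℝ))
    (F := fun s v => K v * F (z + s • e - v)) (F' := fun s v => K v * F' (z + s • e - v))
    (bound := fun v => ‖K v‖ * C') (s := univ) univ_mem
    (Eventually.of_forall fun s => (integrable_cv hK hF hC _).aestronglyMeasurable)
    (integrable_cv hK hF hC _) (integrable_cv hK hF' hC' _).aestronglyMeasurable
    (ae_of_all _ fun v s _ => ?_) (hK.norm.mul_const C') (ae_of_all _ fun v s _ => ?_)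
  · simpa [HasLineDerivAt, cv] using h.2
  · rw [norm_mul]
    exact mul_le_mul_of_nonneg_left (hC' _) (norm_nonneg _)
  · have := (hd' (z - v) s).const_mul (K v)
    simpa [sub_add_eq_add_sub] using this

end bounded

end ParabolicWiener

namespace ParabolicWiener

open MeasureTheory Metric Set Filter Topology
open scoped ENNReal NNReal ContDiff

variable {N : ℕ} {q : ℝ}

/-- The `i`-th spatial unit vector of `ℝ^{N+1}`. -/
noncomputable def eX (i : Fin N) : PSpace N := (EuclideanSpace.single i 1, 0)

/-- The spatial derivative of the heat kernel. -/
noncomputable def dheatK (i : Fin N) (v : PSpace N) : ℝ := -(v.1 i / (2 * v.2)) * heatK N v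

theorem measurable_dheatK (i : Fin N) : Measurable (dheatK i) := by
  have := measurable_heatK N
  unfold dheatK
  have h : Measurable fun v : PSpace N => v.1 i :=
    ((EuclideanSpace.proj (𝕜 := ℝ) i).continuous.comp continuous_fst).measurable
  fun_prop

theorem snd_add_smul_eX (v : PSpace N) (s : ℝ) (i : Fin N) : (v + s • eX i).2 = v.2 := by
  simp [eX]

theorem hasDerivAt_heatK_line (i : Fin N) (v : PSpace N) (s : ℝ) :
    HasDerivAt (fun s : ℝ => heatK N (v + s • eX i)) (dheatK i (v + s • eX i)) s := by
  rcases le_or_gt v.2 0 with hv | hv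
  · have h0 : ∀ s : ℝ, heatK N (v + s • eX i) = 0 := fun s =>
      heatK_of_nonpos (by rw [snd_add_smul_eX]; exact hv)
    simp only [dheatK, h0, mul_zero]
    exact hasDerivAt_const s 0
  · have hp : ∀ s : ℝ, 0 < (v + s • eX i).2 := fun s => by rw [snd_add_smul_eX]; exact hv
    have h1 : HasDerivAt (fun s : ℝ => v.1 + s • (EuclideanSpace.single i (1 : ℝ)))
        (EuclideanSpace.single i 1) s := by
      simpa using ((hasDerivAt_id s).smul_const (EuclideanSpace.single i (1 : ℝ))).const_add v.1
    have h2 := ((((h1.norm_sq).neg).div_const (4 * v.2)).exp).const_mul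
      ((4 * Real.pi * v.2) ^ (-(N : ℝ) / 2))
    have h3 : (fun s : ℝ => heatK N (v + s • eX i)) = fun s =>
        (4 * Real.pi * v.2) ^ (-(N : ℝ) / 2) *
          Real.exp (-‖v.1 + s • (EuclideanSpace.single i (1 : ℝ))‖ ^ 2 / (4 * v.2)) := by
      ext s
      rw [heatK_of_pos (hp s), snd_add_smul_eX]; rfl
    rw [h3]
    refine h2.congr_deriv ?_
    rw [dheatK, heatK_of_pos (hp s), snd_add_smul_eX]
    have h4 : (v + s • eX i).1 = v.1 + s • (EuclideanSpace.single i (1 : ℝ)) := rfl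
    rw [h4, EuclideanSpace.inner_single_right]
    simp
    field_simp
    ring

theorem continuous_dheatK_line (i : Fin N) (v : PSpace N) :
    Continuous fun s : ℝ => dheatK i (v + s • eX i) := by
  have h1 : Continuous fun s : ℝ => heatK N (v + s • eX i) :=
    continuous_iff_continuousAt.2 fun s => (hasDerivAt_heatK_line i v s).continuousAt
  simp only [dheatK, snd_add_smul_eX]
  refine Continuous.mul (Continuous.neg (Continuous.div_const ?_ _)) h1
  have h2 : Continuous fun w : PSpace N => w.1 i :=
    (EuclideanSpace.proj (𝕜 := ℝ) i).continuous.comp continuous_fst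
  exact h2.comp (f := fun s : ℝ => v + s • eX i)
    (continuous_const.add (continuous_id.smul continuous_const))

theorem abs_dheatK_le (i : Fin N) {y : EuclideanSpace ℝ (Fin N)} {s : ℝ} (hs : 0 < s) :
    |dheatK i (y, s)| ≤ 2 ^ ((N : ℝ) / 2) * s ^ (-(1 / 2) : ℝ) * heatK N (y, 2 * s) := by
  rw [dheatK, abs_mul, abs_of_nonneg (heatK_nonneg N _), abs_neg, abs_div,
    abs_of_pos (by positivity : 0 < 2 * s), heatK_of_pos (by simpa using hs),
    heatK_of_pos (by simpa using hs)]
  simp only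
  have h1 : |y i| ≤ ‖y‖ := by simpa using EuclideanSpace.norm_eq y ▸ (PiLp.norm_apply_le y i)
  have hsq : 0 < √s := Real.sqrt_pos.2 hs
  have hss : √s * √s = s := Real.mul_self_sqrt hs.le
  set a := ‖y‖ / √s with ha
  have h2 : a / 2 ≤ Real.exp (a ^ 2 / 8) := by
    refine le_trans ?_ (Real.add_one_le_exp _)
    nlinarith [sq_nonneg (a - 2)]
  have ha2 : a ^ 2 = ‖y‖ ^ 2 / s := by rw [ha, div_pow, Real.sq_sqrt hs.le]
  have h3 : ‖y‖ / (2 * s) = s ^ (-(1 / 2) : ℝ) * (a / 2) := by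
    rw [Real.rpow_neg hs.le, ← Real.sqrt_eq_rpow, ha]
    field_simp
    rw [Real.sq_sqrt hs.le]
  have h4 : (4 * Real.pi * s) ^ (-(N : ℝ) / 2)
      = 2 ^ ((N : ℝ) / 2) * (4 * Real.pi * (2 * s)) ^ (-(N : ℝ) / 2) := by
    rw [show 4 * Real.pi * (2 * s) = 2 * (4 * Real.pi * s) by ring,
      Real.mul_rpow (x := 2) (by norm_num) (by positivity), ← mul_assoc,
      ← Real.rpow_add (by norm_num)]
    rw [show (N : ℝ) / 2 + -(N : ℝ) / 2 = 0 by ring, Real.rpow_zero, one_mul]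
  have h5 : Real.exp (-‖y‖ ^ 2 / (4 * s))
      = Real.exp (-‖y‖ ^ 2 / (4 * (2 * s))) * Real.exp (-(a ^ 2 / 8)) := by
    rw [← Real.exp_add, ha2]; congr 1; field_simp; ring
  rw [h4, h5]
  have h6 : |y i| / (2 * s) * Real.exp (-(a ^ 2 / 8)) ≤ s ^ (-(1 / 2) : ℝ) := by
    calc |y i| / (2 * s) * Real.exp (-(a ^ 2 / 8))
        ≤ ‖y‖ / (2 * s) * Real.exp (-(a ^ 2 / 8)) := by gcongr
      _ = s ^ (-(1 / 2) : ℝ) * (a / 2 * Real.exp (-(a ^ 2 / 8))) := by rw [h3]; ring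
      _ ≤ s ^ (-(1 / 2) : ℝ) * 1 := by
          refine mul_le_mul_of_nonneg_left ?_ (by positivity)
          rw [Real.exp_neg, ← div_eq_mul_inv, div_le_one (Real.exp_pos _)]; exact h2
      _ = _ := mul_one _
  have h7 : 0 ≤ 2 ^ ((N : ℝ) / 2) * (4 * Real.pi * (2 * s)) ^ (-(N : ℝ) / 2) *
      Real.exp (-‖y‖ ^ 2 / (4 * (2 * s))) := by positivity
  nlinarith [mul_le_mul_of_nonneg_left h6 h7]

theorem integrable_slab_dheatK (i : Fin N) (T : ℝ) :
    IntegrableOn (dheatK i) {w : PSpace N | w.2 ∈ Ioo 0 T} := by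
  have hS : MeasurableSet {w : PSpace N | w.2 ∈ Ioo 0 T} := measurable_snd measurableSet_Ioo
  set k : PSpace N → ℝ≥0∞ := fun w => ENNReal.ofReal (2 ^ ((N : ℝ) / 2) * w.2 ^ (-(1 / 2) : ℝ)) *
    Gam N (w.1, 2 * w.2) with hk
  have hkm : Measurable k := by
    have := measurable_Gam N
    fun_prop
  have h1 := lintegral_slab hkm
    (m := fun s => ENNReal.ofReal (2 ^ ((N : ℝ) / 2) * s ^ (-(1 / 2) : ℝ))) (fun s hs => by
      have hm : Measurable fun y : EuclideanSpace ℝ (Fin N) => Gam N (y, 2 * s) :=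
        (measurable_Gam N).comp (measurable_id.prodMk measurable_const)
      simp only [hk]
      rw [lintegral_const_mul _ hm, lintegral_Gam_slice (by linarith), mul_one]) T
  refine ⟨(measurable_dheatK i).aestronglyMeasurable, ?_⟩
  refine lt_of_le_of_lt (b := ∫⁻ w in {w : PSpace N | w.2 ∈ Ioo 0 T}, k w) ?_ ?_
  · refine setLIntegral_mono hkm fun w hw => ?_
    rw [← ofReal_norm, Real.norm_eq_abs, hk]
    have hpos : 0 < w.2 := hw.1
    simp only [Gam]
    rw [← ENNReal.ofReal_mul (by positivity)]
    exact ENNReal.ofReal_le_ofReal (abs_dheatK_le i hpos)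
  · rw [h1]
    rcases le_or_gt T 0 with hT | hT
    · simp [Ioo_eq_empty (not_lt.2 hT)]
    have h2 : IntegrableOn (fun s : ℝ => 2 ^ ((N : ℝ) / 2) * s ^ (-(1 / 2) : ℝ)) (Ioo 0 T) := by
      have := (intervalIntegral.intervalIntegrable_rpow' (a := 0) (b := T)
        (r := (-(1 / 2) : ℝ)) (by norm_num)).const_mul ((2 : ℝ) ^ ((N : ℝ) / 2))
      rw [intervalIntegrable_iff_integrableOn_Ioo_of_le hT.le] at this
      exact this
    exact h2.lintegral_lt_top

/-- The spatial derivative of the localised kernel. -/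
noncomputable def dlocK (i : Fin N) (ψ : PSpace N → ℝ) (v : PSpace N) : ℝ :=
  dX i ψ v * heatK N v + ψ v * dheatK i v

namespace IsCutoff

variable {δ : ℝ} {ψ : PSpace N → ℝ} (h : IsCutoff δ ψ)
include h

theorem measurable_dlocK (i : Fin N) : Measurable (dlocK i ψ) := by
  have h1 := (contDiff_dX h.smooth i).continuous.measurable
  have h2 := h.smooth.continuous.measurable
  have h3 := measurable_dheatK i
  have h4 := measurable_heatK N
  unfold dlocK
  fun_prop

theorem integrable_dlocK (i : Fin N) : Integrable (dlocK i ψ) := by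
  have hc := h.hasCompactSupport
  refine Integrable.add ?_ ?_
  · exact locallyIntegrable_heatK.integrable_smul_left_of_hasCompactSupport
      (contDiff_dX h.smooth i).continuous (hasCompactSupport_dX hc i)
  · have h1 := (integrable_indicator_iff (measurable_snd measurableSet_Ioo)).2
      (integrable_slab_dheatK i (δ + 1))
    refine h1.norm.mono' (h.smooth.continuous.measurable.mul
      (measurable_dheatK i)).aestronglyMeasurable (ae_of_all _ fun v => ?_)
    rw [norm_mul]
    by_cases hv : v ∈ closedBall (0 : PSpace N) δ
    · have hv2 : v.2 < δ + 1 := by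
        have := norm_snd_le v
        rw [mem_closedBall_zero_iff] at hv
        have := (abs_le.1 (this.trans hv)).2
        linarith
      have : dheatK i v = {w : PSpace N | w.2 ∈ Ioo 0 (δ + 1)}.indicator (dheatK i) v := by
        by_cases h0 : 0 < v.2
        · rw [indicator_of_mem (by exact ⟨h0, hv2⟩)]
        · rw [indicator_of_notMem (fun h' => h0 h'.1), dheatK, heatK_of_nonpos (not_lt.1 h0),
            mul_zero]
      change _ ≤ ‖{w : PSpace N | w.2 ∈ Ioo 0 (δ + 1)}.indicator (dheatK i) v‖
      rw [← this]
      refine mul_le_of_le_one_left (norm_nonneg _) ?_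
      rw [Real.norm_of_nonneg (h.nonneg v)]; exact h.le_one v
    · rw [image_eq_zero_of_notMem_tsupport fun h' => hv (h.supp h')]
      simp

theorem hasDerivAt_locK_line (i : Fin N) (v : PSpace N) (s : ℝ) :
    HasDerivAt (fun s : ℝ => locK ψ (v + s • eX i)) (dlocK i ψ (v + s • eX i)) s := by
  have h1 : HasDerivAt (fun s : ℝ => v + s • eX i) (eX i) s := by
    simpa using ((hasDerivAt_id s).smul_const (eX i)).const_add v
  have h2 := ((h.smooth.differentiable (by simp)) (v + s • eX i)).hasFDerivAt.comp_hasDerivAt s h1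
  exact h2.mul (hasDerivAt_heatK_line i v s)

theorem continuous_dlocK_line (i : Fin N) (v : PSpace N) :
    Continuous fun s : ℝ => dlocK i ψ (v + s • eX i) := by
  have h1 : Continuous fun s : ℝ => heatK N (v + s • eX i) :=
    continuous_iff_continuousAt.2 fun s => (hasDerivAt_heatK_line i v s).continuousAt
  have h2 : Continuous fun s : ℝ => v + s • eX i :=
    continuous_const.add (continuous_id.smul continuous_const)
  exact (((contDiff_dX h.smooth i).continuous.comp h2).mul h1).add
    ((h.smooth.continuous.comp h2).mul (continuous_dheatK_line i v))

theorem hasLineDerivAt_cv_locK {F : PSpace N → ℝ} {C : ℝ} (hF : Measurable F)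
    (hC : ∀ z, |F z| ≤ C) (i : Fin N) (z : PSpace N) :
    HasLineDerivAt ℝ (cv (locK ψ) F) (cv (dlocK i ψ) F z) z (eX i) :=
  hasLineDerivAt_cv_left h.integrable_locK hF hC (h.integrable_dlocK i) (h.measurable_dlocK i)
    (h.hasDerivAt_locK_line i) (h.continuous_dlocK_line i) z

end IsCutoff

end ParabolicWiener

namespace ParabolicWiener

open MeasureTheory Metric Set Filter Topology
open scoped ENNReal NNReal ContDiff

variable {N : ℕ} {q : ℝ}

/-- The time unit vector of `ℝ^{N+1}`. -/
noncomputable def eT : PSpace N := (0, 1)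

theorem hasLineDerivAt_dX {φ : PSpace N → ℝ} (hφ : ContDiff ℝ ∞ φ) (i : Fin N) (z : PSpace N) :
    HasLineDerivAt ℝ φ (dX i φ z) z (eX i) :=
  (hφ.differentiable (by simp) z).hasFDerivAt.hasLineDerivAt _

theorem hasLineDerivAt_dT {φ : PSpace N → ℝ} (hφ : ContDiff ℝ ∞ φ) (z : PSpace N) :
    HasLineDerivAt ℝ φ (dT φ z) z eT :=
  (hφ.differentiable (by simp) z).hasFDerivAt.hasLineDerivAt _

theorem tendstoUniformly_cv {K F : PSpace N → ℝ} {f : ℕ → PSpace N → ℝ} (hK : Integrable K)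
    (hf : ∀ n, Continuous (f n)) (hfb : ∀ n, ∃ C, ∀ z, |f n z| ≤ C) (hF : Continuous F)
    (hFb : ∃ C, ∀ z, |F z| ≤ C) (h : TendstoUniformly f F atTop) :
    TendstoUniformly (fun n => cv K (f n)) (cv K F) atTop := by
  rw [Metric.tendstoUniformly_iff] at h ⊢
  intro ε hε
  have hI : 0 ≤ ∫ v, ‖K v‖ := integral_nonneg fun _ => norm_nonneg _
  filter_upwards [h (ε / ((∫ v, ‖K v‖) + 1)) (by positivity)] with n hn z
  obtain ⟨C, hC⟩ := hfb n
  obtain ⟨C', hC'⟩ := hFb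
  have h2 : cv K F z - cv K (f n) z = cv K (F - f n) z := by
    rw [cv, cv, cv, ← integral_sub (integrable_cv hK hF.measurable hC' z)
      (integrable_cv hK (hf n).measurable hC z)]
    congr 1; ext v; simp [mul_sub]
  rw [Real.dist_eq, h2]
  refine (abs_cv_le (F := F - f n) hK (fun z => (hn z).le) z).trans_lt ?_
  rw [mul_div_assoc', div_lt_iff₀ (by positivity)]
  nlinarith

theorem tendstoUniformly_sum {ι : Type*} [Fintype ι] {f : ι → ℕ → PSpace N → ℝ}
    {g : ι → PSpace N → ℝ} (h : ∀ i, TendstoUniformly (f i) (g i) atTop) :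
    TendstoUniformly (fun n w => ∑ i, f i n w) (fun w => ∑ i, g i w) atTop := by
  have : ∀ s : Finset ι, TendstoUniformly (fun n w => ∑ i ∈ s, f i n w)
      (fun w => ∑ i ∈ s, g i w) atTop := by
    intro s
    classical
    induction s using Finset.induction_on with
    | empty =>
      simp only [Finset.sum_empty]
      rw [Metric.tendstoUniformly_iff]
      intro ε hε; simp [hε]
    | insert a s ha ih =>
      simp only [Finset.sum_insert ha]
      exact (h a).add ih
  exact this _

theorem hasDerivAt_of_hasLineDerivAt {f : PSpace N → ℝ} {f' : PSpace N → ℝ} {e : PSpace N}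
    (hd : ∀ z, HasLineDerivAt ℝ f (f' z) z e) (z : PSpace N) (s : ℝ) :
    HasDerivAt (fun s : ℝ => f (z + s • e)) (f' (z + s • e)) s := by
  have h := (hd (z + s • e)).scomp_of_eq (x := s) (h := fun r : ℝ => r - s)
    ((hasDerivAt_id s).sub_const s) (by simp)
  simp only [one_smul] at h
  refine h.congr_of_eventuallyEq (Eventually.of_forall fun r => ?_)
  simp only [Function.comp]
  congr 1; rw [sub_smul]; abel

theorem hasLineDerivAt_of_tendstoUniformly {f f' : ℕ → PSpace N → ℝ} {g g' : PSpace N → ℝ}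
    {e : PSpace N} (hd : ∀ n z, HasLineDerivAt ℝ (f n) (f' n z) z e)
    (hf' : TendstoUniformly f' g' atTop) (hf : ∀ z, Tendsto (fun n => f n z) atTop (𝓝 (g z)))
    (z : PSpace N) : HasLineDerivAt ℝ g (g' z) z e := by
  have key := hasDerivAt_of_tendstoUniformly (l := atTop)
    (f := fun n (s : ℝ) => f n (z + s • e)) (f' := fun n (s : ℝ) => f' n (z + s • e))
    (g := fun s : ℝ => g (z + s • e)) (g' := fun s : ℝ => g' (z + s • e))
    (hf'.comp fun s : ℝ => z + s • e)
    (Eventually.of_forall fun n s => hasDerivAt_of_hasLineDerivAt (hd n) z s)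
    (fun s => hf _) 0
  simpa [HasLineDerivAt] using key

/-- A sequence of mollifiers. -/
noncomputable def moll (N n : ℕ) : ContDiffBump (0 : PSpace N) :=
  ⟨1 / (2 * ((n : ℝ) + 1)), 1 / ((n : ℝ) + 1), by positivity, by
    apply one_div_lt_one_div_of_lt <;> nlinarith [(n.cast_nonneg : (0 : ℝ) ≤ n)]⟩

theorem tendstoUniformly_moll {F : PSpace N → ℝ} (hF : Continuous F) (hc : HasCompactSupport F) :
    TendstoUniformly (fun n => cv ((moll N n).normed volume) F) F atTop := by
  rw [Metric.tendstoUniformly_iff]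
  intro ε hε
  have hu := hc.uniformContinuous_of_continuous hF
  obtain ⟨δ, hδ, hδu⟩ := Metric.uniformContinuous_iff.1 hu (ε / 2) (by positivity)
  obtain ⟨n₀, hn₀⟩ := exists_nat_one_div_lt hδ
  filter_upwards [eventually_ge_atTop n₀] with n hn z
  have hr : 1 / ((n : ℝ) + 1) ≤ δ := (one_div_le_one_div_of_le (by positivity)
    (by simpa using hn)).trans hn₀.le
  have := (moll N n).dist_normed_convolution_le (μ := volume) (x₀ := z) (ε := ε / 2)
    hF.aestronglyMeasurable (fun x hx => (hδu (lt_of_lt_of_le (mem_ball.1 hx) hr)).le)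
  rw [dist_comm]
  exact this.trans_lt (by linarith)

theorem contDiff_cv_left {K F : PSpace N → ℝ} (hK : ContDiff ℝ ∞ K) (hc : HasCompactSupport K)
    (hF : LocallyIntegrable F) : ContDiff ℝ ∞ (cv K F) :=
  hc.contDiff_convolution_left (n := ⊤) (ContinuousLinearMap.mul ℝ ℝ) hK hF

theorem hasCompactSupport_cv {K F : PSpace N → ℝ} (hK : HasCompactSupport K)
    (hF : HasCompactSupport F) : HasCompactSupport (cv K F) := by
  rw [cv_eq_convolution]; exact hK.convolution (ContinuousLinearMap.mul ℝ ℝ) hF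

theorem dX_cv {K F D : PSpace N → ℝ} (hK : ContDiff ℝ ∞ K) (hKc : HasCompactSupport K)
    (hF : Continuous F) (hc : HasCompactSupport F) (hD : Continuous D) (hDc : HasCompactSupport D)
    {i : Fin N} (hd : ∀ z, HasLineDerivAt ℝ F (D z) z (eX i)) : dX i (cv K F) = cv K D := by
  obtain ⟨CF, hCF⟩ := exists_bound hF hc
  obtain ⟨CD, hCD⟩ := exists_bound hD hDc
  ext w
  have := hasLineDerivAt_cv_right (hK.continuous.integrable_of_hasCompactSupport hKc)
    hF.measurable hCF hD.measurable hCD hd w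
  have hf := contDiff_cv_left hK hKc (locallyIntegrable_of_bdd hF.measurable hCF)
  exact (hasLineDerivAt_dX hf i w).lineDeriv.symm.trans this.lineDeriv

theorem exists_smooth_approx {F : PSpace N → ℝ} {D : Fin N → PSpace N → ℝ} (hF : Continuous F)
    (hc : HasCompactSupport F) (hD : ∀ i, Continuous (D i)) (hDc : ∀ i, HasCompactSupport (D i))
    (hd : ∀ i z, HasLineDerivAt ℝ F (D i z) z (eX i)) :
    ∃ f : ℕ → PSpace N → ℝ, (∀ n, ContDiff ℝ ∞ (f n)) ∧ (∀ n, HasCompactSupport (f n)) ∧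
      TendstoUniformly f F atTop ∧
      ∀ i, TendstoUniformly (fun n => dX i (f n)) (D i) atTop := by
  obtain ⟨CF, hCF⟩ := exists_bound hF hc
  refine ⟨fun n => cv ((moll N n).normed volume) F, fun n => ?_, fun n => ?_,
    tendstoUniformly_moll hF hc, fun i => ?_⟩
  · exact contDiff_cv_left (moll N n).contDiff_normed (moll N n).hasCompactSupport_normed
      (locallyIntegrable_of_bdd hF.measurable hCF)
  · exact hasCompactSupport_cv (moll N n).hasCompactSupport_normed hc
  · have e : (fun n => dX i (cv ((moll N n).normed volume) F))
        = fun n => cv ((moll N n).normed volume) (D i) := funext fun n =>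
      dX_cv (moll N n).contDiff_normed (moll N n).hasCompactSupport_normed hF hc (hD i) (hDc i)
        (hd i)
    rw [e]; exact tendstoUniformly_moll (hD i) (hDc i)

namespace IsCutoff

variable {δ : ℝ} {ψ : PSpace N → ℝ} (h : IsCutoff δ ψ)
include h

theorem integrable_errK : Integrable (errK ψ) :=
  h.contDiff_errK.continuous.integrable_of_hasCompactSupport h.hasCompactSupport_errK

theorem cv_locK_dX_dX {f : PSpace N → ℝ} (hf : ContDiff ℝ ∞ f) (hc : HasCompactSupport f)
    (i : Fin N) (z : PSpace N) :
    cv (locK ψ) (dX i (dX i f)) z = cv (dlocK i ψ) (dX i f) z := by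
  have h1 := contDiff_dX hf i
  have c1 := hasCompactSupport_dX hc i
  obtain ⟨C1, hC1⟩ := exists_bound h1.continuous c1
  obtain ⟨C2, hC2⟩ := exists_bound (contDiff_dX h1 i).continuous (hasCompactSupport_dX c1 i)
  have e1 := hasLineDerivAt_cv_right h.integrable_locK h1.continuous.measurable hC1
    (contDiff_dX h1 i).continuous.measurable hC2 (hasLineDerivAt_dX h1 i) z
  have e2 := h.hasLineDerivAt_cv_locK h1.continuous.measurable hC1 i z
  exact e1.lineDeriv.symm.trans e2.lineDeriv

theorem hasLineDerivAt_eT_smooth {f : PSpace N → ℝ} (hf : ContDiff ℝ ∞ f)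
    (hc : HasCompactSupport f) (z : PSpace N) :
    HasLineDerivAt ℝ (cv (locK ψ) f)
      (∑ i, cv (dlocK i ψ) (dX i f) z + f z - cv (errK ψ) f z) z eT := by
  obtain ⟨C, hC⟩ := exists_bound hf.continuous hc
  have hT := contDiff_dT hf
  obtain ⟨C', hC'⟩ := exists_bound hT.continuous (hasCompactSupport_dT hc)
  have e := hasLineDerivAt_cv_right h.integrable_locK hf.continuous.measurable hC
    hT.continuous.measurable hC' (hasLineDerivAt_dT hf) z
  convert e using 1
  have hp := h.integral_locK_heatOp hf hc z
  have hx : ∀ i : Fin N, Integrable fun v => locK ψ v * dX i (dX i f) (z - v) := fun i => by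
    obtain ⟨C2, hC2⟩ := exists_bound (contDiff_dX (contDiff_dX hf i) i).continuous
      (hasCompactSupport_dX (hasCompactSupport_dX hc i) i)
    exact integrable_cv h.integrable_locK
      (contDiff_dX (contDiff_dX hf i) i).continuous.measurable hC2 z
  have h1 : ∫ v, locK ψ v * heatOp f (z - v)
      = cv (locK ψ) (dT f) z - ∑ i, cv (locK ψ) (dX i (dX i f)) z := by
    simp only [cv]
    rw [← integral_finsetSum _ fun i _ => hx i, ← integral_sub
      (integrable_cv h.integrable_locK hT.continuous.measurable hC' z)
      (integrable_finsetSum _ fun i _ => hx i)]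
    congr 1; ext v
    rw [heatOp, mul_sub, Finset.mul_sum]
  rw [h1] at hp
  simp_rw [h.cv_locK_dX_dX hf hc] at hp
  change _ = f z - cv (errK ψ) f z at hp
  linarith

/-- The time derivative of a heat potential of a spatially differentiable function. -/
theorem hasLineDerivAt_eT {F : PSpace N → ℝ} {D : Fin N → PSpace N → ℝ} (hF : Continuous F)
    (hc : HasCompactSupport F) (hD : ∀ i, Continuous (D i)) (hDc : ∀ i, HasCompactSupport (D i))
    (hd : ∀ i z, HasLineDerivAt ℝ F (D i z) z (eX i)) (z : PSpace N) :
    HasLineDerivAt ℝ (cv (locK ψ) F)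
      (∑ i, cv (dlocK i ψ) (D i) z + F z - cv (errK ψ) F z) z eT := by
  obtain ⟨f, hf, hfc, hu, huD⟩ := exists_smooth_approx hF hc hD hDc hd
  have hCF := exists_bound hF hc
  have hfb : ∀ n, ∃ C, ∀ z, |f n z| ≤ C := fun n => exists_bound (hf n).continuous (hfc n)
  have u1 : ∀ i, TendstoUniformly (fun n => cv (dlocK i ψ) (dX i (f n))) (cv (dlocK i ψ) (D i))
      atTop := fun i => tendstoUniformly_cv (h.integrable_dlocK i)
        (fun n => (contDiff_dX (hf n) i).continuous)
        (fun n => exists_bound (contDiff_dX (hf n) i).continuous (hasCompactSupport_dX (hfc n) i))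
        (hD i) (exists_bound (hD i) (hDc i)) (huD i)
  have u2 := tendstoUniformly_cv h.integrable_errK (fun n => (hf n).continuous) hfb hF hCF hu
  have u3 := tendstoUniformly_cv h.integrable_locK (fun n => (hf n).continuous) hfb hF hCF hu
  have u4 := tendstoUniformly_sum u1
  exact hasLineDerivAt_of_tendstoUniformly
    (fun n => h.hasLineDerivAt_eT_smooth (hf n) (hfc n)) ((u4.add hu).sub u2)
    (fun w => u3.tendsto_at w) z

end IsCutoff

end ParabolicWiener

namespace ParabolicWiener

open MeasureTheory Metric Set Filter Topology
open scoped ENNReal NNReal ContDiff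

variable {N : ℕ} {q : ℝ}

theorem cv_congr {K F F' : PSpace N → ℝ} {δ : ℝ} {z : PSpace N}
    (hK : ∀ v ∉ closedBall (0 : PSpace N) δ, K v = 0) (h : ∀ w ∈ closedBall z δ, F w = F' w) :
    cv K F z = cv K F' z := by
  unfold cv
  congr 1
  ext v
  by_cases hv : v ∈ closedBall (0 : PSpace N) δ
  · rw [h _ (sub_mem_closedBall hv)]
  · rw [hK v hv, zero_mul, zero_mul]

theorem pos_lconv_of_eq {k : PSpace N → ℝ} {u : PSpace N → ℝ≥0∞} {G : PSpace N → ℝ} {δ : ℝ}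
    {z : PSpace N} (hk : ∀ v ∉ closedBall (0 : PSpace N) δ, k v = 0)
    (hu : ∀ w ∈ closedBall z δ, u w = ENNReal.ofReal (G w)) (hG : ∀ w, 0 ≤ G w) :
    (pos k ⋆ₗ u) z = ∫⁻ v, ENNReal.ofReal (k v * G (z - v)) := by
  rw [lconv_eq]
  congr 1
  ext v
  by_cases hv : v ∈ closedBall (0 : PSpace N) δ
  · rw [hu _ (sub_mem_closedBall hv), pos, ENNReal.ofReal_mul' (hG _)]
  · simp [pos, hk v hv]

section toReal

variable {u : PSpace N → ℝ≥0∞} {G : PSpace N → ℝ} {δ C : ℝ} {z : PSpace N}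
  (hGm : Measurable G) (hG : ∀ w, 0 ≤ G w) (hGC : ∀ w, |G w| ≤ C)
  (hu : ∀ w ∈ closedBall z δ, u w = ENNReal.ofReal (G w))
include hGm hG hGC hu

theorem toReal_pos_sub_neg {k : PSpace N → ℝ} (hki : Integrable k)
    (hk : ∀ v ∉ closedBall (0 : PSpace N) δ, k v = 0) :
    (pos k ⋆ₗ u) z ≠ ⊤ ∧ (neg k ⋆ₗ u) z ≠ ⊤ ∧
      ((pos k ⋆ₗ u) z).toReal - ((neg k ⋆ₗ u) z).toReal = cv k G z := by
  have hi := integrable_cv hki hGm hGC z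
  have e1 := pos_lconv_of_eq hk hu hG
  have e2 : (neg k ⋆ₗ u) z = ∫⁻ v, ENNReal.ofReal (-(k v * G (z - v))) := by
    rw [neg_eq_pos, pos_lconv_of_eq (fun v hv => by simp [hk v hv]) hu hG]
    simp only [neg_mul]
  rw [e1, e2, cv, integral_eq_lintegral_pos_part_sub_lintegral_neg_part hi]
  exact ⟨hi.lintegral_lt_top.ne, hi.neg.lintegral_lt_top.ne, rfl⟩

omit hGm in
theorem rpow_eq_ofReal (hq : 0 ≤ q) :
    (∀ w, 0 ≤ G w ^ q) ∧ (∀ w, |G w ^ q| ≤ C ^ q) ∧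
      ∀ w ∈ closedBall z δ, u w ^ q = ENNReal.ofReal (G w ^ q) := by
  refine ⟨fun w => Real.rpow_nonneg (hG w) q, fun w => ?_, fun w hw => ?_⟩
  · rw [abs_of_nonneg (Real.rpow_nonneg (hG w) q)]
    exact Real.rpow_le_rpow (hG w) ((le_abs_self _).trans (hGC w)) hq
  · rw [hu w hw, ENNReal.ofReal_rpow_of_nonneg (hG w) hq]

theorem LocalEq.toReal (hq : 0 ≤ q) {ψ : PSpace N → ℝ} (h : IsCutoff δ ψ) (hz : z ∈ closedBall z δ)
    (heq : LocalEq q ψ u z) :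
    G z = cv (errK ψ) G z - cv (locK ψ) (fun w => G w ^ q) z := by
  obtain ⟨h0, hC, he⟩ := rpow_eq_ofReal hG hGC hu hq
  obtain ⟨a1, a2, a3⟩ := toReal_pos_sub_neg hGm hG hGC hu h.integrable_errK
    (fun v hv => h.errK_eq_zero fun hv' => hv (h.supp hv'))
  obtain ⟨b1, -, b3⟩ := toReal_pos_sub_neg (hGm.pow_const q) h0 hC he h.integrable_locK
    (fun v hv => IsCutoff.locK_eq_zero fun hv' => hv (h.supp hv'))
  have hn : (neg (locK ψ) ⋆ₗ fun w => u w ^ q) z = 0 := by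
    have : neg (locK ψ) = 0 := by
      ext v; simp [neg, h.locK_nonneg v]
    rw [this]; simp
  rw [hn] at b3
  have := congrArg ENNReal.toReal heq
  rw [ENNReal.toReal_add (ENNReal.add_ne_top.2 ⟨by rw [hu z hz]; exact ENNReal.ofReal_ne_top, b1⟩) a2,
    ENNReal.toReal_add (by rw [hu z hz]; exact ENNReal.ofReal_ne_top) b1, hu z hz,
    ENNReal.toReal_ofReal (hG z)] at this
  simp only [ENNReal.toReal_zero] at b3
  linarith

theorem WeakEq.toReal (hq : 0 ≤ q) {φ : PSpace N → ℝ} (hφ : ContDiff ℝ ∞ φ)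
    (hs : tsupport φ ⊆ closedBall 0 δ) (hφ0 : ∀ v, 0 ≤ φ v) (heq : WeakEq q φ u z) :
    cv (heatOp φ) G z + cv φ (fun w => G w ^ q) z = 0 := by
  obtain ⟨h0, hC, he⟩ := rpow_eq_ofReal hG hGC hu hq
  have hc : HasCompactSupport φ :=
    (isCompact_closedBall (0 : PSpace N) δ).of_isClosed_subset (isClosed_tsupport φ) hs
  obtain ⟨a1, a2, a3⟩ := toReal_pos_sub_neg hGm hG hGC hu
    ((contDiff_heatOp hφ).continuous.integrable_of_hasCompactSupport (hasCompactSupport_heatOp hc))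
    (fun v hv => heatOp_eq_zero fun hv' => hv (hs hv'))
  obtain ⟨b1, -, b3⟩ := toReal_pos_sub_neg (hGm.pow_const q) h0 hC he
    (hφ.continuous.integrable_of_hasCompactSupport hc)
    (fun v hv => image_eq_zero_of_notMem_tsupport fun hv' => hv (hs hv'))
  have hn : (neg φ ⋆ₗ fun w => u w ^ q) z = 0 := by
    have : neg φ = 0 := by
      ext v; simp [neg, hφ0 v]
    rw [this]; simp
  rw [hn] at b3
  have := congrArg ENNReal.toReal heq
  rw [ENNReal.toReal_add a1 b1] at this
  simp only [ENNReal.toReal_zero] at b3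
  linarith

end toReal

theorem cv_add_const_mul {K L G : PSpace N → ℝ} {C M : ℝ} (hK : Integrable K) (hL : Integrable L)
    (hG : Measurable G) (hC : ∀ z, |G z| ≤ C) (z : PSpace N) :
    cv (fun v => K v + M * L v) G z = cv K G z + M * cv L G z := by
  unfold cv
  rw [← integral_const_mul, ← integral_add (integrable_cv hK hG hC z)
    ((integrable_cv hL hG hC z).const_mul M)]
  congr 1; ext v; ring

theorem heatOp_add_const_mul {φ b : PSpace N → ℝ} (hφ : ContDiff ℝ ∞ φ) (hb : ContDiff ℝ ∞ b)
    (M : ℝ) : heatOp (fun v => φ v + M * b v) = fun v => heatOp φ v + M * heatOp b v := by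
  have hd : ∀ {φ b : PSpace N → ℝ}, ContDiff ℝ ∞ φ → ContDiff ℝ ∞ b → ∀ z,
      fderiv ℝ (fun v => φ v + M * b v) z = fderiv ℝ φ z + M • fderiv ℝ b z := by
    intro φ b hφ hb z
    exact ((hφ.differentiable (by simp) z).hasFDerivAt.add
      ((hb.differentiable (by simp) z).hasFDerivAt.const_mul M)).fderiv
  have hX : ∀ {φ b : PSpace N → ℝ}, ContDiff ℝ ∞ φ → ContDiff ℝ ∞ b → ∀ i,
      dX i (fun v => φ v + M * b v) = fun v => dX i φ v + M * dX i b v := by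
    intro φ b hφ hb i
    ext z
    simp only [dX, hd hφ hb]
    simp
  ext z
  simp only [heatOp, hX hφ hb, hX (contDiff_dX hφ _) (contDiff_dX hb _), dT, hd hφ hb,
    Finset.sum_add_distrib, ← Finset.mul_sum]
  simp
  ring

/-- The weak form holds for signed test functions once it holds for nonnegative ones. -/
theorem weak_of_nonneg {G F : PSpace N → ℝ} {δ C C' : ℝ} {z : PSpace N} (hδ : 0 < δ)
    (hG : Measurable G) (hGC : ∀ w, |G w| ≤ C) (hF : Measurable F) (hFC : ∀ w, |F w| ≤ C')
    (h : ∀ φ : PSpace N → ℝ, ContDiff ℝ ∞ φ → tsupport φ ⊆ closedBall 0 (2 * δ) → (∀ v, 0 ≤ φ v) →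
      cv (heatOp φ) G z + cv φ F z = 0) {φ : PSpace N → ℝ} (hφ : ContDiff ℝ ∞ φ)
    (hs : tsupport φ ⊆ closedBall 0 δ) : cv (heatOp φ) G z + cv φ F z = 0 := by
  have hc : HasCompactSupport φ :=
    (isCompact_closedBall (0 : PSpace N) δ).of_isClosed_subset (isClosed_tsupport φ) hs
  obtain ⟨M, hM⟩ := exists_bound hφ.continuous hc
  let b : ContDiffBump (0 : PSpace N) := ⟨δ, 2 * δ, hδ, by linarith⟩
  have hb : ContDiff ℝ ∞ b := b.contDiff
  have hbs : tsupport b = closedBall 0 (2 * δ) := b.tsupport_eq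
  have hbc : HasCompactSupport b := b.hasCompactSupport
  have hM0 : 0 ≤ M := (abs_nonneg _).trans (hM 0)
  have e1 := h b hb hbs.subset fun v => b.nonneg
  have hsum : ContDiff ℝ ∞ fun v => φ v + M * b v := hφ.add (contDiff_const.mul hb)
  have e2 := h (fun v => φ v + M * b v) hsum ?_ fun v => ?_
  · rw [heatOp_add_const_mul hφ hb, cv_add_const_mul
      ((contDiff_heatOp hφ).continuous.integrable_of_hasCompactSupport (hasCompactSupport_heatOp hc))
      ((contDiff_heatOp hb).continuous.integrable_of_hasCompactSupport
        (hasCompactSupport_heatOp hbc)) hG hGC,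
      cv_add_const_mul (hφ.continuous.integrable_of_hasCompactSupport hc)
        (hb.continuous.integrable_of_hasCompactSupport hbc) hF hFC] at e2
    linear_combination e2 - M * e1
  · refine closure_minimal (fun v hv => ?_) isClosed_closedBall
    by_contra hv'
    refine hv ?_
    have h1 : φ v = 0 := image_eq_zero_of_notMem_tsupport fun hv2 =>
      hv' (closedBall_subset_closedBall (by linarith) (hs hv2))
    have h2 : b v = 0 := image_eq_zero_of_notMem_tsupport fun hv2 => hv' (hbs ▸ hv2)
    simp [h1, h2]
  · by_cases hv : v ∈ closedBall (0 : PSpace N) δ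
    · rw [b.one_of_mem_closedBall hv]
      linarith [neg_abs_le (φ v), hM v]
    · rw [image_eq_zero_of_notMem_tsupport fun hv2 => hv (hs hv2), zero_add]
      exact mul_nonneg hM0 b.nonneg

end ParabolicWiener

namespace ParabolicWiener

open MeasureTheory Metric Set Filter Topology
open scoped ENNReal NNReal ContDiff

variable {N : ℕ} {q : ℝ}

theorem hasLineDerivAt_cv_smooth {K G : PSpace N → ℝ} {C : ℝ} (hK : ContDiff ℝ ∞ K)
    (hKc : HasCompactSupport K) (hG : Measurable G) (hC : ∀ z, |G z| ≤ C) (e z : PSpace N) :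
    HasLineDerivAt ℝ (cv K G) (cv (fun v => fderiv ℝ K v e) G z) z e := by
  have hf : ContDiff ℝ ∞ fun v => fderiv ℝ K v e :=
    (hK.fderiv_right (m := ∞) (by simp)).clm_apply contDiff_const
  have hfc : HasCompactSupport fun v => fderiv ℝ K v e := hKc.fderiv_apply (𝕜 := ℝ) e
  refine hasLineDerivAt_cv_left (hK.continuous.integrable_of_hasCompactSupport hKc) hG hC
    (hf.continuous.integrable_of_hasCompactSupport hfc) hf.continuous.measurable
    (fun v s => ?_) (fun v => hf.continuous.comp
      (continuous_const.add (continuous_id.smul continuous_const))) z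
  have h1 : HasDerivAt (fun s : ℝ => v + s • e) e s := by
    simpa using ((hasDerivAt_id s).smul_const e).const_add v
  exact ((hK.differentiable (by simp)) (v + s • e)).hasFDerivAt.comp_hasDerivAt s h1

theorem fderiv_cv_apply {K G : PSpace N → ℝ} {C : ℝ} (hK : ContDiff ℝ ∞ K)
    (hKc : HasCompactSupport K) (hG : Measurable G) (hC : ∀ z, |G z| ≤ C) (e z : PSpace N) :
    fderiv ℝ (cv K G) z e = cv (fun v => fderiv ℝ K v e) G z := by
  have h := ((contDiff_cv_left hK hKc (locallyIntegrable_of_bdd hG hC)).differentiable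
    (by simp) z).hasFDerivAt.hasLineDerivAt e
  exact h.lineDeriv.symm.trans (hasLineDerivAt_cv_smooth hK hKc hG hC e z).lineDeriv

theorem heatOp_cv {K G : PSpace N → ℝ} {C : ℝ} (hK : ContDiff ℝ ∞ K)
    (hKc : HasCompactSupport K) (hG : Measurable G) (hC : ∀ z, |G z| ≤ C) (z : PSpace N) :
    heatOp (cv K G) z = cv (heatOp K) G z := by
  have hX : ∀ {K : PSpace N → ℝ}, ContDiff ℝ ∞ K → HasCompactSupport K → ∀ i,
      dX i (cv K G) = cv (dX i K) G := fun hK hKc i => by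
    ext z; exact fderiv_cv_apply hK hKc hG hC _ z
  have hT : dT (cv K G) z = cv (dT K) G z := fderiv_cv_apply hK hKc hG hC _ z
  have hi : ∀ {K : PSpace N → ℝ}, ContDiff ℝ ∞ K → HasCompactSupport K →
      Integrable fun v => K v * G (z - v) := fun hK hKc =>
    integrable_cv (hK.continuous.integrable_of_hasCompactSupport hKc) hG hC z
  simp only [heatOp, hX hK hKc, hX (contDiff_dX hK _) (hasCompactSupport_dX hKc _), hT]
  unfold cv
  rw [← integral_finsetSum, ← integral_sub]
  · congr 1; ext v; rw [heatOp, sub_mul, Finset.sum_mul]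
  · exact hi (contDiff_dT hK) (hasCompactSupport_dT hKc)
  · exact integrable_finsetSum _ fun i _ =>
      hi (contDiff_dX (contDiff_dX hK i) i) (hasCompactSupport_dX (hasCompactSupport_dX hKc i) i)
  · exact fun i _ =>
      hi (contDiff_dX (contDiff_dX hK i) i) (hasCompactSupport_dX (hasCompactSupport_dX hKc i) i)

/-- `w` is a classical solution near `z₀`. -/
def SolvesNear (q : ℝ) (w : PSpace N → ℝ) (z₀ : PSpace N) : Prop :=
  ∃ ε > 0, ∃ (U T : PSpace N → ℝ) (D : Fin N → PSpace N → ℝ) (DD : Fin N → Fin N → PSpace N → ℝ),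
    Continuous U ∧ Continuous T ∧ (∀ i, Continuous (D i)) ∧ (∀ i j, Continuous (DD i j)) ∧
    (∀ z, HasLineDerivAt ℝ U (T z) z eT) ∧ (∀ i z, HasLineDerivAt ℝ U (D i z) z (eX i)) ∧
    (∀ i j z, HasLineDerivAt ℝ (D j) (DD i j z) z (eX i)) ∧
    ∀ z ∈ ball z₀ ε, w z = U z ∧ T z - ∑ i, DD i i z + w z ^ q = 0

theorem exists_representation {G : PSpace N → ℝ} {δ C : ℝ} {ψ : PSpace N → ℝ} (h : IsCutoff δ ψ)
    {F : PSpace N → ℝ} {C' : ℝ} (hGm : Measurable G) (hGC : ∀ w, |G w| ≤ C)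
    (hFm : Measurable F) (hFC : ∀ w, |F w| ≤ C') :
    ∃ D : Fin N → PSpace N → ℝ, (Continuous fun z => cv (errK ψ) G z - cv (locK ψ) F z) ∧
      (∀ i, Continuous (D i)) ∧
      ∀ i z, HasLineDerivAt ℝ (fun z => cv (errK ψ) G z - cv (locK ψ) F z) (D i z) z (eX i) := by
  have hV := contDiff_cv_left h.contDiff_errK h.hasCompactSupport_errK
    (locallyIntegrable_of_bdd hGm hGC)
  refine ⟨fun i z => dX i (cv (errK ψ) G) z - cv (dlocK i ψ) F z,
    hV.continuous.sub (continuous_cv h.integrable_locK hFm hFC),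
    fun i => (contDiff_dX hV i).continuous.sub (continuous_cv (h.integrable_dlocK i) hFm hFC),
    fun i z => ?_⟩
  exact (hasLineDerivAt_dX hV i z).sub (h.hasLineDerivAt_cv_locK hFm hFC i z)

theorem solvesNear_of_integral_eq {G : PSpace N → ℝ} {δ C : ℝ} {z₀ : PSpace N} (hq : 1 < q)
    (hδ : 0 < δ) (hGm : Measurable G) (hG : ∀ w, 0 ≤ G w) (hGC : ∀ w, |G w| ≤ C)
    (h1 : ∀ δ' > 0, δ' ≤ δ → ∀ ψ, IsCutoff δ' ψ → ∀ z ∈ ball z₀ δ,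
      G z = cv (errK ψ) G z - cv (locK ψ) (fun w => G w ^ q) z)
    (h2 : ∀ φ : PSpace N → ℝ, ContDiff ℝ ∞ φ → tsupport φ ⊆ closedBall 0 δ → ∀ z ∈ ball z₀ δ,
      cv (heatOp φ) G z + cv φ (fun w => G w ^ q) z = 0) : SolvesNear q G z₀ := by
  have hGq0 : ∀ w, 0 ≤ G w ^ q := fun w => Real.rpow_nonneg (hG w) q
  have hGqC : ∀ w, |G w ^ q| ≤ C ^ q := fun w => by
    rw [abs_of_nonneg (hGq0 w)]
    exact Real.rpow_le_rpow (hG w) ((le_abs_self _).trans (hGC w)) (by linarith)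
  have hGqm : Measurable fun w => G w ^ q := hGm.pow_const q
  obtain ⟨ψ₁, hψ₁⟩ := exists_isCutoff (N := N) hδ
  obtain ⟨D₁, hU₁, hD₁, hd₁⟩ := exists_representation hψ₁ hGm hGC hGqm hGqC
  set U₁ : PSpace N → ℝ := fun z => cv (errK ψ₁) G z - cv (locK ψ₁) (fun w => G w ^ q) z with hU₁d
  have hU₁G : ∀ z ∈ ball z₀ δ, U₁ z = G z := fun z hz => (h1 δ hδ le_rfl ψ₁ hψ₁ z hz).symm
  let χ : ContDiffBump z₀ := ⟨δ / 2, 3 * δ / 4, by positivity, by linarith⟩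
  have hχ : ContDiff ℝ ∞ χ := χ.contDiff
  have hχc : HasCompactSupport χ := χ.hasCompactSupport
  set G' : PSpace N → ℝ := fun z => χ z * U₁ z with hG'
  have hG'0 : ∀ z, 0 ≤ G' z := fun z => by
    by_cases hz : z ∈ ball z₀ δ
    · simp only [hG']
      rw [hU₁G z hz]
      exact mul_nonneg χ.nonneg (hG z)
    · simp only [hG']
      rw [χ.zero_of_le_dist, zero_mul]
      rw [mem_ball, not_lt] at hz
      refine le_trans ?_ hz
      change 3 * δ / 4 ≤ δ
      linarith
  have hG'c : Continuous G' := hχ.continuous.mul hU₁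
  have hG'e : ∀ z ∈ closedBall z₀ (δ / 2), G' z = G z := fun z hz => by
    simp only [hG']
    rw [χ.one_of_mem_closedBall hz, one_mul,
      hU₁G z (closedBall_subset_ball (by linarith) hz)]
  have hG's : HasCompactSupport G' := hχc.mul_right
  set F : PSpace N → ℝ := fun z => G' z ^ q with hF
  have hFc : Continuous F := hG'c.rpow_const fun _ => Or.inr (by linarith)
  have hFs : HasCompactSupport F := by
    refine hG's.comp_left (g := fun x : ℝ => x ^ q) ?_
    exact Real.zero_rpow (by linarith)
  set D₂ : Fin N → PSpace N → ℝ := fun i z =>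
    (dX i χ z * U₁ z + χ z * D₁ i z) * q * G' z ^ (q - 1) with hD₂
  have hD₂c : ∀ i, Continuous (D₂ i) := fun i =>
    ((((contDiff_dX hχ i).continuous.mul hU₁).add (hχ.continuous.mul (hD₁ i))).mul
      continuous_const).mul (hG'c.rpow_const fun _ => Or.inr (by linarith))
  have hD₂s : ∀ i, HasCompactSupport (D₂ i) := fun i => by
    refine HasCompactSupport.mul_left (f := fun z => (dX i χ z * U₁ z + χ z * D₁ i z) * q)
      (f' := fun z => G' z ^ (q - 1)) ?_
    refine hG's.comp_left (g := fun x : ℝ => x ^ (q - 1)) ?_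
    exact Real.zero_rpow (by linarith)
  have hd₂ : ∀ i z, HasLineDerivAt ℝ F (D₂ i z) z (eX i) := fun i z => by
    have a := (hasLineDerivAt_dX hχ i z).mul (hd₁ i z)
    have b := HasDerivAt.rpow_const (p := q) a (Or.inr hq.le)
    refine HasDerivAt.congr_deriv b ?_
    simp [hD₂, hG']
  obtain ⟨ψ, hψ⟩ := exists_isCutoff (N := N) (δ := δ / 4) (by positivity)
  obtain ⟨CF, hCF⟩ := exists_bound hFc hFs
  choose CD hCD using fun i => exists_bound (hD₂c i) (hD₂s i)
  have hV := contDiff_cv_left hψ.contDiff_errK hψ.hasCompactSupport_errK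
    (locallyIntegrable_of_bdd hGm hGC)
  set V := cv (errK ψ) G with hVd
  refine ⟨δ / 4, by positivity, fun z => V z - cv (locK ψ) F z,
    fun z => dT V z - (∑ i, cv (dlocK i ψ) (D₂ i) z + F z - cv (errK ψ) F z),
    fun i z => dX i V z - cv (locK ψ) (D₂ i) z,
    fun i j z => dX i (dX j V) z - cv (dlocK i ψ) (D₂ j) z, ?_, ?_, fun i => ?_, fun i j => ?_,
    fun z => ?_, fun i z => ?_, fun i j z => ?_, fun z hz => ?_⟩
  · exact hV.continuous.sub (continuous_cv hψ.integrable_locK hFc.measurable hCF)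
  · refine (contDiff_dT hV).continuous.sub (((continuous_finsetSum _ fun i _ => ?_).add hFc).sub ?_)
    · exact continuous_cv (hψ.integrable_dlocK i) (hD₂c i).measurable (hCD i)
    · exact continuous_cv hψ.integrable_errK hFc.measurable hCF
  · exact (contDiff_dX hV i).continuous.sub
      (continuous_cv hψ.integrable_locK (hD₂c i).measurable (hCD i))
  · exact (contDiff_dX (contDiff_dX hV j) i).continuous.sub
      (continuous_cv (hψ.integrable_dlocK i) (hD₂c j).measurable (hCD j))
  · exact (hasLineDerivAt_dT hV z).sub (hψ.hasLineDerivAt_eT hFc hFs hD₂c hD₂s hd₂ z)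
  · exact (hasLineDerivAt_dX hV i z).sub (hasLineDerivAt_cv_right hψ.integrable_locK
      hFc.measurable hCF (hD₂c i).measurable (hCD i) (hd₂ i) z)
  · exact (hasLineDerivAt_dX (contDiff_dX hV j) i z).sub
      (hψ.hasLineDerivAt_cv_locK (hD₂c j).measurable (hCD j) i z)
  · have hzδ : z ∈ ball z₀ δ := ball_subset_ball (by linarith) hz
    have hsub : closedBall z (δ / 4) ⊆ closedBall z₀ (δ / 2) :=
      closedBall_subset_closedBall' (by linarith [mem_ball.1 hz])
    have hFe : ∀ w ∈ closedBall z (δ / 4), G w ^ q = F w := fun w hw => by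
      simp only [hF, hG'e w (hsub hw)]
    have e1 := h1 (δ / 4) (by positivity) (by linarith) ψ hψ z hzδ
    have hEs : tsupport (errK ψ) ⊆ tsupport ψ := closure_minimal
      (fun v hv => by_contra fun hv' => hv (hψ.errK_eq_zero hv')) (isClosed_tsupport ψ)
    have e2 := h2 (errK ψ) hψ.contDiff_errK (hEs.trans (hψ.supp.trans
      (closedBall_subset_closedBall (by linarith)))) z hzδ
    rw [cv_congr (fun v hv => IsCutoff.locK_eq_zero fun hv' => hv (hψ.supp hv')) hFe] at e1
    rw [cv_congr (fun v hv => hψ.errK_eq_zero fun hv' => hv (hψ.supp hv')) hFe,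
      ← heatOp_cv hψ.contDiff_errK hψ.hasCompactSupport_errK hGm hGC] at e2
    refine ⟨e1, ?_⟩
    rw [hFe z (mem_closedBall_self (by positivity))]
    simp only [heatOp, ← hVd] at e2
    simp only [Finset.sum_sub_distrib]
    linarith

theorem hasLineDerivAt_slice {w U : PSpace N → ℝ} {d ε : ℝ} {z₀ z : PSpace N} {i : Fin N}
    (hU : HasLineDerivAt ℝ U d z (eX i)) (hw : ∀ z ∈ ball z₀ ε, w z = U z) (hz : z ∈ ball z₀ ε) :
    HasLineDerivAt ℝ (fun y => w (y, z.2)) d z.1 (EuclideanSpace.single i 1) := by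
  have h1 : ∀ t : ℝ, (z.1 + t • EuclideanSpace.single i (1 : ℝ), z.2) = z + t • eX i := fun t => by
    ext <;> simp [eX]
  have hc : Tendsto (fun t : ℝ => z + t • eX i) (𝓝 0) (𝓝 z) := by
    have : Continuous fun t : ℝ => z + t • eX i := by fun_prop
    simpa using this.tendsto 0
  have hU' : HasDerivAt (fun t : ℝ => U (z + t • eX i)) d 0 := hU
  refine HasDerivAt.congr_of_eventuallyEq hU' ?_
  filter_upwards [hc.eventually (isOpen_ball.mem_nhds hz)] with t ht
  simp only [h1, hw _ ht]

theorem hasDerivAt_slice {w U : PSpace N → ℝ} {d ε : ℝ} {z₀ z : PSpace N}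
    (hU : HasLineDerivAt ℝ U d z eT) (hw : ∀ z ∈ ball z₀ ε, w z = U z) (hz : z ∈ ball z₀ ε) :
    HasDerivAt (fun s => w (z.1, s)) d z.2 := by
  have hU' : HasDerivAt (fun t : ℝ => U (z + t • eT)) d (z.2 - z.2) := by
    rw [sub_self]; exact hU
  have h2 := hU'.comp_sub_const z.2 z.2
  have h1 : ∀ s : ℝ, z + (s - z.2) • eT = (z.1, s) := fun t => by
    ext <;> simp [eT]
  simp only [h1] at h2
  have hc : Tendsto (fun s : ℝ => (z.1, s)) (𝓝 z.2) (𝓝 z) := by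
    have : Continuous fun s : ℝ => (z.1, s) := by fun_prop
    simpa using this.tendsto z.2
  refine h2.congr_of_eventuallyEq ?_
  filter_upwards [hc.eventually (isOpen_ball.mem_nhds hz)] with t ht
  exact hw _ ht

theorem isC21_of_solvesNear {O : Set (PSpace N)} {w : PSpace N → ℝ}
    (h : ∀ z ∈ O, SolvesNear q w z) :
    IsC21 O w ∧ ∀ z ∈ O, tDeriv w z - lapl w z + w z ^ q = 0 := by
  have key : ∀ z₀ ∈ O, ∃ ε > 0, ∃ (U T : PSpace N → ℝ) (D : Fin N → PSpace N → ℝ)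
      (DD : Fin N → Fin N → PSpace N → ℝ),
      Continuous U ∧ Continuous T ∧ (∀ i, Continuous (D i)) ∧ (∀ i j, Continuous (DD i j)) ∧
      ∀ z ∈ ball z₀ ε, w z = U z ∧ HasDerivAt (fun s => w (z.1, s)) (T z) z.2 ∧
        (∀ i, HasLineDerivAt ℝ (fun y => w (y, z.2)) (D i z) z.1 (EuclideanSpace.single i 1)) ∧
        (∀ i j, HasLineDerivAt ℝ (fun y => xDeriv j w (y, z.2)) (DD i j z) z.1
          (EuclideanSpace.single i 1)) ∧ T z - ∑ i, DD i i z + w z ^ q = 0 := by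
    intro z₀ hz₀
    obtain ⟨ε, hε, U, T, D, DD, hU, hT, hD, hDD, dT', dX', dXX, he⟩ := h z₀ hz₀
    have hx : ∀ i, ∀ z ∈ ball z₀ ε, xDeriv i w z = D i z := fun i z hz =>
      (hasLineDerivAt_slice (dX' i z) (fun z hz => (he z hz).1) hz).lineDeriv
    exact ⟨ε, hε, U, T, D, DD, hU, hT, hD, hDD, fun z hz => ⟨(he z hz).1,
      hasDerivAt_slice (dT' z) (fun z hz => (he z hz).1) hz,
      fun i => hasLineDerivAt_slice (dX' i z) (fun z hz => (he z hz).1) hz,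
      fun i j => hasLineDerivAt_slice (dXX i j z) (hx j) hz, (he z hz).2⟩⟩
  have hcont : ∀ (f : PSpace N → ℝ), (∀ z₀ ∈ O, ∃ g : PSpace N → ℝ, Continuous g ∧
      ∃ ε > 0, ∀ z ∈ ball z₀ ε, f z = g z) → ContinuousOn f O := by
    intro f hf z hz
    obtain ⟨g, hg, ε, hε, he⟩ := hf z hz
    refine (hg.continuousAt.congr ?_).continuousWithinAt
    filter_upwards [ball_mem_nhds z hε] with y hy using (he y hy).symm
  refine ⟨⟨hcont _ fun z hz => ?_, fun z hz => ?_, hcont _ fun z hz => ?_, fun i z hz => ?_,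
    fun i => hcont _ fun z hz => ?_, fun i j z hz => ?_, fun i j => hcont _ fun z hz => ?_⟩,
    fun z hz => ?_⟩ <;> obtain ⟨ε, hε, U, T, D, DD, hU, hT, hD, hDD, he⟩ := key z hz
  · exact ⟨U, hU, ε, hε, fun y hy => (he y hy).1⟩
  · exact (he z (mem_ball_self hε)).2.1.differentiableAt
  · exact ⟨T, hT, ε, hε, fun y hy => (he y hy).2.1.deriv⟩
  · exact ((he z (mem_ball_self hε)).2.2.1 i).lineDifferentiableAt
  · exact ⟨D i, hD i, ε, hε, fun y hy => ((he y hy).2.2.1 i).lineDeriv⟩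
  · exact ((he z (mem_ball_self hε)).2.2.2.1 i j).lineDifferentiableAt
  · exact ⟨DD i j, hDD i j, ε, hε, fun y hy => ((he y hy).2.2.2.1 i j).lineDeriv⟩
  · obtain ⟨-, e1, -, e2, e3⟩ := he z (mem_ball_self hε)
    have hl : lapl w z = ∑ i, DD i i z := Finset.sum_congr rfl fun i _ => (e2 i i).lineDeriv
    rw [hl, tDeriv, e1.deriv]
    exact e3

end ParabolicWiener

namespace ParabolicWiener

open MeasureTheory Metric Set Filter Topology
open scoped ENNReal NNReal ContDiff

variable {N : ℕ} {q : ℝ}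

theorem SolvesNear.congr {w w' : PSpace N → ℝ} {z₀ : PSpace N} (h : SolvesNear q w z₀) {ε : ℝ}
    (hε : 0 < ε) (hw : ∀ z ∈ ball z₀ ε, w' z = w z) : SolvesNear q w' z₀ := by
  obtain ⟨ε', hε', U, T, D, DD, hU, hT, hD, hDD, dT', dX', dXX, he⟩ := h
  refine ⟨min ε ε', lt_min hε hε', U, T, D, DD, hU, hT, hD, hDD, dT', dX', dXX, fun z hz => ?_⟩
  rw [hw z (ball_subset_ball (min_le_left _ _) hz)]
  exact he z (ball_subset_ball (min_le_right _ _) hz)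

theorem exists_solution (hq : 1 < q) {O : Set (PSpace N)} (hO : IsOpen O) (R : ℝ) :
    ∃ u : PSpace N → ℝ≥0∞, (∀ z ∈ O, u z ≠ ⊤) ∧ IsC21 O (fun z => (u z).toReal) ∧
      (∀ z ∈ O, tDeriv (fun z => (u z).toReal) z - lapl (fun z => (u z).toReal) z
        + (u z).toReal ^ q = 0) ∧
      ∀ z m, (∀ n : ℕ, ∃ h uh : PSpace N → ℝ≥0∞, Measurable h ∧ IsMild q (-R) h uh ∧
        (∃ k : ℕ, h ≤ src O R n k) ∧ m ≤ uh z) → m ≤ u z := by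
  obtain ⟨u, hum, hub, hP, hm⟩ := exists_limit_solution hq O R
  refine ⟨u, fun z hz => ?_, ?_⟩
  · obtain ⟨δ, hδ, hs⟩ := Metric.nhds_basis_closedBall.mem_iff.1 (hO.mem_nhds hz)
    obtain ⟨C, hC⟩ := hub δ hδ
    exact ((hC z hs).trans_lt ENNReal.coe_lt_top).ne
  rw [← and_assoc]
  refine ⟨isC21_of_solvesNear fun z₀ hz₀ => ?_, hm⟩
  obtain ⟨d, hd, hs⟩ := Metric.nhds_basis_closedBall.mem_iff.1 (hO.mem_nhds hz₀)
  set δ := d / 8 with hδ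
  have hδ0 : 0 < δ := by positivity
  obtain ⟨C, hC⟩ := hub δ hδ0
  set G : PSpace N → ℝ := (closedBall z₀ (3 * δ)).indicator fun z => (u z).toReal with hG
  have hGm : Measurable G := hum.ennreal_toReal.indicator isClosed_closedBall.measurableSet
  have hG0 : ∀ w, 0 ≤ G w := fun w => indicator_nonneg (fun z _ => ENNReal.toReal_nonneg) w
  have huC : ∀ w ∈ closedBall z₀ (3 * δ), u w ≤ C := fun w hw =>
    hC w ((closedBall_subset_closedBall' (by linarith [mem_closedBall.1 hw])).trans hs)
  have hGC : ∀ w, |G w| ≤ C := fun w => by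
    rw [abs_of_nonneg (hG0 w), hG]
    by_cases hw : w ∈ closedBall z₀ (3 * δ)
    · rw [indicator_of_mem hw]
      exact ENNReal.toReal_le_coe_of_le_coe (huC w hw)
    · rw [indicator_of_notMem hw]; exact C.2
  have huG : ∀ w ∈ closedBall z₀ (3 * δ), u w = ENNReal.ofReal (G w) := fun w hw => by
    rw [hG, indicator_of_mem hw, ENNReal.ofReal_toReal]
    exact ((huC w hw).trans_lt ENNReal.coe_lt_top).ne
  have hsub : ∀ z ∈ ball z₀ δ, ∀ r ≤ 2 * δ, closedBall z r ⊆ closedBall z₀ (3 * δ) :=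
    fun z hz r hr => closedBall_subset_closedBall' (by linarith [mem_ball.1 hz])
  have hsO : ∀ z ∈ ball z₀ δ, ∀ r ≤ 2 * δ, closedBall z (3 * r) ⊆ O :=
    fun z hz r hr => (closedBall_subset_closedBall' (by linarith [mem_ball.1 hz])).trans hs
  have key := solvesNear_of_integral_eq (z₀ := z₀) hq hδ0 hGm hG0 hGC
    (fun δ' h0 h1 ψ hψ z hz => ?_) (fun φ hφ hφs z hz => ?_)
  · refine key.congr (ε := 3 * δ) (by positivity) fun z hz => ?_
    rw [hG, indicator_of_mem (ball_subset_closedBall hz)]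
  · exact LocalEq.toReal hGm hG0 hGC (fun w hw => huG w (hsub z hz δ' (by linarith) hw))
      (by linarith) hψ (mem_closedBall_self h0.le)
      (hP δ' h0 _ (hψ.limitStable_localEq hq)
        (fun τ g v hg hv z hz => hv.localEq hq hg hψ hz) z (hsO z hz δ' (by linarith)))
  · have hGqC : ∀ w, |G w ^ q| ≤ (C : ℝ) ^ q := fun w => by
      rw [abs_of_nonneg (Real.rpow_nonneg (hG0 w) q)]
      exact Real.rpow_le_rpow (hG0 w) ((le_abs_self _).trans (hGC w)) (by linarith)
    refine weak_of_nonneg hδ0 hGm hGC (hGm.pow_const q) hGqC (fun φ hφ hs h0 => ?_) hφ hφs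
    exact WeakEq.toReal hGm hG0 hGC (fun w hw => huG w (hsub z hz _ le_rfl hw))
      (by linarith) hφ hs h0
      (hP (2 * δ) (by positivity) _ (limitStable_weakEq hq hφ hs)
        (fun τ g v hg hv z hz => hv.weakEq hq hg hφ hs h0 hz) z (hsO z hz _ le_rfl))

end ParabolicWiener

namespace ParabolicWiener

open MeasureTheory Metric Set Filter Topology
open scoped ENNReal NNReal ContDiff

variable {N : ℕ}

section derivatives

variable {φ ψ : PSpace N → ℝ}

theorem tDeriv_eq_dT (hφ : ContDiff ℝ ∞ φ) : tDeriv φ = dT φ := by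
  ext z
  have h : HasDerivAt (fun s : ℝ => ((z.1, s) : PSpace N)) (0, 1) z.2 :=
    (hasDerivAt_const _ _).prodMk (hasDerivAt_id _)
  exact ((hφ.differentiable (by simp) (z.1, z.2)).hasFDerivAt.comp_hasDerivAt z.2 h).deriv

theorem xDeriv_eq_dX (hφ : ContDiff ℝ ∞ φ) (i : Fin N) : xDeriv i φ = dX i φ := by
  ext z
  exact (hasLineDerivAt_slice (z₀ := z) (ε := 1) (hasLineDerivAt_dX hφ i z) (fun _ _ => rfl)
    (mem_ball_self one_pos)).lineDeriv

theorem xxDeriv_eq_dX (hφ : ContDiff ℝ ∞ φ) (i j : Fin N) : xxDeriv i j φ = dX i (dX j φ) := by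
  rw [← xDeriv_eq_dX (contDiff_dX hφ j), ← xDeriv_eq_dX hφ]; rfl

/-- The spatial gradient. -/
noncomputable def grad (φ : PSpace N → ℝ) (z : PSpace N) : EuclideanSpace ℝ (Fin N) :=
  WithLp.toLp 2 fun i => dX i φ z

theorem norm_grad (hφ : ContDiff ℝ ∞ φ) (z : PSpace N) : ‖grad φ z‖ = gradNorm φ z := by
  simp only [gradNorm, xDeriv_eq_dX hφ]
  rw [EuclideanSpace.norm_eq]
  simp [grad]

theorem continuous_grad (hφ : ContDiff ℝ ∞ φ) : Continuous (grad φ) :=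
  (PiLp.continuous_toLp 2 _).comp (continuous_pi fun i => (contDiff_dX hφ i).continuous)

theorem hasCompactSupport_grad (hc : HasCompactSupport φ) : HasCompactSupport (grad φ) := by
  refine HasCompactSupport.intro (K := tsupport φ) hc fun z hz => ?_
  ext i
  simp only [grad, dX]
  rw [image_eq_zero_of_notMem_tsupport fun h => hz (tsupport_fderiv_subset ℝ h)]
  simp

theorem fderiv_lin (hφ : ContDiff ℝ ∞ φ) (hψ : ContDiff ℝ ∞ ψ) (a b : ℝ) (z : PSpace N) :
    fderiv ℝ (a • φ + b • ψ) z = a • fderiv ℝ φ z + b • fderiv ℝ ψ z :=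
  (((hφ.differentiable (by simp) z).hasFDerivAt.const_smul a).add
    ((hψ.differentiable (by simp) z).hasFDerivAt.const_smul b)).fderiv

theorem dX_lin (hφ : ContDiff ℝ ∞ φ) (hψ : ContDiff ℝ ∞ ψ) (a b : ℝ) (i : Fin N) :
    dX i (a • φ + b • ψ) = a • dX i φ + b • dX i ψ := by
  ext z
  simp [dX, fderiv_lin hφ hψ]

theorem dT_lin (hφ : ContDiff ℝ ∞ φ) (hψ : ContDiff ℝ ∞ ψ) (a b : ℝ) :
    dT (a • φ + b • ψ) = a • dT φ + b • dT ψ := by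
  ext z
  simp [dT, fderiv_lin hφ hψ]

theorem grad_lin (hφ : ContDiff ℝ ∞ φ) (hψ : ContDiff ℝ ∞ ψ) (a b : ℝ) :
    grad (a • φ + b • ψ) = a • grad φ + b • grad ψ := by
  ext z i
  simp [grad, dX_lin hφ hψ]

theorem W21Norm_eq (p : ℝ) (hφ : ContDiff ℝ ∞ φ) :
    W21Norm N p φ = (eLpNorm φ (ENNReal.ofReal p) volume).toReal
      + (eLpNorm (dT φ) (ENNReal.ofReal p) volume).toReal
      + (eLpNorm (grad φ) (ENNReal.ofReal p) volume).toReal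
      + ∑ i : Fin N, ∑ j : Fin N,
        (eLpNorm (dX i (dX j φ)) (ENNReal.ofReal p) volume).toReal := by
  rw [W21Norm, tDeriv_eq_dT hφ]
  simp only [xxDeriv_eq_dX hφ]
  rw [← eLpNorm_norm (grad φ)]
  simp only [norm_grad hφ]

theorem W21Norm_nonneg (p : ℝ) (φ : PSpace N → ℝ) : 0 ≤ W21Norm N p φ := by
  unfold W21Norm
  have := Finset.sum_nonneg fun i (_ : i ∈ (Finset.univ : Finset (Fin N))) =>
    Finset.sum_nonneg fun j (_ : j ∈ (Finset.univ : Finset (Fin N))) =>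
      (ENNReal.toReal_nonneg (a := eLpNorm (xxDeriv i j φ) (ENNReal.ofReal p) volume))
  positivity

theorem toReal_eLpNorm_lin {E : Type*} [NormedAddCommGroup E] [NormedSpace ℝ E] {P : ℝ≥0∞}
    (hP : 1 ≤ P) {f g : PSpace N → E} (hf : Continuous f) (hg : Continuous g)
    (hfc : HasCompactSupport f) (hgc : HasCompactSupport g) (a b : ℝ) :
    (eLpNorm (a • f + b • g) P volume).toReal
      ≤ |a| * (eLpNorm f P volume).toReal + |b| * (eLpNorm g P volume).toReal := by
  have h1 := hf.memLp_of_hasCompactSupport (μ := volume) (p := P) hfc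
  have h2 := hg.memLp_of_hasCompactSupport (μ := volume) (p := P) hgc
  have h := eLpNorm_add_le (h1.const_smul a).1 (h2.const_smul b).1 hP
  refine (ENNReal.toReal_mono (ENNReal.add_ne_top.2
    ⟨(h1.const_smul a).2.ne, (h2.const_smul b).2.ne⟩) h).trans ?_
  rw [ENNReal.toReal_add (h1.const_smul a).2.ne (h2.const_smul b).2.ne, eLpNorm_const_smul,
    eLpNorm_const_smul, ENNReal.toReal_mul, ENNReal.toReal_mul]
  simp

theorem W21Norm_lin {p : ℝ} (hp : 1 ≤ p) (hφ : ContDiff ℝ ∞ φ) (hψ : ContDiff ℝ ∞ ψ)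
    (hφc : HasCompactSupport φ) (hψc : HasCompactSupport ψ) (a b : ℝ) :
    W21Norm N p (a • φ + b • ψ) ≤ |a| * W21Norm N p φ + |b| * W21Norm N p ψ := by
  have hP : 1 ≤ ENNReal.ofReal p := ENNReal.one_le_ofReal.2 hp
  have hab : ContDiff ℝ ∞ (a • φ + b • ψ) := (hφ.const_smul a).add (hψ.const_smul b)
  rw [W21Norm_eq p hab, W21Norm_eq p hφ, W21Norm_eq p hψ, dT_lin hφ hψ, grad_lin hφ hψ]
  have e1 := toReal_eLpNorm_lin hP hφ.continuous hψ.continuous hφc hψc a b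
  have e2 := toReal_eLpNorm_lin hP (contDiff_dT hφ).continuous (contDiff_dT hψ).continuous
    (hasCompactSupport_dT hφc) (hasCompactSupport_dT hψc) a b
  have e3 := toReal_eLpNorm_lin hP (continuous_grad hφ) (continuous_grad hψ)
    (hasCompactSupport_grad hφc) (hasCompactSupport_grad hψc) a b
  have e4 : ∑ i : Fin N, ∑ j : Fin N, (eLpNorm (dX i (dX j (a • φ + b • ψ)))
      (ENNReal.ofReal p) volume).toReal ≤ |a| * ∑ i : Fin N, ∑ j : Fin N,
        (eLpNorm (dX i (dX j φ)) (ENNReal.ofReal p) volume).toReal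
      + |b| * ∑ i : Fin N, ∑ j : Fin N,
        (eLpNorm (dX i (dX j ψ)) (ENNReal.ofReal p) volume).toReal := by
    simp only [Finset.mul_sum, ← Finset.sum_add_distrib]
    refine Finset.sum_le_sum fun i _ => Finset.sum_le_sum fun j _ => ?_
    rw [dX_lin hφ hψ, dX_lin (contDiff_dX hφ j) (contDiff_dX hψ j)]
    exact toReal_eLpNorm_lin hP (contDiff_dX (contDiff_dX hφ j) i).continuous
      (contDiff_dX (contDiff_dX hψ j) i).continuous
      (hasCompactSupport_dX (hasCompactSupport_dX hφc j) i)
      (hasCompactSupport_dX (hasCompactSupport_dX hψc j) i) a b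
  linarith

end derivatives

section capacity

variable {p : ℝ}

theorem cap21c_le {K : Set (PSpace N)} {φ : PSpace N → ℝ} (hφ : ContDiff ℝ ∞ φ)
    (hc : HasCompactSupport φ) {U : Set (PSpace N)} (hU : IsOpen U) (hKU : K ⊆ U)
    (h1 : ∀ z ∈ U, 1 ≤ φ z) : cap21c N p K ≤ W21Norm N p φ ^ p := by
  refine csInf_le ⟨0, ?_⟩ ⟨hc.toSchwartzMap hφ, ⟨U, hU, hKU, h1⟩, rfl⟩
  rintro c ⟨φ, -, rfl⟩
  exact Real.rpow_nonneg (W21Norm_nonneg _ _) _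

theorem cap21c_nonneg (K : Set (PSpace N)) : 0 ≤ cap21c N p K := by
  refine Real.sInf_nonneg ?_
  rintro c ⟨φ, -, rfl⟩
  exact Real.rpow_nonneg (W21Norm_nonneg _ _) _

theorem exists_cap21c_bound (N : ℕ) (p R : ℝ) : ∃ C, ∀ K ⊆ closedBall (0 : PSpace N) R,
    cap21c N p K ≤ C := by
  let b : ContDiffBump (0 : PSpace N) := ⟨max R 0 + 1, max R 0 + 2, by positivity, by linarith⟩
  refine ⟨W21Norm N p b ^ p, fun K hK => cap21c_le b.contDiff b.hasCompactSupport isOpen_ball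
    (U := ball 0 (max R 0 + 1)) (hK.trans (closedBall_subset_ball ?_)) fun z hz => ?_⟩
  · linarith [le_max_left R 0]
  · exact (b.one_of_mem_closedBall (ball_subset_closedBall hz)).ge

theorem cap21_bddAbove {E : Set (PSpace N)} {R : ℝ} (hE : E ⊆ closedBall 0 R) :
    BddAbove {c | ∃ D, D ⊆ E ∧ IsCompact D ∧ c = cap21c N p D} := by
  obtain ⟨C, hC⟩ := exists_cap21c_bound N p R
  refine ⟨C, ?_⟩
  rintro c ⟨D, hD, -, rfl⟩
  exact hC D (hD.trans hE)

theorem cap21_mono {E E' : Set (PSpace N)} {R : ℝ} (h : E ⊆ E') (hE : E' ⊆ closedBall 0 R) :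
    cap21 N p E ≤ cap21 N p E' := by
  refine csSup_le_csSup (cap21_bddAbove hE) ⟨_, ∅, empty_subset _, isCompact_empty, rfl⟩ ?_
  rintro c ⟨D, hD, hDc, rfl⟩
  exact ⟨D, hD.trans h, hDc, rfl⟩

theorem exists_compact_half_cap (E : Set (PSpace N)) :
    ∃ D ⊆ E, IsCompact D ∧ cap21 N p E ≤ 2 * cap21c N p D := by
  rcases le_or_gt (cap21 N p E) 0 with h | h
  · exact ⟨∅, empty_subset _, isCompact_empty,
      h.trans (mul_nonneg zero_le_two (cap21c_nonneg _))⟩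
  · have h2 : cap21 N p E / 2 < cap21 N p E := half_lt_self h
    obtain ⟨c, ⟨D, hD, hDc, rfl⟩, hc⟩ := exists_lt_of_lt_csSup
      (s := {c | ∃ D, D ⊆ E ∧ IsCompact D ∧ c = cap21c N p D})
      ⟨_, ∅, empty_subset _, isCompact_empty, rfl⟩ h2
    exact ⟨D, hD, hDc, by linarith⟩

end capacity

end ParabolicWiener

namespace ParabolicWiener

open MeasureTheory Metric Set Filter Topology
open scoped ENNReal NNReal ContDiff

section dual

variable {N : ℕ}

theorem exists_positive_functional {X : Type*} [TopologicalSpace X] [CompactSpace X]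
    {S : Set C(X, ℝ)} (hS : Convex ℝ S) (h0 : 0 ∈ S) (h1 : ∀ f ∈ S, ∃ x, f x ≤ 1) :
    ∃ l : C(X, ℝ) →L[ℝ] ℝ, (∀ f, 0 ≤ f → 0 ≤ l f) ∧ l 1 = 1 ∧ ∀ f ∈ S, l f ≤ 1 := by
  have hP : IsOpen {f : C(X, ℝ) | ∀ x, 1 < f x} := by
    have := ContinuousMap.isOpen_setOfPred_mapsTo (X := X) (isCompact_univ) (isOpen_Ioi (a := (1 : ℝ)))
    simpa [MapsTo] using this
  have hPc : Convex ℝ {f : C(X, ℝ) | ∀ x, 1 < f x} := by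
    intro f hf g hg a b ha hb hab x
    exact (convex_Ioi (1 : ℝ)) (hf x) (hg x) ha hb hab
  obtain ⟨l, u, hl, hu⟩ := geometric_hahn_banach_open hPc hP hS (by
    rw [Set.disjoint_left]
    intro f hf hfS
    obtain ⟨x, hx⟩ := h1 f hfS
    exact absurd (hf x) (not_lt.2 hx))
  have hu0 : u ≤ 0 := by simpa using hu 0 h0
  have hc : ∀ c : ℝ, 1 < c → c * l 1 < u := fun c hc => by
    have := hl (c • 1) fun x => by simpa using hc
    simpa using this
  have hl1 : l 1 < 0 := by linarith [hc 2 one_lt_two]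
  have hl1u : l 1 ≤ u := by
    have ht : Tendsto (fun c : ℝ => c * l 1) (𝓝[>] 1) (𝓝 (1 * l 1)) :=
      (tendsto_nhdsWithin_of_tendsto_nhds tendsto_id).mul_const _
    rw [one_mul] at ht
    exact le_of_tendsto ht (eventually_nhdsWithin_of_forall fun c h => (hc c h).le)
  have hpos : ∀ f, 0 ≤ f → l f ≤ 0 := by
    intro f hf
    by_contra! h
    have := hl ((2 : ℝ) • 1 + ((-2 * l 1) / l f) • f) fun x => by
      have h1 : 0 ≤ ((-2 * l 1) / l f) * f x :=
        mul_nonneg (div_nonneg (by linarith) h.le) (hf x)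
      simp only [ContinuousMap.add_apply, ContinuousMap.smul_apply, ContinuousMap.one_apply,
        smul_eq_mul]
      linarith
    simp only [map_add, map_smul, smul_eq_mul] at this
    rw [div_mul_cancel₀ _ h.ne'] at this
    linarith
  refine ⟨(l 1)⁻¹ • l, fun f hf => ?_, ?_, fun f hf => ?_⟩
  · exact mul_nonneg_of_nonpos_of_nonpos (inv_nonpos.2 hl1.le) (hpos f hf)
  · simp [inv_mul_cancel₀ hl1.ne]
  · have := hu f hf
    change (l 1)⁻¹ * l f ≤ 1
    rw [mul_comm, ← div_eq_mul_inv, div_le_one_of_neg hl1]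
    linarith

theorem exists_dual_measure {p : ℝ} (hp : 1 ≤ p) {D : Set (PSpace N)} (hD : IsCompact D)
    (hc : 0 < cap21c N p D) : ∃ μ : Measure (PSpace N), IsProbabilityMeasure μ ∧ μ Dᶜ = 0 ∧
      ∀ φ : PSpace N → ℝ, ContDiff ℝ ∞ φ → HasCompactSupport φ →
        cap21c N p D ^ (1 / p) * ∫ z, φ z ∂μ ≤ W21Norm N p φ := by
  have hp0 : 0 < p := by linarith
  set κ := cap21c N p D ^ (1 / p) with hκ
  have hκ0 : 0 < κ := Real.rpow_pos_of_pos hc _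
  have hκp : κ ^ p = cap21c N p D := by
    rw [hκ, ← Real.rpow_mul hc.le, one_div_mul_cancel hp0.ne', Real.rpow_one]
  have : CompactSpace D := isCompact_iff_compactSpace.1 hD
  let S : Set C(D, ℝ) := {f | ∃ φ : PSpace N → ℝ, ContDiff ℝ ∞ φ ∧ HasCompactSupport φ ∧
    W21Norm N p φ < κ ∧ ∀ x : D, f x = φ x}
  have hS : Convex ℝ S := by
    rintro f ⟨φ, h1, h2, h3, h4⟩ g ⟨ψ, k1, k2, k3, k4⟩ a b ha hb hab
    refine ⟨a • φ + b • ψ, (h1.const_smul a).add (k1.const_smul b), ?_, ?_, fun x => ?_⟩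
    · exact (h2.mono' (subset_tsupport _ |>.trans' (Function.support_const_smul_subset a φ))).add
        (k2.mono' (subset_tsupport _ |>.trans' (Function.support_const_smul_subset b ψ)))
    · refine (W21Norm_lin hp h1 k1 h2 k2 a b).trans_lt ?_
      rw [abs_of_nonneg ha, abs_of_nonneg hb]
      exact (convex_Iio κ) h3 k3 ha hb hab
    · simp [h4, k4]
  have h0 : (0 : C(D, ℝ)) ∈ S := by
    refine ⟨0, contDiff_const, HasCompactSupport.zero, ?_, fun x => rfl⟩
    have := W21Norm_lin (p := p) hp (φ := (0 : PSpace N → ℝ)) (ψ := 0) contDiff_const contDiff_const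
      HasCompactSupport.zero HasCompactSupport.zero 0 0
    rw [abs_zero, zero_mul, add_zero, smul_zero, add_zero] at this
    exact this.trans_lt hκ0
  obtain ⟨l, hl0, hl1, hlS⟩ := exists_positive_functional hS h0 (by
    rintro f ⟨φ, h1, h2, h3, h4⟩
    by_contra! h
    have := cap21c_le (p := p) h1 h2 (U := {z | 1 < φ z})
      (isOpen_lt continuous_const h1.continuous)
      (K := D) (fun z hz => by have := h ⟨z, hz⟩; rw [h4] at this; exact this)
      fun z hz => le_of_lt hz
    rw [← hκp] at this
    exact absurd this (not_le.2 (Real.rpow_lt_rpow (W21Norm_nonneg _ _) h3 hp0)))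
  let Λ : CompactlySupportedContinuousMap D ℝ →ₚ[ℝ] ℝ :=
    { toFun := fun f => l f.toContinuousMap
      map_add' := fun f g => l.map_add _ _
      map_smul' := fun c f => l.map_smul c f.toContinuousMap
      monotone' := fun f g hfg => by
        have := hl0 (g.toContinuousMap - f.toContinuousMap) fun x => by
          simpa using hfg x
        simpa using this }
  set ν := RealRMK.rieszMeasure Λ with hν
  have hInt : ∀ f : C(D, ℝ), ∫ x, f x ∂ν = l f := fun f =>
    RealRMK.integral_rieszMeasure Λ (CompactlySupportedContinuousMap.continuousMapEquiv f)
  have hν1 : IsProbabilityMeasure ν := by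
    have := hInt 1
    rw [hl1] at this
    simp only [ContinuousMap.one_apply, integral_const, smul_eq_mul, mul_one] at this
    refine ⟨?_⟩
    rwa [measureReal_def, ENNReal.toReal_eq_one_iff] at this
  have hm : MeasurableEmbedding ((↑) : D → PSpace N) := .subtype_coe hD.measurableSet
  refine ⟨ν.map (↑), Measure.isProbabilityMeasure_map hm.measurable.aemeasurable, ?_, ?_⟩
  · rw [hm.map_apply]
    simp
  · intro φ h1 h2
    rw [hm.integral_map]
    have e := hInt ⟨fun x : D => φ x, h1.continuous.comp continuous_subtype_val⟩
    simp only [ContinuousMap.coe_mk] at e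
    rw [e]
    set L := l ⟨fun x : D => φ x, h1.continuous.comp continuous_subtype_val⟩ with hL
    by_contra! h
    obtain ⟨m, hm1, hm2⟩ := exists_between h
    have hm0 : 0 < m := (W21Norm_nonneg _ _).trans_lt hm1
    have := hlS ((κ / m) • ⟨fun x : D => φ x, h1.continuous.comp continuous_subtype_val⟩) (by
      refine ⟨(κ / m) • φ, h1.const_smul (κ / m), h2.mono' (subset_tsupport _ |>.trans'
        (Function.support_const_smul_subset _ φ)), ?_, fun x => rfl⟩
      have h3 := W21Norm_lin hp h1 h1 h2 h2 (κ / m) 0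
      simp only [zero_smul, add_zero, abs_zero, zero_mul, abs_of_nonneg (div_pos hκ0 hm0).le] at h3
      refine h3.trans_lt ?_
      rw [div_mul_eq_mul_div, div_lt_iff₀ hm0]
      gcongr)
    rw [map_smul, smul_eq_mul, ← hL, div_mul_eq_mul_div, div_le_iff₀ hm0] at this
    linarith

end dual

end ParabolicWiener

namespace ParabolicWiener

open MeasureTheory Metric Set Filter Topology
open scoped ENNReal NNReal ContDiff

section wolff

theorem add_rpow_le_add_mul {τ : ℝ} (hτ : 1 ≤ τ) (x y : ℝ≥0∞) :
    (x + y) ^ τ ≤ x ^ τ + ENNReal.ofReal τ * (y * (x + y) ^ (τ - 1)) := by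
  have hτ0 : 0 < τ := by linarith
  have hτ' : ENNReal.ofReal τ ≠ 0 := by simpa using hτ0
  rcases eq_or_ne x ⊤ with rfl | hx
  · simp [ENNReal.top_rpow_of_pos hτ0]
  rcases eq_or_ne y ⊤ with rfl | hy
  · rcases hτ.eq_or_lt with rfl | h
    · simp
    · simp [ENNReal.top_rpow_of_pos hτ0, ENNReal.top_rpow_of_pos (sub_pos.2 h),
        ENNReal.mul_top hτ']
  lift x to ℝ≥0 using hx
  lift y to ℝ≥0 using hy
  rw [← ENNReal.coe_add, ← ENNReal.coe_rpow_of_nonneg _ hτ0.le,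
    ← ENNReal.coe_rpow_of_nonneg _ hτ0.le, ← ENNReal.coe_rpow_of_nonneg _ (sub_nonneg.2 hτ),
    ENNReal.ofReal, ← ENNReal.coe_mul, ← ENNReal.coe_mul, ← ENNReal.coe_add, ENNReal.coe_le_coe,
    ← NNReal.coe_le_coe]
  simp only [NNReal.coe_add, NNReal.coe_mul, NNReal.coe_rpow, Real.coe_toNNReal _ hτ0.le]
  have hx := x.coe_nonneg
  have hy := y.coe_nonneg
  rcases (add_nonneg hx hy).eq_or_lt with h | h
  · have e1 : (x : ℝ) = 0 := by linarith
    have e2 : (y : ℝ) = 0 := by linarith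
    simp [e1, e2, Real.zero_rpow hτ0.ne']
  · have hb := one_add_mul_self_le_rpow_one_add (s := -(y / (x + y) : ℝ)) (by
      rw [neg_le_neg_iff, div_le_one h]; linarith) hτ
    have e : 1 + -((y : ℝ) / (x + y)) = x / (x + y) := by field_simp; ring
    rw [e, Real.div_rpow hx h.le] at hb
    have hp := Real.rpow_pos_of_pos h τ
    rw [le_div_iff₀ hp] at hb
    have e2 : ((x : ℝ) + y) ^ τ = (x + y) * (x + y) ^ (τ - 1) := by
      rw [← Real.rpow_one_add' h.le (by linarith)]; congr 1; ring
    have e3 : (1 + τ * -((y : ℝ) / (x + y))) * (x + y) ^ τ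
        = (x + y) ^ τ - τ * (y * (x + y) ^ (τ - 1)) := by
      rw [e2]; field_simp; ring
    linarith

theorem sum_rpow_le_weighted {σ : ℝ} (hσ : 0 < σ) {ρ : ℝ≥0∞} (h1 : 1 < ρ) (hρ : ρ ≠ ⊤) :
    ∃ C : ℝ≥0∞, C ≠ ⊤ ∧ ∀ (a : ℕ → ℝ≥0∞) (j : ℕ),
      (∑ i ∈ Finset.range (j + 1), a i) ^ σ
        ≤ C * ∑ i ∈ Finset.range (j + 1), ρ ^ (j - i) * a i ^ σ := by
  set κ := ρ ^ (1 / σ) with hκ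
  have hκσ : κ ^ σ = ρ := by
    rw [hκ, ← ENNReal.rpow_mul, one_div_mul_cancel hσ.ne', ENNReal.rpow_one]
  have hκ1 : 1 < κ := ENNReal.one_lt_rpow h1 (by positivity)
  have hκ0 : κ ≠ 0 := (zero_lt_one.trans hκ1).ne'
  have hκt : κ ≠ ⊤ := ENNReal.rpow_ne_top_of_nonneg (by positivity) hρ
  have hG : (1 - κ⁻¹)⁻¹ ≠ ⊤ := by
    rw [ENNReal.inv_ne_top]
    exact (tsub_pos_of_lt (ENNReal.inv_lt_one.2 hκ1)).ne'
  refine ⟨(1 - κ⁻¹)⁻¹ ^ σ, ENNReal.rpow_ne_top_of_nonneg hσ.le hG, fun a j => ?_⟩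
  set S := ∑ i ∈ Finset.range (j + 1), ρ ^ (j - i) * a i ^ σ with hS
  have hi : ∀ i ∈ Finset.range (j + 1), a i ≤ κ⁻¹ ^ (j - i) * S ^ (1 / σ) := by
    intro i hi
    have h2 : κ ^ (j - i) * a i ≤ S ^ (1 / σ) := by
      rw [one_div, ENNReal.le_rpow_inv_iff hσ, ENNReal.mul_rpow_of_nonneg _ _ hσ.le,
        ← ENNReal.rpow_natCast, ← ENNReal.rpow_mul, mul_comm _ σ, ENNReal.rpow_mul, hκσ,
        ENNReal.rpow_natCast]
      exact Finset.single_le_sum (f := fun i => ρ ^ (j - i) * a i ^ σ) (fun _ _ => zero_le) hi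
    calc a i = κ⁻¹ ^ (j - i) * (κ ^ (j - i) * a i) := by
          rw [← mul_assoc, ← mul_pow, ENNReal.inv_mul_cancel hκ0 hκt, one_pow, one_mul]
      _ ≤ _ := by gcongr
  have hsum : ∑ i ∈ Finset.range (j + 1), κ⁻¹ ^ (j - i) ≤ (1 - κ⁻¹)⁻¹ := by
    have := Finset.sum_range_reflect (fun k => κ⁻¹ ^ k) (j + 1)
    simp only [Nat.add_sub_cancel] at this
    rw [this, ← ENNReal.tsum_geometric]
    exact ENNReal.sum_le_tsum _
  calc (∑ i ∈ Finset.range (j + 1), a i) ^ σ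
      ≤ ((1 - κ⁻¹)⁻¹ * S ^ (1 / σ)) ^ σ := by
        refine ENNReal.rpow_le_rpow ((Finset.sum_le_sum hi).trans ?_) hσ.le
        rw [← Finset.sum_mul]
        gcongr
    _ = _ := by
        rw [ENNReal.mul_rpow_of_nonneg _ _ hσ.le, ← ENNReal.rpow_mul, one_div_mul_cancel hσ.ne',
          ENNReal.rpow_one]

theorem rpow_sum_le_double_sum {τ : ℝ} (hτ : 1 < τ) {ρ : ℝ≥0∞} (h1 : 1 < ρ) (hρ : ρ ≠ ⊤) :
    ∃ C : ℝ≥0∞, C ≠ ⊤ ∧ ∀ (a : ℕ → ℝ≥0∞) (J : ℕ),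
      (∑ i ∈ Finset.range J, a i) ^ τ ≤ C * ∑ j ∈ Finset.range J, ∑ i ∈ Finset.range (j + 1),
        ρ ^ (j - i) * (a j * a i ^ (τ - 1)) := by
  obtain ⟨C, hC, h⟩ := sum_rpow_le_weighted (sub_pos.2 hτ) h1 hρ
  refine ⟨ENNReal.ofReal τ * C, ENNReal.mul_ne_top ENNReal.ofReal_ne_top hC, fun a J => ?_⟩
  induction J with
  | zero => simp [ENNReal.zero_rpow_of_pos (zero_lt_one.trans hτ)]
  | succ J ih =>
    rw [Finset.sum_range_succ (n := J), Finset.sum_range_succ (n := J), mul_add]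
    refine (add_rpow_le_add_mul hτ.le _ _).trans (add_le_add ih ?_)
    rw [mul_assoc, ← Finset.sum_range_succ]
    refine mul_le_mul' le_rfl ?_
    calc a J * (∑ i ∈ Finset.range (J + 1), a i) ^ (τ - 1)
        ≤ a J * (C * ∑ i ∈ Finset.range (J + 1), ρ ^ (J - i) * a i ^ (τ - 1)) := by
          gcongr; exact h a J
      _ = _ := by
          rw [mul_left_comm, Finset.mul_sum]
          congr 1
          exact Finset.sum_congr rfl fun i _ => by ring

end wolff

end ParabolicWiener

namespace ParabolicWiener

open MeasureTheory Metric Set Filter Topology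
open scoped ENNReal NNReal ContDiff

section dyadic

variable {N : ℕ} {μ : Measure (PSpace N)}

def cyl (N n : ℕ) : Set (PSpace N) := {w | ‖w.1‖ < (1 / 2) ^ n ∧ |w.2| < (1 / 4) ^ n}

theorem cyl_eq (n : ℕ) :
    cyl N n = ball 0 ((1 / 2) ^ n) ×ˢ Ioo (-(1 / 4) ^ n) ((1 / 4) ^ n) := by
  ext w
  simp [cyl, abs_lt]

theorem isOpen_cyl (n : ℕ) : IsOpen (cyl N n) := by
  rw [cyl_eq]; exact isOpen_ball.prod isOpen_Ioo

theorem measurableSet_cyl (n : ℕ) : MeasurableSet (cyl N n) := (isOpen_cyl n).measurableSet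

theorem neg_mem_cyl {n : ℕ} {w : PSpace N} : -w ∈ cyl N n ↔ w ∈ cyl N n := by simp [cyl]

theorem sub_mem_cyl_comm {n : ℕ} {w v : PSpace N} : w - v ∈ cyl N n ↔ v - w ∈ cyl N n := by
  rw [← neg_mem_cyl, neg_sub]

theorem add_mem_cyl {n : ℕ} {w v : PSpace N} (hw : w ∈ cyl N (n + 1)) (hv : v ∈ cyl N (n + 1)) :
    w + v ∈ cyl N n := by
  obtain ⟨h1, h2⟩ := hw
  obtain ⟨h3, h4⟩ := hv
  rw [pow_succ] at h1 h2 h3 h4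
  have h5 : (0 : ℝ) < (1 / 4) ^ n := by positivity
  refine ⟨(norm_add_le _ _).trans_lt ?_, (abs_add_le _ _).trans_lt ?_⟩ <;> linarith

theorem cyl_anti {m n : ℕ} (h : m ≤ n) : cyl N n ⊆ cyl N m := fun w hw =>
  ⟨hw.1.trans_le (pow_le_pow_of_le_one (by norm_num) (by norm_num) h),
    hw.2.trans_le (pow_le_pow_of_le_one (by norm_num) (by norm_num) h)⟩

theorem volume_cyl_ne_top (n : ℕ) : volume (cyl N n) ≠ ⊤ := by
  rw [cyl_eq, Measure.volume_eq_prod, Measure.prod_prod]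
  exact ENNReal.mul_ne_top measure_ball_lt_top.ne (by simp)

theorem volume_cyl (n : ℕ) :
    volume (cyl N n) = 2⁻¹ ^ (n * N) * 4⁻¹ ^ n * volume (cyl N 0) := by
  rw [cyl_eq, cyl_eq, Measure.volume_eq_prod, Measure.prod_prod, Measure.prod_prod,
    Measure.addHaar_ball_of_pos _ _ (by positivity), Real.volume_Ioo, Real.volume_Ioo]
  have e2 : ENNReal.ofReal ((1 / 2 : ℝ) ^ (n * N)) = 2⁻¹ ^ (n * N) := by
    rw [ENNReal.ofReal_pow (by norm_num), one_div, ENNReal.ofReal_inv_of_pos two_pos,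
      ENNReal.ofReal_ofNat]
  have e4 : ENNReal.ofReal ((1 / 4 : ℝ) ^ n) = 4⁻¹ ^ n := by
    rw [ENNReal.ofReal_pow (by norm_num), one_div, ENNReal.ofReal_inv_of_pos four_pos,
      ENNReal.ofReal_ofNat]
  have e : (1 / 4 : ℝ) ^ n - -(1 / 4) ^ n = (1 / 4) ^ n * 2 := by ring
  rw [finrank_euclideanSpace, Fintype.card_fin, ← pow_mul, e2, e,
    ENNReal.ofReal_mul (by positivity), e4]
  norm_num
  ring

theorem volume_cyl_ne_zero (n : ℕ) : volume (cyl N n) ≠ 0 :=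
  ((isOpen_cyl n).measure_pos _ ⟨0, by simp [cyl]⟩).ne'

noncomputable def dA (μ : Measure (PSpace N)) (n : ℕ) (x : PSpace N) : ℝ≥0∞ :=
  2 ^ (n * N) * μ {v | x - v ∈ cyl N n}

theorem measurableSet_sub_mem_cyl (n : ℕ) :
    MeasurableSet {z : PSpace N × PSpace N | z.1 - z.2 ∈ cyl N n} :=
  (measurable_fst.sub measurable_snd) (measurableSet_cyl n)

theorem measurable_dA [SFinite μ] (n : ℕ) : Measurable (dA μ n) :=
  (measurable_measure_prodMk_left (measurableSet_sub_mem_cyl n)).const_mul _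

theorem volume_sub_mem_cyl (n : ℕ) (v : PSpace N) :
    volume {x | x - v ∈ cyl N n} = volume (cyl N n) := by
  have : {x | x - v ∈ cyl N n} = (fun x => x - v) ⁻¹' cyl N n := rfl
  rw [this, (measurePreserving_sub_right volume v).measure_preimage
    (measurableSet_cyl n).nullMeasurableSet]

theorem volume_sub_mem_cyl' (n : ℕ) (v : PSpace N) :
    volume {x | v - x ∈ cyl N n} = volume (cyl N n) := by
  simp only [sub_mem_cyl_comm (w := v), volume_sub_mem_cyl]

theorem dA_le_of_mem {n : ℕ} {x y : PSpace N} (h : y - x ∈ cyl N (n + 1)) :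
    dA μ (n + 1) y ≤ 2 ^ N * dA μ n x := by
  unfold dA
  rw [← mul_assoc, ← pow_add, add_comm N, add_mul, one_mul]
  refine mul_le_mul_right (measure_mono fun v hv => ?_) _
  have := add_mem_cyl (sub_mem_cyl_comm.1 h) hv
  simpa using this

theorem setLIntegral_dA_le [SFinite μ] (i k : ℕ) (x : PSpace N) :
    ∫⁻ y in {y | y - x ∈ cyl N (i + 1)}, dA μ (i + 1 + k) y
      ≤ volume (cyl N (i + 1)) * (2 ^ N * 4⁻¹ ^ k * dA μ i x) := by
  set j := i + 1 + k with hj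
  have hms : MeasurableSet {y | y - x ∈ cyl N (i + 1)} :=
    (measurable_id.sub_const x) (measurableSet_cyl _)
  have h1 : ∫⁻ y in {y | y - x ∈ cyl N (i + 1)}, μ {v | y - v ∈ cyl N j}
      ≤ volume (cyl N j) * μ {v | x - v ∈ cyl N i} := by
    have e : ∀ y, μ {v | y - v ∈ cyl N j}
        = ∫⁻ v, {z : PSpace N × PSpace N | z.1 - z.2 ∈ cyl N j}.indicator 1 (y, v) ∂μ := by
      intro y
      have : (fun v => {z : PSpace N × PSpace N | z.1 - z.2 ∈ cyl N j}.indicator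
          (1 : PSpace N × PSpace N → ℝ≥0∞) (y, v)) = {v | y - v ∈ cyl N j}.indicator 1 := by
        ext v; simp [indicator]
      rw [this, lintegral_indicator_one]
      exact (measurable_const.sub measurable_id) (measurableSet_cyl j)
    simp only [e]
    rw [lintegral_lintegral_swap (f := fun y v =>
      {z : PSpace N × PSpace N | z.1 - z.2 ∈ cyl N j}.indicator 1 (y, v))
      (measurable_one.indicator (measurableSet_sub_mem_cyl j)).aemeasurable]
    rw [← setLIntegral_const]
    have hm2 : MeasurableSet {v | x - v ∈ cyl N i} :=
      (measurable_const.sub measurable_id) (measurableSet_cyl i)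
    rw [← lintegral_indicator hm2]
    refine lintegral_mono fun v => ?_
    by_cases hv : x - v ∈ cyl N i
    · rw [indicator_of_mem (by exact hv)]
      calc _ ≤ ∫⁻ y, {y | y - v ∈ cyl N j}.indicator 1 y := by
            refine (setLIntegral_le_lintegral _ _).trans_eq ?_
            congr 1
        _ = volume (cyl N j) := by
            rw [lintegral_indicator_one, volume_sub_mem_cyl]
            exact (measurable_id.sub_const v) (measurableSet_cyl j)
    · rw [indicator_of_notMem (by exact hv)]
      refine (lintegral_eq_zero_iff' ?_).2 ?_ |>.le
      · exact ((measurable_one.indicator (measurableSet_sub_mem_cyl j)).comp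
          (measurable_id.prodMk measurable_const)).aemeasurable
      · filter_upwards [ae_restrict_mem hms] with y hy
        refine indicator_of_notMem (fun h => hv ?_) _
        have h3 := add_mem_cyl (sub_mem_cyl_comm.1 hy)
          (cyl_anti (by omega : i + 1 ≤ j) h)
        simpa using h3
  unfold dA
  have hmj : Measurable fun y => μ {v | y - v ∈ cyl N j} :=
    measurable_measure_prodMk_left (measurableSet_sub_mem_cyl j)
  rw [lintegral_const_mul _ hmj]
  refine (mul_le_mul_right h1 _).trans_eq ?_
  have h2 : (2 : ℝ≥0∞) * 2⁻¹ = 1 := ENNReal.mul_inv_cancel two_ne_zero ENNReal.ofNat_ne_top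
  rw [volume_cyl j, volume_cyl (i + 1)]
  have e1 : (2 : ℝ≥0∞) ^ (j * N) * 2⁻¹ ^ (j * N) = 1 := by rw [← mul_pow, h2, one_pow]
  have e2 : (2 : ℝ≥0∞) ^ ((i + 1) * N) * 2⁻¹ ^ ((i + 1) * N) = 1 := by
    rw [← mul_pow, h2, one_pow]
  calc _ = (2 ^ (j * N) * 2⁻¹ ^ (j * N)) * (4⁻¹ ^ j * volume (cyl N 0)
        * μ {v | x - v ∈ cyl N i}) := by ring
    _ = (2 ^ ((i + 1) * N) * 2⁻¹ ^ ((i + 1) * N)) * (4⁻¹ ^ j * volume (cyl N 0)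
        * μ {v | x - v ∈ cyl N i}) := by rw [e1, e2]
    _ = _ := by rw [hj, pow_add 4⁻¹ (i + 1) k]; ring

theorem lintegral_dA_mul_le [SFinite μ] {s q : ℝ} (hs : 0 ≤ s) (hs1 : s ≤ 1) (hsq : s ≤ q)
    (i k : ℕ) : ∫⁻ y, dA μ (i + 1 + k) y ^ s * dA μ (i + 1) y ^ (q - s)
      ≤ (2 ^ N) ^ q * (4⁻¹ ^ k) ^ s * ∫⁻ x, dA μ i x ^ q := by
  set V := volume (cyl N (i + 1)) with hV
  have hV0 : V ≠ 0 := volume_cyl_ne_zero _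
  have hVt : V ≠ ⊤ := volume_cyl_ne_top _
  have hq : 0 ≤ q := hs.trans hsq
  have hms : ∀ x : PSpace N, MeasurableSet {y | y - x ∈ cyl N (i + 1)} := fun x =>
    (measurable_id.sub_const x) (measurableSet_cyl _)
  have hJ : ∀ x, ∫⁻ y in {y | y - x ∈ cyl N (i + 1)}, dA μ (i + 1 + k) y ^ s
      ≤ V * (2 ^ N * 4⁻¹ ^ k * dA μ i x) ^ s := by
    intro x
    have := ENNReal.lintegral_mul_norm_pow_le (μ := volume.restrict {y | y - x ∈ cyl N (i + 1)})
      (f := dA μ (i + 1 + k)) (g := fun _ => 1) (measurable_dA _).aemeasurable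
      aemeasurable_const hs (sub_nonneg.2 hs1) (by ring)
    simp only [ENNReal.one_rpow, mul_one, lintegral_const, Measure.restrict_apply_univ, one_mul,
      volume_sub_mem_cyl, ← hV] at this
    refine this.trans ?_
    calc _ ≤ (V * (2 ^ N * 4⁻¹ ^ k * dA μ i x)) ^ s * V ^ (1 - s) := by
          gcongr; exact setLIntegral_dA_le i k x
      _ = _ := by
          rw [ENNReal.mul_rpow_of_nonneg _ _ hs, mul_right_comm, ← ENNReal.rpow_add _ _ hV0 hVt]
          simp
  have hF : Measurable fun y => dA μ (i + 1 + k) y ^ s * dA μ (i + 1) y ^ (q - s) :=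
    ((measurable_dA _).pow_const _).mul ((measurable_dA _).pow_const _)
  rw [← ENNReal.mul_le_mul_iff_right hV0 hVt]
  calc V * ∫⁻ y, dA μ (i + 1 + k) y ^ s * dA μ (i + 1) y ^ (q - s)
      = ∫⁻ y, ∫⁻ x, {z : PSpace N × PSpace N | z.1 - z.2 ∈ cyl N (i + 1)}.indicator
          (fun z => dA μ (i + 1 + k) z.1 ^ s * dA μ (i + 1) z.1 ^ (q - s)) (y, x) := by
        rw [← lintegral_const_mul _ hF]
        congr 1 with y
        have : (fun x => {z : PSpace N × PSpace N | z.1 - z.2 ∈ cyl N (i + 1)}.indicator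
          (fun z => dA μ (i + 1 + k) z.1 ^ s * dA μ (i + 1) z.1 ^ (q - s)) (y, x))
            = {x | y - x ∈ cyl N (i + 1)}.indicator
              fun _ => dA μ (i + 1 + k) y ^ s * dA μ (i + 1) y ^ (q - s) := by
          ext x; simp [indicator]
        rw [this, lintegral_indicator_const, volume_sub_mem_cyl', mul_comm]
        exact (measurable_const.sub measurable_id) (measurableSet_cyl _)
    _ = ∫⁻ x, ∫⁻ y, {z : PSpace N × PSpace N | z.1 - z.2 ∈ cyl N (i + 1)}.indicator
          (fun z => dA μ (i + 1 + k) z.1 ^ s * dA μ (i + 1) z.1 ^ (q - s)) (y, x) :=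
        lintegral_lintegral_swap
          ((hF.comp measurable_fst).indicator (measurableSet_sub_mem_cyl _)).aemeasurable
    _ ≤ ∫⁻ x, V * ((2 ^ N) ^ q * (4⁻¹ ^ k) ^ s * dA μ i x ^ q) := by
        refine lintegral_mono fun x => ?_
        calc _ = ∫⁻ y in {y | y - x ∈ cyl N (i + 1)},
              dA μ (i + 1 + k) y ^ s * dA μ (i + 1) y ^ (q - s) := by
              rw [← lintegral_indicator (hms x)]
              congr 1
          _ ≤ ∫⁻ y in {y | y - x ∈ cyl N (i + 1)},
              dA μ (i + 1 + k) y ^ s * (2 ^ N * dA μ i x) ^ (q - s) := by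
              refine setLIntegral_mono' (hms x) fun y hy => ?_
              gcongr
              exact dA_le_of_mem hy
          _ ≤ V * (2 ^ N * 4⁻¹ ^ k * dA μ i x) ^ s * (2 ^ N * dA μ i x) ^ (q - s) := by
              rw [lintegral_mul_const _ ((measurable_dA _).pow_const _)]
              gcongr
              exact hJ x
          _ = _ := by
              rw [mul_right_comm (2 ^ N), ENNReal.mul_rpow_of_nonneg _ _ hs, mul_assoc V,
                mul_right_comm (_ ^ s), ← ENNReal.rpow_add_of_nonneg _ _ hs (sub_nonneg.2 hsq),
                add_sub_cancel, ENNReal.mul_rpow_of_nonneg _ _ hq, mul_right_comm]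
    _ = _ := by
        rw [lintegral_const_mul _ (((measurable_dA _).pow_const _).const_mul _),
          lintegral_const_mul _ ((measurable_dA _).pow_const _)]

theorem exists_wolff_bound (N : ℕ) {s q : ℝ} (hs : 0 < s) (hs1 : s ≤ 1) (hsq : s < q) :
    ∃ C : ℝ≥0∞, C ≠ ⊤ ∧ ∀ (μ : Measure (PSpace N)) [SFinite μ] (J : ℕ),
      ∫⁻ x, (∑ i ∈ Finset.range J, dA μ (i + 1) x ^ s) ^ (q / s)
        ≤ C * ∑ i ∈ Finset.range J, ∫⁻ x, dA μ i x ^ q := by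
  have hq : 0 < q := hs.trans hsq
  set ρ : ℝ≥0∞ := 2 ^ s with hρ
  have hρ1 : 1 < ρ := ENNReal.one_lt_rpow ENNReal.one_lt_two hs
  have hρt : ρ ≠ ⊤ := ENNReal.rpow_ne_top_of_nonneg hs.le ENNReal.ofNat_ne_top
  obtain ⟨C, hC, h⟩ := rpow_sum_le_double_sum ((one_lt_div hs).2 hsq) hρ1 hρt
  set r : ℝ≥0∞ := ρ * 4⁻¹ ^ s with hr
  have hr1 : r < 1 := by
    have : (4⁻¹ : ℝ≥0∞) = 2⁻¹ * 2⁻¹ := by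
      rw [← ENNReal.mul_inv (by simp) (by simp)]; norm_num
    rw [hr, hρ, this, ← ENNReal.mul_rpow_of_nonneg _ _ hs.le, ← mul_assoc,
      ENNReal.mul_inv_cancel (by simp) (by simp), one_mul]
    exact ENNReal.rpow_lt_one ENNReal.one_half_lt_one hs
  refine ⟨C * ((2 ^ N) ^ q * (1 - r)⁻¹), ENNReal.mul_ne_top hC (ENNReal.mul_ne_top
    (ENNReal.rpow_ne_top_of_nonneg hq.le (by simp)) (ENNReal.inv_ne_top.2
      (tsub_pos_of_lt hr1).ne')), fun μ _ J => ?_⟩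
  have hm : ∀ i j, Measurable fun x =>
      ρ ^ (j - i) * (dA μ (j + 1) x ^ s * (dA μ (i + 1) x ^ s) ^ (q / s - 1)) := fun i j =>
    (((measurable_dA _).pow_const _).mul
      (((measurable_dA _).pow_const _).pow_const _)).const_mul _
  calc ∫⁻ x, (∑ i ∈ Finset.range J, dA μ (i + 1) x ^ s) ^ (q / s)
      ≤ ∫⁻ x, C * ∑ j ∈ Finset.range J, ∑ i ∈ Finset.range (j + 1),
        ρ ^ (j - i) * (dA μ (j + 1) x ^ s * (dA μ (i + 1) x ^ s) ^ (q / s - 1)) :=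
        lintegral_mono fun x => h (fun i => dA μ (i + 1) x ^ s) J
    _ = C * ∑ j ∈ Finset.range J, ∑ i ∈ Finset.range (j + 1), ∫⁻ x,
        ρ ^ (j - i) * (dA μ (j + 1) x ^ s * (dA μ (i + 1) x ^ s) ^ (q / s - 1)) := by
        rw [lintegral_const_mul _ (Finset.measurable_fun_sum _ fun j _ =>
          Finset.measurable_fun_sum _ fun i _ => hm i j), lintegral_finsetSum _ fun j _ =>
          Finset.measurable_fun_sum _ fun i _ => hm i j]
        congr 1
        exact Finset.sum_congr rfl fun j _ => lintegral_finsetSum _ fun i _ => hm i j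
    _ ≤ C * ∑ j ∈ Finset.range J, ∑ i ∈ Finset.range (j + 1),
        (2 ^ N) ^ q * (r ^ (j - i) * ∫⁻ x, dA μ i x ^ q) := by
        refine mul_le_mul_right (Finset.sum_le_sum fun j _ => Finset.sum_le_sum fun i hi => ?_) _
        obtain ⟨k, rfl⟩ := Nat.exists_eq_add_of_le (Nat.lt_succ_iff.1 (Finset.mem_range.1 hi))
        have h2 := lintegral_dA_mul_le (μ := μ) hs.le hs1 hsq.le i k
        have e : ∀ x, (dA μ (i + 1) x ^ s) ^ (q / s - 1) = dA μ (i + 1) x ^ (q - s) := fun x => by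
          rw [← ENNReal.rpow_mul]; congr 1; field_simp
        simp only [e]
        have hmm : Measurable fun x => dA μ (i + k + 1) x ^ s * dA μ (i + 1) x ^ (q - s) :=
          ((measurable_dA _).pow_const _).mul ((measurable_dA _).pow_const _)
        rw [lintegral_const_mul _ hmm, add_right_comm i k 1, Nat.add_sub_cancel_left]
        refine (mul_le_mul_right h2 _).trans_eq ?_
        have e2 : ((4⁻¹ : ℝ≥0∞) ^ k) ^ s = (4⁻¹ ^ s) ^ k := by
          rw [← ENNReal.rpow_natCast, ← ENNReal.rpow_mul, mul_comm, ENNReal.rpow_mul,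
            ENNReal.rpow_natCast]
        rw [hr, mul_pow, e2]
        ring
    _ ≤ _ := by
        rw [Finset.sum_comm' (t' := Finset.range J) (s' := fun i => Finset.Ico i J) (by
          intro x y; simp only [Finset.mem_range, Finset.mem_Ico]; omega)]
        rw [mul_assoc, mul_assoc]
        refine mul_le_mul_right ?_ C
        rw [Finset.mul_sum (Finset.range J), Finset.mul_sum (Finset.range J)]
        refine Finset.sum_le_sum fun i _ => ?_
        rw [← Finset.mul_sum, ← Finset.sum_mul]
        gcongr
        rw [Finset.sum_Ico_eq_sum_range]
        simp only [Nat.add_sub_cancel_left]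
        rw [← ENNReal.tsum_geometric]
        exact ENNReal.sum_le_tsum _

end dyadic

end ParabolicWiener

namespace ParabolicWiener

open MeasureTheory Metric Set Filter Topology
open scoped ENNReal NNReal ContDiff

section potentials

variable {N : ℕ}

noncomputable def dil (N m : ℕ) : PSpace N →L[ℝ] PSpace N :=
  ((2 ^ m : ℝ) • ContinuousLinearMap.id ℝ (EuclideanSpace ℝ (Fin N))).prodMap
    ((4 ^ m : ℝ) • ContinuousLinearMap.id ℝ ℝ)

theorem dil_apply (m : ℕ) (v : PSpace N) : dil N m v = ((2 ^ m : ℝ) • v.1, 4 ^ m * v.2) := rfl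

noncomputable def resc (m : ℕ) (ψ : PSpace N → ℝ) (v : PSpace N) : ℝ := ψ (dil N m v)

theorem contDiff_resc {ψ : PSpace N → ℝ} (hψ : ContDiff ℝ ∞ ψ) (m : ℕ) :
    ContDiff ℝ ∞ (resc m ψ) := hψ.comp (dil N m).contDiff

theorem fderiv_smul_resc {ψ : PSpace N → ℝ} (hψ : ContDiff ℝ ∞ ψ) (a : ℝ) (m : ℕ)
    (v e : PSpace N) :
    fderiv ℝ (a • resc m ψ) v e = a * fderiv ℝ ψ (dil N m v) (dil N m e) := by
  have h := (((hψ.differentiable (by simp) (dil N m v)).hasFDerivAt.comp v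
    (dil N m).hasFDerivAt).const_smul a).fderiv
  have e1 : a • resc m ψ = a • (ψ ∘ dil N m) := rfl
  rw [e1, h]
  rfl

theorem dX_smul_resc {ψ : PSpace N → ℝ} (hψ : ContDiff ℝ ∞ ψ) (a : ℝ) (m : ℕ) (i : Fin N) :
    dX i (a • resc m ψ) = (a * 2 ^ m) • resc m (dX i ψ) := by
  ext v
  rw [dX, fderiv_smul_resc hψ]
  have : dil N m (EuclideanSpace.single i 1, 0)
      = (2 ^ m : ℝ) • ((EuclideanSpace.single i 1, 0) : PSpace N) := by
    rw [dil_apply]; ext <;> simp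
  rw [this, map_smul]
  simp [resc, dX, mul_assoc]

theorem dT_smul_resc {ψ : PSpace N → ℝ} (hψ : ContDiff ℝ ∞ ψ) (a : ℝ) (m : ℕ) :
    dT (a • resc m ψ) = (a * 4 ^ m) • resc m (dT ψ) := by
  ext v
  rw [dT, fderiv_smul_resc hψ]
  have : dil N m (0, 1) = (4 ^ m : ℝ) • ((0, 1) : PSpace N) := by
    rw [dil_apply]; ext <;> simp
  rw [this, map_smul]
  simp [resc, dT, mul_assoc]

theorem mem_cyl_of_dil {n : ℕ} {v : PSpace N} (h : dil N (n + 1) v ∈ ball 0 2) :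
    v ∈ cyl N n := by
  rw [dil_apply, mem_ball_zero_iff, Prod.norm_def, max_lt_iff] at h
  obtain ⟨h1, h2⟩ := h
  simp only [norm_smul, norm_mul, norm_pow, Real.norm_eq_abs, Nat.abs_ofNat] at h1 h2
  constructor
  · rw [one_div, inv_pow, ← one_div, lt_div_iff₀ (by positivity)]
    rw [pow_succ] at h1
    linarith
  · rw [one_div, inv_pow, ← one_div, lt_div_iff₀ (by positivity)]
    rw [pow_succ] at h2
    linarith

theorem hasCompactSupport_resc {ψ : PSpace N → ℝ} (hψ : ∀ w ∉ ball (0 : PSpace N) 2, ψ w = 0)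
    (m : ℕ) : HasCompactSupport (resc (m + 1) ψ) := by
  refine HasCompactSupport.intro (isCompact_closedBall (0 : PSpace N) 1) fun v hv => ?_
  refine hψ _ fun h => hv ?_
  obtain ⟨h1, h2⟩ := mem_cyl_of_dil h
  rw [mem_closedBall_zero_iff, Prod.norm_def, max_le_iff]
  exact ⟨h1.le.trans (pow_le_one₀ (by norm_num) (by norm_num)),
    h2.le.trans (pow_le_one₀ (by norm_num) (by norm_num))⟩

theorem dA_add_two_le {μ : Measure (PSpace N)} {n : ℕ} {v z : PSpace N}
    (hv : v ∈ cyl N (n + 1)) : dA μ (n + 2) (z - v) ≤ 4 ^ N * dA μ n z := by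
  have h1 : dA μ (n + 2) (z - v) ≤ 2 ^ N * dA μ (n + 1) (z - v) :=
    dA_le_of_mem (by simp [cyl])
  have h2 : dA μ (n + 1) (z - v) ≤ 2 ^ N * dA μ n z := dA_le_of_mem (by
    rw [sub_sub_cancel_left, neg_mem_cyl]; exact hv)
  calc _ ≤ 2 ^ N * (2 ^ N * dA μ n z) := h1.trans (by gcongr)
    _ = _ := by rw [← mul_assoc, ← mul_pow]; norm_num

theorem exists_kernel_bound {r : ℝ} (hr : 0 ≤ r) {ψ : PSpace N → ℝ} (hψ : Continuous ψ)
    (h0 : ∀ w ∉ ball (0 : PSpace N) 2, ψ w = 0) : ∃ C : ℝ≥0∞, C ≠ ⊤ ∧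
      ∀ (μ : Measure (PSpace N)) (n : ℕ) (a : ℝ) (f : PSpace N → ℝ),
      |a| ≤ 2 ^ ((n + 3) * N) * 4 ^ (n + 3) → (∀ y, ‖f y‖ₑ ≤ dA μ (n + 3) y ^ r) →
      ∀ z, ‖cv (a • resc (n + 3) ψ) f z‖ₑ ≤ C * dA μ (n + 1) z ^ r := by
  obtain ⟨M, hM⟩ := exists_bound hψ (HasCompactSupport.intro
    (isCompact_closedBall (0 : PSpace N) 2) fun w hw => h0 w fun h =>
      hw (ball_subset_closedBall h))
  refine ⟨2 ^ N * 4 * volume (cyl N 0) * (ENNReal.ofReal M * (4 ^ N) ^ r), ?_,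
    fun μ n a f ha hf z => ?_⟩
  · exact ENNReal.mul_ne_top (ENNReal.mul_ne_top (by finiteness) (volume_cyl_ne_top _))
      (ENNReal.mul_ne_top ENNReal.ofReal_ne_top (ENNReal.rpow_ne_top_of_nonneg hr (by simp)))
  have hpt : ∀ v, ‖(a • resc (n + 3) ψ) v * f (z - v)‖ₑ ≤ (cyl N (n + 2)).indicator
      (fun _ => (2 ^ ((n + 3) * N) * 4 ^ (n + 3)) * ENNReal.ofReal M *
        (4 ^ N * dA μ (n + 1) z) ^ r) v := by
    intro v
    by_cases hv : v ∈ cyl N (n + 2)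
    · rw [indicator_of_mem hv, enorm_mul]
      have h1 : ‖f (z - v)‖ₑ ≤ (4 ^ N * dA μ (n + 1) z) ^ r :=
        (hf _).trans (ENNReal.rpow_le_rpow (dA_add_two_le hv) hr)
      have h2 : ‖(a • resc (n + 3) ψ) v‖ₑ
          ≤ (2 ^ ((n + 3) * N) * 4 ^ (n + 3)) * ENNReal.ofReal M := by
        rw [Pi.smul_apply, smul_eq_mul, enorm_mul, Real.enorm_eq_ofReal_abs,
          Real.enorm_eq_ofReal_abs]
        have e : ENNReal.ofReal (2 ^ ((n + 3) * N) * 4 ^ (n + 3))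
            = 2 ^ ((n + 3) * N) * 4 ^ (n + 3) := by
          rw [ENNReal.ofReal_mul (by positivity), ENNReal.ofReal_pow (by norm_num),
            ENNReal.ofReal_pow (by norm_num), ENNReal.ofReal_ofNat, ENNReal.ofReal_ofNat]
        rw [← e]
        exact mul_le_mul' (ENNReal.ofReal_le_ofReal ha) (ENNReal.ofReal_le_ofReal (hM _))
      exact mul_le_mul' h2 h1
    · have : resc (n + 3) ψ v = 0 := h0 _ fun h => hv (mem_cyl_of_dil h)
      simp [this]
  refine (enorm_integral_le_lintegral_enorm _).trans ((lintegral_mono hpt).trans_eq ?_)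
  rw [lintegral_indicator_const (measurableSet_cyl _), volume_cyl,
    ENNReal.mul_rpow_of_nonneg _ _ hr]
  have e2 : (2 : ℝ≥0∞) ^ ((n + 2) * N) * 2⁻¹ ^ ((n + 2) * N) = 1 := by
    rw [← mul_pow, ENNReal.mul_inv_cancel two_ne_zero ENNReal.ofNat_ne_top, one_pow]
  have e4 : (4 : ℝ≥0∞) ^ (n + 2) * 4⁻¹ ^ (n + 2) = 1 := by
    rw [← mul_pow, ENNReal.mul_inv_cancel four_ne_zero ENNReal.ofNat_ne_top, one_pow]
  have e3 : (2 : ℝ≥0∞) ^ ((n + 3) * N) = 2 ^ ((n + 2) * N) * 2 ^ N := by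
    rw [← pow_add]; congr 1; ring
  rw [e3, pow_succ 4 (n + 2)]
  calc _ = (2 ^ ((n + 2) * N) * 2⁻¹ ^ ((n + 2) * N)) * (4 ^ (n + 2) * 4⁻¹ ^ (n + 2)) *
        (2 ^ N * 4 * volume (cyl N 0) * (ENNReal.ofReal M * (4 ^ N) ^ r) *
          dA μ (n + 1) z ^ r) := by ring
    _ = _ := by rw [e2, e4, one_mul, one_mul]

end potentials

end ParabolicWiener

namespace ParabolicWiener

open MeasureTheory Metric Set Filter Topology
open scoped ENNReal NNReal ContDiff

section test_function

variable {N : ℕ}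

noncomputable def bump (N : ℕ) : ContDiffBump (0 : PSpace N) := ⟨1, 3 / 2, one_pos, by norm_num⟩

theorem tsupport_bump_subset : tsupport (bump N) ⊆ ball 0 2 := by
  rw [ContDiffBump.tsupport_eq]
  exact closedBall_subset_ball (by norm_num [bump])

theorem bump_eq_zero {w : PSpace N} (hw : w ∉ ball (0 : PSpace N) 2) : bump N w = 0 :=
  image_eq_zero_of_notMem_tsupport fun h => hw (tsupport_bump_subset h)

theorem dX_eq_zero {ψ : PSpace N → ℝ} (h0 : tsupport ψ ⊆ ball 0 2) (i : Fin N) :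
    tsupport (dX i ψ) ⊆ ball 0 2 := by
  refine (closure_mono ?_).trans ((tsupport_fderiv_subset ℝ).trans h0)
  intro v hv h
  exact hv (by simp [dX, h])

theorem dT_eq_zero {ψ : PSpace N → ℝ} (h0 : tsupport ψ ⊆ ball 0 2) :
    tsupport (dT ψ) ⊆ ball 0 2 := by
  refine (closure_mono ?_).trans ((tsupport_fderiv_subset ℝ).trans h0)
  intro v hv h
  exact hv (by simp [dT, h])

noncomputable def ker (N n : ℕ) : PSpace N → ℝ :=
  ((2 : ℝ) ^ ((n + 3) * N)) • resc (n + 3) (bump N)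

theorem contDiff_ker (n : ℕ) : ContDiff ℝ ∞ (ker N n) :=
  (contDiff_resc (bump N).contDiff _).const_smul ((2 : ℝ) ^ ((n + 3) * N))

theorem hasCompactSupport_ker (n : ℕ) : HasCompactSupport (ker N n) :=
  (hasCompactSupport_resc (fun _ => bump_eq_zero) (n + 2)).mono fun v hv h => hv (by
    simp [ker, h])

theorem ker_nonneg (n : ℕ) (v : PSpace N) : 0 ≤ ker N n v :=
  mul_nonneg (by positivity) (bump N).nonneg

theorem le_ker {n : ℕ} {v : PSpace N} (hv : v ∈ cyl N (n + 3)) :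
    2 ^ ((n + 3) * N) ≤ ker N n v := by
  have : bump N (dil N (n + 3) v) = 1 := by
    refine (bump N).one_of_mem_closedBall ?_
    obtain ⟨h1, h2⟩ := hv
    rw [dil_apply, mem_closedBall_zero_iff, Prod.norm_def, max_le_iff]
    simp only [norm_smul, norm_mul, norm_pow, Real.norm_eq_abs, Nat.abs_ofNat]
    rw [one_div, inv_pow] at h1 h2
    constructor
    · exact (mul_le_mul_of_nonneg_left h1.le (by positivity)).trans_eq
        (mul_inv_cancel₀ (by positivity))
    · exact (mul_le_mul_of_nonneg_left h2.le (by positivity)).trans_eq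
        (mul_inv_cancel₀ (by positivity))
  simp [ker, resc, this]

theorem norm_grad_le (φ : PSpace N → ℝ) (z : PSpace N) : ‖grad φ z‖ₑ ≤ ∑ i, ‖dX i φ z‖ₑ := by
  have : grad φ z = ∑ i, EuclideanSpace.single i (dX i φ z) := by
    ext j
    simp [grad, Finset.sum_apply]
  rw [this]
  refine (enorm_sum_le _ _).trans_eq (Finset.sum_congr rfl fun i _ => ?_)
  rw [← ofReal_norm, PiLp.norm_single, ofReal_norm]

theorem dX_sum {ι : Type*} (s : Finset ι) {F : ι → PSpace N → ℝ}
    (hF : ∀ n ∈ s, ContDiff ℝ ∞ (F n)) (i : Fin N) :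
    dX i (fun z => ∑ n ∈ s, F n z) = fun z => ∑ n ∈ s, dX i (F n) z := by
  ext z
  rw [dX, fderiv_fun_sum fun n hn => (hF n hn).differentiable (by simp) z]
  simp [dX]

theorem dT_sum {ι : Type*} (s : Finset ι) {F : ι → PSpace N → ℝ}
    (hF : ∀ n ∈ s, ContDiff ℝ ∞ (F n)) :
    dT (fun z => ∑ n ∈ s, F n z) = fun z => ∑ n ∈ s, dT (F n) z := by
  ext z
  rw [dT, fderiv_fun_sum fun n hn => (hF n hn).differentiable (by simp) z]
  simp [dT]

theorem toReal_eLpNorm_le_of_enorm_le {E : Type*} [NormedAddCommGroup E] {p : ℝ} (hp : 0 < p)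
    {g : PSpace N → E} {T : PSpace N → ℝ≥0∞} (hT : Measurable T)
    (hTt : ∫⁻ x, T x ^ p ≠ ⊤) {C : ℝ≥0∞} (hC : C ≠ ⊤) (hg : ∀ x, ‖g x‖ₑ ≤ C * T x) :
    (eLpNorm g (ENNReal.ofReal p) volume).toReal
      ≤ C.toReal * ((∫⁻ x, T x ^ p) ^ (1 / p)).toReal := by
  rw [← ENNReal.toReal_mul]
  refine ENNReal.toReal_mono (ENNReal.mul_ne_top hC
    (ENNReal.rpow_ne_top_of_nonneg (by positivity) hTt)) ?_
  rw [eLpNorm_eq_lintegral_rpow_enorm_toReal (by simpa using hp) ENNReal.ofReal_ne_top,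
    ENNReal.toReal_ofReal hp.le]
  calc (∫⁻ x, ‖g x‖ₑ ^ p) ^ (1 / p) ≤ (∫⁻ x, C ^ p * T x ^ p) ^ (1 / p) := by
        refine ENNReal.rpow_le_rpow (lintegral_mono fun x => ?_) (by positivity)
        rw [← ENNReal.mul_rpow_of_nonneg _ _ hp.le]
        exact ENNReal.rpow_le_rpow (hg x) hp.le
    _ = _ := by
        rw [lintegral_const_mul _ (hT.pow_const _), ENNReal.mul_rpow_of_nonneg _ _ (by positivity),
          ← ENNReal.rpow_mul, mul_one_div_cancel hp.ne', ENNReal.rpow_one]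

theorem exists_W21Norm_bound (N : ℕ) {p r : ℝ} (hp : 0 < p) (hr : 0 ≤ r) : ∃ C : ℝ, 0 ≤ C ∧
    ∀ (μ : Measure (PSpace N)) [SFinite μ] (J : ℕ) (f : ℕ → PSpace N → ℝ),
      (∀ n, Measurable (f n)) → (∀ n, ∃ M, ∀ z, |f n z| ≤ M) →
      (∀ n y, ‖f n y‖ₑ ≤ dA μ (n + 3) y ^ r) →
      ∫⁻ x, (∑ n ∈ Finset.range J, dA μ (n + 1) x ^ r) ^ p ≠ ⊤ →
      W21Norm N p (fun z => ∑ n ∈ Finset.range J, cv (ker N n) (f n) z)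
        ≤ C * ((∫⁻ x, (∑ n ∈ Finset.range J, dA μ (n + 1) x ^ r) ^ p) ^ (1 / p)).toReal := by
  have hb : ContDiff ℝ ∞ (bump N) := (bump N).contDiff
  have hs : ∀ {ψ : PSpace N → ℝ}, tsupport ψ ⊆ ball 0 2 → ∀ w ∉ ball (0 : PSpace N) 2, ψ w = 0 :=
    fun h w hw => image_eq_zero_of_notMem_tsupport fun h' => hw (h h')
  have hb0 : tsupport (bump N) ⊆ ball 0 2 := tsupport_bump_subset
  obtain ⟨C0, hC0, h0⟩ := exists_kernel_bound hr hb.continuous (hs hb0)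
  obtain ⟨CT, hCT, hT⟩ := exists_kernel_bound hr (contDiff_dT hb).continuous (hs (dT_eq_zero hb0))
  choose CX hCX hX using fun i : Fin N =>
    exists_kernel_bound hr (contDiff_dX hb i).continuous (hs (dX_eq_zero hb0 i))
  choose CXX hCXX hXX using fun i j : Fin N =>
    exists_kernel_bound hr (contDiff_dX (contDiff_dX hb j) i).continuous
      (hs (dX_eq_zero (dX_eq_zero hb0 j) i))
  refine ⟨C0.toReal + CT.toReal + (∑ i, CX i).toReal + ∑ i, ∑ j, (CXX i j).toReal, by positivity,
    fun μ _ J f hfm hfb hf hfin => ?_⟩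
  set T : PSpace N → ℝ≥0∞ := fun x => ∑ n ∈ Finset.range J, dA μ (n + 1) x ^ r with hTdef
  have hTm : Measurable T := Finset.measurable_fun_sum _ fun n _ => (measurable_dA _).pow_const _
  have hcs : ∀ n, ContDiff ℝ ∞ (cv (ker N n) (f n)) := fun n => by
    obtain ⟨M, hM⟩ := hfb n
    exact contDiff_cv_left (contDiff_ker n) (hasCompactSupport_ker n)
      (locallyIntegrable_of_bdd (hfm n) hM)
  have hφ : ContDiff ℝ ∞ (fun z => ∑ n ∈ Finset.range J, cv (ker N n) (f n) z) :=
    ContDiff.sum fun n _ => hcs n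
  have eX : ∀ i n, dX i (cv (ker N n) (f n)) = cv (dX i (ker N n)) (f n) := fun i n => by
    obtain ⟨M, hM⟩ := hfb n
    ext z
    exact fderiv_cv_apply (contDiff_ker n) (hasCompactSupport_ker n) (hfm n) hM _ z
  have eT : ∀ n, dT (cv (ker N n) (f n)) = cv (dT (ker N n)) (f n) := fun n => by
    obtain ⟨M, hM⟩ := hfb n
    ext z
    exact fderiv_cv_apply (contDiff_ker n) (hasCompactSupport_ker n) (hfm n) hM _ z
  have eXX : ∀ i j n, dX i (dX j (cv (ker N n) (f n))) = cv (dX i (dX j (ker N n))) (f n) :=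
    fun i j n => by
      obtain ⟨M, hM⟩ := hfb n
      rw [eX]
      ext z
      exact fderiv_cv_apply (contDiff_dX (contDiff_ker n) j)
        (hasCompactSupport_dX (hasCompactSupport_ker n) j) (hfm n) hM _ z
  have hsum : ∀ {C : ℝ≥0∞} {G : ℕ → PSpace N → ℝ},
      (∀ n z, ‖G n z‖ₑ ≤ C * dA μ (n + 1) z ^ r) →
      ∀ z, ‖∑ n ∈ Finset.range J, G n z‖ₑ ≤ C * T z := fun h z => by
    rw [hTdef, Finset.mul_sum]
    exact (enorm_sum_le _ _).trans (Finset.sum_le_sum fun n _ => h n z)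
  have p2 : ∀ m : ℕ, (1 : ℝ) ≤ 4 ^ m := fun m => one_le_pow₀ (by norm_num)
  have p3 : ∀ m : ℕ, (2 : ℝ) ^ m ≤ 4 ^ m := fun m => by gcongr; norm_num
  have b0 : ∀ z, ‖∑ n ∈ Finset.range J, cv (ker N n) (f n) z‖ₑ ≤ C0 * T z :=
    hsum fun n z => h0 μ n _ _ (by
      rw [abs_of_nonneg (by positivity)]
      exact le_mul_of_one_le_right (by positivity) (p2 _)) (hf n) z
  have bT : ∀ z, ‖dT (fun z => ∑ n ∈ Finset.range J, cv (ker N n) (f n) z) z‖ₑ ≤ CT * T z := by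
    rw [dT_sum _ fun n _ => hcs n]
    refine hsum fun n z => ?_
    rw [eT, ker, dT_smul_resc hb]
    exact hT μ n _ _ (by rw [abs_of_nonneg (by positivity)]) (hf n) z
  have bX : ∀ i z, ‖dX i (fun z => ∑ n ∈ Finset.range J, cv (ker N n) (f n) z) z‖ₑ
      ≤ CX i * T z := by
    intro i
    rw [dX_sum _ fun n _ => hcs n]
    refine hsum fun n z => ?_
    rw [eX, ker, dX_smul_resc hb]
    exact hX i μ n _ _ (by
      rw [abs_of_nonneg (by positivity)]
      exact mul_le_mul_of_nonneg_left (p3 _) (by positivity)) (hf n) z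
  have bXX : ∀ i j z, ‖dX i (dX j (fun z => ∑ n ∈ Finset.range J, cv (ker N n) (f n) z)) z‖ₑ
      ≤ CXX i j * T z := by
    intro i j
    rw [dX_sum _ fun n _ => hcs n, dX_sum _ fun n _ => contDiff_dX (hcs n) j]
    refine hsum fun n z => ?_
    rw [eXX, ker, dX_smul_resc hb, dX_smul_resc (contDiff_dX hb j)]
    refine hXX i j μ n _ _ ?_ (hf n) z
    rw [abs_of_nonneg (by positivity), mul_assoc, ← mul_pow]
    norm_num
  have bG : ∀ z, ‖grad (fun z => ∑ n ∈ Finset.range J, cv (ker N n) (f n) z) z‖ₑ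
      ≤ (∑ i, CX i) * T z := fun z => by
    rw [Finset.sum_mul]
    exact (norm_grad_le _ z).trans (Finset.sum_le_sum fun i _ => bX i z)
  rw [W21Norm_eq p hφ]
  have k0 := toReal_eLpNorm_le_of_enorm_le hp hTm hfin hC0 b0
  have kT := toReal_eLpNorm_le_of_enorm_le hp hTm hfin hCT bT
  have kG := toReal_eLpNorm_le_of_enorm_le hp hTm hfin (ENNReal.sum_ne_top.2 fun i _ => hCX i) bG
  have kXX := Finset.sum_le_sum fun i (_ : i ∈ (Finset.univ : Finset (Fin N))) =>
    Finset.sum_le_sum fun j (_ : j ∈ (Finset.univ : Finset (Fin N))) =>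
      toReal_eLpNorm_le_of_enorm_le hp hTm hfin (hCXX i j) (bXX i j)
  simp only [← Finset.sum_mul] at kXX
  rw [add_mul, add_mul, add_mul]
  exact add_le_add (add_le_add (add_le_add k0 kT) kG) kXX

end test_function

end ParabolicWiener

namespace ParabolicWiener

open MeasureTheory Metric Set Filter Topology
open scoped ENNReal NNReal ContDiff

section energy

variable {N : ℕ} {μ : Measure (PSpace N)}

theorem sum_rpow_le_rpow_sum {ι : Type*} (S : Finset ι) (a : ι → ℝ≥0∞) {t : ℝ} (ht : 1 ≤ t) :
    ∑ i ∈ S, a i ^ t ≤ (∑ i ∈ S, a i) ^ t := by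
  classical
  induction S using Finset.induction_on with
  | empty => simp
  | insert i S hi ih =>
    rw [Finset.sum_insert hi, Finset.sum_insert hi]
    exact (add_le_add_right ih _).trans (ENNReal.add_rpow_le_rpow_add _ _ ht)

theorem sum_rpow_rpow_le {ι : Type*} (S : Finset ι) (a : ι → ℝ≥0∞) {s t q : ℝ} (hs : 0 < s)
    (hst : s ≤ t) (hq : 0 < q) :
    (∑ i ∈ S, a i ^ t) ^ (q / t) ≤ (∑ i ∈ S, a i ^ s) ^ (q / s) := by
  have ht : 0 < t := hs.trans_le hst
  have h := sum_rpow_le_rpow_sum S (fun i => a i ^ s) ((one_le_div hs).2 hst)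
  simp only [← ENNReal.rpow_mul, mul_div_cancel₀ t hs.ne'] at h
  refine (ENNReal.rpow_le_rpow h (by positivity)).trans_eq ?_
  rw [← ENNReal.rpow_mul]
  congr 1
  field_simp

theorem lintegral_dA [SFinite μ] (n : ℕ) :
    ∫⁻ x, dA μ n x = 2 ^ (n * N) * (volume (cyl N n) * μ univ) := by
  unfold dA
  have hm : Measurable fun x : PSpace N => μ {v | x - v ∈ cyl N n} :=
    measurable_measure_prodMk_left (measurableSet_sub_mem_cyl n)
  rw [lintegral_const_mul _ hm]
  congr 1
  have h := (lintegral_lintegral_swap (μ := volume) (ν := μ)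
    (f := fun x v => {z : PSpace N × PSpace N | z.1 - z.2 ∈ cyl N n}.indicator (fun _ => (1 : ℝ≥0∞))
      (x, v)) ((measurable_const.indicator (measurableSet_sub_mem_cyl n)).aemeasurable))
  have e1 : ∀ x, ∫⁻ v, {z : PSpace N × PSpace N | z.1 - z.2 ∈ cyl N n}.indicator
      (fun _ => (1 : ℝ≥0∞)) (x, v) ∂μ = μ {v | x - v ∈ cyl N n} := fun x => by
    have hS : MeasurableSet {v | x - v ∈ cyl N n} :=
      (measurable_const.sub measurable_id) (measurableSet_cyl n)
    rw [← lintegral_indicator_one hS]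
    rfl
  have e2 : ∀ v, ∫⁻ x, {z : PSpace N × PSpace N | z.1 - z.2 ∈ cyl N n}.indicator
      (fun _ => (1 : ℝ≥0∞)) (x, v) = volume (cyl N n) := fun v => by
    have hS : MeasurableSet {x | x - v ∈ cyl N n} :=
      (measurable_id.sub_const v) (measurableSet_cyl n)
    rw [← volume_sub_mem_cyl n v, ← lintegral_indicator_one hS]
    rfl
  simp only [e1, e2, lintegral_const] at h
  exact h

theorem dA_le [IsProbabilityMeasure μ] (n : ℕ) (x : PSpace N) : dA μ n x ≤ 2 ^ (n * N) :=
  (mul_le_mul_right prob_le_one _).trans_eq (mul_one _)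

theorem dA_ne_top [IsProbabilityMeasure μ] (n : ℕ) (x : PSpace N) : dA μ n x ≠ ⊤ :=
  ((dA_le n x).trans_lt (by simp)).ne

theorem lintegral_dA_rpow_le [IsProbabilityMeasure μ] {q : ℝ} (hq : 1 < q) (n : ℕ) :
    ∫⁻ x, dA μ n x ^ q ≤ (2 ^ (n * N)) ^ (q - 1) * (2 ^ (n * N) * volume (cyl N n)) := by
  calc ∫⁻ x, dA μ n x ^ q ≤ ∫⁻ x, (2 ^ (n * N)) ^ (q - 1) * dA μ n x := by
        refine lintegral_mono fun x => ?_
        have : dA μ n x ^ q = dA μ n x ^ (q - 1) * dA μ n x := by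
          conv_rhs => rw [← ENNReal.rpow_one (dA μ n x), ← ENNReal.rpow_mul,
            ← ENNReal.rpow_add_of_nonneg _ _ (by linarith) zero_le_one]
          congr 1; ring
        rw [this]
        exact mul_le_mul' (ENNReal.rpow_le_rpow (dA_le n x) (by linarith)) le_rfl
    _ = _ := by
        rw [lintegral_const_mul _ (measurable_dA n), lintegral_dA, measure_univ, mul_one]

theorem dA_eq_zero {D : Set (PSpace N)} (hμ : μ Dᶜ = 0) {R : ℝ} (hD : D ⊆ closedBall 0 R)
    {n : ℕ} {x : PSpace N} (hx : R + 1 < ‖x‖) : dA μ n x = 0 := by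
  have : μ {v | x - v ∈ cyl N n} = 0 := by
    refine measure_mono_null (t := Dᶜ) (fun v hv hvD => ?_) hμ
    have h1 := cyl_anti (Nat.zero_le n) hv
    have h2 := mem_closedBall_zero_iff.1 (hD hvD)
    have h3 : ‖x - v‖ ≤ 1 := by
      rw [Prod.norm_def]
      exact max_le (by simpa using h1.1.le) (by simpa using h1.2.le)
    have h4 : ‖x‖ ≤ ‖x - v‖ + ‖v‖ := by simpa using norm_add_le (x - v) v
    linarith
  rw [dA, this, mul_zero]

theorem lintegral_cv_ker_ge [SFinite μ] (n : ℕ) {f : PSpace N → ℝ} (hf : Measurable f)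
    (hf0 : ∀ z, 0 ≤ f z) {M : ℝ} (hM : ∀ z, |f z| ≤ M) :
    ∫⁻ y, ENNReal.ofReal (f y) * dA μ (n + 3) y ≤ ∫⁻ z, ENNReal.ofReal (cv (ker N n) f z) ∂μ := by
  have hK : Integrable (ker N n) :=
    (contDiff_ker n).continuous.integrable_of_hasCompactSupport (hasCompactSupport_ker n)
  have e : ∀ z, ENNReal.ofReal (cv (ker N n) f z)
      = ∫⁻ y, ENNReal.ofReal (ker N n (z - y)) * ENNReal.ofReal (f y) := fun z => by
    rw [cv, ofReal_integral_eq_lintegral_ofReal (integrable_cv hK hf hM z)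
      (ae_of_all _ fun v => mul_nonneg (ker_nonneg _ _) (hf0 _)),
      ← lintegral_sub_left_eq_self _ z]
    refine lintegral_congr fun y => ?_
    rw [sub_sub_cancel, ENNReal.ofReal_mul (ker_nonneg _ _)]
  have hS := measurableSet_sub_mem_cyl (N := N) (n + 3)
  have hmf : Measurable fun w : PSpace N × PSpace N =>
      {w : PSpace N × PSpace N | w.1 - w.2 ∈ cyl N (n + 3)}.indicator
        (fun _ => (2 : ℝ≥0∞) ^ ((n + 3) * N)) w * ENNReal.ofReal (f w.1) :=
    (measurable_const.indicator hS).mul (hf.comp measurable_fst).ennreal_ofReal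
  calc ∫⁻ y, ENNReal.ofReal (f y) * dA μ (n + 3) y
      = ∫⁻ y, ∫⁻ z, {w : PSpace N × PSpace N | w.1 - w.2 ∈ cyl N (n + 3)}.indicator
        (fun _ => (2 : ℝ≥0∞) ^ ((n + 3) * N)) (y, z) * ENNReal.ofReal (f y) ∂μ := by
        refine lintegral_congr fun y => ?_
        have hmy : Measurable fun z => {w : PSpace N × PSpace N |
            w.1 - w.2 ∈ cyl N (n + 3)}.indicator (fun _ => (2 : ℝ≥0∞) ^ ((n + 3) * N)) (y, z) :=
          (measurable_const.indicator hS).comp measurable_prodMk_left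
        rw [lintegral_mul_const _ hmy,
          mul_comm, dA]
        congr 1
        have hSy : MeasurableSet {v | y - v ∈ cyl N (n + 3)} :=
          (measurable_const.sub measurable_id) (measurableSet_cyl _)
        rw [← lintegral_indicator_const hSy]
        rfl
    _ = ∫⁻ z, (∫⁻ y, {w : PSpace N × PSpace N | w.1 - w.2 ∈ cyl N (n + 3)}.indicator
        (fun _ => (2 : ℝ≥0∞) ^ ((n + 3) * N)) (y, z) * ENNReal.ofReal (f y)) ∂μ :=
        lintegral_lintegral_swap (f := fun y z =>
          {w : PSpace N × PSpace N | w.1 - w.2 ∈ cyl N (n + 3)}.indicator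
            (fun _ => (2 : ℝ≥0∞) ^ ((n + 3) * N)) (y, z) * ENNReal.ofReal (f y)) hmf.aemeasurable
    _ ≤ _ := by
        refine lintegral_mono fun z => ?_
        rw [e]
        refine lintegral_mono fun y => mul_le_mul' ?_ le_rfl
        by_cases h : y - z ∈ cyl N (n + 3)
        · rw [indicator_of_mem (by exact h)]
          refine le_trans (le_of_eq ?_) (ENNReal.ofReal_le_ofReal (le_ker (sub_mem_cyl_comm.1 h)))
          rw [ENNReal.ofReal_pow (by norm_num), ENNReal.ofReal_ofNat]
        · rw [indicator_of_notMem (by exact h)]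
          exact zero_le

end energy

end ParabolicWiener

namespace ParabolicWiener

open MeasureTheory Metric Set Filter Topology
open scoped ENNReal NNReal ContDiff

section energy

variable {N : ℕ}

theorem le_of_mul_le_mul_rpow {c X B q : ℝ} (hq : 1 < q) (hc : 0 < c) (hX : 0 < X)
    (h : c ^ (1 / (q / (q - 1))) * X ≤ B * X ^ (1 / (q / (q - 1)))) :
    X ≤ B ^ q * c ^ (1 - q) := by
  have hq0 : 0 < q := by linarith
  have hq1 : q - 1 ≠ 0 := by linarith
  set a := 1 / (q / (q - 1)) with ha
  have haq : a * q = q - 1 := by rw [ha]; field_simp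
  have hXa : 0 < X ^ a := Real.rpow_pos_of_pos hX _
  have hca : 0 < c ^ a := Real.rpow_pos_of_pos hc _
  have hB : 0 ≤ B := by
    by_contra! hB
    have := mul_neg_of_neg_of_pos hB hXa
    have := mul_pos hca hX
    linarith
  have h1 := Real.rpow_le_rpow (by positivity) h hq0.le
  rw [Real.mul_rpow hca.le hX.le, Real.mul_rpow hB hXa.le, ← Real.rpow_mul hc.le,
    ← Real.rpow_mul hX.le, haq] at h1
  have h2 : X ^ q = X ^ (q - 1) * X := by
    conv_rhs => rw [← Real.rpow_one X, ← Real.rpow_mul hX.le, ← Real.rpow_add hX]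
    congr 1; ring
  have h3 : 0 < X ^ (q - 1) := Real.rpow_pos_of_pos hX _
  have h4 : c ^ (q - 1) * X ≤ B ^ q := by
    rw [h2] at h1
    refine le_of_mul_le_mul_right ?_ h3
    linarith
  have h5 : c ^ (1 - q) * c ^ (q - 1) = 1 := by
    rw [← Real.rpow_add hc]; simp
  have h6 := mul_le_mul_of_nonneg_left h4 (Real.rpow_pos_of_pos hc (1 - q)).le
  rw [← mul_assoc, h5, one_mul] at h6
  linarith

theorem exists_energy_bound (N : ℕ) {q : ℝ} (hq : 1 < q) (R : ℝ) :
    ∃ C : ℝ≥0∞, C ≠ ⊤ ∧ ∀ D : Set (PSpace N), D ⊆ closedBall 0 R → IsCompact D →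
      0 < cap21c N (q / (q - 1)) D → ∃ μ : Measure (PSpace N), IsProbabilityMeasure μ ∧
        μ Dᶜ = 0 ∧ ∀ J : ℕ, ∑ i ∈ Finset.range J, ∫⁻ x, dA μ i x ^ q
          ≤ C * ENNReal.ofReal (cap21c N (q / (q - 1)) D ^ (1 - q)) := by
  have hq0 : 0 < q := by linarith
  have hq1 : 0 < q - 1 := by linarith
  set p := q / (q - 1) with hp
  have hp1 : 1 ≤ p := (one_le_div hq1).2 (by linarith)
  have hp0 : 0 < p := by linarith
  set s := min 1 (q - 1) with hs
  have hs0 : 0 < s := lt_min one_pos hq1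
  obtain ⟨C₁, hC₁, hW⟩ := exists_W21Norm_bound N hp0 hq1.le
  obtain ⟨C₂, hC₂, hwolff⟩ := exists_wolff_bound N hs0 (min_le_left _ _)
    ((min_le_right _ _).trans_lt (by linarith) : s < q)
  obtain ⟨C₃, hcap⟩ := exists_cap21c_bound N p R
  set k : ℝ≥0∞ := 1 + ∑ i ∈ Finset.range 3,
    ((2 : ℝ≥0∞) ^ (i * N)) ^ (q - 1) * (2 ^ (i * N) * volume (cyl N i)) with hk
  have hkt : k ≠ ⊤ := ENNReal.add_ne_top.2 ⟨ENNReal.one_ne_top, ENNReal.sum_ne_top.2 fun i _ =>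
    ENNReal.mul_ne_top (ENNReal.rpow_ne_top_of_nonneg hq1.le (by simp))
      (ENNReal.mul_ne_top (by simp) (volume_cyl_ne_top i))⟩
  have hk1 : 1 ≤ k := le_self_add
  set B : ℝ := C₃ ^ (1 / p) * k.toReal + C₁ * (C₂ ^ (1 / p)).toReal with hB
  refine ⟨ENNReal.ofReal (B ^ q), ENNReal.ofReal_ne_top, fun D hD hDc hc => ?_⟩
  obtain ⟨μ, hμ, hμD, hdual⟩ := exists_dual_measure hp1 hDc hc
  refine ⟨μ, hμ, hμD, fun J => ?_⟩
  set f : ℕ → PSpace N → ℝ := fun n y => (dA μ (n + 3) y ^ (q - 1)).toReal with hf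
  have hft : ∀ n y, dA μ (n + 3) y ^ (q - 1) ≠ ⊤ := fun n y =>
    ENNReal.rpow_ne_top_of_nonneg hq1.le (dA_ne_top _ _)
  have hfm : ∀ n, Measurable (f n) := fun n => ((measurable_dA _).pow_const _).ennreal_toReal
  have hf0 : ∀ n y, 0 ≤ f n y := fun n y => ENNReal.toReal_nonneg
  have hfe : ∀ n y, ENNReal.ofReal (f n y) = dA μ (n + 3) y ^ (q - 1) := fun n y =>
    ENNReal.ofReal_toReal (hft n y)
  have hfb : ∀ n, ∃ M, ∀ z, |f n z| ≤ M := fun n =>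
    ⟨(((2 : ℝ≥0∞) ^ ((n + 3) * N)) ^ (q - 1)).toReal, fun z => by
      rw [abs_of_nonneg (hf0 n z)]
      exact ENNReal.toReal_mono (ENNReal.rpow_ne_top_of_nonneg hq1.le (by simp))
        (ENNReal.rpow_le_rpow (dA_le _ _) hq1.le)⟩
  have hfc : ∀ n, HasCompactSupport (f n) := fun n =>
    HasCompactSupport.of_support_subset_isCompact (isCompact_closedBall (0 : PSpace N) (R + 1))
      fun z hz => by
        by_contra h
        rw [mem_closedBall_zero_iff, not_le] at h
        exact hz (by simp [hf, dA_eq_zero hμD hD h, hq1])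
  set φ : PSpace N → ℝ := fun z => ∑ n ∈ Finset.range J, cv (ker N n) (f n) z with hφ
  have hcs : ∀ n, ContDiff ℝ ∞ (cv (ker N n) (f n)) := fun n => by
    obtain ⟨M, hM⟩ := hfb n
    exact contDiff_cv_left (contDiff_ker n) (hasCompactSupport_ker n)
      (locallyIntegrable_of_bdd (hfm n) hM)
  have hcc : ∀ n, HasCompactSupport (cv (ker N n) (f n)) := fun n =>
    hasCompactSupport_cv (hasCompactSupport_ker n) (hfc n)
  have hcv0 : ∀ n z, 0 ≤ cv (ker N n) (f n) z := fun n z =>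
    integral_nonneg fun v => mul_nonneg (ker_nonneg _ _) (hf0 _ _)
  have hφs : ContDiff ℝ ∞ φ := ContDiff.sum fun n _ => hcs n
  have hφc : HasCompactSupport φ := by
    have : φ = ∑ n ∈ Finset.range J, cv (ker N n) (f n) := by ext z; simp [hφ]
    rw [this]
    exact HasCompactSupport.finset_sum fun n _ => hcc n
  set E : ℝ≥0∞ := ∑ n ∈ Finset.range J, ∫⁻ x, dA μ (n + 3) x ^ q with hE
  have hEφ : E ≤ ∫⁻ z, ENNReal.ofReal (φ z) ∂μ := by
    have : ∀ z, ENNReal.ofReal (φ z)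
        = ∑ n ∈ Finset.range J, ENNReal.ofReal (cv (ker N n) (f n) z) := fun z =>
      ENNReal.ofReal_sum_of_nonneg fun n _ => hcv0 n z
    simp only [this]
    rw [lintegral_finsetSum _ fun n _ => (hcs n).continuous.measurable.ennreal_ofReal]
    refine Finset.sum_le_sum fun n _ => ?_
    obtain ⟨M, hM⟩ := hfb n
    refine le_trans (le_of_eq ?_) (lintegral_cv_ker_ge n (hfm n) (hf0 n) hM)
    refine lintegral_congr fun x => ?_
    rw [hfe]
    conv_rhs => rw [← ENNReal.rpow_one (dA μ (n + 3) x), ← ENNReal.rpow_mul,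
      ← ENNReal.rpow_add_of_nonneg _ _ (by linarith) zero_le_one]
    congr 1; ring
  have hφi : Integrable φ μ := hφs.continuous.integrable_of_hasCompactSupport hφc
  have hφ0 : ∀ z, 0 ≤ φ z := fun z => Finset.sum_nonneg fun n _ => hcv0 n z
  have hφt : ENNReal.ofReal (∫ z, φ z ∂μ) = ∫⁻ z, ENNReal.ofReal (φ z) ∂μ :=
    ofReal_integral_eq_lintegral_ofReal hφi (ae_of_all _ hφ0)
  rw [← hφt] at hEφ
  have hEt : E ≠ ⊤ := (hEφ.trans_lt ENNReal.ofReal_lt_top).ne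
  have hXt : k + E ≠ ⊤ := ENNReal.add_ne_top.2 ⟨hkt, hEt⟩
  have hA : ∑ i ∈ Finset.range J, ∫⁻ x, dA μ i x ^ q ≤ k + E := by
    refine (Finset.sum_le_sum_of_subset (Finset.range_mono (Nat.le_add_left J 3))).trans ?_
    rw [Finset.sum_range_add]
    refine add_le_add ((Finset.sum_le_sum fun i _ => lintegral_dA_rpow_le hq i).trans
      le_add_self) (le_of_eq ?_)
    simp only [hE, add_comm 3]
  have hT : ∫⁻ x, (∑ n ∈ Finset.range J, dA μ (n + 1) x ^ (q - 1)) ^ p ≤ C₂ * (k + E) := by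
    refine (lintegral_mono fun x => sum_rpow_rpow_le _ _ hs0 (min_le_right _ _) hq0).trans ?_
    exact (hwolff μ J).trans (mul_le_mul_right hA _)
  have hTt : C₂ * (k + E) ≠ ⊤ := ENNReal.mul_ne_top hC₂ hXt
  have h1 := (hdual φ hφs hφc).trans (hW μ J f hfm hfb (fun n y => by
    rw [← ofReal_norm, Real.norm_of_nonneg (hf0 n y), hfe]) (hT.trans_lt hTt.lt_top).ne)
  set X : ℝ := (k + E).toReal with hX
  have hX1 : 1 ≤ X := by
    rw [hX, ← ENNReal.toReal_one]
    exact ENNReal.toReal_mono hXt (hk1.trans le_self_add)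
  have h2 : ((∫⁻ x, (∑ n ∈ Finset.range J, dA μ (n + 1) x ^ (q - 1)) ^ p) ^ (1 / p)).toReal
      ≤ (C₂ ^ (1 / p)).toReal * X ^ (1 / p) := by
    rw [hX, ENNReal.toReal_rpow, ← ENNReal.toReal_mul,
      ← ENNReal.mul_rpow_of_nonneg _ _ (by positivity)]
    exact ENNReal.toReal_mono (ENNReal.rpow_ne_top_of_nonneg (by positivity) hTt)
      (ENNReal.rpow_le_rpow hT (by positivity))
  have h3 : X ≤ k.toReal + ∫ z, φ z ∂μ := by
    rw [hX, ENNReal.toReal_add hkt hEt]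
    refine add_le_add le_rfl ?_
    exact ENNReal.toReal_le_of_le_ofReal (integral_nonneg hφ0) hEφ
  have hc0 : 0 ≤ cap21c N p D ^ (1 / p) := Real.rpow_nonneg hc.le _
  have hX2 : 1 ≤ X ^ (1 / p) := Real.one_le_rpow hX1 (by positivity)
  have h4 : cap21c N p D ^ (1 / p) * k.toReal ≤ C₃ ^ (1 / p) * k.toReal * X ^ (1 / p) := by
    refine le_trans (mul_le_mul_of_nonneg_right (Real.rpow_le_rpow hc.le (hcap D hD)
      (by positivity)) ENNReal.toReal_nonneg) (le_mul_of_one_le_right ?_ hX2)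
    exact mul_nonneg (Real.rpow_nonneg (hc.le.trans (hcap D hD)) _) ENNReal.toReal_nonneg
  have h5 : cap21c N p D ^ (1 / p) * X ≤ B * X ^ (1 / p) := by
    calc cap21c N p D ^ (1 / p) * X
        ≤ cap21c N p D ^ (1 / p) * k.toReal + cap21c N p D ^ (1 / p) * ∫ z, φ z ∂μ := by
          rw [← mul_add]; exact mul_le_mul_of_nonneg_left h3 hc0
      _ ≤ C₃ ^ (1 / p) * k.toReal * X ^ (1 / p)
          + C₁ * ((C₂ ^ (1 / p)).toReal * X ^ (1 / p)) :=
          add_le_add h4 (h1.trans (mul_le_mul_of_nonneg_left h2 hC₁))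
      _ = _ := by rw [hB]; ring
  have h6 := le_of_mul_le_mul_rpow hq hc (by linarith) h5
  refine hA.trans ?_
  rw [← ENNReal.ofReal_toReal hXt, ← ENNReal.ofReal_mul' (Real.rpow_nonneg hc.le _)]
  exact ENNReal.ofReal_le_ofReal h6

end energy

end ParabolicWiener

namespace ParabolicWiener

open MeasureTheory Metric Set Filter Topology
open scoped ENNReal NNReal ContDiff

section potential

variable {N : ℕ}

noncomputable def Gloc (N : ℕ) : PSpace N → ℝ≥0∞ := (cyl N 1).indicator (Gam N)

theorem measurable_Gloc : Measurable (Gloc N) := (measurable_Gam N).indicator (measurableSet_cyl 1)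

theorem exists_Gloc_le (N : ℕ) : ∃ C : ℝ≥0∞, C ≠ ⊤ ∧ ∀ w,
    Gloc N w ≤ C * ∑' n : ℕ, (cyl N (n + 1)).indicator (fun _ => (2 : ℝ≥0∞) ^ ((n + 1) * N)) w := by
  refine ⟨ENNReal.ofReal ((1 + 4 ^ N * N.factorial) * 2 ^ N), ENNReal.ofReal_ne_top, fun w => ?_⟩
  by_cases hw : w ∈ cyl N 1
  swap
  · rw [Gloc, indicator_of_notMem hw]; exact zero_le
  rw [Gloc, indicator_of_mem hw]
  by_cases hall : ∀ n, w ∈ cyl N (n + 1)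
  · have h2 : |w.2| ≤ 0 := by
      refine ge_of_tendsto' (tendsto_pow_atTop_nhds_zero_of_lt_one (r := (1 / 4 : ℝ))
        (by norm_num) (by norm_num)) fun n => ?_
      exact (hall n).2.le.trans (pow_le_pow_of_le_one (by norm_num) (by norm_num) (Nat.le_succ n))
    rw [Gam_of_nonpos (abs_nonpos_iff.1 h2).le]
    exact zero_le
  classical
  push Not at hall
  have hmin := Nat.find_spec hall
  set m := Nat.find hall with hm
  have hm0 : m ≠ 0 := fun h => hmin (by rw [h]; exact hw)
  obtain ⟨n, hn⟩ := Nat.exists_eq_succ_of_ne_zero hm0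
  have hin : w ∈ cyl N (n + 1) := by
    by_contra h
    exact Nat.find_min hall (show n < m by omega) h
  refine le_trans ?_ (mul_le_mul_right (ENNReal.le_tsum n) _)
  rw [indicator_of_mem hin]
  rw [hn] at hmin
  have h1 : (1 / 2 : ℝ) ^ (n + 2) ≤ ‖w.1‖ ∨ ((1 / 2 : ℝ) ^ (n + 2)) ^ 2 ≤ |w.2| := by
    by_contra! h
    refine hmin ⟨h.1, h.2.trans_eq ?_⟩
    rw [← pow_mul, mul_comm, pow_mul]; norm_num
  have h2 := heatK_le (N := N) (by positivity) h1
  rw [Gam]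
  refine (ENNReal.ofReal_le_ofReal h2).trans_eq ?_
  rw [show (2 : ℝ≥0∞) ^ ((n + 1) * N) = ENNReal.ofReal (2 ^ ((n + 1) * N)) by
    rw [ENNReal.ofReal_pow (by norm_num), ENNReal.ofReal_ofNat],
    ← ENNReal.ofReal_mul (by positivity)]
  congr 1
  rw [mul_assoc, ← pow_mul, one_div, inv_pow, inv_inv, ← pow_add]
  congr 2; ring

theorem exists_potential_bound (N : ℕ) {q : ℝ} (hq : 1 < q) (R : ℝ) :
    ∃ C : ℝ≥0∞, C ≠ ⊤ ∧ ∀ D : Set (PSpace N), D ⊆ closedBall 0 R → IsCompact D →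
      0 < cap21c N (q / (q - 1)) D → ∃ μ : Measure (PSpace N), IsProbabilityMeasure μ ∧
        μ Dᶜ = 0 ∧ ∫⁻ z, (∫⁻ v, Gloc N (z - v) ∂μ) ^ q
          ≤ C * ENNReal.ofReal (cap21c N (q / (q - 1)) D ^ (1 - q)) := by
  have hq0 : 0 < q := by linarith
  set s := min 1 (q - 1) with hs
  have hs0 : 0 < s := lt_min one_pos (by linarith)
  obtain ⟨C₁, hC₁, hE⟩ := exists_energy_bound N hq R
  obtain ⟨C₂, hC₂, hwolff⟩ := exists_wolff_bound N hs0 (min_le_left _ _)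
    ((min_le_right _ _).trans_lt (by linarith) : s < q)
  obtain ⟨C₃, hC₃, hG⟩ := exists_Gloc_le N
  refine ⟨C₃ ^ q * (C₂ * C₁), ENNReal.mul_ne_top (ENNReal.rpow_ne_top_of_nonneg hq0.le hC₃)
    (ENNReal.mul_ne_top hC₂ hC₁), fun D hD hDc hc => ?_⟩
  obtain ⟨μ, hμ, hμD, hJ⟩ := hE D hD hDc hc
  refine ⟨μ, hμ, hμD, ?_⟩
  have hpt : ∀ z, ∫⁻ v, Gloc N (z - v) ∂μ ≤ C₃ * ⨆ J, ∑ n ∈ Finset.range J, dA μ (n + 1) z := by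
    intro z
    have hS : ∀ n, MeasurableSet {v | z - v ∈ cyl N n} := fun n =>
      (measurable_const.sub measurable_id) (measurableSet_cyl n)
    have hi : ∀ n : ℕ, Measurable fun v => (cyl N (n + 1)).indicator
        (fun _ => (2 : ℝ≥0∞) ^ ((n + 1) * N)) (z - v) := fun n =>
      (measurable_const.indicator (measurableSet_cyl _)).comp
        (measurable_const.sub measurable_id)
    rw [← ENNReal.tsum_eq_iSup_nat]
    calc ∫⁻ v, Gloc N (z - v) ∂μ
        ≤ ∫⁻ v, C₃ * ∑' n : ℕ, (cyl N (n + 1)).indicator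
            (fun _ => (2 : ℝ≥0∞) ^ ((n + 1) * N)) (z - v) ∂μ := lintegral_mono fun v => hG _
      _ = _ := by
        rw [lintegral_const_mul _ (Measurable.tsum hi),
          lintegral_tsum fun n => (hi n).aemeasurable]
        congr 2
        ext n
        rw [dA, ← lintegral_indicator_const (hS (n + 1))]
        rfl
  have hmono : Monotone fun J z => (∑ n ∈ Finset.range J, dA μ (n + 1) z) ^ q :=
    fun J J' h z => ENNReal.rpow_le_rpow
      (Finset.sum_le_sum_of_subset (Finset.range_mono h)) hq0.le
  have hm : ∀ J, Measurable fun z => (∑ n ∈ Finset.range J, dA μ (n + 1) z) ^ q := fun J =>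
    (Finset.measurable_fun_sum _ fun n _ => measurable_dA _).pow_const _
  calc ∫⁻ z, (∫⁻ v, Gloc N (z - v) ∂μ) ^ q
      ≤ ∫⁻ z, C₃ ^ q * ⨆ J, (∑ n ∈ Finset.range J, dA μ (n + 1) z) ^ q := by
        refine lintegral_mono fun z => ?_
        refine (ENNReal.rpow_le_rpow (hpt z) hq0.le).trans_eq ?_
        rw [ENNReal.mul_rpow_of_nonneg _ _ hq0.le]
        congr 1
        exact (ENNReal.orderIsoRpow q hq0).map_iSup _
    _ = C₃ ^ q * ⨆ J, ∫⁻ z, (∑ n ∈ Finset.range J, dA μ (n + 1) z) ^ q := by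
        rw [lintegral_const_mul _ (Measurable.iSup hm), lintegral_iSup hm hmono]
    _ ≤ C₃ ^ q * (C₂ * (C₁ * ENNReal.ofReal (cap21c N (q / (q - 1)) D ^ (1 - q)))) := by
        refine mul_le_mul_right (iSup_le fun J => ?_) _
        refine le_trans (lintegral_mono fun z => ?_)
          ((hwolff μ J).trans (mul_le_mul_right (hJ J) _))
        have := sum_rpow_rpow_le (Finset.range J) (fun n => dA μ (n + 1) z) hs0
          (min_le_left 1 (q - 1)) hq0
        simpa using this
    _ = _ := by ring

theorem lintegral_rpow_le {α : Type*} [MeasurableSpace α] {ν : Measure α} [IsProbabilityMeasure ν] {q : ℝ}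
    (hq : 1 < q) {f : α → ℝ≥0∞} (hf : Measurable f) : (∫⁻ x, f x ∂ν) ^ q ≤ ∫⁻ x, f x ^ q ∂ν := by
  have hq0 : 0 < q := by linarith
  have h := ENNReal.lintegral_mul_le_Lp_mul_Lq ν (Real.HolderConjugate.conjExponent hq)
    hf.aemeasurable (g := fun _ => 1) aemeasurable_const
  simp only [Pi.mul_apply, mul_one, ENNReal.one_rpow, lintegral_one, measure_univ] at h
  rw [one_div] at h
  exact (ENNReal.le_rpow_inv_iff hq0).1 h

end potential

end ParabolicWiener

namespace ParabolicWiener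

open MeasureTheory Metric Set Filter Topology
open scoped ENNReal NNReal ContDiff

section smear

variable {N : ℕ}

noncomputable def smear (μ : Measure (PSpace N)) (ε : ℝ) (w : PSpace N) : ℝ≥0∞ :=
  (volume (ball (0 : PSpace N) ε))⁻¹ * μ {v | w - v ∈ ball 0 ε}

variable {μ : Measure (PSpace N)} {ε : ℝ}

theorem measurableSet_sub_mem_ball (ε : ℝ) :
    MeasurableSet {z : PSpace N × PSpace N | z.1 - z.2 ∈ ball 0 ε} :=
  (measurable_fst.sub measurable_snd) measurableSet_ball

theorem measurable_smear [SFinite μ] : Measurable (smear μ ε) :=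
  (measurable_measure_prodMk_left (measurableSet_sub_mem_ball ε)).const_mul _

theorem smear_le [IsProbabilityMeasure μ] (w : PSpace N) :
    smear μ ε w ≤ (volume (ball (0 : PSpace N) ε))⁻¹ :=
  (mul_le_mul_right prob_le_one _).trans_eq (mul_one _)

theorem smear_eq_zero {D : Set (PSpace N)} (hμ : μ Dᶜ = 0) {w : PSpace N}
    (hw : w ∉ thickening ε D) : smear μ ε w = 0 := by
  have : μ {v | w - v ∈ ball 0 ε} = 0 := by
    refine measure_mono_null (t := Dᶜ) (fun v hv hvD => hw ?_) hμ
    refine mem_thickening_iff.2 ⟨v, hvD, ?_⟩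
    simpa [dist_eq_norm] using hv
  rw [smear, this, mul_zero]

theorem lconv_smear [SFinite μ] (hε : 0 < ε) {K : PSpace N → ℝ≥0∞} (hK : Measurable K) (z : PSpace N) :
    (K ⋆ₗ smear μ ε) z
      = ∫⁻ b, (∫⁻ v, K (z - b - v) ∂μ) ∂(ProbabilityTheory.cond volume (ball 0 ε)) := by
  set a := (volume (ball (0 : PSpace N) ε))⁻¹ with ha
  have hB := measurableSet_sub_mem_ball (N := N) ε
  have e0 : ∀ w, smear μ ε w = ∫⁻ v, a * (ball (0 : PSpace N) ε).indicator 1 (w - v) ∂μ := by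
    intro w
    have hS : MeasurableSet {v | w - v ∈ ball (0 : PSpace N) ε} :=
      (measurable_const.sub measurable_id) measurableSet_ball
    have hm : Measurable fun v => (ball (0 : PSpace N) ε).indicator (1 : PSpace N → ℝ≥0∞) (w - v) :=
      (measurable_const.indicator measurableSet_ball).comp (measurable_const.sub measurable_id)
    rw [lintegral_const_mul _ hm, smear, ← lintegral_indicator_one hS]
    rfl
  have hF : Measurable fun x : PSpace N × PSpace N =>
      K x.1 * (a * (ball (0 : PSpace N) ε).indicator (1 : PSpace N → ℝ≥0∞) (z - x.1 - x.2)) :=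
    (hK.comp measurable_fst).mul (((measurable_const.indicator measurableSet_ball).comp
      ((measurable_const.sub measurable_fst).sub measurable_snd)).const_mul a)
  have hF' : Measurable fun x : PSpace N × PSpace N =>
      (a * (ball (0 : PSpace N) ε).indicator (1 : PSpace N → ℝ≥0∞) x.2) * K (z - x.2 - x.1) :=
    (((measurable_const.indicator measurableSet_ball).comp measurable_snd).const_mul a).mul
      (hK.comp ((measurable_const.sub measurable_snd).sub measurable_fst))
  calc (K ⋆ₗ smear μ ε) z
      = ∫⁻ w, ∫⁻ v, K w * (a * (ball (0 : PSpace N) ε).indicator (1 : PSpace N → ℝ≥0∞)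
          (z - w - v)) ∂μ := by
        rw [lconv_eq]
        refine lintegral_congr fun w => ?_
        have hm : Measurable fun v => a *
            (ball (0 : PSpace N) ε).indicator (1 : PSpace N → ℝ≥0∞) (z - w - v) :=
          ((measurable_const.indicator measurableSet_ball).comp
            (measurable_const.sub measurable_id)).const_mul a
        rw [e0, lintegral_const_mul _ hm]
    _ = ∫⁻ v, (∫⁻ w, K w * (a * (ball (0 : PSpace N) ε).indicator (1 : PSpace N → ℝ≥0∞)
          (z - w - v))) ∂μ :=
        lintegral_lintegral_swap (f := fun w v => K w * (a * (ball (0 : PSpace N) ε).indicator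
          (1 : PSpace N → ℝ≥0∞) (z - w - v))) hF.aemeasurable
    _ = ∫⁻ v, (∫⁻ b, (a * (ball (0 : PSpace N) ε).indicator (1 : PSpace N → ℝ≥0∞) b)
          * K (z - b - v)) ∂μ := by
        refine lintegral_congr fun v => ?_
        rw [← lintegral_sub_left_eq_self _ (z - v)]
        refine lintegral_congr fun b => ?_
        rw [mul_comm, show z - (z - v - b) - v = b by abel, show z - v - b = z - b - v by abel]
    _ = ∫⁻ b, ∫⁻ v, (a * (ball (0 : PSpace N) ε).indicator (1 : PSpace N → ℝ≥0∞) b)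
          * K (z - b - v) ∂μ :=
        lintegral_lintegral_swap (f := fun v b => (a * (ball (0 : PSpace N) ε).indicator
          (1 : PSpace N → ℝ≥0∞) b) * K (z - b - v)) hF'.aemeasurable
    _ = _ := by
        rw [ProbabilityTheory.cond, lintegral_smul_measure, ← lintegral_indicator measurableSet_ball,
          smul_eq_mul, ← lintegral_const_mul']
        · refine lintegral_congr fun b => ?_
          have hm : Measurable fun v => K (z - b - v) :=
            hK.comp (measurable_const.sub measurable_id)
          rw [lintegral_const_mul _ hm]
          by_cases hb : b ∈ ball (0 : PSpace N) ε <;> simp [hb, ← ha]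
        · exact ENNReal.inv_ne_top.2 (measure_ball_pos volume _ hε).ne'

theorem lintegral_smear [IsProbabilityMeasure μ] (hε : 0 < ε) : ∫⁻ w, smear μ ε w = 1 := by
  have := ProbabilityTheory.cond_isProbabilityMeasure_of_finite (μ := volume)
    (measure_ball_pos volume (0 : PSpace N) hε).ne' measure_ball_lt_top.ne
  have h := lconv_smear (μ := μ) hε (K := 1) measurable_one 0
  rw [lconv_eq] at h
  simp only [Pi.one_apply, lintegral_one, measure_univ, one_mul] at h
  rwa [lintegral_sub_left_eq_self (fun w => smear μ ε w) 0] at h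

theorem lintegral_lconv_smear_rpow_le [SFinite μ] (hε : 0 < ε) {K : PSpace N → ℝ≥0∞}
    (hK : Measurable K) {q : ℝ} (hq : 1 < q) :
    ∫⁻ z, (K ⋆ₗ smear μ ε) z ^ q ≤ ∫⁻ z, (∫⁻ v, K (z - v) ∂μ) ^ q := by
  have := ProbabilityTheory.cond_isProbabilityMeasure_of_finite (μ := volume)
    (measure_ball_pos volume (0 : PSpace N) hε).ne' measure_ball_lt_top.ne
  set ν := ProbabilityTheory.cond volume (ball (0 : PSpace N) ε)
  have hP : Measurable fun z => ∫⁻ v, K (z - v) ∂μ :=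
    Measurable.lintegral_prod_right (hK.comp (measurable_fst.sub measurable_snd))
  calc ∫⁻ z, (K ⋆ₗ smear μ ε) z ^ q
      ≤ ∫⁻ z, ∫⁻ b, (∫⁻ v, K (z - b - v) ∂μ) ^ q ∂ν := by
        refine lintegral_mono fun z => ?_
        rw [lconv_smear hε hK]
        exact lintegral_rpow_le hq (hP.comp (measurable_const.sub measurable_id))
    _ = ∫⁻ b, (∫⁻ z, (∫⁻ v, K (z - b - v) ∂μ) ^ q) ∂ν :=
        lintegral_lintegral_swap (f := fun z b => (∫⁻ v, K (z - b - v) ∂μ) ^ q)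
          ((hP.comp (measurable_fst.sub measurable_snd)).pow_const q).aemeasurable
    _ = ∫⁻ b, (∫⁻ z, (∫⁻ v, K (z - v) ∂μ) ^ q) ∂ν := by
        refine lintegral_congr fun b => ?_
        exact lintegral_sub_right_eq_self (fun z => (∫⁻ v, K (z - v) ∂μ) ^ q) b
    _ = _ := by simp

theorem exists_source (N : ℕ) {q : ℝ} (hq : 1 < q) (R : ℝ) :
    ∃ C : ℝ≥0∞, C ≠ ⊤ ∧ ∀ D : Set (PSpace N), D ⊆ closedBall 0 R → IsCompact D →
      ∀ ε : ℝ, 0 < ε → ∃ g : PSpace N → ℝ≥0∞, Measurable g ∧ (∃ L : ℝ≥0, ∀ z, g z ≤ L) ∧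
        (∀ z ∉ thickening ε D, g z = 0) ∧
        ∫⁻ z, g z = ENNReal.ofReal (cap21c N (q / (q - 1)) D) ∧
        ∫⁻ z, (Gloc N ⋆ₗ g) z ^ q ≤ C * ENNReal.ofReal (cap21c N (q / (q - 1)) D) := by
  have hq0 : 0 < q := by linarith
  obtain ⟨C, hC, h⟩ := exists_potential_bound N hq R
  refine ⟨C, hC, fun D hD hDc ε hε => ?_⟩
  set c := cap21c N (q / (q - 1)) D with hcdef
  have hc0 : 0 ≤ c := cap21c_nonneg D
  rcases hc0.eq_or_lt with hc | hc
  · refine ⟨0, measurable_zero, ⟨0, fun z => le_rfl⟩, fun z _ => rfl, by simp [← hc], ?_⟩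
    simp [lconv_eq, hq0]
  obtain ⟨μ, hμ, hμD, hpot⟩ := h D hD hDc hc
  have hv0 : volume (ball (0 : PSpace N) ε) ≠ 0 := (measure_ball_pos volume _ hε).ne'
  refine ⟨fun z => ENNReal.ofReal c * smear μ ε z, measurable_smear.const_mul _,
    ⟨(ENNReal.ofReal c * (volume (ball (0 : PSpace N) ε))⁻¹).toNNReal, fun z => ?_⟩,
    fun z hz => by simp [smear_eq_zero hμD hz], ?_, ?_⟩
  · rw [ENNReal.coe_toNNReal (ENNReal.mul_ne_top ENNReal.ofReal_ne_top (ENNReal.inv_ne_top.2 hv0))]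
    exact mul_le_mul_right (smear_le z) _
  · rw [lintegral_const_mul _ measurable_smear, lintegral_smear hε, mul_one]
  · have e : ∀ z, (Gloc N ⋆ₗ fun z => ENNReal.ofReal c * smear μ ε z) z
        = ENNReal.ofReal c * (Gloc N ⋆ₗ smear μ ε) z :=
      congrFun (lconv_const_mul _ measurable_Gloc measurable_smear)
    simp only [e, ENNReal.mul_rpow_of_nonneg _ _ hq0.le]
    rw [lintegral_const_mul' _ _ (ENNReal.rpow_ne_top_of_nonneg hq0.le ENNReal.ofReal_ne_top)]
    refine (mul_le_mul_right ((lintegral_lconv_smear_rpow_le hε measurable_Gloc hq).trans hpot)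
      _).trans_eq ?_
    rw [ENNReal.ofReal_rpow_of_pos hc, mul_left_comm, ← ENNReal.ofReal_mul (Real.rpow_nonneg hc0 _),
      ← Real.rpow_add hc]
    simp

end smear

end ParabolicWiener

namespace ParabolicWiener

open MeasureTheory Metric Set Filter Topology
open scoped ENNReal NNReal ContDiff

section annuli

variable {N : ℕ}

def annS (z₀ : PSpace N) (k : ℕ) : Set (PSpace N) :=
  {y | ‖y.1 - z₀.1‖ < 2 * (1 / 2) ^ k ∧ (1 / 4) ^ k / 8 < z₀.2 - y.2 ∧ z₀.2 - y.2 < 31 * (1 / 4) ^ k}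

def annN (z₀ : PSpace N) (k : ℕ) : Set (PSpace N) :=
  {y | ‖y.1 - z₀.1‖ < 3 * (1 / 2) ^ k ∧ (1 / 4) ^ k / 16 < z₀.2 - y.2 ∧
    z₀.2 - y.2 < 32 * (1 / 4) ^ k}

theorem measurableSet_annN (z₀ : PSpace N) (k : ℕ) : MeasurableSet (annN z₀ k) := by
  have h1 : IsOpen {y : PSpace N | ‖y.1 - z₀.1‖ < 3 * (1 / 2) ^ k} :=
    isOpen_lt (by fun_prop) continuous_const
  have h2 : IsOpen {y : PSpace N | (1 / 4) ^ k / 16 < z₀.2 - y.2} :=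
    isOpen_lt continuous_const (by fun_prop)
  have h3 : IsOpen {y : PSpace N | z₀.2 - y.2 < 32 * (1 / 4) ^ k} :=
    isOpen_lt (by fun_prop) continuous_const
  exact (h1.inter (h2.inter h3)).measurableSet

noncomputable def heatC (N : ℕ) : ℝ≥0∞ := ENNReal.ofReal (1 + 4 ^ N * N.factorial)

theorem heatC_ne_top : heatC N ≠ ⊤ := ENNReal.ofReal_ne_top

theorem Gam_le {m : ℕ} {z : PSpace N} (hz : (1 / 2) ^ m ≤ ‖z.1‖ ∨ (1 / 4) ^ m ≤ |z.2|) :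
    Gam N z ≤ heatC N * 2 ^ (m * N) := by
  have h1 : (1 / 2 : ℝ) ^ m ≤ ‖z.1‖ ∨ ((1 / 2 : ℝ) ^ m) ^ 2 ≤ |z.2| := by
    rwa [← pow_mul, mul_comm, pow_mul, show (1 / 2 : ℝ) ^ 2 = 1 / 4 by norm_num]
  rw [Gam, heatC]
  refine (ENNReal.ofReal_le_ofReal (heatK_le (by positivity) h1)).trans_eq ?_
  rw [ENNReal.ofReal_mul (by positivity)]
  congr 1
  rw [← pow_mul, one_div, inv_pow, inv_inv, ENNReal.ofReal_pow (by norm_num), ENNReal.ofReal_ofNat]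

theorem le_add_four_of_mem_annN {z₀ w : PSpace N} {k j : ℕ} (hk : w ∈ annN z₀ k)
    (hj : w ∈ annN z₀ j) : j ≤ k + 4 := by
  by_contra! h
  have h1 := hk.2.1
  have h2 := hj.2.2
  have h3 : (1 / 4 : ℝ) ^ j ≤ (1 / 4) ^ (k + 5) :=
    pow_le_pow_of_le_one (by norm_num) (by norm_num) h
  rw [pow_add] at h3
  have h4 : (0 : ℝ) < (1 / 4) ^ k := by positivity
  norm_num at h3
  linarith

theorem card_filter_annN_le (z₀ w : PSpace N) (I : Finset ℕ) [DecidablePred fun k => w ∈ annN z₀ k] :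
    (I.filter fun k => w ∈ annN z₀ k).card ≤ 5 := by
  set F := I.filter fun k => w ∈ annN z₀ k with hF
  rcases F.eq_empty_or_nonempty with h | h
  · simp [h]
  have hm := F.min'_mem h
  have : F ⊆ Finset.Ico (F.min' h) (F.min' h + 5) := fun j hj => by
    have := le_add_four_of_mem_annN (Finset.mem_filter.1 hm).2 (Finset.mem_filter.1 hj).2
    exact Finset.mem_Ico.2 ⟨F.min'_le j hj, by omega⟩
  simpa using Finset.card_le_card this

variable {z₀ : PSpace N} {k : ℕ} {g : PSpace N → ℝ≥0∞}

theorem lconv_Gam_le_of_notMem_annN (hg : ∀ y ∉ annS z₀ k, g y = 0) {w : PSpace N}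
    (hw : w ∉ annN z₀ k) :
    (Gam N ⋆ₗ g) w ≤ heatC N * 2 ^ ((k + 2) * N) * ∫⁻ y, g y := by
  rw [lconv_eq, ← lintegral_sub_left_eq_self (fun y => g y) w,
    ← lintegral_const_mul' _ _ (ENNReal.mul_ne_top heatC_ne_top (by simp))]
  refine lintegral_mono fun v => ?_
  by_cases hy : w - v ∈ annS z₀ k
  swap
  · simp [hg _ hy]
  refine mul_le_mul' (Gam_le ?_) le_rfl
  by_contra! h
  obtain ⟨h1, h2⟩ := h
  obtain ⟨h3, h4, h5⟩ := hy
  rw [pow_add] at h1 h2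
  have h6 : (0 : ℝ) < (1 / 2) ^ k := by positivity
  have h7 : (0 : ℝ) < (1 / 4) ^ k := by positivity
  obtain ⟨h8, h9⟩ := abs_lt.1 h2
  simp only [Prod.fst_sub, Prod.snd_sub] at h3 h4 h5
  refine hw ⟨?_, by linarith, by linarith⟩
  have h10 : ‖w.1 - z₀.1‖ ≤ ‖w.1 - v.1 - z₀.1‖ + ‖v.1‖ := by
    have := norm_add_le (w.1 - v.1 - z₀.1) v.1
    rwa [show w.1 - v.1 - z₀.1 + v.1 = w.1 - z₀.1 by abel] at this
  linarith

theorem lconv_Gam_eq_of_mem_annN (hk : 6 ≤ k) (hg : ∀ y ∉ annS z₀ k, g y = 0) {w : PSpace N}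
    (hw : w ∈ annN z₀ k) : (Gam N ⋆ₗ g) w = (Gloc N ⋆ₗ g) w := by
  rw [lconv_eq, lconv_eq]
  refine lintegral_congr fun v => ?_
  by_cases hy : w - v ∈ annS z₀ k
  swap
  · simp [hg _ hy]
  have hv : v ∈ cyl N 1 := by
    obtain ⟨h3, h4, h5⟩ := hy
    obtain ⟨h6, h7, h8⟩ := hw
    have h1 : (1 / 2 : ℝ) ^ k ≤ (1 / 2) ^ 6 := pow_le_pow_of_le_one (by norm_num) (by norm_num) hk
    have h2 : (1 / 4 : ℝ) ^ k ≤ (1 / 4) ^ 6 := pow_le_pow_of_le_one (by norm_num) (by norm_num) hk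
    simp only [Prod.fst_sub, Prod.snd_sub] at h3 h4 h5
    have h9 : (0 : ℝ) < (1 / 4) ^ k := by positivity
    refine ⟨?_, abs_lt.2 ⟨?_, ?_⟩⟩
    · have h10 : ‖v.1‖ ≤ ‖w.1 - z₀.1‖ + ‖w.1 - v.1 - z₀.1‖ := by
        have := norm_sub_le (w.1 - z₀.1) (w.1 - v.1 - z₀.1)
        rwa [show w.1 - z₀.1 - (w.1 - v.1 - z₀.1) = v.1 by abel] at this
      norm_num at h1 ⊢
      norm_num at h3 h6
      linarith
    all_goals
      norm_num at h2 h9 ⊢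
      norm_num at h4 h5 h7 h8
      linarith
  rw [Gloc, indicator_of_mem hv]

theorem lconv_Gam_indicator_annN_le {f : PSpace N → ℝ≥0∞} {z : PSpace N}
    (hz : z₀.2 - (1 / 4) ^ k / 32 < z.2) :
    (Gam N ⋆ₗ (annN z₀ k).indicator f) z ≤ heatC N * 2 ^ ((k + 3) * N) * ∫⁻ y, f y := by
  rw [lconv_eq, ← lintegral_sub_left_eq_self (fun y => f y) z,
    ← lintegral_const_mul' _ _ (ENNReal.mul_ne_top heatC_ne_top (by simp))]
  refine lintegral_mono fun v => ?_
  by_cases hy : z - v ∈ annN z₀ k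
  swap
  · simp [hy]
  rw [indicator_of_mem hy]
  refine mul_le_mul' (Gam_le (Or.inr ?_)) le_rfl
  obtain ⟨-, h4, -⟩ := hy
  rw [Prod.snd_sub] at h4
  refine le_trans ?_ (le_abs_self _)
  have h7 : (0 : ℝ) < (1 / 4) ^ k := by positivity
  rw [pow_add]
  norm_num
  linarith

noncomputable def lowC (N : ℕ) : ℝ := (4 * Real.pi * 31) ^ (-(N : ℝ) / 2) * Real.exp (-36)

theorem lowC_pos : 0 < lowC N := by unfold lowC; positivity

theorem le_lconv_Gam (hg : ∀ y ∉ annS z₀ k, g y = 0) {z : PSpace N}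
    (hz1 : ‖z.1 - z₀.1‖ ≤ (1 / 2) ^ k) (hz2 : z₀.2 - (1 / 4) ^ k / 32 < z.2) (hz3 : z.2 ≤ z₀.2) :
    ENNReal.ofReal (lowC N) * 2 ^ (k * N) * ∫⁻ y, g y ≤ (Gam N ⋆ₗ g) z := by
  rw [lconv_eq, ← lintegral_sub_left_eq_self (fun y => g y) z,
    ← lintegral_const_mul' _ _ (ENNReal.mul_ne_top ENNReal.ofReal_ne_top (by simp))]
  refine lintegral_mono fun v => ?_
  by_cases hy : z - v ∈ annS z₀ k
  swap
  · simp [hg _ hy]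
  refine mul_le_mul' ?_ le_rfl
  obtain ⟨h3, h4, h5⟩ := hy
  simp only [Prod.fst_sub, Prod.snd_sub] at h3 h4 h5
  have h6 : (0 : ℝ) < (1 / 2) ^ k := by positivity
  have h7 : (0 : ℝ) < (1 / 4) ^ k := by positivity
  have h8 : ‖v.1‖ ≤ 3 * (1 / 2) ^ k := by
    have := norm_sub_le (z.1 - z₀.1) (z.1 - v.1 - z₀.1)
    rw [show z.1 - z₀.1 - (z.1 - v.1 - z₀.1) = v.1 by abel] at this
    linarith
  have h9 := le_heatK (N := N) (z := v) (a := (1 / 4) ^ k / 16) (b := 31 * (1 / 4) ^ k)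
    (by positivity) (by linarith) (by linarith) h8
  rw [Gam]
  refine le_trans (le_of_eq ?_) (ENNReal.ofReal_le_ofReal h9)
  rw [show (2 : ℝ≥0∞) ^ (k * N) = ENNReal.ofReal (2 ^ (k * N)) by
    rw [ENNReal.ofReal_pow (by norm_num), ENNReal.ofReal_ofNat],
    ← ENNReal.ofReal_mul lowC_pos.le]
  congr 1
  have e1 : -((3 * (1 / 2) ^ k) ^ 2 / (4 * ((1 / 4) ^ k / 16))) = (-36 : ℝ) := by
    rw [mul_pow, ← pow_mul, mul_comm k, pow_mul, show ((1 : ℝ) / 2) ^ 2 = 1 / 4 by norm_num]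
    field_simp
    norm_num
  have e2 : ((1 / 4 : ℝ) ^ k) ^ (-(N : ℝ) / 2) = 2 ^ (k * N) := by
    rw [show (1 / 4 : ℝ) = 2 ^ (-2 : ℝ) by rw [Real.rpow_neg (by norm_num)]; norm_num,
      ← Real.rpow_natCast, ← Real.rpow_mul (by norm_num), ← Real.rpow_mul (by norm_num),
      ← Real.rpow_natCast]
    congr 1
    push_cast
    ring
  rw [e1, ← mul_assoc, Real.mul_rpow (by positivity) h7.le, e2, lowC]
  ring

end annuli

end ParabolicWiener

namespace ParabolicWiener

open MeasureTheory Metric Set Filter Topology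
open scoped ENNReal NNReal ContDiff

section annular_sources

variable {N : ℕ}

theorem lconv_finsetSum {ι : Type*} (I : Finset ι) {K : PSpace N → ℝ≥0∞} (hK : Measurable K)
    {g : ι → PSpace N → ℝ≥0∞} (hg : ∀ k, Measurable (g k)) (θ : ℝ≥0∞) (z : PSpace N) :
    (K ⋆ₗ fun y => ∑ k ∈ I, θ * g k y) z = ∑ k ∈ I, θ * (K ⋆ₗ g k) z := by
  simp only [lconv_eq, Finset.mul_sum]
  have hms : ∀ k ∈ I, Measurable fun w => K w * (θ * g k (z - w)) := fun k _ =>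
    hK.mul (((hg k).comp (measurable_const.sub measurable_id)).const_mul θ)
  rw [lintegral_finsetSum I hms]
  refine Finset.sum_congr rfl fun k _ => ?_
  have hm : Measurable fun w => K w * g k (z - w) :=
    hK.mul ((hg k).comp (measurable_const.sub measurable_id))
  rw [← lintegral_const_mul θ hm]
  exact lintegral_congr fun w => mul_left_comm _ _ _

theorem indicator_sum_rpow_le (z₀ w : PSpace N) (I : Finset ℕ) (P : ℕ → PSpace N → ℝ≥0∞) {q : ℝ}
    (hq : 1 < q) :
    (∑ k ∈ I, (annN z₀ k).indicator (P k) w) ^ q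
      ≤ 5 ^ (q - 1) * ∑ k ∈ I, (annN z₀ k).indicator (fun y => P k y ^ q) w := by
  classical
  simp only [indicator_apply, ← Finset.sum_filter]
  refine (ENNReal.rpow_sum_le_const_mul_sum_rpow _ _ hq.le).trans (mul_le_mul' ?_ le_rfl)
  refine ENNReal.rpow_le_rpow ?_ (by linarith)
  exact_mod_cast card_filter_annN_le z₀ w I

theorem exists_annular_bound (N : ℕ) {q : ℝ} (hq : 1 < q) {Cs : ℝ≥0∞} (hCs : Cs ≠ ⊤) :
    ∃ C : ℝ≥0∞, C ≠ ⊤ ∧ ∀ (z₀ : PSpace N) (k₁ k₂ : ℕ), 6 ≤ k₁ →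
      ∀ (g : ℕ → PSpace N → ℝ≥0∞) (c : ℕ → ℝ≥0∞) (θ : ℝ≥0∞), θ ≠ ⊤ →
      (∀ k, Measurable (g k)) → (∀ k, ∀ y ∉ annS z₀ k, g k y = 0) → (∀ k, ∫⁻ y, g k y = c k) →
      (∀ k, ∫⁻ y, (Gloc N ⋆ₗ g k) y ^ q ≤ Cs * c k) →
      ∀ z : PSpace N, z₀.2 - (1 / 4) ^ k₂ / 32 < z.2 → z.2 ≤ z₀.2 →
        (Gam N ⋆ₗ fun w => (Gam N ⋆ₗ fun y => ∑ k ∈ Finset.Ico k₁ k₂, θ * g k y) w ^ q) z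
          ≤ C * (ENNReal.ofReal ((1 / 4) ^ k₁)
              * (∑ k ∈ Finset.Ico k₁ k₂, θ * (2 ^ (k * N) * c k)) ^ q
            + θ ^ (q - 1) * ∑ k ∈ Finset.Ico k₁ k₂, θ * (2 ^ (k * N) * c k)) := by
  have hq0 : 0 < q := by linarith
  set B : ℝ≥0∞ := heatC N * 2 ^ (2 * N) with hB
  set C₁ : ℝ≥0∞ := 31 * (2 ^ (q - 1) * B ^ q) with hC₁
  set C₂ : ℝ≥0∞ := 2 ^ (q - 1) * 5 ^ (q - 1) * (heatC N * 2 ^ (3 * N) * Cs) with hC₂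
  have hBt : B ≠ ⊤ := ENNReal.mul_ne_top heatC_ne_top (by simp)
  have h2t : (2 : ℝ≥0∞) ^ (q - 1) ≠ ⊤ := ENNReal.rpow_ne_top_of_nonneg (by linarith) (by simp)
  have h5t : (5 : ℝ≥0∞) ^ (q - 1) ≠ ⊤ := ENNReal.rpow_ne_top_of_nonneg (by linarith) (by simp)
  have hC₁t : C₁ ≠ ⊤ := ENNReal.mul_ne_top (by simp)
    (ENNReal.mul_ne_top h2t (ENNReal.rpow_ne_top_of_nonneg hq0.le hBt))
  have hC₂t : C₂ ≠ ⊤ := ENNReal.mul_ne_top (ENNReal.mul_ne_top h2t h5t)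
    (ENNReal.mul_ne_top (ENNReal.mul_ne_top heatC_ne_top (by simp)) hCs)
  refine ⟨C₁ + C₂, ENNReal.add_ne_top.2 ⟨hC₁t, hC₂t⟩, ?_⟩
  intro z₀ k₁ k₂ hk₁ g c θ hθ hgm hg0 hgi hgq z hz1 hz2
  set I := Finset.Ico k₁ k₂ with hI
  set A := ∑ k ∈ I, θ * (2 ^ (k * N) * c k) with hA
  set H := Gam N ⋆ₗ fun y => ∑ k ∈ I, θ * g k y with hH
  set τ := z₀.2 - 31 * (1 / 4) ^ k₁ with hτ
  set P : ℕ → PSpace N → ℝ≥0∞ := fun k w => θ * (Gloc N ⋆ₗ g k) w with hP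
  have hPm : ∀ k, Measurable (P k) := fun k => by
    have : Measurable (Gloc N ⋆ₗ g k) := measurable_lconvolution _ measurable_Gloc (hgm k)
    exact this.const_mul θ
  have hcausal : Causal τ H := by
    refine causal_lconv causal_Gam fun y hy => Finset.sum_eq_zero fun k hk => ?_
    rw [hg0 k y fun h => ?_, mul_zero]
    have h1 := h.2.2
    have h2 : (1 / 4 : ℝ) ^ k ≤ (1 / 4) ^ k₁ :=
      pow_le_pow_of_le_one (by norm_num) (by norm_num) (Finset.mem_Ico.1 hk).1
    linarith
  have hpt : ∀ w, H w ≤ B * A + ∑ k ∈ I, (annN z₀ k).indicator (P k) w := fun w => by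
    rw [hH, lconv_finsetSum I (measurable_Gam N) hgm, hA, Finset.mul_sum, ← Finset.sum_add_distrib]
    refine Finset.sum_le_sum fun k hk => ?_
    by_cases hw : w ∈ annN z₀ k
    · rw [indicator_of_mem hw,
        lconv_Gam_eq_of_mem_annN (hk₁.trans (Finset.mem_Ico.1 hk).1) (hg0 k) hw]
      exact le_add_self
    · refine le_trans ?_ le_self_add
      refine (mul_le_mul_right (lconv_Gam_le_of_notMem_annN (hg0 k) hw) θ).trans_eq ?_
      rw [hgi, hB, add_mul, pow_add]
      ring
  set F₁ : PSpace N → ℝ≥0∞ := {w | τ < w.2}.indicator fun _ => 2 ^ (q - 1) * (B * A) ^ q with hF₁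
  set F₂ : PSpace N → ℝ≥0∞ := fun w =>
    ∑ k ∈ I, (2 ^ (q - 1) * 5 ^ (q - 1)) * (annN z₀ k).indicator (fun y => P k y ^ q) w with hF₂
  have hHF : (fun w => H w ^ q) ≤ F₁ + F₂ := fun w => by
    rcases le_or_gt w.2 τ with hw | hw
    · simp [hcausal w hw, hq0]
    · rw [Pi.add_apply, hF₁, indicator_of_mem (by exact hw), hF₂]
      refine (ENNReal.rpow_le_rpow (hpt w) hq0.le).trans ?_
      refine (ENNReal.rpow_add_le_mul_rpow_add_rpow _ _ hq.le).trans ?_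
      beta_reduce
      rw [mul_add, ← Finset.mul_sum, mul_assoc (2 ^ (q - 1))]
      exact add_le_add le_rfl (mul_le_mul_right (indicator_sum_rpow_le _ _ _ _ hq) _)
  have hτm : MeasurableSet {w : PSpace N | τ < w.2} := measurableSet_lt measurable_const measurable_snd
  have hF₁m : Measurable F₁ := measurable_const.indicator hτm
  have b1 : (Gam N ⋆ₗ F₁) z ≤ C₁ * (ENNReal.ofReal ((1 / 4) ^ k₁) * A ^ q) := by
    have hc : Causal τ F₁ := fun w hw => indicator_of_notMem (by simpa using hw) _
    refine (Gam_lconv_le hc (M := 2 ^ (q - 1) * (B * A) ^ q)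
      fun w _ => indicator_le_self' (fun _ _ => zero_le) w).trans ?_
    have : ENNReal.ofReal (z.2 - τ) ≤ 31 * ENNReal.ofReal ((1 / 4) ^ k₁) := by
      rw [← ENNReal.ofReal_ofNat, ← ENNReal.ofReal_mul (by norm_num)]
      exact ENNReal.ofReal_le_ofReal (by rw [hτ]; linarith)
    refine (mul_le_mul' this le_rfl).trans_eq ?_
    rw [hC₁, ENNReal.mul_rpow_of_nonneg _ _ hq0.le]
    ring
  have b2 : (Gam N ⋆ₗ F₂) z ≤ C₂ * (θ ^ (q - 1) * A) := by
    have hm : ∀ k, Measurable ((annN z₀ k).indicator fun y => P k y ^ q) := fun k =>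
      ((hPm k).pow_const q).indicator (measurableSet_annN z₀ k)
    rw [hF₂, lconv_finsetSum I (measurable_Gam N) hm, hA, Finset.mul_sum, Finset.mul_sum]
    refine Finset.sum_le_sum fun k hk => ?_
    have hzk : z₀.2 - (1 / 4) ^ k / 32 < z.2 := by
      have : (1 / 4 : ℝ) ^ k₂ ≤ (1 / 4) ^ k :=
        pow_le_pow_of_le_one (by norm_num) (by norm_num) (Finset.mem_Ico.1 hk).2.le
      linarith
    have hInt : ∫⁻ y, P k y ^ q ≤ θ ^ q * (Cs * c k) := by
      simp only [hP, ENNReal.mul_rpow_of_nonneg _ _ hq0.le]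
      rw [lintegral_const_mul' _ _ (ENNReal.rpow_ne_top_of_nonneg hq0.le hθ)]
      exact mul_le_mul_right (hgq k) _
    have hθq : θ ^ q = θ ^ (q - 1) * θ := by
      conv_rhs => rw [← ENNReal.rpow_one θ, ← ENNReal.rpow_mul,
        ← ENNReal.rpow_add_of_nonneg _ _ (by linarith) zero_le_one]
      congr 1; ring
    refine (mul_le_mul_right ((lconv_Gam_indicator_annN_le hzk).trans
      (mul_le_mul_right hInt _)) _).trans_eq ?_
    rw [hθq, hC₂, add_mul, pow_add]
    ring
  have hb : (Gam N ⋆ₗ fun w => H w ^ q) z ≤ (Gam N ⋆ₗ F₁) z + (Gam N ⋆ₗ F₂) z := by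
    refine (lconv_mono le_rfl hHF z).trans_eq ?_
    rw [lconv_add _ (measurable_Gam N) hF₁m, Pi.add_apply]
  refine (hb.trans (add_le_add b1 b2)).trans ?_
  rw [mul_add]
  exact add_le_add (mul_le_mul' le_self_add le_rfl) (mul_le_mul' le_add_self le_rfl)

end annular_sources

end ParabolicWiener

namespace ParabolicWiener

open MeasureTheory Metric Set Filter Topology
open scoped ENNReal NNReal ContDiff

section dyadic

variable {N : ℕ}

/-- The part of `Oᶜ` in the `k`-th dyadic parabolic annulus below `z₀`. -/
def annE (O : Set (PSpace N)) (z₀ : PSpace N) (k : ℕ) : Set (PSpace N) :=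
  Oᶜ ∩ (ball z₀.1 ((1 / 2) ^ k) ×ˢ Ioo (z₀.2 - 30 * (1 / 4) ^ k) (z₀.2 - (1 / 4) ^ k / 4))

theorem annE_subset_closedBall (O : Set (PSpace N)) (z₀ : PSpace N) (k : ℕ) :
    annE O z₀ k ⊆ closedBall 0 (‖z₀‖ + 30) := by
  rintro w ⟨-, h1, h2, h3⟩
  have e1 : (1 / 2 : ℝ) ^ k ≤ 1 := pow_le_one₀ (by norm_num) (by norm_num)
  have e2 : (1 / 4 : ℝ) ^ k ≤ 1 := pow_le_one₀ (by norm_num) (by norm_num)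
  have e3 : 0 < (1 / 4 : ℝ) ^ k := by positivity
  have hd : dist w z₀ ≤ 30 := by
    rw [Prod.dist_eq]
    refine max_le ((mem_ball.1 h1).le.trans (by linarith)) ?_
    rw [Real.dist_eq, abs_le]
    constructor <;> linarith
  rw [mem_closedBall, dist_zero_right]
  have := norm_le_norm_add_norm_sub z₀ w
  rw [← dist_eq_norm, dist_comm] at this
  linarith

theorem Ioo_subset_iUnion_dyadic :
    Ioo (0 : ℝ) 1 ⊆ ⋃ k : ℕ, Ioc ((1 / 2 : ℝ) ^ (k + 1)) ((1 / 2) ^ k) := by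
  intro ρ hρ
  obtain ⟨n, h1, h2⟩ := exists_nat_pow_near_of_lt_one hρ.1 hρ.2.le
    (by norm_num : (0 : ℝ) < 1 / 2) (by norm_num)
  exact mem_iUnion.2 ⟨n, h1, h2⟩

theorem subset_annE (O : Set (PSpace N)) (z₀ : PSpace N) {k : ℕ} {ρ : ℝ}
    (hρ : ρ ∈ Ioc ((1 / 2 : ℝ) ^ (k + 1)) ((1 / 2) ^ k)) :
    Oᶜ ∩ (ball z₀.1 (ρ / 30) ×ˢ Ioo (z₀.2 - 30 * ρ ^ 2) (z₀.2 - ρ ^ 2)) ⊆ annE O z₀ k := by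
  have h0 : (0 : ℝ) < (1 / 2) ^ (k + 1) := by positivity
  have e4 : ((1 / 2 : ℝ) ^ k) ^ 2 = (1 / 4) ^ k := by
    rw [← pow_mul, mul_comm, pow_mul]; norm_num
  have h1 : ρ ^ 2 ≤ (1 / 4) ^ k := by
    rw [← e4]; exact pow_le_pow_left₀ (h0.trans hρ.1).le hρ.2 2
  have h2 : (1 / 4) ^ k / 4 ≤ ρ ^ 2 := by
    have := pow_le_pow_left₀ h0.le hρ.1.le 2
    rw [pow_succ _ k, mul_pow, e4] at this
    linarith
  refine inter_subset_inter le_rfl (prod_mono (ball_subset_ball ?_) (Ioo_subset_Ioo ?_ ?_))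
  · linarith [hρ.1, hρ.2]
  · linarith
  · linarith

theorem exists_compact_dyadic {O : Set (PSpace N)} {z₀ : PSpace N} (p : ℝ)
    (h : ∫⁻ ρ in Ioo (0 : ℝ) 1,
        ENNReal.ofReal (cap21 N p
            (Oᶜ ∩ (ball z₀.1 (ρ / 30) ×ˢ Ioo (z₀.2 - 30 * ρ ^ 2) (z₀.2 - ρ ^ 2))) / ρ ^ (N + 1))
        = ⊤) :
    ∃ D : ℕ → Set (PSpace N), (∀ k, D k ⊆ annE O z₀ k) ∧ (∀ k, IsCompact (D k)) ∧
      ∑' k, 2 ^ (k * N) * ENNReal.ofReal (cap21c N p (D k)) = ⊤ := by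
  choose D hD hDc hcap using fun k => exists_compact_half_cap (p := p) (annE O z₀ k)
  refine ⟨D, hD, hDc, ?_⟩
  have key : ∀ k : ℕ, ∫⁻ ρ in Ioc ((1 / 2 : ℝ) ^ (k + 1)) ((1 / 2) ^ k),
      ENNReal.ofReal (cap21 N p
        (Oᶜ ∩ (ball z₀.1 (ρ / 30) ×ˢ Ioo (z₀.2 - 30 * ρ ^ 2) (z₀.2 - ρ ^ 2))) / ρ ^ (N + 1))
      ≤ 2 ^ (N + 1) * (2 ^ (k * N) * ENNReal.ofReal (cap21c N p (D k))) := by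
    intro k
    have hc0 := cap21c_nonneg (p := p) (D k)
    have hb : ∀ ρ ∈ Ioc ((1 / 2 : ℝ) ^ (k + 1)) ((1 / 2) ^ k),
        ENNReal.ofReal (cap21 N p
          (Oᶜ ∩ (ball z₀.1 (ρ / 30) ×ˢ Ioo (z₀.2 - 30 * ρ ^ 2) (z₀.2 - ρ ^ 2))) / ρ ^ (N + 1))
        ≤ ENNReal.ofReal (2 * cap21c N p (D k) / ((1 / 2) ^ (k + 1)) ^ (N + 1)) := by
      intro ρ hρ
      have h0 : (0 : ℝ) < (1 / 2) ^ (k + 1) := by positivity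
      refine ENNReal.ofReal_le_ofReal (div_le_div₀ (by positivity) ?_ (by positivity)
        (pow_le_pow_left₀ h0.le hρ.1.le _))
      exact (cap21_mono (subset_annE O z₀ hρ) (annE_subset_closedBall O z₀ k)).trans (hcap k)
    refine (setLIntegral_mono measurable_const hb).trans ?_
    rw [setLIntegral_const, Real.volume_Ioc, ← ENNReal.ofReal_mul (by positivity),
      ← ENNReal.ofReal_ofNat, ← ENNReal.ofReal_pow zero_le_two, ← ENNReal.ofReal_pow zero_le_two,
      ← ENNReal.ofReal_mul (by positivity), ← ENNReal.ofReal_mul (by positivity)]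
    refine ENNReal.ofReal_le_ofReal (le_of_eq ?_)
    have e : (1 / 2 : ℝ) ^ k - (1 / 2) ^ (k + 1) = (1 / 2) ^ (k + 1) := by ring
    rw [e, one_div, inv_pow, inv_pow, div_inv_eq_mul]
    have h2 : (2 : ℝ) ^ (k + 1) ≠ 0 := by positivity
    have h3 : ((2 : ℝ) ^ (k + 1)) ^ N = 2 ^ (k * N) * 2 ^ N := by
      rw [← pow_mul, add_mul, one_mul, pow_add]
    rw [pow_succ _ N, ← mul_assoc, mul_inv_cancel_right₀ h2, h3, pow_succ]
    ring
  have h1 := (lintegral_mono_set (μ := volume) (f := fun ρ : ℝ => ENNReal.ofReal (cap21 N p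
    (Oᶜ ∩ (ball z₀.1 (ρ / 30) ×ˢ Ioo (z₀.2 - 30 * ρ ^ 2) (z₀.2 - ρ ^ 2))) / ρ ^ (N + 1)))
    Ioo_subset_iUnion_dyadic).trans (lintegral_iUnion_le _ _)
  have h2 := h1.trans (ENNReal.tsum_le_tsum key)
  rw [h, top_le_iff, ENNReal.tsum_mul_left] at h2
  by_contra hne
  exact ENNReal.mul_ne_top (by simp) hne h2

end dyadic

end ParabolicWiener

namespace ParabolicWiener

open MeasureTheory Metric Set Filter Topology
open scoped ENNReal NNReal ContDiff

section lower_bound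

variable {N : ℕ} {q : ℝ}

theorem IsMild.half_le {τ : ℝ} {h u : PSpace N → ℝ≥0∞} (hu : IsMild q τ h u) (hq : 0 < q)
    {m : ℝ≥0∞} (hm : m ≠ ⊤) {z : PSpace N} (h1 : 2 * m ≤ (Gam N ⋆ₗ h) z)
    (h2 : (Gam N ⋆ₗ fun w => (Gam N ⋆ₗ h) w ^ q) z ≤ m) : m ≤ u z := by
  have h3 : (Gam N ⋆ₗ fun w => u w ^ q) z ≤ m := by
    refine le_trans (lconv_mono le_rfl (fun w => ?_) z) h2
    exact ENNReal.rpow_le_rpow (le_self_add.trans_eq (hu.eqn w)) hq.le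
  rw [← hu.eqn z, two_mul] at h1
  exact (ENNReal.add_le_add_iff_right hm).1 (h1.trans (by gcongr))

theorem exists_small_parameters (hq : 1 < q) {C A : ℝ≥0∞} (hC : C ≠ ⊤) (hA : A ≠ ⊤) {m : ℝ}
    (hm : 0 < m) : ∃ k₁ : ℕ, 6 ≤ k₁ ∧ ∃ θ₀ : ℝ, 0 < θ₀ ∧ ∀ θ ≤ ENNReal.ofReal θ₀,
      C * (ENNReal.ofReal ((1 / 4) ^ k₁) * A ^ q + θ ^ (q - 1) * A) ≤ ENNReal.ofReal m := by
  have hq1 : 0 < q - 1 := by linarith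
  set B : ℝ≥0∞ := C * (A ^ q + A) with hB
  have hBt : B ≠ ⊤ := ENNReal.mul_ne_top hC
    (ENNReal.add_ne_top.2 ⟨ENNReal.rpow_ne_top_of_nonneg (by linarith) hA, hA⟩)
  set ε : ℝ := m / (B.toReal + 1) with hε
  have hB0 : 0 ≤ B.toReal := ENNReal.toReal_nonneg
  have hε0 : 0 < ε := by positivity
  have hεB : ENNReal.ofReal ε * B ≤ ENNReal.ofReal m := by
    rw [← ENNReal.ofReal_toReal hBt, ← ENNReal.ofReal_mul hε0.le]
    refine ENNReal.ofReal_le_ofReal ?_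
    rw [hε, div_mul_eq_mul_div, div_le_iff₀ (by positivity)]
    nlinarith
  obtain ⟨n, hn⟩ := exists_pow_lt_of_lt_one hε0 (by norm_num : (1 / 4 : ℝ) < 1)
  refine ⟨max 6 n, le_max_left _ _, ε ^ (q - 1)⁻¹, by positivity, fun θ hθ => ?_⟩
  have e1 : ENNReal.ofReal ((1 / 4) ^ max 6 n) ≤ ENNReal.ofReal ε :=
    ENNReal.ofReal_le_ofReal ((pow_le_pow_of_le_one (by norm_num) (by norm_num)
      (le_max_right 6 n)).trans hn.le)
  have e2 : θ ^ (q - 1) ≤ ENNReal.ofReal ε := by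
    refine (ENNReal.rpow_le_rpow hθ hq1.le).trans_eq ?_
    rw [ENNReal.ofReal_rpow_of_nonneg (by positivity) hq1.le, Real.rpow_inv_rpow hε0.le hq1.ne']
  refine le_trans ?_ hεB
  rw [hB, mul_left_comm, mul_add (ENNReal.ofReal ε)]
  exact mul_le_mul' le_rfl (add_le_add (mul_le_mul' e1 le_rfl) (mul_le_mul' e2 le_rfl))

theorem exists_le_sum_Ico {a : ℕ → ℝ≥0∞} (ha : ∀ k, a k ≠ ⊤) (hs : ∑' k, a k = ⊤) (k₁ : ℕ)
    {T : ℝ≥0∞} (hT : T ≠ ⊤) : ∃ k₂, T ≤ ∑ k ∈ Finset.Ico k₁ k₂, a k := by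
  have h0 : ∑ k ∈ Finset.range k₁, a k ≠ ⊤ := ENNReal.sum_ne_top.2 fun k _ => ha k
  have ht := ENNReal.tendsto_nat_tsum a
  rw [hs] at ht
  have hlt : (∑ k ∈ Finset.range k₁, a k) + T < ⊤ := ENNReal.add_lt_top.2 ⟨h0.lt_top, hT.lt_top⟩
  obtain ⟨k₂, h1, h2⟩ := ((ht.eventually (lt_mem_nhds hlt)).and (eventually_ge_atTop k₁)).exists
  refine ⟨k₂, ?_⟩
  rw [← Finset.sum_range_add_sum_Ico _ h2] at h1
  exact (ENNReal.add_le_add_iff_left h0).1 h1.le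

theorem thickening_annE_subset_annS (O : Set (PSpace N)) (z₀ : PSpace N) {k : ℕ} {ε : ℝ}
    (hε : ε ≤ (1 / 4) ^ k / 8) : thickening ε (annE O z₀ k) ⊆ annS z₀ k := by
  intro y hy
  obtain ⟨w, ⟨-, hw1, hw2, hw3⟩, hd⟩ := mem_thickening_iff.1 hy
  have e0 : 0 < (1 / 4 : ℝ) ^ k := by positivity
  have e1 : (1 / 4 : ℝ) ^ k ≤ (1 / 2) ^ k := pow_le_pow_left₀ (by norm_num) (by norm_num) k
  rw [Prod.dist_eq, max_lt_iff] at hd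
  obtain ⟨hd1, hd2⟩ := hd
  rw [Real.dist_eq, abs_lt] at hd2
  rw [mem_ball] at hw1
  refine ⟨?_, ?_, ?_⟩
  · rw [← dist_eq_norm]
    have := dist_triangle y.1 w.1 z₀.1
    linarith
  · linarith [hd2.2]
  · linarith [hd2.1]

theorem exists_sources (hq : 1 < q) {O : Set (PSpace N)} {z₀ : PSpace N} {D : ℕ → Set (PSpace N)}
    (hD : ∀ k, D k ⊆ annE O z₀ k) (hDc : ∀ k, IsCompact (D k)) :
    ∃ Cs : ℝ≥0∞, Cs ≠ ⊤ ∧ ∀ n : ℕ, ∃ g : ℕ → PSpace N → ℝ≥0∞, (∀ k, Measurable (g k)) ∧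
      (∀ k, ∃ L : ℝ≥0, ∀ z, g k z ≤ L) ∧ (∀ k, ∀ y ∉ annS z₀ k, g k y = 0) ∧
      (∀ k, ∀ y ∉ thickening (1 / ((n : ℝ) + 1)) Oᶜ, g k y = 0) ∧
      (∀ k, ∫⁻ y, g k y = ENNReal.ofReal (cap21c N (q / (q - 1)) (D k))) ∧
      ∀ k, ∫⁻ y, (Gloc N ⋆ₗ g k) y ^ q
        ≤ Cs * ENNReal.ofReal (cap21c N (q / (q - 1)) (D k)) := by
  obtain ⟨Cs, hCs, h⟩ := exists_source N hq (‖z₀‖ + 30)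
  refine ⟨Cs, hCs, fun n => ?_⟩
  have hε : ∀ k : ℕ, 0 < min (1 / ((n : ℝ) + 1)) ((1 / 4) ^ k / 8) := fun k =>
    lt_min (by positivity) (by positivity)
  choose g hgm hgL hg0 hgi hgq using fun k =>
    h (D k) ((hD k).trans (annE_subset_closedBall O z₀ k)) (hDc k) _ (hε k)
  refine ⟨g, hgm, hgL, fun k y hy => hg0 k y fun hy' => hy ?_,
    fun k y hy => hg0 k y fun hy' => hy ?_, hgi, hgq⟩
  · exact thickening_annE_subset_annS O z₀ (min_le_right _ _)
      (thickening_subset_of_subset _ (hD k) hy')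
  · exact thickening_mono (min_le_left _ _) _
      (thickening_subset_of_subset _ ((hD k).trans inter_subset_left) hy')

theorem exists_lower_bound (hq : 1 < q) {O : Set (PSpace N)} {z₀ : PSpace N} {R : ℝ}
    (hR : ‖z₀‖ + 31 ≤ R)
    (h : ∫⁻ ρ in Ioo (0 : ℝ) 1,
        ENNReal.ofReal (cap21 N (q / (q - 1))
            (Oᶜ ∩ (ball z₀.1 (ρ / 30) ×ˢ Ioo (z₀.2 - 30 * ρ ^ 2) (z₀.2 - ρ ^ 2))) / ρ ^ (N + 1))
        = ⊤) (M : ℝ) :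
    ∃ δ > 0, ∀ z ∈ pQ N δ z₀, ∀ n : ℕ, ∃ h uh : PSpace N → ℝ≥0∞, Measurable h ∧
      IsMild q (-R) h uh ∧ (∃ k : ℕ, h ≤ src O R n k) ∧ ENNReal.ofReal M ≤ uh z := by
  have hq0 : 0 < q := by linarith
  obtain ⟨D, hD, hDc, hsum⟩ := exists_compact_dyadic _ h
  obtain ⟨Cs, hCs, hsrc⟩ := exists_sources hq hD hDc
  obtain ⟨C, hC, hann⟩ := exists_annular_bound N hq hCs
  set c : ℕ → ℝ≥0∞ := fun k => ENNReal.ofReal (cap21c N (q / (q - 1)) (D k)) with hc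
  have hl : 0 < lowC N := lowC_pos
  set m : ℝ := max M 1 with hm
  have hm0 : 0 < m := lt_max_of_lt_right one_pos
  set A : ℝ≥0∞ := ENNReal.ofReal (2 * m / lowC N) with hA
  have hAt : A ≠ ⊤ := ENNReal.ofReal_ne_top
  have hA0 : A ≠ 0 := (ENNReal.ofReal_pos.2 (by positivity)).ne'
  have hlA : ENNReal.ofReal (lowC N) * A = 2 * ENNReal.ofReal m := by
    rw [hA, ← ENNReal.ofReal_mul hl.le, mul_div_cancel₀ _ hl.ne', ENNReal.ofReal_mul zero_le_two,
      ENNReal.ofReal_ofNat]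
  obtain ⟨k₁, hk₁, θ₀, hθ₀, hsmall⟩ := exists_small_parameters hq hC hAt hm0
  have hθ₀' : ENNReal.ofReal θ₀ ≠ 0 := (ENNReal.ofReal_pos.2 hθ₀).ne'
  have hat : ∀ k, 2 ^ (k * N) * c k ≠ ⊤ := fun k =>
    ENNReal.mul_ne_top (by simp) ENNReal.ofReal_ne_top
  obtain ⟨k₂, hk₂⟩ := exists_le_sum_Ico hat hsum k₁ (ENNReal.div_ne_top hAt hθ₀')
  set I := Finset.Ico k₁ k₂ with hI
  set S := ∑ k ∈ I, 2 ^ (k * N) * c k with hS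
  have hSt : S ≠ ⊤ := ENNReal.sum_ne_top.2 fun k _ => hat k
  have hS0 : S ≠ 0 := fun h0 => by
    rw [h0, nonpos_iff_eq_zero, ENNReal.div_eq_zero_iff] at hk₂
    exact hk₂.elim hA0 ENNReal.ofReal_ne_top
  set θ := A / S with hθ
  have hθt : θ ≠ ⊤ := ENNReal.div_ne_top hAt hS0
  have hθle : θ ≤ ENNReal.ofReal θ₀ := by
    refine ENNReal.div_le_of_le_mul ?_
    rw [mul_comm]
    exact (ENNReal.div_le_iff hθ₀' ENNReal.ofReal_ne_top).1 hk₂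
  have hθS : ∑ k ∈ I, θ * (2 ^ (k * N) * c k) = A := by
    rw [← Finset.mul_sum, ← hS, hθ, ENNReal.div_mul_cancel hS0 hSt]
  have hp2 : (0 : ℝ) < (1 / 2) ^ k₂ := by positivity
  refine ⟨(1 / 2) ^ k₂ / 8, by positivity, fun z hz n => ?_⟩
  obtain ⟨g, hgm, hgL, hg0, hgO, hgi, hgq⟩ := hsrc n
  obtain ⟨hz1, hz2, hz3⟩ := hz
  rw [mem_ball, dist_eq_norm] at hz1
  have e4 : ((1 / 2 : ℝ) ^ k₂) ^ 2 = (1 / 4) ^ k₂ := by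
    rw [← pow_mul, mul_comm, pow_mul]; norm_num
  have hzt : z₀.2 - (1 / 4) ^ k₂ / 32 < z.2 := by
    have : ((1 / 2 : ℝ) ^ k₂ / 8) ^ 2 = (1 / 4) ^ k₂ / 64 := by rw [div_pow, e4]; norm_num
    rw [this] at hz2
    have : (0 : ℝ) < (1 / 4) ^ k₂ := by positivity
    linarith
  set f : PSpace N → ℝ≥0∞ := fun y => ∑ k ∈ I, θ * g k y with hf
  have hfm : Measurable f := Finset.measurable_fun_sum I fun k _ => (hgm k).const_mul θ
  choose L hL using hgL
  set K : ℝ≥0 := ∑ k ∈ I, θ.toNNReal * L k with hK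
  have hfK : ∀ y, f y ≤ (K : ℝ≥0∞) := fun y => by
    rw [hK]
    push_cast
    rw [ENNReal.coe_toNNReal hθt]
    exact Finset.sum_le_sum fun k _ => mul_le_mul' le_rfl (hL k y)
  have hbelow : ∀ k y, y.2 ≤ -R → g k y = 0 := fun k y hy => hg0 k y fun hy' => by
    have h1 := hy'.2.2
    have h2 : (1 / 4 : ℝ) ^ k ≤ 1 := pow_le_one₀ (by norm_num) (by norm_num)
    have h3 : |z₀.2| ≤ ‖z₀‖ := norm_snd_le z₀
    linarith [neg_abs_le z₀.2]
  have hfc : Causal (-R) f := fun y hy => Finset.sum_eq_zero fun k _ => by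
    rw [hbelow k y hy, mul_zero]
  have hK1 : (K : ℝ≥0∞) ≤ (((K + 1) ^ q⁻¹ : ℝ≥0) : ℝ≥0∞) ^ q := by
    rw [← ENNReal.coe_rpow_of_nonneg _ hq0.le, ← NNReal.rpow_mul, inv_mul_cancel₀ hq0.ne',
      NNReal.rpow_one]
    exact_mod_cast le_self_add
  obtain ⟨u, hu⟩ := exists_isMild hq hfm (NNReal.rpow_pos (by positivity))
    (fun y => (hfK y).trans hK1) hfc
  refine ⟨f, u, hfm, hu, ?_, ?_⟩
  · obtain ⟨k, hk⟩ := exists_nat_ge K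
    refine ⟨k, fun y => ?_⟩
    by_cases hy : y ∈ {z | z ∈ thickening (1 / ((n : ℝ) + 1)) Oᶜ ∧ -R < z.2}
    · rw [src, indicator_of_mem hy]
      exact (hfK y).trans (by exact_mod_cast hk)
    · refine (Finset.sum_eq_zero fun k _ => ?_).trans_le zero_le
      rw [mul_eq_zero]
      right
      by_cases hy1 : y ∈ thickening (1 / ((n : ℝ) + 1)) Oᶜ
      · exact hbelow k y (not_lt.1 fun h => hy ⟨hy1, h⟩)
      · exact hgO k y hy1
  · refine (ENNReal.ofReal_le_ofReal (le_max_left M 1)).trans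
      (hu.half_le hq0 ENNReal.ofReal_ne_top ?_ ?_)
    · rw [← hlA, ← hθS, hf, lconv_finsetSum I (measurable_Gam N) hgm, Finset.mul_sum]
      refine Finset.sum_le_sum fun k hk => ?_
      have hkk : k ≤ k₂ := (Finset.mem_Ico.1 hk).2.le
      have h2 : (1 / 2 : ℝ) ^ k₂ ≤ (1 / 2) ^ k :=
        pow_le_pow_of_le_one (by norm_num) (by norm_num) hkk
      have h4 : (1 / 4 : ℝ) ^ k₂ ≤ (1 / 4) ^ k :=
        pow_le_pow_of_le_one (by norm_num) (by norm_num) hkk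
      have hlow := le_lconv_Gam (hg0 k) (z := z) (by linarith) (by linarith) hz3
      rw [hgi] at hlow
      refine le_trans (le_of_eq ?_) (mul_le_mul_right hlow θ)
      ring
    · refine (hann z₀ k₁ k₂ hk₁ g c θ hθt hgm hg0 hgi hgq z hzt hz3).trans ?_
      rw [hθS]
      exact hsmall θ hθle

end lower_bound

end ParabolicWiener

/-- **Theorem 1.1 (i).** Wiener-type sufficient condition for existence of a large
solution of `∂_t u - Δu + u^q = 0` in a bounded open set `O ⊆ ℝ^{N+1}`. -/
theorem capacity_wiener_test_implies_large_solution
    (N : ℕ) (hN : 2 ≤ N) (q : ℝ)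
    (hq : ((N : ℝ) + 2) / N < q ∨ (q = ((N : ℝ) + 2) / N ∧ 3 ≤ N))
    (O : Set (PSpace N)) (hO : IsOpen O) (hOb : Bornology.IsBounded O)
    (hcap : ∀ z ∈ pBoundary N O,
      ∫⁻ ρ in Ioo (0 : ℝ) 1,
        ENNReal.ofReal (cap21 N (q / (q - 1))
            (Oᶜ ∩ (ball z.1 (ρ / 30) ×ˢ Ioo (z.2 - 30 * ρ ^ 2) (z.2 - ρ ^ 2))) / ρ ^ (N + 1))
        = ⊤) :
    ∃ u : PSpace N → ℝ, IsLargeSolution O (fun s => s ^ q) u := by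
  have hq1 : 1 < q := by
    have hN0 : (0 : ℝ) < N := by positivity
    have h1 : 1 < ((N : ℝ) + 2) / N := by rw [lt_div_iff₀ hN0]; linarith
    rcases hq with h | ⟨h, -⟩ <;> linarith
  obtain ⟨r, hr⟩ := (isBounded_iff_forall_norm_le.1 hOb.closure)
  obtain ⟨u, hut, huC, hueq, hum⟩ := ParabolicWiener.exists_solution hq1 hO (r + 31)
  refine ⟨fun z => (u z).toReal, huC, hueq, fun z₀ hz₀ M => ?_⟩
  have hR : ‖z₀‖ + 31 ≤ r + 31 := by linarith [hr z₀ (frontier_subset_closure hz₀.1)]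
  obtain ⟨δ, hδ, hlow⟩ := ParabolicWiener.exists_lower_bound hq1 hR (hcap z₀ hz₀) M
  exact ⟨δ, hδ, fun w hw => (ENNReal.ofReal_le_iff_le_toReal (hut w hw.1)).1
    (hum w _ (hlow w hw.2))⟩
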